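/- For every A ∈ Ω and every 0 < T < ∞ there exists a unique function G_T(·,·;A) ≥ 0 with the following properties: (i) (x,y) ↦ G_T(x,y;A) is continuous on {(x,y) ∈ ℝ^d×ℝ^d : x ≠ y}; (ii) there exist c > 0 and C < ∞ depending only on d and λ such that G_T(x,y;A) ≤ C exp(−c|x−y|/√T)·ln(2+√T/|x−y|) for d = 2 and G_T(x,y;A) ≤ C exp(−c|x−y|/√T)·|x−y|^{2−d} for d > 2; (iii) for all R > 0, ( R^{−d} ∫_{R<|x−y|<2R} |∇_x G_T(x,y;A)|² dx )^{1/2} ≤ C exp(−cR/√T) R^{1−d} and ( R^{−d} ∫_{R<|y−x|<2R} |∇_y G_T(x,y;A)|² dy )^{1/2} ≤ C exp(−cR/√T) R^{1−d}; (iv) x ↦ (G_T(x,y;A), ∇_x G_T(x,y;A)) and y ↦ (G_T(x,y;A), ∇_y G_T(x,y;A)) are locally integrable and T⁻¹G_T − ∇_x·(A(x)∇_x G_T(·,y;A)) = δ(·−y) distributionally in x while T⁻¹G_T − ∇_y·(A*(y)∇_y G_T(x,·;A)) = δ(·−x) distributionally in y. Moreover, the uniqueness implies G_T(x,y;A*)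 = G_T(y,x;A). -/

import Mathlib

open MeasureTheory Filter Metric Matrix ENNReal

noncomputable section

namespace GO

/-- Euclidean space `ℝ^d`. -/
abbrev E (d : ℕ) : Type := EuclideanSpace ℝ (Fin d)

/-- The set `Ω₀` of bounded elliptic matrices: `|A₀ξ| ≤ |ξ|` and `ξ·A₀ξ ≥ λ|ξ|²`. -/
def IsEllipticMatrix (d : ℕ) (lam : ℝ) (M : Matrix (Fin d) (Fin d) ℝ) : Prop :=
  (∀ ξ : Fin d → ℝ, (M.mulVec ξ) ⬝ᵥ (M.mulVec ξ) ≤ ξ ⬝ᵥ ξ) ∧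
  (∀ ξ : Fin d → ℝ, lam * (ξ ⬝ᵥ ξ) ≤ ξ ⬝ᵥ (M.mulVec ξ))

instance matrixMeasurableSpace (d : ℕ) : MeasurableSpace (Matrix (Fin d) (Fin d) ℝ) :=
  MeasurableSpace.pi

/-- `Ω` : Lebesgue-measurable coefficient fields with values in `Ω₀`. -/
structure CoeffField (d : ℕ) (lam : ℝ) : Type where
  A : E d → Matrix (Fin d) (Fin d) ℝ
  measurable : Measurable A
  elliptic : ∀ x, IsEllipticMatrix d lam (A x)

/-- Smooth compactly supported test functions. -/
def IsTestFun (d : ℕ) (χ : E d → ℝ) : Prop :=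
  ContDiff ℝ (⊤ : ℕ∞) χ ∧ HasCompactSupport χ

/-- The σ-algebra `𝓕` generated by the maps `A ↦ ∫ A_{ij} χ`. -/
def ensembleSigma (d : ℕ) (lam : ℝ) : MeasurableSpace (CoeffField d lam) :=
  ⨆ (i : Fin d) (j : Fin d) (χ : E d → ℝ) (_ : IsTestFun d χ),
    MeasurableSpace.comap (fun W => ∫ x : E d, W.A x i j * χ x) inferInstance

instance (d : ℕ) (lam : ℝ) : MeasurableSpace (CoeffField d lam) := ensembleSigma d lam

/-- The shift `τ_z A = A(· + z)`. -/
def shift {d : ℕ} {lam : ℝ} (z : E d) (W : CoeffField d lam) : CoeffField d lam where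
  A := fun x => W.A (x + z)
  measurable := W.measurable.comp (measurable_add_const z)
  elliptic := fun x => W.elliptic (x + z)

/-- Stationarity of an ensemble. -/
def IsStationary {d : ℕ} {lam : ℝ} (μ : Measure (CoeffField d lam)) : Prop :=
  ∀ z : E d, μ.map (shift z) = μ

/-- `W'` agrees with `W` outside `U`. -/
def agreesOff {d : ℕ} {lam : ℝ} (U : Set (E d)) (W W' : CoeffField d lam) : Prop :=
  ∀ x ∉ U, W'.A x = W.A x

/-- The oscillation `osc_{A|U} X` (with values in `ℝ≥0∞`). -/
def osc {d : ℕ} {lam : ℝ} (U : Set (E d)) (X : CoeffField d lam → ℝ)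
    (W : CoeffField d lam) : ℝ≥0∞ :=
  ⨆ (W₁ : CoeffField d lam) (_ : agreesOff U W W₁) (W₂ : CoeffField d lam)
    (_ : agreesOff U W W₂), ENNReal.ofReal (X W₁ - X W₂)

/-- Outer expectation of a (possibly non-measurable) nonnegative quantity. -/
def outerE {d : ℕ} {lam : ℝ} (μ : Measure (CoeffField d lam))
    (f : CoeffField d lam → ℝ≥0∞) : ℝ≥0∞ :=
  ⨅ (g : CoeffField d lam → ℝ≥0∞) (_ : Measurable g) (_ : ∀ W, f W ≤ g W), ∫⁻ W, g W ∂μ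

/-- Expectation `⟨X⟩`. -/
def ensMean {d : ℕ} {lam : ℝ} (μ : Measure (CoeffField d lam))
    (X : CoeffField d lam → ℝ) : ℝ :=
  ∫ W, X W ∂μ

/-- Variance `var[X]` (with values in `ℝ≥0∞`). -/
def ensVar {d : ℕ} {lam : ℝ} (μ : Measure (CoeffField d lam))
    (X : CoeffField d lam → ℝ) : ℝ≥0∞ :=
  ∫⁻ W, ENNReal.ofReal ((X W - ensMean μ X) ^ 2) ∂μ

/-- The spectral gap estimate (SG) with constants `ρ` and `ℓ`. -/
def SpectralGap {d : ℕ} {lam : ℝ} (μ : Measure (CoeffField d lam)) (ρ ℓ : ℝ) : Prop :=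
  ∀ X : CoeffField d lam → ℝ, Measurable X →
    ensVar μ X ≤ ENNReal.ofReal ρ⁻¹ *
      outerE μ (fun W => ∫⁻ z : E d, (osc (ball z ℓ) X W) ^ 2)

/-- The gradient of a test function, as a vector of `ℝ^d`. -/
def gradAt {d : ℕ} (χ : E d → ℝ) (x : E d) : Fin d → ℝ :=
  fun i => fderiv ℝ χ x (EuclideanSpace.single i 1)

/-- `φ ∈ H¹_loc(ℝ^d)` with weak gradient `Dφ`. -/
def IsWeakH1Loc {d : ℕ} (φ : E d → ℝ) (Dφ : E d → Fin d → ℝ) : Prop :=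
  (∀ R : ℝ, 0 < R →
    IntegrableOn (fun x => (φ x) ^ 2) (ball (0:E d) R) volume ∧
    IntegrableOn (fun x => Dφ x ⬝ᵥ Dφ x) (ball (0:E d) R) volume) ∧
  (∀ χ : E d → ℝ, IsTestFun d χ → ∀ i : Fin d,
    ∫ x : E d, φ x * gradAt χ x i = - ∫ x : E d, Dφ x i * χ x)

/-- The uniqueness class: `limsup_{t↑∞} ⨍_{B_t} (φ² + |∇φ|²) < ∞`. -/
def GrowthClass {d : ℕ} (φ : E d → ℝ) (Dφ : E d → Fin d → ℝ) : Prop :=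
  Filter.limsup (fun t : ℝ =>
      (∫⁻ x in ball (0:E d) t, ENNReal.ofReal ((φ x) ^ 2 + Dφ x ⬝ᵥ Dφ x)) /
        volume (ball (0:E d) t)) Filter.atTop < ⊤

/-- The modified corrector: distributional solution of `T⁻¹φ_T − ∇·A(ξ+∇φ_T) = 0`
in the growth class. -/
def IsModifiedCorrector {d : ℕ} {lam : ℝ} (W : CoeffField d lam) (T : ℝ) (ξ : Fin d → ℝ)
    (φ : E d → ℝ) (Dφ : E d → Fin d → ℝ) : Prop :=
  IsWeakH1Loc φ Dφ ∧ GrowthClass φ Dφ ∧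
  ∀ χ : E d → ℝ, IsTestFun d χ →
    ∫ x : E d, (T⁻¹ * φ x * χ x + gradAt χ x ⬝ᵥ (W.A x).mulVec (ξ + Dφ x)) = 0

/-- The modified adjoint corrector (with `A` replaced by its pointwise transpose `A*`). -/
def IsModifiedAdjointCorrector {d : ℕ} {lam : ℝ} (W : CoeffField d lam) (T : ℝ)
    (ξ' : Fin d → ℝ) (φ : E d → ℝ) (Dφ : E d → Fin d → ℝ) : Prop :=
  IsWeakH1Loc φ Dφ ∧ GrowthClass φ Dφ ∧
  ∀ χ : E d → ℝ, IsTestFun d χ →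
    ∫ x : E d, (T⁻¹ * φ x * χ x + gradAt χ x ⬝ᵥ ((W.A x).transpose).mulVec (ξ' + Dφ x)) = 0

/-- The solution `ψ_T` of `T⁻¹ψ_T − ∇·A∇ψ_T = φ_T` in the growth class. -/
def IsPsiSolution {d : ℕ} {lam : ℝ} (W : CoeffField d lam) (T : ℝ) (φ : E d → ℝ)
    (ψ : E d → ℝ) (Dψ : E d → Fin d → ℝ) : Prop :=
  IsWeakH1Loc ψ Dψ ∧ GrowthClass ψ Dψ ∧
  ∀ χ : E d → ℝ, IsTestFun d χ →
    ∫ x : E d, (T⁻¹ * ψ x * χ x + gradAt χ x ⬝ᵥ (W.A x).mulVec (Dψ x)) = ∫ x : E d, φ x * χ x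

/-- The pointwise bound `g_T` for the Green function. -/
def gBound (d : ℕ) (c T r : ℝ) : ℝ :=
  Real.exp (-(c * r) / Real.sqrt T) *
    (if d = 2 then Real.log (2 + Real.sqrt T / r) else r ^ ((2:ℝ) - (d:ℝ)))

/-- `Df` is the weak gradient of `f`. -/
def HasWeakGrad {d : ℕ} (f : E d → ℝ) (Df : E d → Fin d → ℝ) : Prop :=
  ∀ χ : E d → ℝ, IsTestFun d χ → ∀ i : Fin d,
    ∫ x : E d, f x * gradAt χ x i = - ∫ x : E d, Df x i * χ x

/-- The defining properties of the Green function `G_T` (with constants `c`, `C`). -/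
def GreenProps {d : ℕ} {lam : ℝ} (W : CoeffField d lam) (T : ℝ) (c C : ℝ)
    (G : E d → E d → ℝ) (DxG DyG : E d → E d → Fin d → ℝ) : Prop :=
  (∀ x y : E d, 0 ≤ G x y) ∧
  ContinuousOn (fun p : E d × E d => G p.1 p.2) {p : E d × E d | p.1 ≠ p.2} ∧
  (∀ x y : E d, x ≠ y → G x y ≤ C * gBound d c T (dist x y)) ∧
  (∀ y : E d, HasWeakGrad (fun x => G x y) (fun x => DxG x y)) ∧
  (∀ x : E d, HasWeakGrad (fun y => G x y) (fun y => DyG x y)) ∧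
  (∀ y : E d, ∀ R : ℝ, 0 < R →
    IntegrableOn (fun x => G x y) (ball (0:E d) R) volume ∧
    ∀ i : Fin d, IntegrableOn (fun x => DxG x y i) (ball (0:E d) R) volume) ∧
  (∀ x : E d, ∀ R : ℝ, 0 < R →
    IntegrableOn (fun y => G x y) (ball (0:E d) R) volume ∧
    ∀ i : Fin d, IntegrableOn (fun y => DyG x y i) (ball (0:E d) R) volume) ∧
  (∀ y : E d, ∀ R : ℝ, 0 < R →
    (∫⁻ x in {x : E d | R < dist x y ∧ dist x y < 2*R}, ENNReal.ofReal (DxG x y ⬝ᵥ DxG x y)) ≤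
      ENNReal.ofReal ((C * Real.exp (-(c*R) / Real.sqrt T) * R ^ ((1:ℝ) - (d:ℝ))) ^ 2 * R ^ d)) ∧
  (∀ x : E d, ∀ R : ℝ, 0 < R →
    (∫⁻ y in {y : E d | R < dist y x ∧ dist y x < 2*R}, ENNReal.ofReal (DyG x y ⬝ᵥ DyG x y)) ≤
      ENNReal.ofReal ((C * Real.exp (-(c*R) / Real.sqrt T) * R ^ ((1:ℝ) - (d:ℝ))) ^ 2 * R ^ d)) ∧
  (∀ y : E d, ∀ χ : E d → ℝ, IsTestFun d χ →
    ∫ x : E d, (T⁻¹ * G x y * χ x + gradAt χ x ⬝ᵥ (W.A x).mulVec (DxG x y)) = χ y) ∧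
  (∀ x : E d, ∀ χ : E d → ℝ, IsTestFun d χ →
    ∫ y : E d, (T⁻¹ * G x y * χ y + gradAt χ y ⬝ᵥ ((W.A y).transpose).mulVec (DyG x y)) = χ x)

/-- `G` is the Green function of `W`, with gradients `DxG`, `DyG`
(for some admissible constants `c`, `C`). -/
def IsGreenFunction {d : ℕ} {lam : ℝ} (W : CoeffField d lam) (T : ℝ)
    (G : E d → E d → ℝ) (DxG DyG : E d → E d → Fin d → ℝ) : Prop :=
  ∃ c C : ℝ, 0 < c ∧ 0 < C ∧ GreenProps W T c C G DxG DyG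

/-- `DDG` is the mixed second gradient `∇∇G` of the Green function. -/
def IsMixedGrad {d : ℕ} (DxG : E d → E d → Fin d → ℝ)
    (DDG : E d → E d → Fin d → Fin d → ℝ) : Prop :=
  ∀ (y : E d) (j : Fin d), HasWeakGrad (fun x => DxG y x j) (fun x => DDG y x j)

/-- The quantity `h_T(z,x)` built from the Green function gradient. -/
def hTval (d : ℕ) (R : ℝ) (DxG : E d → E d → Fin d → ℝ) (z x : E d) : ℝ :=
  if dist z x < 2*R then 1
  else Real.sqrt ((∫⁻ y in ball z R, ENNReal.ofReal (DxG y x ⬝ᵥ DxG y x)).toReal)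

/-- `ν_d(T)`. -/
def nud (d : ℕ) (T : ℝ) : ℝ :=
  if d = 2 then T * Real.log T
  else if d = 3 then Real.sqrt T
  else if d = 4 then Real.log T
  else 1

end GO

namespace GO

section GreenFunction

open scoped Gradient InnerProductSpace Topology NNReal

variable {d : ℕ}

/-- Continuously differentiable functions with compact support. -/
def CC1 (φ : E d → ℝ) : Prop := ContDiff ℝ 1 φ ∧ HasCompactSupport φ

/-- `(u, U)` lies in the closure of `{(φ, ∇φ) : φ ∈ C¹_c}` in `L² × L²`. -/
structure H1 (u : E d → ℝ) (U : E d → E d) : Prop where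
  mu : Measurable u
  mU : Measurable U
  lu : MemLp u 2 volume
  lU : MemLp U 2 volume
  approx : ∀ ε : ℝ≥0∞, 0 < ε → ∃ φ, CC1 φ ∧ eLpNorm (φ - u) 2 volume ≤ ε ∧
    eLpNorm (∇ φ - U) 2 volume ≤ ε

section Basic

theorem tendsto_eLpNorm_two_of_dominated {F : Type*} [NormedAddCommGroup F]
    {f : ℕ → E d → F} {f0 : E d → F} {g : E d → ℝ}
    (hf : ∀ n, AEStronglyMeasurable (f n) volume) (hf0 : AEStronglyMeasurable f0 volume)
    (hg : MemLp g 2 volume) (hb : ∀ n, ∀ᵐ x, ‖f n x - f0 x‖ ≤ g x)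
    (hl : ∀ᵐ x, Tendsto (fun n => f n x) atTop (𝓝 (f0 x))) :
    Tendsto (fun n => eLpNorm (f n - f0) 2 volume) atTop (𝓝 0) := by
  have h1 : Tendsto (fun n => ∫⁻ x, ‖(f n - f0) x‖ₑ ^ (2 : ℝ)) atTop
      (𝓝 (∫⁻ _ : E d, 0)) := by
    refine tendsto_lintegral_of_dominated_convergence' (fun x => ‖g x‖ₑ ^ (2 : ℝ)) ?_ ?_ ?_ ?_
    · intro n; exact (((hf n).sub hf0).enorm).pow_const _
    · intro n
      filter_upwards [hb n] with x hx
      gcongr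
      rw [Pi.sub_apply, enorm_le_iff_norm_le, Real.norm_eq_abs]
      exact hx.trans (le_abs_self _)
    · have := hg.2
      rw [eLpNorm_eq_lintegral_rpow_enorm_toReal (by norm_num) (by norm_num)] at this
      simp only [toReal_ofNat, one_div] at this
      intro h
      rw [h, ENNReal.top_rpow_of_pos (by norm_num)] at this
      exact absurd this (by simp)
    · filter_upwards [hl] with x hx
      have : Tendsto (fun n => ‖f n x - f0 x‖ₑ) atTop (𝓝 0) := by
        have := (tendsto_iff_norm_sub_tendsto_zero.1 hx)
        rw [← tendsto_zero_iff_enorm_tendsto_zero]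
        exact tendsto_zero_iff_norm_tendsto_zero.2 this
      have h2 := ((ENNReal.continuous_rpow_const (y := 2)).tendsto 0).comp this
      simpa [Function.comp_def] using h2
  simp only [lintegral_zero] at h1
  have h2 := ((ENNReal.continuous_rpow_const (y := 1/2)).tendsto 0).comp h1
  rw [ENNReal.zero_rpow_of_pos (by norm_num)] at h2
  refine h2.congr (fun n => ?_)
  rw [eLpNorm_eq_lintegral_rpow_enorm_toReal (by norm_num) (by norm_num)]
  simp

theorem CC1.continuous {φ : E d → ℝ} (h : CC1 φ) : Continuous φ := h.1.continuous

theorem continuous_gradient {φ : E d → ℝ} (h : ContDiff ℝ 1 φ) : Continuous (∇ φ) := by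
  have : Continuous (fderiv ℝ φ) := h.continuous_fderiv one_ne_zero
  exact (InnerProductSpace.toDual ℝ (E d)).symm.continuous.comp this

theorem hasCompactSupport_gradient {φ : E d → ℝ} (h : HasCompactSupport φ) :
    HasCompactSupport (∇ φ) := by
  have : HasCompactSupport (fderiv ℝ φ) := h.fderiv (𝕜 := ℝ)
  exact this.comp_left (g := (InnerProductSpace.toDual ℝ (E d)).symm) (map_zero _)

theorem norm_gradient (φ : E d → ℝ) (x : E d) : ‖∇ φ x‖ = ‖fderiv ℝ φ x‖ := by
  simp [gradient]

theorem CC1.memLp {φ : E d → ℝ} (h : CC1 φ) (p : ℝ≥0∞) : MemLp φ p volume :=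
  h.continuous.memLp_of_hasCompactSupport h.2

theorem CC1.memLp_grad {φ : E d → ℝ} (h : CC1 φ) (p : ℝ≥0∞) : MemLp (∇ φ) p volume :=
  (continuous_gradient h.1).memLp_of_hasCompactSupport (hasCompactSupport_gradient h.2)

theorem H1.of_CC1 {φ : E d → ℝ} (h : CC1 φ) : H1 φ (∇ φ) where
  mu := h.continuous.measurable
  mU := (continuous_gradient h.1).measurable
  lu := h.memLp 2
  lU := h.memLp_grad 2
  approx ε _ := ⟨φ, h, by simp, by simp⟩

/-- Closedness of `H1` under `L²` limits. -/
theorem H1.of_approx {u : E d → ℝ} {U : E d → E d} (mu : Measurable u) (mU : Measurable U)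
    (lu : MemLp u 2 volume) (lU : MemLp U 2 volume)
    (h : ∀ ε : ℝ≥0∞, 0 < ε → ∃ v V, H1 v V ∧ eLpNorm (v - u) 2 volume ≤ ε ∧
      eLpNorm (V - U) 2 volume ≤ ε) : H1 u U where
  mu := mu
  mU := mU
  lu := lu
  lU := lU
  approx ε hε := by
    have hε2 : 0 < ε / 2 := ENNReal.half_pos hε.ne'
    obtain ⟨v, V, hv, h1, h2⟩ := h _ hε2
    obtain ⟨φ, hφ, h3, h4⟩ := hv.approx _ hε2
    refine ⟨φ, hφ, ?_, ?_⟩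
    · calc eLpNorm (φ - u) 2 volume = eLpNorm ((φ - v) + (v - u)) 2 volume := by congr 1; abel
        _ ≤ _ := eLpNorm_add_le ((hφ.memLp 2).1.sub hv.lu.1) (hv.lu.1.sub lu.1) (by norm_num)
        _ ≤ ε / 2 + ε / 2 := add_le_add h3 h1
        _ = ε := ENNReal.add_halves ε
    · calc eLpNorm (∇ φ - U) 2 volume = eLpNorm ((∇ φ - V) + (V - U)) 2 volume := by
            congr 1; abel
        _ ≤ _ := eLpNorm_add_le ((hφ.memLp_grad 2).1.sub hv.lU.1) (hv.lU.1.sub lU.1) (by norm_num)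
        _ ≤ ε / 2 + ε / 2 := add_le_add h4 h2
        _ = ε := ENNReal.add_halves ε

theorem H1.of_tendsto {u : E d → ℝ} {U : E d → E d} (mu : Measurable u) (mU : Measurable U)
    (lu : MemLp u 2 volume) (lU : MemLp U 2 volume) {v : ℕ → E d → ℝ} {V : ℕ → E d → E d}
    (h : ∀ n, H1 (v n) (V n)) (h1 : Tendsto (fun n => eLpNorm (v n - u) 2 volume) atTop (𝓝 0))
    (h2 : Tendsto (fun n => eLpNorm (V n - U) 2 volume) atTop (𝓝 0)) : H1 u U := by
  refine H1.of_approx mu mU lu lU (fun ε hε => ?_)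
  obtain ⟨n, hn1, hn2⟩ := ((ENNReal.tendsto_nhds_zero.1 h1 ε hε).and
    (ENNReal.tendsto_nhds_zero.1 h2 ε hε)).exists
  exact ⟨_, _, h n, hn1, hn2⟩

/-- An approximating sequence converging in `L²` and almost everywhere. -/
theorem H1.exists_seq {u : E d → ℝ} {U : E d → E d} (h : H1 u U) :
    ∃ φ : ℕ → E d → ℝ, (∀ n, CC1 (φ n)) ∧
      Tendsto (fun n => eLpNorm (φ n - u) 2 volume) atTop (𝓝 0) ∧
      Tendsto (fun n => eLpNorm (∇ (φ n) - U) 2 volume) atTop (𝓝 0) ∧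
      (∀ᵐ x, Tendsto (fun n => φ n x) atTop (𝓝 (u x))) := by
  have hpos : ∀ n : ℕ, (0 : ℝ≥0∞) < ((n : ℝ≥0∞) + 1)⁻¹ := fun n => by simp
  choose φ hφ h1 h2 using fun n : ℕ => h.approx _ (hpos n)
  have hlim : Tendsto (fun n : ℕ => ((n : ℝ≥0∞) + 1)⁻¹) atTop (𝓝 0) := by
    have := ENNReal.tendsto_inv_nat_nhds_zero.comp (tendsto_add_atTop_nat 1)
    simpa [Function.comp_def] using this
  have h1' : Tendsto (fun n => eLpNorm (φ n - u) 2 volume) atTop (𝓝 0) :=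
    tendsto_of_tendsto_of_tendsto_of_le_of_le tendsto_const_nhds hlim (fun _ => zero_le) h1
  have h2' : Tendsto (fun n => eLpNorm (∇ (φ n) - U) 2 volume) atTop (𝓝 0) :=
    tendsto_of_tendsto_of_tendsto_of_le_of_le tendsto_const_nhds hlim (fun _ => zero_le) h2
  have hm := tendstoInMeasure_of_tendsto_eLpNorm (by norm_num : (2 : ℝ≥0∞) ≠ 0)
    (fun n => ((hφ n).memLp 2).1) h.lu.1 h1'
  obtain ⟨ns, hns, hae⟩ := hm.exists_seq_tendsto_ae
  exact ⟨fun n => φ (ns n), fun n => hφ _, h1'.comp hns.tendsto_atTop,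
    h2'.comp hns.tendsto_atTop, hae⟩

theorem HasGradientAt.mul {f g : E d → ℝ} {f' g' x : E d} (hf : HasGradientAt f f' x)
    (hg : HasGradientAt g g' x) : HasGradientAt (fun y => f y * g y) (f x • g' + g x • f') x := by
  rw [hasGradientAt_iff_hasFDerivAt] at *
  rw [map_add, map_smul, map_smul]
  exact HasFDerivAt.mul hf hg

theorem HasGradientAt.add {f g : E d → ℝ} {f' g' x : E d} (hf : HasGradientAt f f' x)
    (hg : HasGradientAt g g' x) : HasGradientAt (fun y => f y + g y) (f' + g') x := by
  rw [hasGradientAt_iff_hasFDerivAt] at *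
  rw [map_add]
  exact HasFDerivAt.add hf hg

theorem HasGradientAt.comp_real {f : E d → ℝ} {F : ℝ → ℝ} {f' x : E d} {a : ℝ}
    (hF : HasDerivAt F a (f x)) (hf : HasGradientAt f f' x) :
    HasGradientAt (fun y => F (f y)) (a • f') x := by
  rw [hasGradientAt_iff_hasFDerivAt] at *
  rw [map_smul]
  exact hF.comp_hasFDerivAt x hf

theorem ContDiff.hasGrad {f : E d → ℝ} (h : ContDiff ℝ 1 f) (x : E d) :
    HasGradientAt f (∇ f x) x :=
  (h.differentiable one_ne_zero x).hasGradientAt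

theorem CC1.hasGrad {f : E d → ℝ} (h : CC1 f) (x : E d) : HasGradientAt f (∇ f x) x :=
  ContDiff.hasGrad h.1 x

theorem H1.add {u v : E d → ℝ} {U V : E d → E d} (hu : H1 u U) (hv : H1 v V) :
    H1 (fun x => u x + v x) (fun x => U x + V x) where
  mu := hu.mu.add hv.mu
  mU := hu.mU.add hv.mU
  lu := hu.lu.add hv.lu
  lU := hu.lU.add hv.lU
  approx ε hε := by
    have hε2 : 0 < ε / 2 := ENNReal.half_pos hε.ne'
    obtain ⟨φ, hφ, h1, h2⟩ := hu.approx _ hε2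
    obtain ⟨ψ, hψ, h3, h4⟩ := hv.approx _ hε2
    refine ⟨φ + ψ, ⟨hφ.1.add hψ.1, hφ.2.add hψ.2⟩, ?_, ?_⟩
    · calc _ = eLpNorm ((φ - u) + (ψ - v)) 2 volume := by
            congr 1; ext x; simp; ring
        _ ≤ _ := eLpNorm_add_le ((hφ.memLp 2).1.sub hu.lu.1) ((hψ.memLp 2).1.sub hv.lu.1)
            (by norm_num)
        _ ≤ ε / 2 + ε / 2 := add_le_add h1 h3
        _ = ε := ENNReal.add_halves ε
    · have : ∇ (φ + ψ) = ∇ φ + ∇ ψ := by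
        refine gradient_eq (fun x => ?_)
        exact HasGradientAt.add (hφ.hasGrad x) (hψ.hasGrad x)
      calc _ = eLpNorm ((∇ φ - U) + (∇ ψ - V)) 2 volume := by
            congr 1; rw [this]; ext x; simp; ring
        _ ≤ _ := eLpNorm_add_le ((hφ.memLp_grad 2).1.sub hu.lU.1)
            ((hψ.memLp_grad 2).1.sub hv.lU.1) (by norm_num)
        _ ≤ ε / 2 + ε / 2 := add_le_add h2 h4
        _ = ε := ENNReal.add_halves ε

theorem H1.congr_ae {u v : E d → ℝ} {U V : E d → E d} (hu : H1 u U) (mv : Measurable v)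
    (mV : Measurable V) (h1 : u =ᵐ[volume] v) (h2 : U =ᵐ[volume] V) : H1 v V :=
  H1.of_approx mv mV ((memLp_congr_ae h1).1 hu.lu) ((memLp_congr_ae h2).1 hu.lU) (fun ε _ =>
    ⟨u, U, hu, by
      rw [eLpNorm_congr_ae (g := fun _ => 0) (by filter_upwards [h1] with x hx; simp [hx])]; simp,
      by rw [eLpNorm_congr_ae (g := fun _ => 0) (by filter_upwards [h2] with x hx; simp [hx])]
         simp⟩)

/-- Multiplication by a bounded `C¹` function with bounded gradient. -/
theorem H1.mul_C1 {u η : E d → ℝ} {U : E d → E d} (hu : H1 u U) (hη : ContDiff ℝ 1 η)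
    {K : ℝ} (hK : ∀ x, |η x| ≤ K) (hK' : ∀ x, ‖∇ η x‖ ≤ K) :
    H1 (fun x => η x * u x) (fun x => η x • U x + u x • ∇ η x) := by
  have mη := hη.continuous.measurable
  have mη' := (continuous_gradient hη).measurable
  have key : ∀ {v : E d → ℝ}, AEStronglyMeasurable v volume →
      eLpNorm (fun x => η x * v x) 2 volume ≤ ENNReal.ofReal K * eLpNorm v 2 volume := by
    intro v hv
    refine eLpNorm_le_mul_eLpNorm_of_ae_le_mul (Eventually.of_forall fun x => ?_) 2
    rw [norm_mul]; gcongr; exact hK x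
  have key2 : ∀ {V : E d → E d}, AEStronglyMeasurable V volume →
      eLpNorm (fun x => η x • V x) 2 volume ≤ ENNReal.ofReal K * eLpNorm V 2 volume := by
    intro v hv
    refine eLpNorm_le_mul_eLpNorm_of_ae_le_mul (Eventually.of_forall fun x => ?_) 2
    rw [norm_smul]; gcongr; exact hK x
  have key3 : ∀ {v : E d → ℝ}, AEStronglyMeasurable v volume →
      eLpNorm (fun x => v x • ∇ η x) 2 volume ≤ ENNReal.ofReal K * eLpNorm v 2 volume := by
    intro v hv
    refine eLpNorm_le_mul_eLpNorm_of_ae_le_mul (Eventually.of_forall fun x => ?_) 2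
    rw [norm_smul, mul_comm]; gcongr; exact hK' x
  have mU' : Measurable (fun x => η x • U x + u x • ∇ η x) :=
    (mη.smul hu.mU).add (hu.mu.smul mη')
  obtain ⟨φ, hφ, h1, h2, -⟩ := hu.exists_seq
  refine H1.of_tendsto (mη.mul hu.mu) mU' ?_ ?_ (v := fun n x => η x * φ n x)
    (V := fun n x => η x • ∇ (φ n) x + φ n x • ∇ η x) ?_ ?_ ?_
  · exact ⟨(mη.mul hu.mu).aestronglyMeasurable,
      (key hu.lu.1).trans_lt (ENNReal.mul_lt_top (by simp) hu.lu.2)⟩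
  · refine MemLp.add ⟨(mη.smul hu.mU).aestronglyMeasurable,
      (key2 hu.lU.1).trans_lt (ENNReal.mul_lt_top (by simp) hu.lU.2)⟩
      ⟨(hu.mu.smul mη').aestronglyMeasurable,
      (key3 hu.lu.1).trans_lt (ENNReal.mul_lt_top (by simp) hu.lu.2)⟩
  · intro n
    have hc : CC1 (fun x => η x * φ n x) := ⟨hη.mul (hφ n).1, (hφ n).2.mul_left⟩
    have hg : ∇ (fun x => η x * φ n x) = fun x => η x • ∇ (φ n) x + φ n x • ∇ η x :=
      gradient_eq fun x => HasGradientAt.mul (ContDiff.hasGrad hη x) ((hφ n).hasGrad x)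
    have := H1.of_CC1 hc
    rwa [hg] at this
  · have h3 : Tendsto (fun n => ENNReal.ofReal K * eLpNorm (φ n - u) 2 volume) atTop (𝓝 0) := by
      simpa using ENNReal.Tendsto.const_mul h1 (Or.inr ENNReal.ofReal_ne_top)
    refine tendsto_of_tendsto_of_tendsto_of_le_of_le tendsto_const_nhds h3 (fun _ => zero_le)
      (fun n => ?_)
    refine le_trans (le_of_eq ?_) (key (((hφ n).memLp 2).1.sub hu.lu.1))
    congr 1; ext x; simp [mul_sub]
  · have h3 : Tendsto (fun n => ENNReal.ofReal K * eLpNorm (∇ (φ n) - U) 2 volume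
        + ENNReal.ofReal K * eLpNorm (φ n - u) 2 volume) atTop (𝓝 0) := by
      simpa using (ENNReal.Tendsto.const_mul h2 (Or.inr ENNReal.ofReal_ne_top)).add
        (ENNReal.Tendsto.const_mul h1 (Or.inr ENNReal.ofReal_ne_top))
    refine tendsto_of_tendsto_of_tendsto_of_le_of_le tendsto_const_nhds h3 (fun _ => zero_le)
      (fun n => ?_)
    have a1 : AEStronglyMeasurable (∇ (φ n) - U) volume := ((hφ n).memLp_grad 2).1.sub hu.lU.1
    have a2 : AEStronglyMeasurable (φ n - u) volume := ((hφ n).memLp 2).1.sub hu.lu.1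
    refine le_trans (le_trans (le_of_eq ?_) (eLpNorm_add_le
      (f := fun x => η x • (∇ (φ n) - U) x) (g := fun x => (φ n - u) x • ∇ η x)
      (mη.aestronglyMeasurable.smul a1) (a2.smul mη'.aestronglyMeasurable) (by norm_num)))
      (add_le_add (key2 a1) (key3 a2))
    congr 1; ext x; simp [mul_sub, sub_mul]; ring

theorem H1.const_mul {u : E d → ℝ} {U : E d → E d} (hu : H1 u U) (c : ℝ) :
    H1 (fun x => c * u x) (fun x => c • U x) := by
  have := hu.mul_C1 (η := fun _ => c) contDiff_const (K := |c|) (fun _ => le_rfl)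
    (fun x => by rw [gradient_fun_const]; simp)
  simpa [gradient_fun_const] using this

theorem H1.neg {u : E d → ℝ} {U : E d → E d} (hu : H1 u U) :
    H1 (fun x => - u x) (fun x => - U x) := by
  simpa using hu.const_mul (-1)

theorem H1.sub {u v : E d → ℝ} {U V : E d → E d} (hu : H1 u U) (hv : H1 v V) :
    H1 (fun x => u x - v x) (fun x => U x - V x) := by
  simpa [sub_eq_add_neg] using hu.add hv.neg

end Basic

section Truncation

theorem lipschitz_of_deriv_le {F f : ℝ → ℝ} (hF : ∀ s, HasDerivAt F (f s) s) {K : ℝ}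
    (hK : ∀ s, |f s| ≤ K) (s t : ℝ) : |F s - F t| ≤ K * |s - t| := by
  have := Convex.norm_image_sub_le_of_norm_hasDerivWithin_le (f := F) (f' := f) (C := K)
    (s := Set.univ) (x := t) (y := s) (fun x _ => (hF x).hasDerivWithinAt) (fun x _ => hK x)
    convex_univ trivial trivial
  simpa using this

theorem H1.comp_C1 {u : E d → ℝ} {U : E d → E d} (hu : H1 u U) {F f : ℝ → ℝ}
    (hF : ∀ s, HasDerivAt F (f s) s) (hf : Continuous f) {K : ℝ} (hK : ∀ s, |f s| ≤ K) :
    H1 (fun x => F (u x) - F 0) (fun x => f (u x) • U x) := by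
  have hFc : ContDiff ℝ 1 F := by
    rw [contDiff_one_iff_deriv]
    refine ⟨fun s => (hF s).differentiableAt, ?_⟩
    rwa [show deriv F = f from funext fun s => (hF s).deriv]
  have hlip := lipschitz_of_deriv_le hF hK
  obtain ⟨φ, hφ, h1, h2, h3⟩ := hu.exists_seq
  have mu' : Measurable (fun x => F (u x) - F 0) :=
    (hFc.continuous.measurable.comp hu.mu).sub_const _
  have mU' : Measurable (fun x => f (u x) • U x) := (hf.measurable.comp hu.mu).smul hu.mU
  refine H1.of_tendsto mu' mU' ?_ ?_ (v := fun n x => F (φ n x) - F 0)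
    (V := fun n x => f (φ n x) • ∇ (φ n) x) ?_ ?_ ?_
  · refine MemLp.of_le_mul (c := K) hu.lu mu'.aestronglyMeasurable
      (Eventually.of_forall fun x => ?_)
    simpa using hlip (u x) 0
  · refine MemLp.of_le_mul (c := K) hu.lU mU'.aestronglyMeasurable
      (Eventually.of_forall fun x => ?_)
    rw [norm_smul]; gcongr; exact hK _
  · intro n
    have hc : CC1 (fun x => F (φ n x) - F 0) :=
      ⟨(hFc.comp (hφ n).1).sub contDiff_const,
        (hφ n).2.comp_left (g := fun s => F s - F 0) (by simp)⟩
    have hg : ∇ (fun x => F (φ n x) - F 0) = fun x => f (φ n x) • ∇ (φ n) x := by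
      refine gradient_eq fun x => ?_
      exact HasGradientAt.comp_real (F := fun s => F s - F 0) ((hF _).sub_const _)
        ((hφ n).hasGrad x)
    have := H1.of_CC1 hc
    rwa [hg] at this
  · have h4 : Tendsto (fun n => ENNReal.ofReal K * eLpNorm (φ n - u) 2 volume) atTop (𝓝 0) := by
      simpa using ENNReal.Tendsto.const_mul h1 (Or.inr ENNReal.ofReal_ne_top)
    refine tendsto_of_tendsto_of_tendsto_of_le_of_le tendsto_const_nhds h4 (fun _ => zero_le)
      (fun n => ?_)
    refine eLpNorm_le_mul_eLpNorm_of_ae_le_mul (Eventually.of_forall fun x => ?_) 2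
    simpa using hlip (φ n x) (u x)
  · have m1 : ∀ n, AEStronglyMeasurable (fun x => f (φ n x) • U x) volume := fun n =>
      ((hf.measurable.comp (hφ n).continuous.measurable).smul hu.mU).aestronglyMeasurable
    have h5 : Tendsto (fun n => eLpNorm ((fun x => f (φ n x) • U x) - fun x => f (u x) • U x)
        2 volume) atTop (𝓝 0) := by
      refine tendsto_eLpNorm_two_of_dominated (g := fun x => (2 * K) * ‖U x‖) m1
        mU'.aestronglyMeasurable (hu.lU.norm.const_mul _) ?_ ?_
      · refine fun n => Eventually.of_forall fun x => ?_
        rw [← sub_smul, norm_smul]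
        gcongr
        calc _ ≤ |f (φ n x)| + |f (u x)| := abs_sub _ _
          _ ≤ _ := by linarith [hK (φ n x), hK (u x)]
      · filter_upwards [h3] with x hx
        exact ((hf.tendsto _).comp hx).smul_const _
    have h4 : Tendsto (fun n => ENNReal.ofReal K * eLpNorm (∇ (φ n) - U) 2 volume +
        eLpNorm ((fun x => f (φ n x) • U x) - fun x => f (u x) • U x) 2 volume)
        atTop (𝓝 0) := by
      simpa using (ENNReal.Tendsto.const_mul h2 (Or.inr ENNReal.ofReal_ne_top)).add h5
    refine tendsto_of_tendsto_of_tendsto_of_le_of_le tendsto_const_nhds h4 (fun _ => zero_le)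
      (fun n => ?_)
    have a1 : AEStronglyMeasurable (∇ (φ n) - U) volume := ((hφ n).memLp_grad 2).1.sub hu.lU.1
    have a2 : AEStronglyMeasurable (fun x => f (φ n x) • (∇ (φ n) - U) x) volume :=
      (hf.measurable.comp (hφ n).continuous.measurable).aestronglyMeasurable.smul a1
    have b1 : eLpNorm (fun x => f (φ n x) • (∇ (φ n) - U) x) 2 volume
        ≤ ENNReal.ofReal K * eLpNorm (∇ (φ n) - U) 2 volume := by
      refine eLpNorm_le_mul_eLpNorm_of_ae_le_mul (Eventually.of_forall fun x => ?_) 2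
      rw [norm_smul]; gcongr; exact hK _
    refine le_trans (le_trans (le_of_eq ?_) (eLpNorm_add_le a2
      ((m1 n).sub mU'.aestronglyMeasurable) (by norm_num))) (add_le_add_left b1 _)
    congr 1; ext x; simp [mul_sub]

/-- Smooth approximations of `s ↦ (s - k)₊`. -/
def smoothPos (δ s : ℝ) : ℝ := ((s - δ) + Real.sqrt ((s - δ) ^ 2 + δ ^ 4)) / 2

def smoothPosDeriv (δ s : ℝ) : ℝ := (1 + (s - δ) / Real.sqrt ((s - δ) ^ 2 + δ ^ 4)) / 2

theorem smoothPos_hasDerivAt {δ : ℝ} (hδ : 0 < δ) (s : ℝ) :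
    HasDerivAt (smoothPos δ) (smoothPosDeriv δ s) s := by
  have hpos : 0 < (s - δ) ^ 2 + δ ^ 4 := by positivity
  have h1 : HasDerivAt (fun s => s - δ) 1 s := (hasDerivAt_id s).sub_const δ
  have h2 : HasDerivAt (fun s => (s - δ) ^ 2 + δ ^ 4) (2 * (s - δ)) s := by
    simpa using (h1.pow 2).add_const (δ ^ 4)
  have h3 := (h1.add (h2.sqrt hpos.ne')).div_const 2
  refine HasDerivAt.congr_deriv (f := smoothPos δ) h3 ?_
  unfold smoothPosDeriv
  rw [mul_div_mul_left _ _ two_ne_zero]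

theorem smoothPosDeriv_abs_le {δ : ℝ} (hδ : 0 < δ) (s : ℝ) : |smoothPosDeriv δ s| ≤ 1 := by
  have hpos : 0 < (s - δ) ^ 2 + δ ^ 4 := by positivity
  have h1 : |(s - δ) / Real.sqrt ((s - δ) ^ 2 + δ ^ 4)| ≤ 1 := by
    rw [abs_div, abs_of_pos (Real.sqrt_pos.2 hpos), div_le_one (Real.sqrt_pos.2 hpos)]
    exact Real.abs_le_sqrt (by nlinarith [sq_nonneg (δ ^ 2)])
  rw [abs_le] at h1 ⊢
  unfold smoothPosDeriv
  constructor <;> linarith [h1.1, h1.2]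

theorem smoothPosDeriv_continuous {δ : ℝ} (hδ : 0 < δ) : Continuous (smoothPosDeriv δ) := by
  unfold smoothPosDeriv
  refine Continuous.div_const (continuous_const.add (Continuous.div (by fun_prop) (by fun_prop)
    fun s => ?_)) 2
  exact (Real.sqrt_pos.2 (by positivity)).ne'

theorem smoothPos_tendsto (s : ℝ) : Tendsto (fun δ => smoothPos δ s) (𝓝 0) (𝓝 (max s 0)) := by
  have : Continuous fun δ => smoothPos δ s := by unfold smoothPos; fun_prop
  convert this.tendsto 0 using 2
  simp only [smoothPos, sub_zero, ne_eq, OfNat.ofNat_ne_zero, not_false_eq_true, zero_pow,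
    add_zero, Real.sqrt_sq_eq_abs]
  rcases le_total 0 s with h | h
  · rw [max_eq_left h, abs_of_nonneg h]; ring
  · rw [max_eq_right h, abs_of_nonpos h]; ring

theorem smoothPosDeriv_tendsto (s : ℝ) :
    Tendsto (fun δ => smoothPosDeriv δ s) (𝓝[>] 0) (𝓝 (if 0 < s then 1 else 0)) := by
  rcases eq_or_ne s 0 with rfl | hs
  · have h1 : Continuous fun δ : ℝ => (1 - 1 / Real.sqrt (1 + δ ^ 2)) / 2 := by
      refine Continuous.div_const (continuous_const.sub (Continuous.div (by fun_prop)
        (by fun_prop) fun s => ?_)) 2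
      exact (Real.sqrt_pos.2 (by positivity)).ne'
    have h2 := (h1.tendsto 0).mono_left (nhdsWithin_le_nhds (s := Set.Ioi (0:ℝ)))
    simp only [lt_irrefl, if_false]
    convert h2.congr' ?_ using 2
    · simp
    · filter_upwards [self_mem_nhdsWithin] with δ hδ
      have hδ : 0 < δ := hδ
      unfold smoothPosDeriv
      rw [show (0 - δ) ^ 2 + δ ^ 4 = δ ^ 2 * (1 + δ ^ 2) by ring,
        Real.sqrt_mul (by positivity), Real.sqrt_sq hδ.le]
      congr 1
      have : Real.sqrt (1 + δ ^ 2) ≠ 0 := (Real.sqrt_pos.2 (by positivity)).ne'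
      field_simp
      ring
  · have hc : ContinuousAt (fun δ => smoothPosDeriv δ s) 0 := by
      unfold smoothPosDeriv
      refine ContinuousAt.div_const (continuousAt_const.add (ContinuousAt.div (by fun_prop)
        (by fun_prop) ?_)) 2
      simp [Real.sqrt_sq_eq_abs, hs]
    have h2 := hc.tendsto.mono_left (nhdsWithin_le_nhds (s := Set.Ioi (0:ℝ)))
    convert h2 using 2
    simp only [smoothPosDeriv, sub_zero, ne_eq, OfNat.ofNat_ne_zero, not_false_eq_true, zero_pow,
      add_zero, Real.sqrt_sq_eq_abs]
    rcases lt_or_gt_of_ne hs with h | h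
    · rw [if_neg (by linarith), abs_of_neg h, div_neg, div_self hs]; norm_num
    · rw [if_pos h, abs_of_pos h, div_self hs]; norm_num

/-- Truncation at level `k`. -/
theorem H1.trunc {u : E d → ℝ} {U : E d → E d} (hu : H1 u U) (k : ℝ) :
    H1 (fun x => max (u x - k) 0 - max (-k) 0) ({x | k < u x}.indicator U) := by
  set δ : ℕ → ℝ := fun n => 1 / ((n : ℝ) + 1) with hδ
  have hδpos : ∀ n, 0 < δ n := fun n => by positivity
  have hδ0 : Tendsto δ atTop (𝓝 0) := tendsto_one_div_add_atTop_nhds_zero_nat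
  have hδ0' : Tendsto δ atTop (𝓝[>] 0) :=
    tendsto_nhdsWithin_iff.2 ⟨hδ0, Eventually.of_forall hδpos⟩
  have hder : ∀ n s, HasDerivAt (fun s => smoothPos (δ n) (s - k))
      (smoothPosDeriv (δ n) (s - k)) s := fun n s => by
    have h1 : HasDerivAt (fun s => s - k) 1 s := (hasDerivAt_id s).sub_const k
    have := (smoothPos_hasDerivAt (hδpos n) (s - k)).comp s h1
    rw [mul_one] at this
    exact this
  have hc : ∀ n, Continuous (fun s => smoothPosDeriv (δ n) (s - k)) := fun n =>
    (smoothPosDeriv_continuous (hδpos n)).comp (by fun_prop)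
  have hb : ∀ n s, |smoothPosDeriv (δ n) (s - k)| ≤ 1 := fun n s =>
    smoothPosDeriv_abs_le (hδpos n) _
  have hH := fun n => hu.comp_C1 (hder n) (hc n) (hb n)
  have mset : MeasurableSet {x | k < u x} := measurableSet_lt measurable_const hu.mu
  have mu' : Measurable (fun x => max (u x - k) 0 - max (-k) 0) :=
    ((hu.mu.sub_const k).max measurable_const).sub_const _
  have mU' : Measurable ({x | k < u x}.indicator U) := hu.mU.indicator mset
  have hlip : ∀ x, ‖max (u x - k) 0 - max (-k) 0‖ ≤ ‖u x‖ := fun x => by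
    have := abs_max_sub_max_le_abs (u x - k) (-k) 0
    simpa using this
  refine H1.of_tendsto mu' mU' (hu.lu.of_le mu'.aestronglyMeasurable
    (Eventually.of_forall hlip)) (hu.lU.indicator mset) hH ?_ ?_
  · refine tendsto_eLpNorm_two_of_dominated (g := fun x => 2 * ‖u x‖)
      (fun n => (hH n).mu.aestronglyMeasurable) mu'.aestronglyMeasurable
      (hu.lu.norm.const_mul _) (fun n => Eventually.of_forall fun x => ?_)
      (Eventually.of_forall fun x => ?_)
    · have := lipschitz_of_deriv_le (hder n) (hb n) (u x) 0
      calc _ ≤ |smoothPos (δ n) (u x - k) - smoothPos (δ n) (0 - k)|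
            + |max (u x - k) 0 - max (-k) 0| := abs_sub _ _
        _ ≤ _ := by
          have h2 := hlip x
          simp only [Real.norm_eq_abs, sub_zero, one_mul] at *
          linarith
    · rw [show -k = 0 - k by ring]
      exact ((smoothPos_tendsto _).comp hδ0).sub ((smoothPos_tendsto _).comp hδ0)
  · refine tendsto_eLpNorm_two_of_dominated (g := fun x => 2 * ‖U x‖)
      (fun n => (hH n).mU.aestronglyMeasurable) mU'.aestronglyMeasurable
      (hu.lU.norm.const_mul _) (fun n => Eventually.of_forall fun x => ?_)
      (Eventually.of_forall fun x => ?_)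
    · have h1 : ‖smoothPosDeriv (δ n) (u x - k) • U x‖ ≤ ‖U x‖ := by
        rw [norm_smul]; exact mul_le_of_le_one_left (norm_nonneg _) (hb n _)
      have h2 : ‖({x | k < u x}.indicator U) x‖ ≤ ‖U x‖ := norm_indicator_le_norm_self _ _
      calc _ ≤ _ := norm_sub_le _ _
        _ ≤ _ := by linarith
    · have h1 := ((smoothPosDeriv_tendsto (u x - k)).comp hδ0').smul_const (U x)
      rwa [show (if 0 < u x - k then (1:ℝ) else 0) • U x = ({x | k < u x}.indicator U) x by
        by_cases h : k < u x <;> simp [h]] at h1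

end Truncation

section Cutoff

/-- A universal bound for the derivative of the smooth transition function. -/
theorem exists_smoothTransition_deriv_bound :
    ∃ C : ℝ, 0 < C ∧ ∀ s, |deriv Real.smoothTransition s| ≤ C := by
  have hcd : ContDiff ℝ 1 Real.smoothTransition := Real.smoothTransition.contDiff
  have hc : Continuous (deriv Real.smoothTransition) := hcd.continuous_deriv le_rfl
  obtain ⟨C, hC⟩ := (isCompact_Icc (a := (0:ℝ)) (b := 1)).exists_bound_of_continuousOn
    hc.continuousOn
  refine ⟨max C 1, by positivity, fun s => ?_⟩
  by_cases hs : s ∈ Set.Icc (0:ℝ) 1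
  · exact (hC s hs).trans (le_max_left _ _)
  · have : deriv Real.smoothTransition s = 0 := by
      rw [Set.mem_Icc, not_and_or, not_le, not_le] at hs
      rcases hs with hs | hs
      · have : Real.smoothTransition =ᶠ[𝓝 s] fun _ => 0 := by
          filter_upwards [Iio_mem_nhds hs] with t ht
          exact Real.smoothTransition.zero_of_nonpos (le_of_lt ht)
        rw [this.deriv_eq]; simp
      · have : Real.smoothTransition =ᶠ[𝓝 s] fun _ => 1 := by
          filter_upwards [Ioi_mem_nhds hs] with t ht
          exact Real.smoothTransition.one_of_one_le (le_of_lt ht)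
        rw [this.deriv_eq]; simp
    rw [this]; simp

/-- `η` is a smooth cutoff for `ball x0 r ⊂ ball x0 R` with gradient bound `K`. -/
structure Cutoff (x0 : E d) (r R K : ℝ) (η : E d → ℝ) : Prop where
  smooth : ContDiff ℝ (⊤ : ℕ∞) η
  nonneg : ∀ x, 0 ≤ η x
  le_one : ∀ x, η x ≤ 1
  one : ∀ x, dist x x0 ≤ r → η x = 1
  zero : ∀ x, R ≤ dist x x0 → η x = 0
  grad_le : ∀ x, ‖∇ η x‖ ≤ K
  grad_zero : ∀ x, (dist x x0 < r ∨ R ≤ dist x x0) → ∇ η x = 0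

theorem exists_cutoff : ∃ C : ℝ, 0 < C ∧ ∀ (d : ℕ) (x0 : E d) (r R : ℝ), 0 < r → r < R →
    ∃ η : E d → ℝ, Cutoff x0 r R (C / (R - r)) η := by
  obtain ⟨C, hC, hb⟩ := exists_smoothTransition_deriv_bound
  refine ⟨2 * C, by positivity, fun d x0 r R hr hrR => ?_⟩
  have hRr : 0 < R ^ 2 - r ^ 2 := by nlinarith
  set q : E d → ℝ := fun x => (R ^ 2 - ‖x - x0‖ ^ 2) / (R ^ 2 - r ^ 2) with hq
  have hqs : ContDiff ℝ (⊤ : ℕ∞) q := by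
    refine ContDiff.div_const (contDiff_const.sub ?_) _
    exact (contDiff_id.sub contDiff_const).norm_sq ℝ
  have hη : ContDiff ℝ (⊤ : ℕ∞) (fun x => Real.smoothTransition (q x)) :=
    Real.smoothTransition.contDiff.comp hqs
  have hgq : ∀ x, HasGradientAt q (-(2 / (R ^ 2 - r ^ 2)) • (x - x0)) x := fun x => by
    rw [hasGradientAt_iff_hasFDerivAt]
    have h1 : HasFDerivAt (fun x : E d => x - x0) (ContinuousLinearMap.id ℝ (E d)) x :=
      (hasFDerivAt_id x).sub_const x0
    have h2 := (((h1.norm_sq).const_sub (R ^ 2)).mul_const (R ^ 2 - r ^ 2)⁻¹)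
    refine HasFDerivAt.congr_fderiv (f := q) (by simpa [hq, div_eq_mul_inv] using h2) ?_
    ext v
    simp
    ring
  have hgη : ∀ x, ∇ (fun x => Real.smoothTransition (q x)) x =
      deriv Real.smoothTransition (q x) • (-(2 / (R ^ 2 - r ^ 2)) • (x - x0)) := fun x => by
    refine HasGradientAt.gradient (HasGradientAt.comp_real ?_ (hgq x))
    exact ((Real.smoothTransition.contDiff (n := 1)).differentiable one_ne_zero _).hasDerivAt
  have hdz : ∀ s, s ≤ 0 ∨ 1 < s → deriv Real.smoothTransition s = 0 := by
    rintro s (hs | hs)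
    · have hmin : IsLocalMin Real.smoothTransition s := by
        refine Eventually.of_forall fun t => ?_
        rw [Real.smoothTransition.zero_of_nonpos hs]
        exact Real.smoothTransition.nonneg t
      exact hmin.deriv_eq_zero
    · have hmax : IsLocalMax Real.smoothTransition s := by
        refine Eventually.of_forall fun t => ?_
        rw [Real.smoothTransition.one_of_one_le hs.le]
        exact Real.smoothTransition.le_one t
      exact hmax.deriv_eq_zero
  have hz : ∀ x, R ≤ dist x x0 → q x ≤ 0 := fun x hx => by
    rw [dist_eq_norm] at hx
    refine div_nonpos_of_nonpos_of_nonneg ?_ hRr.le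
    nlinarith
  refine ⟨_, hη, fun x => Real.smoothTransition.nonneg _, fun x => Real.smoothTransition.le_one _,
    fun x hx => ?_, fun x hx => ?_, fun x => ?_, fun x hx => ?_⟩
  · apply Real.smoothTransition.one_of_one_le
    rw [dist_eq_norm] at hx
    rw [one_le_div hRr]
    nlinarith [norm_nonneg (x - x0)]
  · exact Real.smoothTransition.zero_of_nonpos (hz x hx)
  · rw [hgη]
    by_cases hx : R ≤ dist x x0
    · rw [hdz _ (Or.inl (hz x hx))]
      have : 0 < R - r := by linarith
      simp; positivity
    · rw [not_le, dist_eq_norm] at hx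
      rw [norm_smul, norm_smul, Real.norm_eq_abs, Real.norm_eq_abs, abs_neg,
        abs_of_pos (by positivity : 0 < 2 / (R ^ 2 - r ^ 2))]
      calc _ ≤ C * (2 / (R ^ 2 - r ^ 2) * R) := by
            gcongr
            exact hb _
        _ ≤ _ := by
          have h1 : R ^ 2 - r ^ 2 = (R - r) * (R + r) := by ring
          have h2 : 0 < R - r := by linarith
          have h3 : 0 < R + r := by linarith
          rw [h1, show C * (2 / ((R - r) * (R + r)) * R) = 2 * C / (R - r) * (R / (R + r)) by
            field_simp]
          refine mul_le_of_le_one_right (by positivity) ?_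
          rw [div_le_one h3]; linarith
  · rw [hgη]
    rcases hx with hx | hx
    · rw [hdz _ (Or.inr ?_), zero_smul]
      rw [dist_eq_norm] at hx
      rw [hq]
      simp only
      rw [one_lt_div hRr]
      nlinarith [norm_nonneg (x - x0)]
    · rw [hdz _ (Or.inl (hz x hx)), zero_smul]

theorem Cutoff.contDiff_one {x0 : E d} {r R K : ℝ} {η : E d → ℝ} (h : Cutoff x0 r R K η) :
    ContDiff ℝ 1 η := h.smooth.of_le (by exact_mod_cast le_top)

theorem Cutoff.hasCompactSupport {x0 : E d} {r R K : ℝ} {η : E d → ℝ} (h : Cutoff x0 r R K η) :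
    HasCompactSupport η :=
  HasCompactSupport.of_support_subset_isCompact (isCompact_closedBall x0 R) fun x hx => by
    by_contra hx'
    exact hx (h.zero x (le_of_lt (not_le.1 hx')))

theorem Cutoff.cc1 {x0 : E d} {r R K : ℝ} {η : E d → ℝ} (h : Cutoff x0 r R K η) : CC1 η :=
  ⟨h.contDiff_one, h.hasCompactSupport⟩

end Cutoff

section FaberKrahn

theorem eLpNorm_two_sq {F : Type*} [NormedAddCommGroup F] {f : E d → F} (hf : MemLp f 2 volume) :
    eLpNorm f 2 volume ^ 2 = ENNReal.ofReal (∫ x, ‖f x‖ ^ 2) := by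
  have h1 : Integrable (fun x => ‖f x‖ ^ 2) volume := hf.integrable_norm_pow two_ne_zero
  rw [eLpNorm_eq_lintegral_rpow_enorm_toReal (by norm_num) (by norm_num)]
  rw [← ENNReal.rpow_natCast, ← ENNReal.rpow_mul]
  simp only [toReal_ofNat, one_div, Nat.cast_ofNat, ne_eq, OfNat.ofNat_ne_zero, not_false_eq_true,
    inv_mul_cancel₀, ENNReal.rpow_one]
  rw [ofReal_integral_eq_lintegral_ofReal h1 (Eventually.of_forall fun x => by positivity)]
  refine lintegral_congr fun x => ?_
  rw [ENNReal.ofReal_pow (norm_nonneg _), ofReal_norm]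
  exact ENNReal.rpow_natCast _ 2

theorem sobolev_sq (hd : 2 ≤ d) : ∃ C : ℝ≥0, ∃ κ : ℝ≥0, NNReal.HolderConjugate (d : ℝ≥0) κ ∧
    ∀ (v : E d → ℝ) (V : E d → E d), H1 v V →
      eLpNorm (fun x => v x ^ 2) κ volume ≤ C * (eLpNorm v 2 volume * eLpNorm V 2 volume) := by
  have hd1 : (1 : ℝ≥0) < d := by exact_mod_cast hd
  obtain ⟨κ, hκ⟩ : ∃ κ, NNReal.HolderConjugate (d : ℝ≥0) κ :=
    ⟨_, NNReal.HolderConjugate.conjExponent hd1⟩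
  have hκ' : NNReal.HolderConjugate (Module.finrank ℝ (E d) : ℝ≥0) κ := by simpa using hκ
  refine ⟨2 * eLpNormLESNormFDerivOneConst (volume : Measure (E d)) κ, κ, hκ, fun v V hv => ?_⟩
  set C := eLpNormLESNormFDerivOneConst (volume : Measure (E d)) κ
  have hsm : ∀ φ : E d → ℝ, CC1 φ → eLpNorm (fun x => φ x ^ 2) κ volume ≤
      (2 * C : ℝ≥0) * (eLpNorm φ 2 volume * eLpNorm (∇ φ) 2 volume) := by
    intro φ hφ
    have h1 : ContDiff ℝ 1 (fun x => φ x ^ 2) := hφ.1.pow 2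
    have h2 : HasCompactSupport (fun x => φ x ^ 2) :=
      hφ.2.comp_left (g := fun s : ℝ => s ^ 2) (by simp)
    refine (eLpNorm_le_eLpNorm_fderiv_one volume h1 h2 hκ').trans ?_
    rw [ENNReal.coe_mul, mul_comm ((2:ℝ≥0) : ℝ≥0∞) (C : ℝ≥0∞), mul_assoc]
    gcongr
    have h3 : eLpNorm (fderiv ℝ fun x => φ x ^ 2) 1 volume ≤
        ENNReal.ofReal 2 * eLpNorm (φ • ∇ φ) 1 volume := by
      refine eLpNorm_le_mul_eLpNorm_of_ae_le_mul (Eventually.of_forall fun x => ?_) 1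
      rw [← norm_gradient]
      have : ∇ (fun x => φ x ^ 2) x = (2 * φ x) • ∇ φ x := by
        refine HasGradientAt.gradient (HasGradientAt.comp_real (F := fun s => s ^ 2) ?_
          (hφ.hasGrad x))
        simpa using hasDerivAt_pow 2 (φ x)
      rw [this, mul_smul, norm_smul]; simp
    refine h3.trans ?_
    rw [ENNReal.ofReal_ofNat]
    gcongr
    · simp
    · exact eLpNorm_smul_le_mul_eLpNorm (hφ.memLp_grad 2).1 (hφ.memLp 2).1
  obtain ⟨φ, hφ, h1, h2, h3⟩ := hv.exists_seq
  have hF := Lp.eLpNorm_lim_le_liminf_eLpNorm (p := κ) (μ := volume) (f := fun n x => φ n x ^ 2)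
    (fun n => ((hφ n).continuous.pow 2).aestronglyMeasurable) (fun x => v x ^ 2)
    (by filter_upwards [h3] with x hx; exact hx.pow 2)
  have b1 : ∀ n, eLpNorm (φ n) 2 volume ≤ eLpNorm v 2 volume + eLpNorm (φ n - v) 2 volume := by
    intro n
    calc _ = eLpNorm (v + (φ n - v)) 2 volume := by congr 1; abel
      _ ≤ _ := eLpNorm_add_le hv.lu.1 (((hφ n).memLp 2).1.sub hv.lu.1) (by norm_num)
  have b2 : ∀ n, eLpNorm (∇ (φ n)) 2 volume ≤
      eLpNorm V 2 volume + eLpNorm (∇ (φ n) - V) 2 volume := by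
    intro n
    calc _ = eLpNorm (V + (∇ (φ n) - V)) 2 volume := by congr 1; abel
      _ ≤ _ := eLpNorm_add_le hv.lU.1 (((hφ n).memLp_grad 2).1.sub hv.lU.1) (by norm_num)
  have hlim : Tendsto (fun n => ((2 * C : ℝ≥0) : ℝ≥0∞) *
      ((eLpNorm v 2 volume + eLpNorm (φ n - v) 2 volume) *
      (eLpNorm V 2 volume + eLpNorm (∇ (φ n) - V) 2 volume))) atTop
      (𝓝 ((2 * C : ℝ≥0) * ((eLpNorm v 2 volume + 0) * (eLpNorm V 2 volume + 0)))) := by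
    refine ENNReal.Tendsto.const_mul (ENNReal.Tendsto.mul (tendsto_const_nhds.add h1) ?_
      (tendsto_const_nhds.add h2) ?_) (Or.inr ENNReal.coe_ne_top)
    · right; simpa using hv.lU.2.ne
    · right; simpa using hv.lu.2.ne
  rw [add_zero, add_zero] at hlim
  refine hF.trans ?_
  rw [← hlim.liminf_eq]
  refine liminf_le_liminf (Eventually.of_forall fun n => ?_)
  refine (hsm _ (hφ n)).trans ?_
  gcongr
  · exact b1 n
  · exact b2 n

/-- Faber–Krahn type inequality. -/
theorem faberKrahn (hd : 2 ≤ d) : ∃ C : ℝ, 0 < C ∧ ∀ (v : E d → ℝ) (V : E d → E d) (m : ℝ),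
    H1 v V → 0 ≤ m → volume {x | v x ≠ 0} ≤ ENNReal.ofReal (m ^ d) →
      ∫ x, v x ^ 2 ≤ C * m ^ 2 * ∫ x, ‖V x‖ ^ 2 := by
  obtain ⟨C, κ, hκ, hC⟩ := sobolev_sq hd
  refine ⟨(C : ℝ) ^ 2 + 1, by positivity, fun v V m hv hm hvol => ?_⟩
  set a := eLpNorm v 2 volume
  set b := eLpNorm V 2 volume
  have hd0 : d ≠ 0 := by omega
  have ha : a ^ 2 ≤ C * (a * b) * ENNReal.ofReal m := by
    have e1 : a ^ 2 = eLpNorm (fun x => v x ^ 2) 1 volume := by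
      have h1 : Integrable (fun x => v x ^ 2) volume := hv.lu.integrable_sq
      rw [eLpNorm_two_sq hv.lu, eLpNorm_one_eq_lintegral_enorm,
        ofReal_integral_eq_lintegral_ofReal (by simpa using h1)
          (Eventually.of_forall fun x => by positivity)]
      refine lintegral_congr fun x => ?_
      rw [← ofReal_norm]; simp
    have hsub : (fun x => v x ^ 2).support ⊆ {x | v x ≠ 0} := fun x hx => by
      simp only [Function.mem_support, ne_eq] at hx
      intro h; exact hx (by simp [h])
    rw [e1, ← eLpNorm_restrict_eq_of_support_subset hsub]
    have hκ1 : (1 : ℝ≥0∞) ≤ κ := by exact_mod_cast hκ.symm.lt.le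
    refine (eLpNorm_le_eLpNorm_mul_rpow_measure_univ hκ1
      (hv.mu.pow_const 2).aestronglyMeasurable).trans ?_
    rw [eLpNorm_restrict_eq_of_support_subset hsub]
    gcongr
    · exact hC v V hv
    · have he : (1 / (1 : ℝ≥0∞).toReal - 1 / (κ : ℝ≥0∞).toReal) = (d : ℝ)⁻¹ := by
        have := hκ.coe.inv_add_inv_eq_one
        simp at this ⊢
        linarith
      rw [he, Measure.restrict_apply_univ]
      calc _ ≤ (ENNReal.ofReal (m ^ d)) ^ (d : ℝ)⁻¹ := by gcongr
        _ = ENNReal.ofReal m := by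
          rw [ENNReal.ofReal_rpow_of_nonneg (by positivity) (by positivity),
            Real.pow_rpow_inv_natCast hm hd0]
  have ha2 : a ≤ C * b * ENNReal.ofReal m := by
    by_cases h0 : a = 0
    · rw [h0]; exact zero_le
    · have hat : a ≠ ∞ := hv.lu.2.ne
      rw [← ENNReal.mul_le_mul_iff_right h0 hat]
      calc a * a = a ^ 2 := (sq a).symm
        _ ≤ _ := ha
        _ = _ := by ring
  have h3 : a ^ 2 ≤ (C * b * ENNReal.ofReal m) ^ 2 := by gcongr
  rw [mul_pow, mul_pow, eLpNorm_two_sq hv.lu, eLpNorm_two_sq hv.lU,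
    ← ENNReal.ofReal_pow hm, ← ENNReal.ofReal_coe_nnreal, ← ENNReal.ofReal_pow (by positivity),
    ← ENNReal.ofReal_mul (by positivity), ← ENNReal.ofReal_mul (by positivity),
    ENNReal.ofReal_le_ofReal_iff (by positivity)] at h3
  simp only [Real.norm_eq_abs, sq_abs] at h3
  refine h3.trans ?_
  have : 0 ≤ m ^ 2 * ∫ x, ‖V x‖ ^ 2 := by positivity
  nlinarith

end FaberKrahn

section Poincare

theorem lintegral_comp_convex_le {g : E d → ℝ≥0∞} (hg : Measurable g) (x : E d) {t : ℝ}
    (ht : 1 / 2 ≤ t) : ∫⁻ y, g (x + t • (y - x)) ≤ 2 ^ d * ∫⁻ y, g y := by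
  have ht0 : 0 < t := by linarith
  have e1 : ∀ y, x + t • (y - x) = (x - t • x) + t • y := fun y => by
    rw [smul_sub]; abel
  simp_rw [e1]
  have h1 : ∫⁻ y, g ((x - t • x) + t • y) =
      ∫⁻ z, g ((x - t • x) + z) ∂(Measure.map (t • ·) (volume : Measure (E d))) := by
    rw [lintegral_map (by fun_prop) (by fun_prop)]
  rw [h1, Measure.map_addHaar_smul volume ht0.ne', lintegral_smul_measure,
    lintegral_add_left_eq_self]
  simp only [finrank_euclideanSpace, Fintype.card_fin, smul_eq_mul]
  gcongr
  rw [abs_of_pos (by positivity), ← inv_pow, ENNReal.ofReal_pow (by positivity)]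
  gcongr
  rw [show (2 : ℝ≥0∞) = ENNReal.ofReal 2 by simp]
  apply ENNReal.ofReal_le_ofReal
  rw [inv_le_comm₀ ht0 (by norm_num)]; linarith

theorem enorm_sub_le_lintegral_segment {φ : E d → ℝ} (hφ : ContDiff ℝ 1 φ) (x y : E d) :
    ‖φ x - φ y‖ₑ ≤ ∫⁻ t in Set.Ioc (0:ℝ) 1, ‖∇ φ (x + t • (y - x))‖ₑ * ‖y - x‖ₑ := by
  have hd : ∀ t : ℝ, HasDerivAt (fun t : ℝ => φ (x + t • (y - x)))
      (fderiv ℝ φ (x + t • (y - x)) (y - x)) t := fun t => by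
    have h1 : HasDerivAt (fun t : ℝ => x + t • (y - x)) (y - x) t := by
      simpa using ((hasDerivAt_id t).smul_const (y - x)).const_add x
    exact ((hφ.differentiable one_ne_zero _).hasFDerivAt).comp_hasDerivAt t h1
  have hc : Continuous fun t : ℝ => fderiv ℝ φ (x + t • (y - x)) (y - x) := by
    have := hφ.continuous_fderiv one_ne_zero
    fun_prop
  have := intervalIntegral.integral_eq_sub_of_hasDerivAt (a := 0) (b := 1)
    (fun t _ => hd t) (hc.intervalIntegrable _ _)
  simp only [one_smul, zero_smul, add_zero, add_sub_cancel] at this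
  rw [← enorm_neg, neg_sub, ← this, intervalIntegral.integral_of_le zero_le_one]
  refine (enorm_integral_le_lintegral_enorm _).trans (lintegral_mono fun t => ?_)
  have := (fderiv ℝ φ (x + t • (y - x))).le_opNorm (y - x)
  rw [← norm_gradient] at this
  rw [← ofReal_norm, ← ofReal_norm, ← ofReal_norm, ← ENNReal.ofReal_mul (norm_nonneg _)]
  exact ENNReal.ofReal_le_ofReal this

/-- The double-integral form of the Poincaré inequality, for `C¹` functions. -/
theorem poincare_double_C1 {φ : E d → ℝ} (hφ : ContDiff ℝ 1 φ) (x0 : E d) {ρ : ℝ} (hρ : 0 < ρ) :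
    ∫⁻ p, ‖φ p.1 - φ p.2‖ₑ ∂((volume.restrict (ball x0 ρ)).prod (volume.restrict (ball x0 ρ))) ≤
      ENNReal.ofReal (2 * ρ) * (2 ^ d * volume (ball x0 ρ) * ∫⁻ x in ball x0 ρ, ‖∇ φ x‖ₑ) := by
  set B := ball x0 ρ
  set μ := volume.restrict B
  set g : E d → ℝ≥0∞ := B.indicator fun x => ‖∇ φ x‖ₑ with hgdef
  have hgc : Continuous fun x => ‖∇ φ x‖ₑ := (continuous_gradient hφ).enorm
  have hg : Measurable g := hgc.measurable.indicator measurableSet_ball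
  have hgm : Measurable (fun q : (E d × E d) × ℝ => g (q.1.1 + q.2 • (q.1.2 - q.1.1))) :=
    hg.comp (by fun_prop)
  have hJ : ∀ t : ℝ, 1 / 2 ≤ t →
      ∫⁻ x, ∫⁻ y, g (x + t • (y - x)) ∂μ ∂μ ≤ 2 ^ d * volume B * ∫⁻ x in B, ‖∇ φ x‖ₑ := by
    intro t ht
    calc _ ≤ ∫⁻ x, (2 ^ d * ∫⁻ x in B, ‖∇ φ x‖ₑ) ∂μ := by
          refine lintegral_mono fun x => ?_
          refine (lintegral_mono' Measure.restrict_le_self le_rfl).trans ?_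
          refine (lintegral_comp_convex_le hg x ht).trans ?_
          rw [hgdef, lintegral_indicator measurableSet_ball]
      _ = _ := by
          rw [lintegral_const, Measure.restrict_apply_univ]; ring
  have hJ' : ∀ t : ℝ, 
      ∫⁻ p, g (p.1 + t • (p.2 - p.1)) ∂(μ.prod μ) ≤ 2 ^ d * volume B * ∫⁻ x in B, ‖∇ φ x‖ₑ := by
    intro t
    have hm : Measurable fun p : E d × E d => g (p.1 + t • (p.2 - p.1)) := hg.comp (by fun_prop)
    rcases le_total (1 / 2) t with ht | ht
    · rw [lintegral_prod _ hm.aemeasurable]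
      exact hJ t ht
    · rw [lintegral_prod_symm _ hm.aemeasurable]
      refine le_trans (le_of_eq ?_) (hJ (1 - t) (by linarith))
      refine lintegral_congr fun y => lintegral_congr fun x => ?_
      congr 1
      rw [smul_sub, smul_sub, sub_smul, sub_smul]; simp; abel
  have hae : ∀ᵐ p ∂(μ.prod μ), p.1 ∈ B ∧ p.2 ∈ B := by
    have h1 : ∀ᵐ x ∂μ, x ∈ B := ae_restrict_mem measurableSet_ball
    exact (Measure.quasiMeasurePreserving_fst.ae h1).and
      (Measure.quasiMeasurePreserving_snd.ae h1)
  calc _ ≤ ∫⁻ p, (∫⁻ t in Set.Ioc (0:ℝ) 1, g (p.1 + t • (p.2 - p.1)) * ENNReal.ofReal (2 * ρ))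
        ∂(μ.prod μ) := by
        refine lintegral_mono_ae ?_
        filter_upwards [hae] with p hp
        refine (enorm_sub_le_lintegral_segment hφ p.1 p.2).trans ?_
        refine setLIntegral_mono' measurableSet_Ioc fun t ht => ?_
        have hmem : p.1 + t • (p.2 - p.1) ∈ B :=
          (convex_ball x0 ρ).add_smul_sub_mem hp.1 hp.2 ⟨ht.1.le, ht.2⟩
        rw [hgdef, Set.indicator_of_mem hmem]
        gcongr
        rw [← ofReal_norm]
        apply ENNReal.ofReal_le_ofReal
        rw [← dist_eq_norm]
        have := dist_triangle_right p.2 p.1 x0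
        have h1 := mem_ball.1 hp.1
        have h2 := mem_ball.1 hp.2
        linarith
    _ = ∫⁻ t in Set.Ioc (0:ℝ) 1, (∫⁻ p, g (p.1 + t • (p.2 - p.1)) * ENNReal.ofReal (2 * ρ)
        ∂(μ.prod μ)) := by
        rw [lintegral_lintegral_swap]
        exact (hgm.mul_const _).aemeasurable
    _ ≤ ∫⁻ t in Set.Ioc (0:ℝ) 1,
        ENNReal.ofReal (2 * ρ) * (2 ^ d * volume B * ∫⁻ x in B, ‖∇ φ x‖ₑ) := by
        refine lintegral_mono fun t => ?_
        have hm : Measurable fun p : E d × E d => g (p.1 + t • (p.2 - p.1)) :=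
          hg.comp (by fun_prop)
        rw [lintegral_mul_const _ hm, mul_comm]
        gcongr
        exact hJ' t
    _ = _ := by
        rw [setLIntegral_const]; simp [μ]

theorem poincare_double {w : E d → ℝ} {W : E d → E d} (hw : H1 w W) (x0 : E d) {ρ : ℝ}
    (hρ : 0 < ρ) :
    ∫⁻ p, ‖w p.1 - w p.2‖ₑ ∂((volume.restrict (ball x0 ρ)).prod (volume.restrict (ball x0 ρ))) ≤
      ENNReal.ofReal (2 * ρ) * (2 ^ d * volume (ball x0 ρ) * ∫⁻ x in ball x0 ρ, ‖W x‖ₑ) := by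
  obtain ⟨φ, hφ, -, h2, h3⟩ := hw.exists_seq
  set B := ball x0 ρ
  set μ := volume.restrict B
  have h3' : ∀ᵐ x ∂μ, Tendsto (fun n => φ n x) atTop (𝓝 (w x)) := ae_restrict_of_ae h3
  have hF : ∫⁻ p, ‖w p.1 - w p.2‖ₑ ∂(μ.prod μ) ≤
      liminf (fun n => ∫⁻ p, ‖φ n p.1 - φ n p.2‖ₑ ∂(μ.prod μ)) atTop := by
    refine le_trans (le_of_eq ?_) (lintegral_liminf_le fun n => ?_)
    · refine lintegral_congr_ae ?_
      filter_upwards [Measure.quasiMeasurePreserving_fst.ae h3',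
        Measure.quasiMeasurePreserving_snd.ae h3'] with p h4 h5
      exact ((continuous_enorm.tendsto _).comp (h4.sub h5)).liminf_eq.symm
    · have := (hφ n).continuous
      exact Continuous.measurable (by fun_prop)
  have hfin : IsFiniteMeasure μ := ⟨by simpa [μ] using measure_ball_lt_top⟩
  have hlim : Tendsto (fun n => eLpNorm (∇ (φ n) - W) 2 volume * μ Set.univ ^
      (1 / (1 : ℝ≥0∞).toReal - 1 / (2 : ℝ≥0∞).toReal)) atTop (𝓝 0) := by
    have := ENNReal.Tendsto.mul_const (b := μ Set.univ ^
      (1 / (1 : ℝ≥0∞).toReal - 1 / (2 : ℝ≥0∞).toReal)) h2 (Or.inr ?_)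
    · simpa using this
    · refine ENNReal.rpow_ne_top_of_nonneg ?_ (measure_ne_top _ _)
      norm_num
  have hb : ∀ n, ∫⁻ x in B, ‖∇ (φ n) x‖ₑ ≤ (∫⁻ x in B, ‖W x‖ₑ) + eLpNorm (∇ (φ n) - W) 2 volume *
      μ Set.univ ^ (1 / (1 : ℝ≥0∞).toReal - 1 / (2 : ℝ≥0∞).toReal) := by
    intro n
    have a1 : AEStronglyMeasurable (∇ (φ n) - W) volume := ((hφ n).memLp_grad 2).1.sub hw.lU.1
    rw [← eLpNorm_one_eq_lintegral_enorm, ← eLpNorm_one_eq_lintegral_enorm]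
    calc _ = eLpNorm (W + (∇ (φ n) - W)) 1 μ := by congr 1; abel
      _ ≤ _ := eLpNorm_add_le hw.lU.1.restrict a1.restrict le_rfl
      _ ≤ _ := by
        gcongr
        refine (eLpNorm_le_eLpNorm_mul_rpow_measure_univ (q := 2) (by norm_num)
          a1.restrict).trans ?_
        gcongr
        exact Measure.restrict_le_self
  have hlim2 := ENNReal.Tendsto.const_mul (a := ENNReal.ofReal (2 * ρ))
    (ENNReal.Tendsto.const_mul (a := 2 ^ d * volume B)
    (tendsto_const_nhds (x := ∫⁻ x in B, ‖W x‖ₑ) |>.add hlim)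
    (Or.inr (ENNReal.mul_ne_top (by simp) measure_ball_lt_top.ne)))
    (Or.inr ENNReal.ofReal_ne_top)
  rw [add_zero] at hlim2
  refine hF.trans ?_
  rw [← hlim2.liminf_eq]
  refine liminf_le_liminf (Eventually.of_forall fun n => ?_)
  refine (poincare_double_C1 (hφ n).1 x0 hρ).trans ?_
  gcongr
  exact hb n

/-- Poincaré inequality for functions which are constant on a large part of a ball. -/
theorem poincare {w : E d → ℝ} {W : E d → E d} (hw : H1 w W) (x0 : E d) {ρ : ℝ}
    (hρ : 0 < ρ) (c : ℝ) (hZ : volume (ball x0 ρ) ≤ 2 * volume (ball x0 ρ ∩ {x | w x = c})) :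
    ∫ x in ball x0 ρ, |w x - c| ≤ 2 ^ (d + 2) * ρ * ∫ x in ball x0 ρ, ‖W x‖ := by
  set B := ball x0 ρ
  set μ := volume.restrict B
  have hfin : IsFiniteMeasure μ := ⟨by simpa [μ] using measure_ball_lt_top⟩
  have i1 : Integrable (fun x => w x - c) μ :=
    ((hw.lu.restrict B).integrable (by norm_num)).sub (integrable_const c)
  have i2 : Integrable W μ := (hw.lU.restrict B).integrable (by norm_num)
  have mZ : MeasurableSet {x | w x = c} := hw.mu (measurableSet_singleton c)
  have hvpos : volume B ≠ 0 := (measure_ball_pos volume x0 hρ).ne'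
  have hvfin : volume B ≠ ∞ := measure_ball_lt_top.ne
  have key : (∫⁻ x, ‖w x - c‖ₑ ∂μ) * volume (B ∩ {x | w x = c}) ≤
      ∫⁻ p, ‖w p.1 - w p.2‖ₑ ∂(μ.prod μ) := by
    rw [lintegral_prod _ (by have := hw.mu; fun_prop), ← lintegral_mul_const' _ _ ?_]
    · refine lintegral_mono fun x => ?_
      have : ‖w x - c‖ₑ * volume (B ∩ {x | w x = c}) =
          ∫⁻ y in {x | w x = c}, ‖w x - w y‖ₑ ∂μ := by
        rw [setLIntegral_congr_fun (g := fun _ => ‖w x - c‖ₑ) mZ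
          (fun y hy => by simp only [Set.mem_ofPred_eq] at hy; simp only [hy]),
          lintegral_const, Measure.restrict_apply_univ, Measure.restrict_apply mZ, Set.inter_comm]
      rw [this]
      exact lintegral_mono' Measure.restrict_le_self le_rfl
    · exact (measure_mono Set.inter_subset_left).trans_lt measure_ball_lt_top |>.ne
  have h1 : (∫⁻ x, ‖w x - c‖ₑ ∂μ) ≤ 2 * (ENNReal.ofReal (2 * ρ) *
      (2 ^ d * ∫⁻ x in B, ‖W x‖ₑ)) := by
    rw [← ENNReal.mul_le_mul_iff_left hvpos hvfin]
    calc _ ≤ (∫⁻ x, ‖w x - c‖ₑ ∂μ) * (2 * volume (B ∩ {x | w x = c})) := by gcongr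
      _ = 2 * ((∫⁻ x, ‖w x - c‖ₑ ∂μ) * volume (B ∩ {x | w x = c})) := by ring
      _ ≤ 2 * (ENNReal.ofReal (2 * ρ) * (2 ^ d * volume B * ∫⁻ x in B, ‖W x‖ₑ)) :=
          mul_le_mul_right (key.trans (poincare_double hw x0 hρ)) 2
      _ = _ := by ring
  have e1 := ofReal_integral_norm_eq_lintegral_enorm i1
  have e2 := ofReal_integral_norm_eq_lintegral_enorm i2
  have e3 : (2 : ℝ≥0∞) * (ENNReal.ofReal (2 * ρ) * (2 ^ d * ENNReal.ofReal (∫ x, ‖W x‖ ∂μ))) =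
      ENNReal.ofReal 2 * (ENNReal.ofReal (2 * ρ) *
        (ENNReal.ofReal (2 ^ d) * ENNReal.ofReal (∫ x, ‖W x‖ ∂μ))) := by
    rw [ENNReal.ofReal_pow (by norm_num), ENNReal.ofReal_ofNat]
  rw [← e1, ← e2, e3, ← ENNReal.ofReal_mul (by positivity), ← ENNReal.ofReal_mul (by positivity),
    ← ENNReal.ofReal_mul (by positivity), ENNReal.ofReal_le_ofReal_iff (by positivity)] at h1
  refine h1.trans (le_of_eq ?_)
  ring

end Poincare

/-- The energy inequality on superlevel sets defining De Giorgi classes. -/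
def DG (C1 F k0 : ℝ) (u : E d → ℝ) (U : E d → E d) (B : Set (E d)) : Prop :=
  ∀ k, k0 ≤ k → ∀ η : E d → ℝ, CC1 η → (∀ x, 0 ≤ η x) → (∀ x, η x ≤ 1) → (∀ x ∉ B, η x = 0) →
    ∫ x, ‖η x • {x | k < u x}.indicator U x + max (u x - k) 0 • ∇ η x‖ ^ 2 ≤
      C1 * (F * (∫ x, η x ^ 2 * max (u x - k) 0) + ∫ x, ‖∇ η x‖ ^ 2 * max (u x - k) 0 ^ 2)

theorem DG.mono {C1 F k0 k1 : ℝ} {u : E d → ℝ} {U : E d → E d} {B B' : Set (E d)}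
    (h : DG C1 F k0 u U B) (hk : k0 ≤ k1) (hB : B' ⊆ B) : DG C1 F k1 u U B' :=
  fun k hk' η h1 h2 h3 h4 => h k (hk.trans hk') η h1 h2 h3 fun x hx => h4 x fun h => hx (hB h)

theorem CC1.exists_bound {η : E d → ℝ} (hη : CC1 η) :
    ∃ K : ℝ, (∀ x, |η x| ≤ K) ∧ ∀ x, ‖∇ η x‖ ≤ K := by
  obtain ⟨K1, h1⟩ := hη.2.exists_bound_of_continuous hη.continuous
  obtain ⟨K2, h2⟩ := (hasCompactSupport_gradient hη.2).exists_bound_of_continuous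
    (continuous_gradient hη.1)
  exact ⟨max K1 K2, fun x => (h1 x).trans (le_max_left _ _), fun x => (h2 x).trans (le_max_right _ _)⟩

theorem H1.cutTrunc {u η : E d → ℝ} {U : E d → E d} (hu : H1 u U) (hη : CC1 η) (k : ℝ) :
    H1 (fun x => η x * max (u x - k) 0)
      (fun x => η x • {x | k < u x}.indicator U x + max (u x - k) 0 • ∇ η x) := by
  obtain ⟨K, h1, h2⟩ := hη.exists_bound
  have a := (hu.trunc k).mul_C1 hη.1 h1 h2
  have b := (H1.of_CC1 hη).const_mul (max (-k) 0)
  convert a.add b using 1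
  · funext x; ring
  · funext x; simp only [add_assoc, ← add_smul]; simp

theorem H1.memLp_pos_ball {u : E d → ℝ} {U : E d → E d} (hu : H1 u U) (k : ℝ) (x0 : E d) (r : ℝ) :
    MemLp (fun x => max (u x - k) 0) 2 (volume.restrict (ball x0 r)) := by
  have : IsFiniteMeasure (volume.restrict (ball x0 r)) := ⟨by simpa using measure_ball_lt_top⟩
  exact ((hu.lu.restrict _).sub (memLp_const k)).pos_part

theorem H1.integrableOn_pos_sq {u : E d → ℝ} {U : E d → E d} (hu : H1 u U) (k : ℝ) (x0 : E d)
    (r : ℝ) : IntegrableOn (fun x => max (u x - k) 0 ^ 2) (ball x0 r) :=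
  (hu.memLp_pos_ball k x0 r).integrable_sq

theorem H1.integrableOn_pos {u : E d → ℝ} {U : E d → E d} (hu : H1 u U) (k : ℝ) (x0 : E d)
    (r : ℝ) : IntegrableOn (fun x => max (u x - k) 0) (ball x0 r) := by
  have : IsFiniteMeasure (volume.restrict (ball x0 r)) := ⟨by simpa using measure_ball_lt_top⟩
  exact (hu.memLp_pos_ball k x0 r).integrable (by norm_num)

theorem setIntegral_eq_of_zero {B : Set (E d)} {f : E d → ℝ} (h : ∀ x ∉ B, f x = 0) :
    ∫ x, f x = ∫ x in B, f x :=
  (setIntegral_eq_integral_of_forall_compl_eq_zero h).symm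

/-- One step of the De Giorgi iteration. -/
theorem DG.step (hd : 2 ≤ d) : ∃ C : ℝ, 0 < C ∧ ∀ (u : E d → ℝ) (U : E d → E d) (x0 : E d)
    (C1 F k0 k k' r R m : ℝ), H1 u U → DG C1 F k0 u U (ball x0 R) → k0 ≤ k' → k < k' → 0 < r →
    r < R → 0 ≤ F → 0 ≤ C1 → 0 ≤ m →
    ∫ x in ball x0 R, max (u x - k) 0 ^ 2 ≤ m ^ d * (k' - k) ^ 2 →
    ∫ x in ball x0 r, max (u x - k') 0 ^ 2 ≤
      C * C1 * m ^ 2 * (F / (k' - k) + 1 / (R - r) ^ 2) *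
        ∫ x in ball x0 R, max (u x - k) 0 ^ 2 := by
  obtain ⟨CF, hCF, hFK⟩ := faberKrahn hd
  obtain ⟨Ce, hCe, hcut⟩ := exists_cutoff
  refine ⟨CF * (1 + Ce ^ 2), by positivity, ?_⟩
  intro u U x0 C1 F k0 k k' r R m hu hDG hk0 hkk hr hrR hF hC1 hm hsmall
  obtain ⟨η, hη⟩ := hcut d x0 r R hr hrR
  set h := k' - k with hh
  have hhpos : 0 < h := sub_pos.2 hkk
  set I := ∫ x in ball x0 R, max (u x - k) 0 ^ 2
  have hI0 : 0 ≤ I := by positivity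
  have hv := hu.cutTrunc hη.cc1 k'
  have hpt : ∀ x, max (u x - k') 0 * h ≤ max (u x - k) 0 ^ 2 := by
    intro x
    rcases le_total (u x - k') 0 with h1 | h1
    · rw [max_eq_right h1, zero_mul]; positivity
    · rw [max_eq_left h1, max_eq_left (by linarith)]
      have : u x - k = (u x - k') + h := by rw [hh]; ring
      rw [this]; nlinarith
  have hpt2 : ∀ x, max (u x - k') 0 ^ 2 ≤ max (u x - k) 0 ^ 2 := by
    intro x
    have : max (u x - k') 0 ≤ max (u x - k) 0 := max_le_max (by linarith) le_rfl
    gcongr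
  have hvol : volume {x | η x * max (u x - k') 0 ≠ 0} ≤ ENNReal.ofReal (m ^ d) := by
    have hsub : {x | η x * max (u x - k') 0 ≠ 0} ⊆
        {x | ENNReal.ofReal (h ^ 2) ≤ ENNReal.ofReal (max (u x - k) 0 ^ 2)} ∩ ball x0 R := by
      intro x hx
      have hx : η x * max (u x - k') 0 ≠ 0 := hx
      constructor
      · have h1 : max (u x - k') 0 ≠ 0 := right_ne_zero_of_mul hx
        have h2 : k' < u x := by
          by_contra h2
          exact h1 (max_eq_right (by linarith))
        apply ENNReal.ofReal_le_ofReal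
        rw [max_eq_left (by linarith)]
        gcongr
        linarith
      · by_contra h2
        exact left_ne_zero_of_mul hx (hη.zero x (by simpa [mem_ball] using h2))
    have hmk := mul_meas_ge_le_lintegral₀ (μ := volume.restrict (ball x0 R))
      (f := fun x => ENNReal.ofReal (max (u x - k) 0 ^ 2))
      (by have := hu.mu; fun_prop) (ENNReal.ofReal (h ^ 2))
    rw [← ofReal_integral_eq_lintegral_ofReal (hu.integrableOn_pos_sq k x0 R)
      (Eventually.of_forall fun x => by positivity)] at hmk
    rw [Measure.restrict_apply (by
      have := hu.mu; exact measurableSet_le (by fun_prop) (by fun_prop))] at hmk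
    have h3 : ENNReal.ofReal (h ^ 2) * volume {x | η x * max (u x - k') 0 ≠ 0} ≤
        ENNReal.ofReal (h ^ 2) * ENNReal.ofReal (m ^ d) := by
      calc _ ≤ _ := mul_le_mul_right (measure_mono hsub) _
        _ ≤ _ := hmk
        _ ≤ ENNReal.ofReal (m ^ d * h ^ 2) := ENNReal.ofReal_le_ofReal hsmall
        _ = _ := by rw [mul_comm, ENNReal.ofReal_mul (by positivity)]
    exact (ENNReal.mul_le_mul_iff_right (by simp; positivity) ENNReal.ofReal_ne_top).1 h3
  have h1 := hFK _ _ m hv hm hvol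
  have h2 := hDG k' hk0 η hη.cc1 hη.nonneg hη.le_one fun x hx =>
    hη.zero x (by simpa [mem_ball] using hx)
  have h3 : ∫ x in ball x0 r, max (u x - k') 0 ^ 2 ≤ ∫ x, (η x * max (u x - k') 0) ^ 2 := by
    calc _ = ∫ x in ball x0 r, (η x * max (u x - k') 0) ^ 2 := by
          refine setIntegral_congr_fun measurableSet_ball fun x hx => ?_
          simp only [hη.one x (mem_ball.1 hx).le, one_mul]
      _ ≤ _ := setIntegral_le_integral hv.lu.integrable_sq
          (Eventually.of_forall fun x => sq_nonneg _)
  have h4 : ∫ x, η x ^ 2 * max (u x - k') 0 ≤ I / h := by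
    rw [setIntegral_eq_of_zero (B := ball x0 R) fun x hx => by
      rw [hη.zero x (by simpa [mem_ball] using hx)]; simp, le_div_iff₀ hhpos, ← integral_mul_const]
    refine integral_mono_of_nonneg (Eventually.of_forall fun x => by positivity)
      (hu.integrableOn_pos_sq k x0 R) (Eventually.of_forall fun x => ?_)
    have := hη.nonneg x
    have h5 := hη.le_one x
    have h6 : η x ^ 2 ≤ 1 := pow_le_one₀ this h5
    have h7 : 0 ≤ max (u x - k') 0 * h := by positivity
    have := hpt x
    simp only
    nlinarith
  have h5 : ∫ x, ‖∇ η x‖ ^ 2 * max (u x - k') 0 ^ 2 ≤ (Ce / (R - r)) ^ 2 * I := by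
    rw [setIntegral_eq_of_zero (B := ball x0 R) fun x hx => by
      rw [hη.grad_zero x (Or.inr (by simpa [mem_ball] using hx))]; simp, ← integral_const_mul]
    refine integral_mono_of_nonneg (Eventually.of_forall fun x => by positivity)
      ((hu.integrableOn_pos_sq k x0 R).const_mul _) (Eventually.of_forall fun x => ?_)
    have := hη.grad_le x
    exact mul_le_mul (by gcongr) (hpt2 x) (by positivity) (by positivity)
  have hRr : 0 < R - r := sub_pos.2 hrR
  calc _ ≤ _ := h3
    _ ≤ _ := h1
    _ ≤ CF * m ^ 2 * (C1 * (F * (I / h) + (Ce / (R - r)) ^ 2 * I)) := by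
        gcongr
        refine h2.trans ?_
        gcongr
    _ = CF * C1 * m ^ 2 * (F / h + Ce ^ 2 * (1 / (R - r) ^ 2)) * I := by
        field_simp
    _ ≤ CF * C1 * m ^ 2 * ((1 + Ce ^ 2) * (F / h + 1 / (R - r) ^ 2)) * I := by
        gcongr
        have : 0 ≤ F / h := by positivity
        have : 0 ≤ 1 / (R - r) ^ 2 := by positivity
        nlinarith [sq_nonneg Ce]
    _ = _ := by ring

/-- Local boundedness in De Giorgi classes. -/
theorem DG.bound (hd : 2 ≤ d) {C1 : ℝ} (hC1 : 0 ≤ C1) : ∃ ε : ℝ, 0 < ε ∧ ε ≤ 1 ∧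
    ∀ (u : E d → ℝ) (U : E d → E d) (x0 : E d) (F k0 ρ K : ℝ), H1 u U →
    DG C1 F k0 u U (ball x0 ρ) → 0 < ρ → 0 < K → 0 ≤ F → F * ρ ^ 2 ≤ K →
    4 * ∫ x in ball x0 ρ, max (u x - k0) 0 ^ 2 ≤ (ε * ρ) ^ d * K ^ 2 →
    ∀ᵐ x, x ∈ ball x0 (ρ / 2) → u x ≤ k0 + K := by
  obtain ⟨C, hC, hstep⟩ := DG.step hd
  set q : ℝ := (1 / 4) ^ (d + 1) with hq
  have hq0 : 0 < q := by positivity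
  have hq1 : q ≤ 1 := pow_le_one₀ (by norm_num) (by norm_num)
  set ε : ℝ := q / (18 * C * C1 + 1) with hε
  have hε0 : 0 < ε := by positivity
  have hε1 : ε ≤ 1 := by
    rw [hε, div_le_one (by positivity)]
    have : 0 ≤ 18 * C * C1 := by positivity
    linarith
  have hεq : 18 * C * C1 * ε ^ 2 ≤ q := by
    calc 18 * C * C1 * ε ^ 2 ≤ (18 * C * C1 + 1) * ε := by
          have : ε ^ 2 ≤ ε := by nlinarith
          have : 0 ≤ 18 * C * C1 := by positivity
          nlinarith
      _ = q := by rw [hε]; field_simp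
  refine ⟨ε, hε0, hε1, ?_⟩
  intro u U x0 F k0 ρ K hu hDG hρ hK hF hFK hsmall
  set I0 := ∫ x in ball x0 ρ, max (u x - k0) 0 ^ 2
  have hI0 : 0 ≤ I0 := by positivity
  set J : ℕ → ℝ := fun j => ∫ x in ball x0 (ρ * (1 / 2 + (1 / 2) ^ j / 2)),
    max (u x - (k0 + K * (1 - (1 / 2) ^ j))) 0 ^ 2 with hJdef
  have hJ : ∀ j, J j ≤ q ^ j * I0 := by
    intro j
    induction j with
    | zero =>
      apply le_of_eq
      simp only [hJdef, pow_zero, one_mul, sub_self, mul_zero, add_zero]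
      norm_num; rfl
    | succ j ih =>
      set a : ℝ := (1 / 2) ^ j with ha
      have ha0 : 0 < a := by positivity
      have ha1 : a ≤ 1 := pow_le_one₀ (by norm_num) (by norm_num)
      have hqj : q ^ j = (a ^ 2) ^ (d + 1) := by
        rw [hq, ha, ← pow_mul, ← pow_mul, ← pow_mul]
        rw [show (1 / 4 : ℝ) = (1 / 2) ^ 2 by norm_num, ← pow_mul]
        congr 1; ring
      have ha' : (1 / 2 : ℝ) ^ (j + 1) = a / 2 := by rw [pow_succ, ← ha]; ring
      have key := hstep u U x0 C1 F k0 (k0 + K * (1 - a)) (k0 + K * (1 - a / 2))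
        (ρ * (1 / 2 + a / 2 / 2)) (ρ * (1 / 2 + a / 2)) (ε * ρ * a ^ 2) hu
        (hDG.mono le_rfl (ball_subset_ball (by nlinarith)))
        (by nlinarith) (by nlinarith) (by positivity) (by nlinarith) hF hC1 (by positivity) (by
          refine ih.trans ?_
          calc q ^ j * I0 ≤ q ^ j * ((ε * ρ) ^ d * K ^ 2 / 4) := by
                gcongr; linarith
            _ = _ := by rw [hqj]; ring)
      simp only [hJdef, ha']
      refine key.trans ?_
      have hfac : C * C1 * (ε * ρ * a ^ 2) ^ 2 *
          (F / (k0 + K * (1 - a / 2) - (k0 + K * (1 - a))) +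
          1 / (ρ * (1 / 2 + a / 2) - ρ * (1 / 2 + a / 2 / 2)) ^ 2) ≤ q := by
        have e1 : k0 + K * (1 - a / 2) - (k0 + K * (1 - a)) = K * a / 2 := by ring
        have e2 : ρ * (1 / 2 + a / 2) - ρ * (1 / 2 + a / 2 / 2) = ρ * a / 4 := by ring
        rw [e1, e2]
        have e3 : F / (K * a / 2) ≤ 2 / (ρ ^ 2 * a ^ 2) := by
          rw [div_le_div_iff₀ (by positivity) (by positivity)]
          calc F * (ρ ^ 2 * a ^ 2) = (F * ρ ^ 2) * a ^ 2 := by ring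
            _ ≤ K * a ^ 2 := by gcongr
            _ ≤ K * a := by
                have : a ^ 2 ≤ a := by nlinarith
                gcongr
            _ = _ := by ring
        calc _ ≤ C * C1 * (ε * ρ * a ^ 2) ^ 2 * (2 / (ρ ^ 2 * a ^ 2) + 1 / (ρ * a / 4) ^ 2) := by
              gcongr
          _ = 18 * C * C1 * ε ^ 2 * a ^ 2 := by field_simp; ring
          _ ≤ 18 * C * C1 * ε ^ 2 * 1 := by
              gcongr; exact pow_le_one₀ ha0.le ha1
          _ ≤ q := by linarith
      calc _ ≤ q * (q ^ j * I0) :=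
            mul_le_mul hfac ih (by positivity) hq0.le
        _ = _ := by ring
  have hlim : Tendsto (fun j : ℕ => q ^ j * I0) atTop (𝓝 0) := by
    have := (_root_.tendsto_pow_atTop_nhds_zero_of_lt_one hq0.le
      (pow_lt_one₀ (by norm_num) (by norm_num) (by omega) : q < 1)).mul_const I0
    simpa using this
  have hz : ∫ x in ball x0 (ρ / 2), max (u x - (k0 + K)) 0 ^ 2 ≤ 0 := by
    refine ge_of_tendsto' hlim fun j => le_trans ?_ (hJ j)
    have ha0 : (0 : ℝ) < (1 / 2) ^ j := by positivity
    calc _ ≤ ∫ x in ball x0 (ρ / 2), max (u x - (k0 + K * (1 - (1 / 2) ^ j))) 0 ^ 2 := by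
          refine setIntegral_mono (hu.integrableOn_pos_sq _ _ _) (hu.integrableOn_pos_sq _ _ _)
            fun x => ?_
          have : max (u x - (k0 + K)) 0 ≤ max (u x - (k0 + K * (1 - (1 / 2) ^ j))) 0 :=
            max_le_max (by nlinarith) le_rfl
          simp only
          gcongr
      _ ≤ _ := by
          refine setIntegral_mono_set (hu.integrableOn_pos_sq _ _ _)
            (Eventually.of_forall fun x => by positivity)
            (LE.le.eventuallyLE (ball_subset_ball (by nlinarith)))
  have hz' := (integral_eq_zero_iff_of_nonneg (fun x => by positivity)
    (hu.integrableOn_pos_sq (k0 + K) x0 (ρ / 2))).1 (le_antisymm hz (by positivity))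
  filter_upwards [(ae_restrict_iff' measurableSet_ball).1 hz'] with x hx hxB
  have h1 : max (u x - (k0 + K)) 0 ^ 2 = 0 := hx hxB
  have h2 : max (u x - (k0 + K)) 0 = 0 := by simpa using h1
  have := le_max_left (u x - (k0 + K)) 0
  linarith

/-- Local boundedness from smallness in measure. -/
theorem DG.bound_of_measure (hd : 2 ≤ d) {C1 δ : ℝ} (hC1 : 0 ≤ C1) (hδ : 0 < δ) :
    ∃ μ : ℝ, 0 < μ ∧
    ∀ (u : E d → ℝ) (U : E d → E d) (x0 : E d) (F k0 ρ M : ℝ), H1 u U →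
    DG C1 F k0 u U (ball x0 ρ) → 0 < ρ → 0 < M → 0 ≤ F → F * ρ ^ 2 ≤ δ * M →
    (∀ᵐ x, x ∈ ball x0 ρ → u x ≤ k0 + M) →
    volume.real (ball x0 ρ ∩ {x | k0 < u x}) ≤ μ * ρ ^ d →
    ∀ᵐ x, x ∈ ball x0 (ρ / 2) → u x ≤ k0 + δ * M := by
  obtain ⟨ε, hε, -, hb⟩ := DG.bound hd hC1
  refine ⟨ε ^ d * δ ^ 2 / 4, by positivity, ?_⟩
  intro u U x0 F k0 ρ M hu hDG hρ hM hF hFM hle hvol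
  refine hb u U x0 F k0 ρ (δ * M) hu hDG hρ (by positivity) hF hFM ?_
  have mS : MeasurableSet {x | k0 < u x} := measurableSet_lt measurable_const hu.mu
  have hfin : volume (ball x0 ρ ∩ {x | k0 < u x}) ≠ ∞ :=
    ((measure_mono Set.inter_subset_left).trans_lt measure_ball_lt_top).ne
  have : ∫ x in ball x0 ρ, max (u x - k0) 0 ^ 2 ≤
      M ^ 2 * volume.real (ball x0 ρ ∩ {x | k0 < u x}) := by
    calc _ ≤ ∫ x in ball x0 ρ, {x | k0 < u x}.indicator (fun _ => M ^ 2) x := by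
          refine setIntegral_mono_ae_restrict (hu.integrableOn_pos_sq _ _ _)
            (((integrableOn_const (C := M ^ 2) measure_ball_lt_top.ne)).indicator mS) ?_
          filter_upwards [(ae_restrict_iff' measurableSet_ball).2 hle] with x hx
          by_cases h : x ∈ {x | k0 < u x}
          · have h' : k0 < u x := h
            rw [Set.indicator_of_mem h, max_eq_left (by linarith)]
            have : u x - k0 ≤ M := by linarith
            have : 0 ≤ u x - k0 := by linarith
            gcongr
          · have h' : ¬ k0 < u x := h
            rw [Set.indicator_of_notMem h, max_eq_right (by linarith)]; simp
      _ = _ := by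
          rw [setIntegral_indicator mS, setIntegral_const, smul_eq_mul, mul_comm]
  calc _ ≤ 4 * (M ^ 2 * (ε ^ d * δ ^ 2 / 4 * ρ ^ d)) := by gcongr; exact this.trans (by gcongr)
    _ = _ := by ring

theorem ae_of_locally {B : Set (E d)} {p : E d → Prop}
    (h : ∀ x ∈ B, ∃ r > 0, ∀ᵐ y, y ∈ ball x r → p y) : ∀ᵐ y, y ∈ B → p y := by
  have : volume {y | y ∈ B ∧ ¬ p y} = 0 := by
    refine measure_null_of_locally_null _ fun x hx => ?_
    obtain ⟨r, hr, hy⟩ := h x hx.1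
    refine ⟨ball x r ∩ {y | y ∈ B ∧ ¬ p y}, Filter.inter_mem (mem_nhdsWithin_of_mem_nhds (ball_mem_nhds x hr)) self_mem_nhdsWithin, ?_⟩
    rw [ae_iff] at hy
    refine measure_mono_null (fun y hy' => ?_) hy
    simp only [Set.mem_inter_iff, Set.mem_ofPred_eq] at hy' ⊢
    tauto
  rw [ae_iff]
  convert this using 2
  ext y; simp

/-- Quantitative boundedness from a decay of the measure of superlevel sets. -/
theorem DG.bound_of_levels (hd : 2 ≤ d) {C1 C2 : ℝ} (hC1 : 0 ≤ C1) (hC2 : 0 ≤ C2) :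
    ∃ C' : ℝ, 1 ≤ C' ∧
    ∀ (u : E d → ℝ) (U : E d → E d) (x0 : E d) (F k0 ρ Λ M0 : ℝ), H1 u U →
    DG C1 F k0 u U (ball x0 ρ) → 0 < ρ → 0 < Λ → 0 ≤ F → F * ρ ^ 2 ≤ Λ →
    (∀ᵐ x, x ∈ ball x0 ρ → u x ≤ M0) →
    (∀ n : ℕ, volume.real (ball x0 ρ ∩ {x | k0 + Λ * 4 ^ (n * d) < u x}) ≤
      C2 * (1 / 2) ^ (n * d) * ρ ^ d) →
    ∀ᵐ x, x ∈ ball x0 (ρ / 2) → u x ≤ k0 + C' * Λ := by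
  set δ : ℝ := (1 / 4) ^ d / 2 with hδdef
  have hδ : 0 < δ := by positivity
  have hδ1 : δ < 1 := by
    have : (1 / 4 : ℝ) ^ d ≤ 1 := pow_le_one₀ (by norm_num) (by norm_num)
    rw [hδdef]; linarith
  obtain ⟨μ, hμ, hb⟩ := DG.bound_of_measure hd hC1 hδ
  obtain ⟨N, hN⟩ : ∃ N : ℕ, C2 * 4 ^ d * (1 / 2) ^ (N * d) ≤ μ := by
    have h1 : Tendsto (fun N : ℕ => C2 * 4 ^ d * ((1 / 2 : ℝ) ^ d) ^ N) atTop (𝓝 (C2 * 4 ^ d * 0)) :=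
      (_root_.tendsto_pow_atTop_nhds_zero_of_lt_one (by positivity)
        (pow_lt_one₀ (by norm_num) (by norm_num) (by omega))).const_mul _
    rw [mul_zero] at h1
    obtain ⟨N, hN⟩ := (h1.eventually (gt_mem_nhds hμ)).exists
    exact ⟨N, by rw [mul_comm N d, pow_mul]; exact hN.le⟩
  refine ⟨2 * 4 ^ (N * d), ?_, ?_⟩
  · have : (1 : ℝ) ≤ 4 ^ (N * d) := one_le_pow₀ (by norm_num)
    linarith
  intro u U x0 F k0 ρ Λ M0 hu hDG hρ hΛ hF hFΛ hM0 hlev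
  set M1 := max (M0 - k0) 0
  have hM1 : 0 ≤ M1 := le_max_right _ _
  have claim : ∀ n j : ℕ, ∀ᵐ x, x ∈ ball x0 (ρ * (1 - (1 / 2) ^ (j + 1))) →
      u x ≤ k0 + 2 * Λ * 4 ^ ((j + N) * d) + δ ^ n * M1 := by
    intro n
    induction n with
    | zero =>
      intro j
      filter_upwards [hM0] with x hx hxB
      have h1 : u x ≤ M0 := hx (ball_subset_ball (by
        have : (0 : ℝ) < (1 / 2) ^ (j + 1) := by positivity
        nlinarith) hxB)
      have h2 : M0 - k0 ≤ M1 := le_max_left _ _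
      have : 0 ≤ 2 * Λ * 4 ^ ((j + N) * d) := by positivity
      rw [pow_zero, one_mul]; linarith
    | succ n ih =>
      intro j
      refine ae_of_locally fun x hx => ?_
      set a : ℝ := (1 / 2) ^ (j + 1) with ha
      have ha0 : 0 < a := by positivity
      have ha1 : a ≤ 1 := pow_le_one₀ (by norm_num) (by norm_num)
      set σ := ρ * (a / 2) with hσdef
      have hσ : 0 < σ := by positivity
      have ha' : (1 / 2 : ℝ) ^ (j + 1 + 1) = a / 2 := by rw [pow_succ, ← ha]; ring
      have hsub : ball x σ ⊆ ball x0 (ρ * (1 - (1 / 2) ^ (j + 1 + 1))) := by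
        refine ball_subset_ball' ?_
        rw [ha', hσdef]
        have := mem_ball.1 hx
        linarith
      have hsub2 : ball x σ ⊆ ball x0 ρ := hsub.trans (ball_subset_ball (by
        rw [ha']; nlinarith))
      set P : ℝ := 4 ^ ((j + N) * d) with hP
      have hP1 : 1 ≤ P := one_le_pow₀ (by norm_num)
      have hP4 : (4 : ℝ) ^ ((j + 1 + N) * d) = P * 4 ^ d := by
        rw [hP, ← pow_add]; congr 1; ring
      have hδP : δ * (2 * Λ * (P * 4 ^ d)) = Λ * P := by
        rw [hδdef]
        have : (1 / 4 : ℝ) ^ d * 4 ^ d = 1 := by rw [← mul_pow]; norm_num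
        linear_combination (Λ * P) * this
      refine ⟨σ / 2, by positivity, ?_⟩
      have := hb u U x F (k0 + Λ * P) σ (2 * Λ * (P * 4 ^ d) + δ ^ n * M1) hu
        (hDG.mono (by nlinarith) hsub2) hσ (by positivity) hF ?_ ?_ ?_
      · filter_upwards [this] with y hy hyB
        refine (hy hyB).trans (le_of_eq ?_)
        rw [mul_add, hδP, pow_succ]; ring
      · calc F * σ ^ 2 = F * ρ ^ 2 * (a / 2) ^ 2 := by rw [hσdef]; ring
          _ ≤ Λ * 1 := by
              gcongr
              exact pow_le_one₀ (by positivity) (by linarith)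
          _ ≤ Λ * P := by gcongr
          _ ≤ _ := by
              rw [mul_add, hδP]
              have : 0 ≤ δ * (δ ^ n * M1) := by positivity
              linarith
      · filter_upwards [ih (j + 1)] with y hy hyB
        have := hy (hsub hyB)
        rw [hP4] at this
        have : 0 ≤ Λ * P := by positivity
        linarith
      · calc _ ≤ volume.real (ball x0 ρ ∩ {x | k0 + Λ * 4 ^ ((j + N) * d) < u x}) := by
              refine measureReal_mono (Set.inter_subset_inter_left _ hsub2) ?_
              exact ((measure_mono Set.inter_subset_left).trans_lt measure_ball_lt_top).ne
          _ ≤ _ := hlev (j + N)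
          _ = C2 * 4 ^ d * (1 / 2) ^ (N * d) * σ ^ d := by
              have e1 : σ ^ d * 4 ^ d = ρ ^ d * (1 / 2) ^ (j * d) := by
                rw [pow_mul, ← mul_pow, ← mul_pow, hσdef, ha]
                congr 1; ring
              rw [add_mul, pow_add]
              linear_combination (-C2 * (1 / 2) ^ (N * d)) * e1
          _ ≤ _ := by gcongr
  have hall : ∀ᵐ x, ∀ n : ℕ, x ∈ ball x0 (ρ / 2) →
      u x ≤ k0 + 2 * Λ * 4 ^ (N * d) + δ ^ n * M1 := by
    rw [ae_all_iff]
    intro n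
    have := claim n 0
    norm_num at this
    rwa [mul_one_div] at this
  filter_upwards [hall] with x hx hxB
  have hlim : Tendsto (fun n : ℕ => k0 + 2 * Λ * 4 ^ (N * d) + δ ^ n * M1) atTop
      (𝓝 (k0 + 2 * Λ * 4 ^ (N * d) + 0 * M1)) :=
    tendsto_const_nhds.add ((_root_.tendsto_pow_atTop_nhds_zero_of_lt_one hδ.le hδ1).mul_const _)
  refine (ge_of_tendsto' hlim fun n => hx n hxB).trans (le_of_eq (by ring))

/-- The volume of the unit ball. -/
def vB (d : ℕ) : ℝ := volume.real (ball (0 : E d) 1)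

theorem vB_pos : 0 < vB d :=
  ENNReal.toReal_pos (measure_ball_pos volume _ one_pos).ne' measure_ball_lt_top.ne

theorem volume_real_ball (x : E d) {r : ℝ} (hr : 0 < r) :
    volume.real (ball x r) = r ^ d * vB d := by
  rw [Measure.real, Measure.addHaar_ball_of_pos volume x hr, ENNReal.toReal_mul,
    ENNReal.toReal_ofReal (by positivity), vB, Measure.real]
  simp

theorem integral_mul_sq_le {α : Type*} [MeasurableSpace α] {μ : Measure α} {f g : α → ℝ}
    (hf : MemLp f 2 μ) (hg : MemLp g 2 μ) :
    (∫ x, f x * g x ∂μ) ^ 2 ≤ (∫ x, f x ^ 2 ∂μ) * ∫ x, g x ^ 2 ∂μ := by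
  have hfg : Integrable (fun x => f x * g x) μ := hf.integrable_mul hg
  have h : ∀ a : ℝ, 0 ≤ (∫ x, g x ^ 2 ∂μ) * (a * a) + (-2 * ∫ x, f x * g x ∂μ) * a +
      ∫ x, f x ^ 2 ∂μ := by
    intro a
    have h1 : 0 ≤ ∫ x, (f x - a * g x) ^ 2 ∂μ := by positivity
    have h2 : ∫ x, (f x - a * g x) ^ 2 ∂μ =
        ∫ x, (f x ^ 2 + (-2 * a) * (f x * g x) + (a * a) * g x ^ 2) ∂μ := by
      congr 1; ext x; ring
    have i1 : Integrable (fun x => f x ^ 2 + (-2 * a) * (f x * g x)) μ :=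
      hf.integrable_sq.add (hfg.const_mul _)
    rw [h2, integral_add i1 (hg.integrable_sq.const_mul _),
      integral_add hf.integrable_sq (hfg.const_mul _), integral_const_mul, integral_const_mul] at h1
    linarith
  have := discrim_le_zero h
  rw [discrim] at this
  nlinarith

theorem sq_setIntegral_norm_le {S : Set (E d)} (hS : volume S ≠ ∞)
    {U : E d → E d} (hU : MemLp U 2 volume) :
    (∫ x in S, ‖U x‖) ^ 2 ≤ volume.real S * ∫ x in S, ‖U x‖ ^ 2 := by
  have : IsFiniteMeasure (volume.restrict S) := ⟨by simpa using hS.lt_top⟩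
  have h := integral_mul_sq_le (μ := volume.restrict S) (f := fun _ => (1 : ℝ))
    (g := fun x => ‖U x‖) (memLp_const 1) (hU.restrict S).norm
  simpa [Measure.real] using h

/-- Poincaré inequality between two levels. -/
theorem level_poincare {u : E d → ℝ} {U : E d → E d} (hu : H1 u U) (x0 : E d) {ρ k h : ℝ}
    (hρ : 0 < ρ) (hh : 0 ≤ h)
    (hk : volume (ball x0 ρ) ≤ 2 * volume (ball x0 ρ ∩ {x | u x ≤ k})) :
    h * volume.real (ball x0 ρ ∩ {x | k + h < u x}) ≤
      2 ^ (d + 2) * ρ * ∫ x in ball x0 ρ ∩ {x | k < u x ∧ u x ≤ k + h}, ‖U x‖ := by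
  have hmu := hu.mu
  have hw := (hu.trunc k).sub (hu.trunc (k + h))
  have mS : MeasurableSet {x | k + h < u x} := measurableSet_lt measurable_const hmu
  have mS' : MeasurableSet {x | k < u x ∧ u x ≤ k + h} :=
    (measurableSet_lt measurable_const hmu).inter (measurableSet_le hmu measurable_const)
  have hP := poincare hw x0 hρ (max (-(k + h)) 0 - max (-k) 0) (hk.trans (by
    refine mul_le_mul_right (measure_mono (Set.inter_subset_inter_right _ ?_)) _
    intro x hx
    have hx : u x ≤ k := hx
    change _ - _ - (_ - _) = _
    rw [max_eq_right (by linarith : u x - k ≤ 0),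
      max_eq_right (by linarith : u x - (k + h) ≤ 0)]
    ring))
  have e1 : ∀ x, max (u x - k) 0 - max (-k) 0 - (max (u x - (k + h)) 0 - max (-(k + h)) 0) -
      (max (-(k + h)) 0 - max (-k) 0) = max (u x - k) 0 - max (u x - (k + h)) 0 := fun x => by ring
  have e2 : ∀ x, {x | k < u x}.indicator U x - {x | k + h < u x}.indicator U x =
      {x | k < u x ∧ u x ≤ k + h}.indicator U x := by
    intro x
    by_cases h1 : k < u x <;> by_cases h2 : k + h < u x
    · simp [Set.indicator, h1, h2, not_le.2 h2]
    · simp [Set.indicator, h1, h2, not_lt.1 h2]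
    · exfalso; linarith
    · simp [Set.indicator, h1, h2]
  simp only [e1, e2] at hP
  have e3 : ∀ x, ‖{x | k < u x ∧ u x ≤ k + h}.indicator U x‖ =
      {x | k < u x ∧ u x ≤ k + h}.indicator (fun x => ‖U x‖) x := fun x =>
    norm_indicator_eq_indicator_norm _ _
  simp only [e3] at hP
  rw [setIntegral_indicator mS'] at hP
  refine le_trans ?_ hP
  calc _ = ∫ x in ball x0 ρ, {x | k + h < u x}.indicator (fun _ => h) x := by
        rw [setIntegral_indicator mS, setIntegral_const, smul_eq_mul, mul_comm]
    _ ≤ _ := by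
        refine setIntegral_mono
          (((integrableOn_const (C := h) measure_ball_lt_top.ne)).indicator mS)
          (((hu.integrableOn_pos k x0 ρ).sub (hu.integrableOn_pos (k + h) x0 ρ)).abs) fun x => ?_
        by_cases hx : x ∈ {x | k + h < u x}
        · rw [Set.indicator_of_mem hx]
          have hx : k + h < u x := hx
          rw [max_eq_left (by linarith), max_eq_left (by linarith)]
          exact le_trans (le_of_eq (by ring)) (le_abs_self _)
        · rw [Set.indicator_of_notMem hx]; positivity

/-- Caccioppoli inequality in De Giorgi classes. -/
theorem DG.caccioppoli : ∃ C : ℝ, 0 < C ∧ ∀ {d : ℕ} (u : E d → ℝ) (U : E d → E d) (x0 : E d)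
    (C1 F k H r R : ℝ), H1 u U → DG C1 F k u U (ball x0 R) → 0 < r → r < R → 0 ≤ F → 0 ≤ C1 →
    0 ≤ H → (∀ᵐ x, x ∈ ball x0 R → u x ≤ k + H) →
    ∫ x in ball x0 r ∩ {x | k < u x}, ‖U x‖ ^ 2 ≤
      C1 * (F * H + C * H ^ 2 / (R - r) ^ 2) * volume.real (ball x0 R) := by
  obtain ⟨Ce, hCe, hcut⟩ := exists_cutoff
  refine ⟨Ce ^ 2, by positivity, ?_⟩
  intro d u U x0 C1 F k H r R hu hDG hr hrR hF hC1 hH hle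
  obtain ⟨η, hη⟩ := hcut d x0 r R hr hrR
  have h2 := hDG k le_rfl η hη.cc1 hη.nonneg hη.le_one fun x hx =>
    hη.zero x (by simpa [mem_ball] using hx)
  have hv := hu.cutTrunc hη.cc1 k
  have mS : MeasurableSet {x | k < u x} := measurableSet_lt measurable_const hu.mu
  have hle' := (ae_restrict_iff' measurableSet_ball).2 hle
  have hpp : ∀ᵐ x ∂(volume.restrict (ball x0 R)), max (u x - k) 0 ≤ H := by
    filter_upwards [hle'] with x hx
    exact max_le (by linarith) hH
  have h3 : ∫ x in ball x0 r ∩ {x | k < u x}, ‖U x‖ ^ 2 ≤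
      ∫ x, ‖η x • {x | k < u x}.indicator U x + max (u x - k) 0 • ∇ η x‖ ^ 2 := by
    calc _ = ∫ x in ball x0 r ∩ {x | k < u x},
          ‖η x • {x | k < u x}.indicator U x + max (u x - k) 0 • ∇ η x‖ ^ 2 := by
          refine setIntegral_congr_fun (measurableSet_ball.inter mS) fun x hx => ?_
          simp only [hη.one x (mem_ball.1 hx.1).le, one_smul, Set.indicator_of_mem hx.2,
            hη.grad_zero x (Or.inl (mem_ball.1 hx.1)), smul_zero, add_zero]
      _ ≤ _ := setIntegral_le_integral (hv.lU.integrable_norm_pow two_ne_zero)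
          (Eventually.of_forall fun x => by positivity)
  have h4 : ∫ x, η x ^ 2 * max (u x - k) 0 ≤ H * volume.real (ball x0 R) := by
    rw [setIntegral_eq_of_zero (B := ball x0 R) fun x hx => by
      rw [hη.zero x (by simpa [mem_ball] using hx)]; simp]
    calc _ ≤ ∫ x in ball x0 R, H := by
          refine integral_mono_of_nonneg (Eventually.of_forall fun x => by positivity)
            (integrableOn_const measure_ball_lt_top.ne) ?_
          filter_upwards [hpp] with x hx
          have h6 : η x ^ 2 ≤ 1 := pow_le_one₀ (hη.nonneg x) (hη.le_one x)
          calc _ ≤ 1 * H := by gcongr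
            _ = H := one_mul H
      _ = _ := by rw [setIntegral_const, smul_eq_mul, mul_comm]
  have h5 : ∫ x, ‖∇ η x‖ ^ 2 * max (u x - k) 0 ^ 2 ≤
      (Ce / (R - r)) ^ 2 * H ^ 2 * volume.real (ball x0 R) := by
    rw [setIntegral_eq_of_zero (B := ball x0 R) fun x hx => by
      rw [hη.grad_zero x (Or.inr (by simpa [mem_ball] using hx))]; simp]
    calc _ ≤ ∫ x in ball x0 R, (Ce / (R - r)) ^ 2 * H ^ 2 := by
          refine integral_mono_of_nonneg (Eventually.of_forall fun x => by positivity)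
            (integrableOn_const measure_ball_lt_top.ne) ?_
          filter_upwards [hpp] with x hx
          have := hη.grad_le x
          gcongr
      _ = _ := by rw [setIntegral_const, smul_eq_mul, mul_comm]
  refine h3.trans (h2.trans ?_)
  calc _ ≤ C1 * (F * (H * volume.real (ball x0 R)) +
        (Ce / (R - r)) ^ 2 * H ^ 2 * volume.real (ball x0 R)) := by gcongr
    _ = _ := by rw [div_pow]; ring

theorem DG.decay (hd : 2 ≤ d) {C1 : ℝ} (hC1 : 0 ≤ C1) : ∃ c : ℝ, 0 < c ∧ c ≤ 1 / 4 ∧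
    ∀ (u : E d → ℝ) (U : E d → E d) (x0 : E d) (F k0 M ω ρ : ℝ), H1 u U →
    DG C1 F k0 u U (ball x0 (2 * ρ)) → k0 ≤ M - ω / 2 → 0 < ρ → 0 < ω → 0 ≤ F →
    F * ρ ^ 2 ≤ c * ω → (∀ᵐ x, x ∈ ball x0 (2 * ρ) → u x ≤ M) →
    volume (ball x0 ρ) ≤ 2 * volume (ball x0 ρ ∩ {x | u x ≤ M - ω / 2}) →
    ∀ᵐ x, x ∈ ball x0 (ρ / 2) → u x ≤ M - c * ω := by
  obtain ⟨μ, hμ, hb⟩ := DG.bound_of_measure hd hC1 (δ := 1 / 2) (by norm_num)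
  obtain ⟨Cc, hCc, hcacc⟩ := DG.caccioppoli
  have hv := vB_pos (d := d)
  set C3 : ℝ := (2 ^ (d + 2)) ^ 2 * (C1 * (2 + 4 * Cc) * (2 ^ d * vB d)) with hC3
  have hC30 : 0 ≤ C3 := by positivity
  obtain ⟨N, hN⟩ := exists_nat_gt (C3 * vB d / μ ^ 2)
  have hN0 : (0 : ℝ) < N := lt_of_le_of_lt (by positivity) hN
  set c : ℝ := (1 / 2) ^ (N + 2) with hc
  refine ⟨c, by positivity, ?_, ?_⟩
  · calc c ≤ (1 / 2) ^ 2 := pow_le_pow_of_le_one (by norm_num) (by norm_num) (by omega)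
      _ = 1 / 4 := by norm_num
  intro u U x0 F k0 M ω ρ hu hDG hk0 hρ hω hF hFω hle hhalf
  have hmu := hu.mu
  set k : ℕ → ℝ := fun j => M - ω * (1 / 2) ^ (j + 1) with hk
  set A : ℕ → ℝ := fun j => volume.real (ball x0 ρ ∩ {x | k j < u x}) with hA
  have hfin : ∀ s : Set (E d), volume (ball x0 ρ ∩ s) ≠ ∞ := fun s =>
    ((measure_mono Set.inter_subset_left).trans_lt measure_ball_lt_top).ne
  have hkmono : Monotone k := by
    intro i j hij
    simp only [hk]
    have : (1 / 2 : ℝ) ^ (j + 1) ≤ (1 / 2) ^ (i + 1) :=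
      pow_le_pow_of_le_one (by norm_num) (by norm_num) (by omega)
    nlinarith
  have hkge : ∀ j, M - ω / 2 ≤ k j := fun j => by
    have := hkmono (Nat.zero_le j)
    simp only [hk] at this ⊢
    norm_num at this
    linarith
  have hAanti : ∀ i j, i ≤ j → A j ≤ A i := fun i j hij =>
    measureReal_mono (Set.inter_subset_inter_right _ fun x (hx : k j < u x) =>
      lt_of_le_of_lt (hkmono hij) hx) (hfin _)
  have hstep : ∀ j, j < N → A (j + 1) ^ 2 ≤ C3 * ρ ^ d * (A j - A (j + 1)) := by
    intro j hj
    set h := ω * (1 / 2) ^ (j + 2) with hh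
    have hh0 : 0 < h := by positivity
    have hk1 : k (j + 1) = k j + h := by simp only [hk, hh, pow_succ]; ring
    have hMk : M = k j + 2 * h := by simp only [hk, hh, pow_succ]; ring
    have hFh : F * ρ ^ 2 ≤ h := by
      refine hFω.trans ?_
      rw [hh, mul_comm ω]
      gcongr
      exact pow_le_pow_of_le_one (by norm_num) (by norm_num) (by omega)
    have hhalf' : volume (ball x0 ρ) ≤ 2 * volume (ball x0 ρ ∩ {x | u x ≤ k j}) :=
      hhalf.trans (mul_le_mul_right (measure_mono (Set.inter_subset_inter_right _
        fun x (hx : u x ≤ _) => hx.trans (hkge j))) _)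
    have h1 := level_poincare hu x0 hρ hh0.le hhalf'
    rw [← hk1] at h1
    set S := ball x0 ρ ∩ {x | k j < u x ∧ u x ≤ k (j + 1)} with hS
    have h2 := sq_setIntegral_norm_le (hfin {x | k j < u x ∧ u x ≤ k (j + 1)}) hu.lU
    have h3 := hcacc u U x0 C1 F (k j) (2 * h) ρ (2 * ρ) hu
      (hDG.mono (hk0.trans (hkge j)) subset_rfl) hρ (by linarith) hF hC1 (by positivity)
      (by rw [← hMk]; exact hle)
    have h4 : ∫ x in S, ‖U x‖ ^ 2 ≤ ∫ x in ball x0 ρ ∩ {x | k j < u x}, ‖U x‖ ^ 2 := by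
      refine setIntegral_mono_set (hu.lU.integrable_norm_pow two_ne_zero).integrableOn
        (Eventually.of_forall fun x => by positivity) (LE.le.eventuallyLE ?_)
      exact fun x hx => ⟨hx.1, hx.2.1⟩
    have h5 : volume.real S = A j - A (j + 1) := by
      have hsub : ball x0 ρ ∩ {x | k (j + 1) < u x} ⊆ ball x0 ρ ∩ {x | k j < u x} :=
        Set.inter_subset_inter_right _ fun x (hx : k (j + 1) < u x) =>
          lt_of_le_of_lt (hkmono (Nat.le_succ j)) hx
      have : S = (ball x0 ρ ∩ {x | k j < u x}) \ (ball x0 ρ ∩ {x | k (j + 1) < u x}) := by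
        ext x
        simp only [hS, Set.mem_inter_iff, Set.mem_ofPred_eq, Set.mem_sdiff]
        constructor
        · rintro ⟨a, b, c⟩; exact ⟨⟨a, b⟩, fun h => absurd h.2 (not_lt.2 c)⟩
        · rintro ⟨⟨a, b⟩, c⟩; exact ⟨a, b, not_lt.1 fun h => c ⟨a, h⟩⟩
      rw [this, measureReal_sdiff hsub (measurableSet_ball.inter
        (measurableSet_lt measurable_const hmu)) (hfin _)]
    have hS0 : 0 ≤ volume.real S := measureReal_nonneg
    rw [volume_real_ball x0 (by positivity : 0 < 2 * ρ)] at h3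
    have h6 : F * (2 * h) + Cc * (2 * h) ^ 2 / (2 * ρ - ρ) ^ 2 ≤ (2 + 4 * Cc) * h ^ 2 / ρ ^ 2 := by
      rw [show 2 * ρ - ρ = ρ by ring, ← sub_nonneg]
      have : (2 + 4 * Cc) * h ^ 2 / ρ ^ 2 - (F * (2 * h) + Cc * (2 * h) ^ 2 / ρ ^ 2) =
          2 * h * (h - F * ρ ^ 2) / ρ ^ 2 := by field_simp; ring
      rw [this]
      have : 0 ≤ h - F * ρ ^ 2 := by linarith
      positivity
    have h7 : (h * A (j + 1)) ^ 2 ≤ h ^ 2 * (C3 * ρ ^ d * (A j - A (j + 1))) := by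
      calc (h * A (j + 1)) ^ 2 ≤ (2 ^ (d + 2) * ρ * ∫ x in S, ‖U x‖) ^ 2 := by
            have : 0 ≤ A (j + 1) := measureReal_nonneg
            gcongr
        _ = (2 ^ (d + 2)) ^ 2 * ρ ^ 2 * (∫ x in S, ‖U x‖) ^ 2 := by ring
        _ ≤ (2 ^ (d + 2)) ^ 2 * ρ ^ 2 * (volume.real S * (C1 * ((2 + 4 * Cc) * h ^ 2 / ρ ^ 2) *
            ((2 * ρ) ^ d * vB d))) := by
            gcongr
            refine h2.trans ?_
            gcongr
            refine h4.trans (h3.trans ?_)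
            gcongr
        _ = _ := by
            rw [h5, hC3, mul_pow 2 ρ d]; field_simp
    rw [mul_pow] at h7
    exact le_of_mul_le_mul_left h7 (by positivity)
  have hA0 : 0 ≤ A N := measureReal_nonneg
  have hsum : N * A N ^ 2 ≤ C3 * ρ ^ d * (ρ ^ d * vB d) := by
    have h1 : ∑ j ∈ Finset.range N, A N ^ 2 ≤
        ∑ j ∈ Finset.range N, C3 * ρ ^ d * (A j - A (j + 1)) := by
      refine Finset.sum_le_sum fun j hj => ?_
      have hj := Finset.mem_range.1 hj
      refine le_trans ?_ (hstep j hj)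
      have := hAanti (j + 1) N hj
      gcongr
    rw [Finset.sum_const, Finset.card_range, nsmul_eq_mul, ← Finset.mul_sum,
      Finset.sum_range_sub'] at h1
    refine h1.trans ?_
    gcongr
    have : A 0 ≤ volume.real (ball x0 ρ) :=
      measureReal_mono Set.inter_subset_left measure_ball_lt_top.ne
    rw [volume_real_ball x0 hρ] at this
    linarith
  have hAN : A N ≤ μ * ρ ^ d := by
    refine le_of_sq_le_sq ?_ (by positivity)
    rw [div_lt_iff₀ (by positivity)] at hN
    have h1 : N * A N ^ 2 ≤ N * (μ * ρ ^ d) ^ 2 := by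
      calc _ ≤ _ := hsum
        _ = (C3 * vB d) * (ρ ^ d) ^ 2 := by ring
        _ ≤ (N * μ ^ 2) * (ρ ^ d) ^ 2 := by gcongr
        _ = _ := by ring
    exact le_of_mul_le_mul_left h1 hN0
  have hfinal := hb u U x0 F (k N) ρ (ω * (1 / 2) ^ (N + 1)) hu
    (hDG.mono (hk0.trans (hkge N)) (ball_subset_ball (by linarith))) hρ (by positivity) hF
    (hFω.trans (le_of_eq (by rw [hc]; ring))) ?_ hAN
  · filter_upwards [hfinal] with x hx hxB
    refine (hx hxB).trans (le_of_eq ?_)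
    simp only [hk, hc, pow_succ]; ring
  · filter_upwards [hle] with x hx hxB
    have := hx (ball_subset_ball (by linarith) hxB)
    simp only [hk]; linarith

/-- Oscillation decay in De Giorgi classes. -/
theorem DG.osc (hd : 2 ≤ d) {C1 : ℝ} (hC1 : 0 ≤ C1) : ∃ θ C : ℝ, 0 < θ ∧ θ < 1 ∧ 0 < C ∧
    ∀ (u : E d → ℝ) (U : E d → E d) (x0 : E d) (F m ω ρ : ℝ), H1 u U →
    (∀ k, DG C1 F k u U (ball x0 ρ)) → (∀ k, DG C1 F k (-u) (-U) (ball x0 ρ)) →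
    0 < ρ → 0 < ω → 0 ≤ F → (∀ᵐ x, x ∈ ball x0 ρ → m ≤ u x ∧ u x ≤ m + ω) →
    ∀ j : ℕ, ∃ m' : ℝ, ∀ᵐ x, x ∈ ball x0 (ρ * (1 / 4) ^ j) →
      m' ≤ u x ∧ u x ≤ m' + θ ^ j * (ω + C * F * ρ ^ 2) := by
  obtain ⟨c, hc0, hc1, hdec⟩ := DG.decay hd hC1
  refine ⟨1 - c, 1 / c, by linarith, by linarith, by positivity, ?_⟩
  intro u U x0 F m ω ρ hu hD hD' hρ hω hF hle j
  have hmu := hu.mu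
  set Ω := ω + 1 / c * F * ρ ^ 2 with hΩ
  have hF0 : 0 ≤ 1 / c * F * ρ ^ 2 := by positivity
  have hΩ0 : 0 < Ω := by positivity
  have hθ : 0 < 1 - c := by linarith
  induction j with
  | zero =>
    refine ⟨m, ?_⟩
    filter_upwards [hle] with x hx hxB
    have := hx (by simpa using hxB)
    exact ⟨this.1, by rw [pow_zero, one_mul]; linarith⟩
  | succ j ih =>
    obtain ⟨m1, hm1⟩ := ih
    set r := ρ * (1 / 4) ^ j / 2 with hr
    have hr0 : 0 < r := by positivity
    set w := (1 - c) ^ j * Ω with hw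
    have hw0 : 0 < w := by positivity
    have hball : ρ * (1 / 4) ^ j = 2 * r := by rw [hr]; ring
    have hball' : ρ * (1 / 4) ^ (j + 1) = r / 2 := by rw [hr, pow_succ]; ring
    have hsub : ball x0 (2 * r) ⊆ ball x0 ρ := by
      rw [← hball]
      refine ball_subset_ball ?_
      have : (1 / 4 : ℝ) ^ j ≤ 1 := pow_le_one₀ (by norm_num) (by norm_num)
      nlinarith
    rw [hball] at hm1
    rw [hball']
    have hFr : F * r ^ 2 ≤ c * w := by
      have e1 : r ^ 2 = ρ ^ 2 * ((1 / 16) ^ j) / 4 := by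
        rw [hr, div_pow, mul_pow, ← pow_mul, mul_comm j 2, pow_mul]; norm_num
      have e2 : (1 / 16 : ℝ) ^ j ≤ (1 - c) ^ j := by
        gcongr; linarith
      have e3 : F * ρ ^ 2 ≤ c * Ω := by
        have : c * Ω = c * ω + F * ρ ^ 2 := by rw [hΩ]; field_simp
        rw [this]; nlinarith
      calc F * r ^ 2 = (F * ρ ^ 2) * (1 / 16) ^ j / 4 := by rw [e1]; ring
        _ ≤ (F * ρ ^ 2) * (1 / 16) ^ j := by
            have : 0 ≤ (F * ρ ^ 2) * (1 / 16) ^ j := by positivity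
            linarith
        _ ≤ (c * Ω) * (1 - c) ^ j := by gcongr
        _ = _ := by rw [hw]; ring
    have hww : (1 - c) ^ (j + 1) * Ω = w - c * w := by rw [hw, pow_succ]; ring
    rw [hww]
    rcases le_total (volume (ball x0 r)) (2 * volume (ball x0 r ∩ {x | u x ≤ m1 + w / 2}))
      with hcase | hcase
    · refine ⟨m1, ?_⟩
      have := hdec u U x0 F (m1 + w - w / 2) (m1 + w) w r hu ((hD _).mono le_rfl hsub) le_rfl hr0
        hw0 hF hFr (by filter_upwards [hm1] with x hx hxB using (hx hxB).2)
        (by rwa [show m1 + w - w / 2 = m1 + w / 2 by ring])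
      filter_upwards [this, hm1] with x hx hx1 hxB
      have h1 := hx1 (ball_subset_ball (by linarith) hxB)
      exact ⟨h1.1, by linarith [hx hxB]⟩
    · refine ⟨m1 + c * w, ?_⟩
      have hhalf : volume (ball x0 r) ≤ 2 * volume (ball x0 r ∩ {x | (-u) x ≤ -m1 - w / 2}) := by
        have h1 := measure_inter_add_sdiff (μ := volume) (ball x0 r)
          (measurableSet_le hmu (measurable_const (a := m1 + w / 2)))
        have h2 : volume (ball x0 r \ {x | u x ≤ m1 + w / 2}) ≤
            volume (ball x0 r ∩ {x | (-u) x ≤ -m1 - w / 2}) := by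
          refine measure_mono fun x hx => ⟨hx.1, ?_⟩
          have : ¬ u x ≤ m1 + w / 2 := hx.2
          change - u x ≤ _
          linarith
        set a := volume (ball x0 r ∩ {x | u x ≤ m1 + w / 2})
        set b := volume (ball x0 r \ {x | u x ≤ m1 + w / 2})
        have ha : a ≠ ∞ := ((measure_mono Set.inter_subset_left).trans_lt measure_ball_lt_top).ne
        have h3 : a ≤ b := by
          rw [← h1, two_mul] at hcase
          exact (ENNReal.add_le_add_iff_left ha).1 hcase
        rw [← h1, two_mul]
        exact add_le_add (h3.trans h2) h2
      have := hdec (-u) (-U) x0 F (-m1 - w / 2) (-m1) w r hu.neg ((hD' _).mono le_rfl hsub) le_rfl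
        hr0 hw0 hF hFr (by
          filter_upwards [hm1] with x hx hxB
          have := (hx hxB).1
          simp only [Pi.neg_apply]; linarith) hhalf
      filter_upwards [this, hm1] with x hx hx1 hxB
      have h1 := hx1 (ball_subset_ball (by linarith) hxB)
      have h2 := hx hxB
      simp only [Pi.neg_apply] at h2
      exact ⟨by linarith, by linarith⟩

/-- A bounded measurable elliptic coefficient field `a` together with its pointwise adjoint `b`. -/
structure Coef (lam : ℝ) (a b : E d → E d →ₗ[ℝ] E d) : Prop where
  pos : 0 < lam
  meas : ∀ U : E d → E d, Measurable U → Measurable fun x => a x (U x)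
  meas' : ∀ U : E d → E d, Measurable U → Measurable fun x => b x (U x)
  bound : ∀ x v, ‖a x v‖ ≤ ‖v‖
  bound' : ∀ x v, ‖b x v‖ ≤ ‖v‖
  ell : ∀ x v, lam * ‖v‖ ^ 2 ≤ ⟪v, a x v⟫_ℝ
  adj : ∀ x v w, ⟪v, a x w⟫_ℝ = ⟪w, b x v⟫_ℝ

theorem Coef.symm {lam : ℝ} {a b : E d → E d →ₗ[ℝ] E d} (h : Coef lam a b) : Coef lam b a where
  pos := h.pos
  meas := h.meas'
  meas' := h.meas
  bound := h.bound'
  bound' := h.bound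
  ell x v := by rw [← h.adj]; exact h.ell x v
  adj x v w := (h.adj x w v).symm

theorem Coef.memLp {lam : ℝ} {a b : E d → E d →ₗ[ℝ] E d} (h : Coef lam a b) {U : E d → E d}
    (mU : Measurable U) (hU : MemLp U 2 volume) : MemLp (fun x => a x (U x)) 2 volume :=
  hU.mono (h.meas U mU).aestronglyMeasurable (ae_of_all _ fun x => h.bound x (U x))

theorem integrable_inner {U V : E d → E d} (hU : MemLp U 2 volume) (hV : MemLp V 2 volume) :
    Integrable fun x => ⟪U x, V x⟫_ℝ := by
  refine (hU.norm.integrable_mul hV.norm).mono (hU.1.inner hV.1) (ae_of_all _ fun x => ?_)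
  simpa using norm_inner_le_norm (𝕜 := ℝ) (U x) (V x)

theorem Coef.integrable {lam : ℝ} {a b : E d → E d →ₗ[ℝ] E d} (h : Coef lam a b)
    {u v : E d → ℝ} {U V : E d → E d} (hu : H1 u U) (hv : H1 v V) :
    Integrable fun x => ⟪V x, a x (U x)⟫_ℝ :=
  integrable_inner hv.lU (h.memLp hu.mU hu.lU)

/-- Weak solutions in `H¹` of `T⁻¹ u - ∇ · a ∇ u = g`. -/
structure Sol (a : E d → E d →ₗ[ℝ] E d) (T : ℝ) (g u : E d → ℝ) (U : E d → E d) : Prop where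
  h1 : H1 u U
  eq : ∀ φ Φ, H1 φ Φ → T⁻¹ * (∫ x, u x * φ x) + ∫ x, ⟪Φ x, a x (U x)⟫_ℝ = ∫ x, g x * φ x

theorem H1.int_mul {u v : E d → ℝ} {U V : E d → E d} (hu : H1 u U) (hv : H1 v V) :
    Integrable fun x => u x * v x := hu.lu.integrable_mul hv.lu

theorem Sol.neg {a : E d → E d →ₗ[ℝ] E d} {T : ℝ} {g u : E d → ℝ} {U : E d → E d}
    (h : Sol a T g u U) : Sol a T (-g) (-u) (-U) where
  h1 := h.h1.neg
  eq φ Φ hφ := by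
    have := h.eq φ Φ hφ
    simp only [Pi.neg_apply, neg_mul, integral_neg, map_neg, inner_neg_right]
    linarith

theorem Sol.sub {lam : ℝ} {a b : E d → E d →ₗ[ℝ] E d} (ha : Coef lam a b) {T : ℝ}
    {g g' u u' : E d → ℝ} {U U' : E d → E d} (hg : MemLp g 2 volume) (hg' : MemLp g' 2 volume)
    (h : Sol a T g u U) (h' : Sol a T g' u' U') :
    Sol a T (fun x => g x - g' x) (fun x => u x - u' x) (fun x => U x - U' x) where
  h1 := h.h1.sub h'.h1
  eq φ Φ hφ := by
    simp only [sub_mul, map_sub, inner_sub_right]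
    rw [integral_sub (h.h1.int_mul hφ) (h'.h1.int_mul hφ),
      integral_sub (ha.integrable h.h1 hφ) (ha.integrable h'.h1 hφ),
      integral_sub (f := fun x => g x * φ x) (g := fun x => g' x * φ x)
        (hg.integrable_mul hφ.lu) (hg'.integrable_mul hφ.lu), ← h.eq φ Φ hφ,
      ← h'.eq φ Φ hφ]
    ring

/-- Duality between the solution operators of `a` and of its adjoint. -/
theorem Sol.duality {lam : ℝ} {a b : E d → E d →ₗ[ℝ] E d} (ha : Coef lam a b) {T : ℝ}
    {g f u v : E d → ℝ} {U V : E d → E d} (h : Sol a T g u U) (h' : Sol b T f v V) :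
    ∫ x, g x * v x = ∫ x, f x * u x := by
  rw [← h.eq v V h'.h1, ← h'.eq u U h.h1]
  congr 2
  · exact integral_congr_ae (ae_of_all _ fun x => mul_comm _ _)
  · ext x; rw [ha.adj]

theorem H1.congr_left {u v : E d → ℝ} {U : E d → E d} (hu : H1 u U) (mv : Measurable v)
    (h1 : u =ᵐ[volume] v) : H1 v U := hu.congr_ae mv hu.mU h1 (ae_eq_refl _)

theorem Sol.congr_left {a : E d → E d →ₗ[ℝ] E d} {T : ℝ} {g u v : E d → ℝ} {U : E d → E d}
    (h : Sol a T g u U) (mv : Measurable v) (huv : u =ᵐ[volume] v) : Sol a T g v U where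
  h1 := h.h1.congr_left mv huv
  eq φ Φ hφ := by
    rw [← h.eq φ Φ hφ]
    congr 2
    exact integral_congr_ae (huv.mono fun x hx => by simp only [hx])

theorem Sol.nonneg {lam : ℝ} {a b : E d → E d →ₗ[ℝ] E d} (ha : Coef lam a b) {T : ℝ} (hT : 0 < T)
    {g u : E d → ℝ} {U : E d → E d} (h : Sol a T g u U) (hg : ∀ x, 0 ≤ g x) :
    ∀ᵐ x, 0 ≤ u x := by
  have ht : H1 (fun x => max (-u x) 0) ({x | 0 < -u x}.indicator fun x => -U x) := by
    have := h.h1.neg.trunc 0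
    simpa using this
  have e := h.eq _ _ ht
  have e1 : 0 ≤ ∫ x, g x * max (-u x) 0 :=
    integral_nonneg fun x => mul_nonneg (hg x) (le_max_right _ _)
  have e2 : ∫ x, ⟪({x | 0 < -u x}.indicator fun x => -U x) x, a x (U x)⟫_ℝ ≤ 0 := by
    refine integral_nonpos fun x => ?_
    by_cases hx : x ∈ {x | 0 < -u x}
    · rw [Set.indicator_of_mem hx, inner_neg_left]
      have := ha.ell x (U x)
      have := ha.pos
      simp only [Pi.zero_apply, Left.neg_nonpos_iff]
      nlinarith [sq_nonneg ‖U x‖]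
    · rw [Set.indicator_of_notMem hx]; simp
  have e3 : ∀ x, u x * max (-u x) 0 = - max (-u x) 0 ^ 2 := by
    intro x
    rcases le_total (-u x) 0 with hx | hx
    · rw [max_eq_right hx]; simp
    · rw [max_eq_left hx]; ring
  simp only [e3, integral_neg] at e
  have e4 : ∫ x, max (-u x) 0 ^ 2 ≤ 0 := by
    have : 0 ≤ T⁻¹ * -∫ x, max (-u x) 0 ^ 2 := by linarith
    have := nonneg_of_mul_nonneg_right this (by positivity)
    linarith
  have e5 := (integral_eq_zero_iff_of_nonneg (fun x => sq_nonneg _) ht.lu.integrable_sq).1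
    (le_antisymm e4 (integral_nonneg fun x => sq_nonneg _))
  filter_upwards [e5] with x hx
  have hx' : max (-u x) 0 = 0 := by simpa using hx
  have := le_max_left (-u x) 0
  linarith

section LaxMilgram

/-- The space `L² × L²` in which `H¹` sits. -/
abbrev PairSpace (d : ℕ) := WithLp 2 (Lp ℝ 2 (volume : Measure (E d)) × Lp (E d) 2 (volume : Measure (E d)))

/-- `H¹` as a subspace of `L² × L²`. -/
def h1Sub (d : ℕ) : Submodule ℝ (PairSpace d) where
  carrier := {p | ∃ u U, H1 u U ∧ p.fst =ᵐ[volume] u ∧ p.snd =ᵐ[volume] U}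
  add_mem' := by
    rintro p q ⟨u, U, h, h1, h2⟩ ⟨v, V, h', h1', h2'⟩
    refine ⟨_, _, h.add h', ?_, ?_⟩
    · filter_upwards [Lp.coeFn_add p.fst q.fst, h1, h1'] with x e e1 e2
      simp only [WithLp.add_fst, e, Pi.add_apply, e1, e2]
    · filter_upwards [Lp.coeFn_add p.snd q.snd, h2, h2'] with x e e1 e2
      simp only [WithLp.add_snd, e, Pi.add_apply, e1, e2]
  zero_mem' := by
    refine ⟨_, _, H1.of_CC1 (φ := fun _ => 0) ⟨contDiff_const, HasCompactSupport.zero⟩, ?_, ?_⟩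
    · filter_upwards [Lp.coeFn_zero ℝ 2 (volume : Measure (E d))] with x e
      exact e
    · filter_upwards [Lp.coeFn_zero (E d) 2 (volume : Measure (E d))] with x e
      simpa [gradient_const] using e
  smul_mem' := by
    rintro c p ⟨u, U, h, h1, h2⟩
    refine ⟨_, _, h.const_mul c, ?_, ?_⟩
    · filter_upwards [Lp.coeFn_smul c p.fst, h1] with x e e1
      simp only [WithLp.smul_fst, e, Pi.smul_apply, e1, smul_eq_mul]
    · filter_upwards [Lp.coeFn_smul c p.snd, h2] with x e e1
      simp only [WithLp.smul_snd, e, Pi.smul_apply, e1]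

theorem h1Sub_isClosed : IsClosed (h1Sub d : Set (PairSpace d)) := by
  rw [← isSeqClosed_iff_isClosed]
  intro p q hp hpq
  choose u U h h1 h2 using hp
  have m1 : Measurable (q.fst : E d → ℝ) := (Lp.stronglyMeasurable q.fst).measurable
  have m2 : Measurable (q.snd : E d → E d) := (Lp.stronglyMeasurable q.snd).measurable
  have t1 : Tendsto (fun n => (p n).fst) atTop (𝓝 q.fst) :=
    ((WithLp.prod_continuous_ofLp 2 _ _).fst.tendsto q).comp hpq
  have t2 : Tendsto (fun n => (p n).snd) atTop (𝓝 q.snd) :=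
    ((WithLp.prod_continuous_ofLp 2 _ _).snd.tendsto q).comp hpq
  refine ⟨q.fst, q.snd, H1.of_tendsto m1 m2 (Lp.memLp _) (Lp.memLp _) h ?_ ?_,
    ae_eq_refl _, ae_eq_refl _⟩
  · refine ((Lp.tendsto_Lp_iff_tendsto_eLpNorm' _ _).1 t1).congr fun n => eLpNorm_congr_ae ?_
    exact (h1 n).sub (ae_eq_refl _)
  · refine ((Lp.tendsto_Lp_iff_tendsto_eLpNorm' _ _).1 t2).congr fun n => eLpNorm_congr_ae ?_
    exact (h2 n).sub (ae_eq_refl _)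

/-- Multiplication by the coefficient field as an operator on `L²`. -/
def Coef.mulOp {lam : ℝ} {a b : E d → E d →ₗ[ℝ] E d} (ha : Coef lam a b) :
    Lp (E d) 2 (volume : Measure (E d)) →L[ℝ] Lp (E d) 2 (volume : Measure (E d)) :=
  LinearMap.mkContinuous
    { toFun := fun F => (ha.memLp (Lp.stronglyMeasurable F).measurable (Lp.memLp F)).toLp _
      map_add' := fun F G => by
        rw [← MemLp.toLp_add]
        refine (MemLp.toLp_eq_toLp_iff _ _).2 ?_
        filter_upwards [Lp.coeFn_add F G] with x hx
        rw [hx, Pi.add_apply, map_add, Pi.add_apply]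
      map_smul' := fun c F => by
        rw [RingHom.id_apply, ← MemLp.toLp_const_smul]
        refine (MemLp.toLp_eq_toLp_iff _ _).2 ?_
        filter_upwards [Lp.coeFn_smul c F] with x hx
        rw [hx, Pi.smul_apply, map_smul, Pi.smul_apply] } 1 fun F => by
    rw [one_mul]
    refine Lp.norm_le_norm_of_ae_le ?_
    filter_upwards [(ha.memLp (Lp.stronglyMeasurable F).measurable (Lp.memLp F)).coeFn_toLp]
      with x hx
    simp only [LinearMap.coe_mk, AddHom.coe_mk]
    rw [hx]
    exact ha.bound x _

theorem Coef.mulOp_coe {lam : ℝ} {a b : E d → E d →ₗ[ℝ] E d} (ha : Coef lam a b)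
    (F : Lp (E d) 2 (volume : Measure (E d))) :
    ha.mulOp F =ᵐ[volume] fun x => a x (F x) :=
  (ha.memLp (Lp.stronglyMeasurable F).measurable (Lp.memLp F)).coeFn_toLp

/-- The bilinear form of the equation on `H¹`. -/
def Coef.bilin {lam : ℝ} {a b : E d → E d →ₗ[ℝ] E d} (ha : Coef lam a b) (T : ℝ) :
    h1Sub d →L[ℝ] h1Sub d →L[ℝ] ℝ :=
  LinearMap.mkContinuous₂
    (LinearMap.mk₂ ℝ (fun p q : h1Sub d => T⁻¹ * ⟪(p : PairSpace d).fst, (q : PairSpace d).fst⟫_ℝ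
      + ⟪ha.mulOp (p : PairSpace d).snd, (q : PairSpace d).snd⟫_ℝ)
      (fun p p' q => by simp [inner_add_left]; ring)
      (fun c p q => by simp [inner_smul_left]; ring)
      (fun p q q' => by simp [inner_add_right]; ring)
      (fun c p q => by simp [inner_smul_right]; ring))
    (|T⁻¹| + ‖ha.mulOp‖) fun p q => by
      have n1 : ∀ p : PairSpace d, ‖p.fst‖ ≤ ‖p‖ := fun p => by
        rw [WithLp.prod_norm_eq_of_L2]
        exact Real.le_sqrt_of_sq_le (by nlinarith [sq_nonneg ‖p.snd‖])
      have n2 : ∀ p : PairSpace d, ‖p.snd‖ ≤ ‖p‖ := fun p => by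
        rw [WithLp.prod_norm_eq_of_L2]
        exact Real.le_sqrt_of_sq_le (by nlinarith [sq_nonneg ‖p.fst‖])
      simp only [LinearMap.mk₂_apply]
      refine (norm_add_le _ _).trans ?_
      rw [norm_mul, Real.norm_eq_abs T⁻¹]
      have i1 := norm_inner_le_norm (𝕜 := ℝ) (p : PairSpace d).fst (q : PairSpace d).fst
      have i2 := norm_inner_le_norm (𝕜 := ℝ) (ha.mulOp (p : PairSpace d).snd)
        (q : PairSpace d).snd
      have i3 := ha.mulOp.le_opNorm (p : PairSpace d).snd
      calc _ ≤ |T⁻¹| * (‖(p : PairSpace d)‖ * ‖(q : PairSpace d)‖) +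
            ‖ha.mulOp‖ * ‖(p : PairSpace d)‖ * ‖(q : PairSpace d)‖ := by
            gcongr
            · exact i1.trans (mul_le_mul (n1 _) (n1 _) (norm_nonneg _) (norm_nonneg _))
            · refine i2.trans (mul_le_mul (i3.trans ?_) (n2 _) (norm_nonneg _) (by positivity))
              gcongr; exact n2 _
        _ = _ := by simp only [Submodule.coe_norm]; ring

theorem Coef.bilin_apply {lam : ℝ} {a b : E d → E d →ₗ[ℝ] E d} (ha : Coef lam a b) (T : ℝ)
    (p q : h1Sub d) : ha.bilin T p q = T⁻¹ * ⟪(p : PairSpace d).fst, (q : PairSpace d).fst⟫_ℝ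
      + ⟪ha.mulOp (p : PairSpace d).snd, (q : PairSpace d).snd⟫_ℝ := rfl

theorem Coef.bilin_coercive {lam : ℝ} {a b : E d → E d →ₗ[ℝ] E d} (ha : Coef lam a b) {T : ℝ}
    (hT : 0 < T) : IsCoercive (ha.bilin T) := by
  have hl := ha.pos
  refine ⟨min T⁻¹ lam, lt_min (by positivity) ha.pos, fun p => ?_⟩
  have e : lam * ‖(p : PairSpace d).snd‖ ^ 2 ≤
      ⟪ha.mulOp (p : PairSpace d).snd, (p : PairSpace d).snd⟫_ℝ := by
    rw [← real_inner_self_eq_norm_sq, L2.inner_def, L2.inner_def, ← integral_const_mul]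
    refine integral_mono_ae ((L2.integrable_inner _ _).const_mul _) (L2.integrable_inner _ _) ?_
    filter_upwards [ha.mulOp_coe (p : PairSpace d).snd] with x hx
    rw [hx, real_inner_self_eq_norm_sq, real_inner_comm]
    exact ha.ell x _
  rw [ha.bilin_apply, real_inner_self_eq_norm_sq]
  have e2 : ‖p‖ * ‖p‖ = ‖(p : PairSpace d).fst‖ ^ 2 + ‖(p : PairSpace d).snd‖ ^ 2 := by
    rw [← sq, Submodule.coe_norm, WithLp.prod_norm_sq_eq_of_L2]
  rw [mul_assoc, e2]
  nlinarith [min_le_left T⁻¹ lam, min_le_right T⁻¹ lam, sq_nonneg ‖(p : PairSpace d).fst‖,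
    sq_nonneg ‖(p : PairSpace d).snd‖]

theorem exists_sol {lam : ℝ} {a b : E d → E d →ₗ[ℝ] E d} (ha : Coef lam a b) {T : ℝ}
    (hT : 0 < T) {g : E d → ℝ} (hg : MemLp g 2 volume) : ∃ u U, Sol a T g u U := by
  have : CompleteSpace (h1Sub d) := h1Sub_isClosed.completeSpace_coe
  have hB := ha.bilin_coercive hT
  let ℓ : h1Sub d →L[ℝ] ℝ := (innerSL ℝ (hg.toLp g)).comp
    ((WithLp.fstL 2 ℝ _ _).comp (h1Sub d).subtypeL)
  let p : h1Sub d := hB.continuousLinearEquivOfBilin.symm ((InnerProductSpace.toDual ℝ _).symm ℓ)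
  have hp : ∀ q : h1Sub d, ha.bilin T p q = ℓ q := fun q => by
    rw [← hB.continuousLinearEquivOfBilin_apply]
    simp [p]
  obtain ⟨u, U, h, h1, h2⟩ := p.2
  refine ⟨u, U, h, fun φ Φ hφ => ?_⟩
  let q : h1Sub d := ⟨WithLp.toLp 2 (hφ.lu.toLp φ, hφ.lU.toLp Φ), φ, Φ, hφ, hφ.lu.coeFn_toLp,
    hφ.lU.coeFn_toLp⟩
  have := hp q
  rw [ha.bilin_apply] at this
  have e1 : ⟪(p : PairSpace d).fst, (q : PairSpace d).fst⟫_ℝ = ∫ x, u x * φ x := by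
    rw [L2.inner_def]
    refine integral_congr_ae ?_
    filter_upwards [h1, hφ.lu.coeFn_toLp] with x a1 a2
    change ⟪(p : PairSpace d).fst x, (hφ.lu.toLp φ) x⟫_ℝ = _
    rw [a1, a2]; simp [mul_comm]
  have e2 : ⟪ha.mulOp (p : PairSpace d).snd, (q : PairSpace d).snd⟫_ℝ =
      ∫ x, ⟪Φ x, a x (U x)⟫_ℝ := by
    rw [L2.inner_def]
    refine integral_congr_ae ?_
    filter_upwards [h2, hφ.lU.coeFn_toLp, ha.mulOp_coe (p : PairSpace d).snd] with x a1 a2 a3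
    change ⟪(ha.mulOp (p : PairSpace d).snd) x, (hφ.lU.toLp Φ) x⟫_ℝ = _
    rw [a3, a1, a2, real_inner_comm]
  have e3 : ℓ q = ∫ x, g x * φ x := by
    change ⟪hg.toLp g, hφ.lu.toLp φ⟫_ℝ = _
    rw [L2.inner_def]
    refine integral_congr_ae ?_
    filter_upwards [hg.coeFn_toLp, hφ.lu.coeFn_toLp] with x a1 a2
    rw [a1, a2]; simp [mul_comm]
  rw [e1, e2, e3] at this
  exact this

theorem exists_sol_nonneg {lam : ℝ} {a b : E d → E d →ₗ[ℝ] E d} (ha : Coef lam a b) {T : ℝ}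
    (hT : 0 < T) {g : E d → ℝ} (hg : MemLp g 2 volume) (hg0 : ∀ x, 0 ≤ g x) :
    ∃ u U, Sol a T g u U ∧ ∀ x, 0 ≤ u x := by
  obtain ⟨u, U, h⟩ := exists_sol ha hT hg
  refine ⟨fun x => max (u x) 0, U, h.congr_left (h.h1.mu.max measurable_const) ?_,
    fun x => le_max_right _ _⟩
  filter_upwards [h.nonneg ha hT hg0] with x hx
  rw [max_eq_left hx]

end LaxMilgram

/-- The Caccioppoli constant. -/
def c1 (lam : ℝ) : ℝ := 2 / lam * (2 / lam + 1)

theorem c1_nonneg {lam : ℝ} (h : 0 < lam) : 0 ≤ c1 lam := by unfold c1; positivity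

theorem Coef.lower_bound {lam : ℝ} {a b : E d → E d →ₗ[ℝ] E d} (ha : Coef lam a b) (x Z Y : E d) :
    lam / 2 * ‖Z‖ ^ 2 - (2 / lam + 1) * ‖Y‖ ^ 2 ≤ ⟪Z + Y, a x (Z - Y)⟫_ℝ := by
  have hl := ha.pos
  have e1 := ha.ell x Z
  have e2 : |⟪Z, a x Y⟫_ℝ| ≤ ‖Z‖ * ‖Y‖ := (abs_real_inner_le_norm _ _).trans
    (mul_le_mul_of_nonneg_left (ha.bound x Y) (norm_nonneg _))
  have e3 : |⟪Y, a x Z⟫_ℝ| ≤ ‖Y‖ * ‖Z‖ := (abs_real_inner_le_norm _ _).trans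
    (mul_le_mul_of_nonneg_left (ha.bound x Z) (norm_nonneg _))
  have e4 : |⟪Y, a x Y⟫_ℝ| ≤ ‖Y‖ * ‖Y‖ := (abs_real_inner_le_norm _ _).trans
    (mul_le_mul_of_nonneg_left (ha.bound x Y) (norm_nonneg _))
  rw [map_sub, inner_add_left, inner_sub_right, inner_sub_right]
  have e5 : 2 * (‖Z‖ * ‖Y‖) ≤ lam / 2 * ‖Z‖ ^ 2 + 2 / lam * ‖Y‖ ^ 2 := by
    have : lam / 2 * ‖Z‖ ^ 2 + 2 / lam * ‖Y‖ ^ 2 - 2 * (‖Z‖ * ‖Y‖)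
        = (lam * ‖Z‖ - 2 * ‖Y‖) ^ 2 / (2 * lam) := by field_simp; ring
    have : 0 ≤ (lam * ‖Z‖ - 2 * ‖Y‖) ^ 2 / (2 * lam) := by positivity
    linarith
  have := abs_le.1 e2
  have := abs_le.1 e3
  have := abs_le.1 e4
  nlinarith

/-- Solutions satisfy the De Giorgi inequality. -/
theorem Sol.dg {lam : ℝ} {a b : E d → E d →ₗ[ℝ] E d} (ha : Coef lam a b) {T F : ℝ}
    {g u : E d → ℝ} {U : E d → E d} (h : Sol a T g u U) {B : Set (E d)} (hg : ∀ x ∈ B, g x = 0)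
    (hF : 0 ≤ F) (hu : ∀ᵐ x, x ∈ B → - (T⁻¹ * u x) ≤ F) (k : ℝ) : DG (c1 lam) F k u U B := by
  intro k' _ η hη h0 h1 hB
  have hl := ha.pos
  obtain ⟨K, hK, hK'⟩ := hη.exists_bound
  have ht := h.h1.cutTrunc hη k'
  have ht2 := ht.mul_C1 hη.1 hK hK'
  set w : E d → ℝ := fun x => max (u x - k') 0 with hw
  set Z : E d → E d := fun x => η x • {x | k' < u x}.indicator U x + max (u x - k') 0 • ∇ η x with hZ
  have e := h.eq _ _ ht2
  have e0 : ∫ x, g x * (η x * (η x * max (u x - k') 0)) = 0 := by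
    rw [integral_eq_zero_of_ae]
    refine ae_of_all _ fun x => ?_
    by_cases hx : x ∈ B
    · simp [hg x hx]
    · simp [hB x hx]
  rw [e0] at e
  have i1 : Integrable (fun x => u x * (η x * (η x * max (u x - k') 0))) := h.h1.int_mul ht2
  have i2 := ha.integrable h.h1 ht2
  have hw2 : Integrable fun x => ‖∇ η x‖ ^ 2 * max (u x - k') 0 ^ 2 := by
    have hm : MemLp (fun x => Z x - η x • {x | k' < u x}.indicator U x) 2 volume := by
      refine ht.lU.sub ?_
      have hU : MemLp ({x | k' < u x}.indicator U) 2 volume := (h.h1.trunc k').lU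
      refine (hU.norm.const_mul K).mono ((hη.1.continuous.aestronglyMeasurable).smul hU.1)
        (ae_of_all _ fun x => ?_)
      rw [norm_smul, norm_mul, norm_norm]
      exact mul_le_mul_of_nonneg_right ((hK x).trans (le_abs_self K)) (norm_nonneg _)
    refine (hm.norm.integrable_sq).congr (ae_of_all _ fun x => ?_)
    simp only [hZ, add_sub_cancel_left, norm_smul, mul_pow, Real.norm_eq_abs, sq_abs]
    ring
  have iw : Integrable (fun x => η x ^ 2 * max (u x - k') 0) := by
    have := (hη.memLp 2).integrable_mul ht.lu
    refine this.congr (ae_of_all _ fun x => ?_)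
    simp only [Pi.mul_apply]; ring
  have iZ : Integrable (fun x => ‖Z x‖ ^ 2) := ht.lU.norm.integrable_sq
  have key : ∀ᵐ x, lam / 2 * ‖Z x‖ ^ 2 - (2 / lam + 1) * (‖∇ η x‖ ^ 2 * max (u x - k') 0 ^ 2) -
      F * (η x ^ 2 * max (u x - k') 0) ≤
      T⁻¹ * (u x * (η x * (η x * max (u x - k') 0))) +
      ⟪η x • Z x + (η x * max (u x - k') 0) • ∇ η x, a x (U x)⟫_ℝ := by
    filter_upwards [hu] with x hux
    have a1 : -(F * (η x ^ 2 * max (u x - k') 0)) ≤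
        T⁻¹ * (u x * (η x * (η x * max (u x - k') 0))) := by
      by_cases hx : x ∈ B
      · have := hux hx
        have h3 : 0 ≤ η x ^ 2 * max (u x - k') 0 := by positivity
        nlinarith
      · simp [hB x hx]
    have a2 : ⟪η x • Z x + (η x * max (u x - k') 0) • ∇ η x, a x (U x)⟫_ℝ =
        ⟪Z x + max (u x - k') 0 • ∇ η x, a x (Z x - max (u x - k') 0 • ∇ η x)⟫_ℝ := by
      simp only [hZ, add_sub_cancel_right]
      by_cases hx : x ∈ {x | k' < u x}
      · rw [Set.indicator_of_mem hx, map_smul, inner_smul_right, ← real_inner_smul_left]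
        congr 1
        module
      · rw [Set.indicator_of_notMem hx]
        have hx' : max (u x - k') 0 = 0 := max_eq_right (by simpa using hx)
        simp [hx']
    have a3 := ha.lower_bound x (Z x) (max (u x - k') 0 • ∇ η x)
    rw [norm_smul, mul_pow, Real.norm_eq_abs, sq_abs] at a3
    rw [a2]; linarith
  have e1 := integral_mono_ae (((iZ.const_mul _).sub (hw2.const_mul _)).sub (iw.const_mul _))
    ((i1.const_mul _).add i2) key
  have e2 : ∫ x, (T⁻¹ * (u x * (η x * (η x * max (u x - k') 0))) +
      ⟪η x • Z x + (η x * max (u x - k') 0) • ∇ η x, a x (U x)⟫_ℝ) = 0 := by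
    rw [integral_add (i1.const_mul _) i2, integral_const_mul]; exact e
  have e3 : ∫ x, (lam / 2 * ‖Z x‖ ^ 2 - (2 / lam + 1) * (‖∇ η x‖ ^ 2 * max (u x - k') 0 ^ 2) -
      F * (η x ^ 2 * max (u x - k') 0)) = lam / 2 * (∫ x, ‖Z x‖ ^ 2) -
      (2 / lam + 1) * (∫ x, ‖∇ η x‖ ^ 2 * max (u x - k') 0 ^ 2) -
      F * ∫ x, η x ^ 2 * max (u x - k') 0 := by
    have j1 : Integrable fun x => lam / 2 * ‖Z x‖ ^ 2 := iZ.const_mul _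
    have j2 : Integrable fun x => (2 / lam + 1) * (‖∇ η x‖ ^ 2 * max (u x - k') 0 ^ 2) :=
      hw2.const_mul _
    have j3 : Integrable fun x => lam / 2 * ‖Z x‖ ^ 2 -
        (2 / lam + 1) * (‖∇ η x‖ ^ 2 * max (u x - k') 0 ^ 2) := j1.sub j2
    rw [integral_sub j3 (iw.const_mul _), integral_sub j1 j2, integral_const_mul,
      integral_const_mul, integral_const_mul]
  have e4 : lam / 2 * (∫ x, ‖Z x‖ ^ 2) -
      (2 / lam + 1) * (∫ x, ‖∇ η x‖ ^ 2 * max (u x - k') 0 ^ 2) -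
      F * (∫ x, η x ^ 2 * max (u x - k') 0) ≤ 0 := by
    rw [← e3]; exact e1.trans_eq e2
  have p1 : 0 ≤ F * (∫ x, η x ^ 2 * max (u x - k') 0) :=
    mul_nonneg hF (integral_nonneg fun x => by positivity)
  have p2 : 0 ≤ ∫ x, ‖∇ η x‖ ^ 2 * max (u x - k') 0 ^ 2 :=
    integral_nonneg fun x => by positivity
  have p3 : 0 < 2 / lam := by positivity
  calc ∫ x, ‖Z x‖ ^ 2 = 2 / lam * (lam / 2 * ∫ x, ‖Z x‖ ^ 2) := by field_simp
    _ ≤ 2 / lam * ((2 / lam + 1) * (F * (∫ x, η x ^ 2 * max (u x - k') 0) +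
        ∫ x, ‖∇ η x‖ ^ 2 * max (u x - k') 0 ^ 2)) := by
        refine mul_le_mul_of_nonneg_left ?_ p3.le
        nlinarith
    _ = _ := by unfold c1; ring

/-- Weighted energy estimate away from the support of the right-hand side. -/
theorem Sol.energy {lam : ℝ} {a b : E d → E d →ₗ[ℝ] E d} (ha : Coef lam a b) {T : ℝ}
    {g u η : E d → ℝ} {U : E d → E d} (h : Sol a T g u U) (hη : ContDiff ℝ 1 η) {K : ℝ}
    (hK : ∀ x, |η x| ≤ K) (hK' : ∀ x, ‖∇ η x‖ ≤ K) (hg : ∀ x, g x * η x = 0) :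
    T⁻¹ * (∫ x, η x ^ 2 * u x ^ 2) + lam / 2 * (∫ x, η x ^ 2 * ‖U x‖ ^ 2) ≤
      2 / lam * ∫ x, ‖∇ η x‖ ^ 2 * u x ^ 2 := by
  have hl := ha.pos
  have h1 := h.h1.mul_C1 hη hK hK'
  have h2 := h1.mul_C1 hη hK hK'
  have e := h.eq _ _ h2
  have e0 : ∫ x, g x * (η x * (η x * u x)) = 0 := by
    rw [integral_eq_zero_of_ae]
    refine ae_of_all _ fun x => ?_
    simp only [← mul_assoc, hg]; simp
  have i1 : Integrable (fun x => u x * (η x * (η x * u x))) := h.h1.int_mul h2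
  have i2 := ha.integrable h.h1 h2
  have b2 : MemLp (fun x => η x • U x) 2 volume := by
    refine (h.h1.lU.norm.const_mul K).mono (hη.continuous.aestronglyMeasurable.smul h.h1.lU.1)
      (ae_of_all _ fun x => ?_)
    rw [norm_smul, norm_mul, norm_norm]
    exact mul_le_mul_of_nonneg_right ((hK x).trans (le_abs_self K)) (norm_nonneg _)
  have j2 : Integrable fun x => η x ^ 2 * ‖U x‖ ^ 2 :=
    b2.norm.integrable_sq.congr (ae_of_all _ fun x => by
      simp [norm_smul, mul_pow])
  have j1 : Integrable fun x => η x ^ 2 * u x ^ 2 :=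
    h1.lu.integrable_sq.congr (ae_of_all _ fun x => by simp [mul_pow])
  have j3 : Integrable fun x => ‖∇ η x‖ ^ 2 * u x ^ 2 := by
    have : MemLp (fun x => (η x • U x + u x • ∇ η x) - η x • U x) 2 volume := h1.lU.sub b2
    refine this.norm.integrable_sq.congr (ae_of_all _ fun x => ?_)
    simp only [add_sub_cancel_left, norm_smul, mul_pow, Real.norm_eq_abs, sq_abs]
    ring
  have key : ∀ x, T⁻¹ * (η x ^ 2 * u x ^ 2) + lam / 2 * (η x ^ 2 * ‖U x‖ ^ 2) -
      2 / lam * (‖∇ η x‖ ^ 2 * u x ^ 2) ≤ T⁻¹ * (u x * (η x * (η x * u x))) +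
      ⟪η x • (η x • U x + u x • ∇ η x) + (η x * u x) • ∇ η x, a x (U x)⟫_ℝ := by
    intro x
    have a1 := ha.ell x (U x)
    have a2 : |⟪∇ η x, a x (U x)⟫_ℝ| ≤ ‖∇ η x‖ * ‖U x‖ := (abs_real_inner_le_norm _ _).trans
      (mul_le_mul_of_nonneg_left (ha.bound x _) (norm_nonneg _))
    have a3 : ⟪η x • (η x • U x + u x • ∇ η x) + (η x * u x) • ∇ η x, a x (U x)⟫_ℝ =
        η x ^ 2 * ⟪U x, a x (U x)⟫_ℝ + 2 * ((η x * u x) * ⟪∇ η x, a x (U x)⟫_ℝ) := by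
      simp only [inner_add_left, real_inner_smul_left]; ring
    have a4 : |(η x * u x) * ⟪∇ η x, a x (U x)⟫_ℝ| ≤ |η x * u x| * (‖∇ η x‖ * ‖U x‖) := by
      rw [abs_mul]; exact mul_le_mul_of_nonneg_left a2 (abs_nonneg _)
    have a5 : 2 * (|η x * u x| * (‖∇ η x‖ * ‖U x‖)) ≤ lam / 2 * (η x ^ 2 * ‖U x‖ ^ 2) +
        2 / lam * (‖∇ η x‖ ^ 2 * u x ^ 2) := by
      rw [abs_mul]
      have : lam / 2 * (η x ^ 2 * ‖U x‖ ^ 2) + 2 / lam * (‖∇ η x‖ ^ 2 * u x ^ 2) -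
          2 * (|η x| * |u x| * (‖∇ η x‖ * ‖U x‖)) =
          (lam * (|η x| * ‖U x‖) - 2 * (‖∇ η x‖ * |u x|)) ^ 2 / (2 * lam) := by
        rw [← sq_abs (η x), ← sq_abs (u x)]
        field_simp; ring
      have : 0 ≤ (lam * (|η x| * ‖U x‖) - 2 * (‖∇ η x‖ * |u x|)) ^ 2 / (2 * lam) := by positivity
      linarith
    rw [a3]
    have a6 := neg_abs_le ((η x * u x) * ⟪∇ η x, a x (U x)⟫_ℝ)
    have a7 := mul_le_mul_of_nonneg_left a1 (sq_nonneg (η x))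
    have a8 : T⁻¹ * (u x * (η x * (η x * u x))) = T⁻¹ * (η x ^ 2 * u x ^ 2) := by ring
    rw [a8]
    linarith
  have k1 : Integrable fun x => T⁻¹ * (η x ^ 2 * u x ^ 2) := j1.const_mul _
  have k2 : Integrable fun x => lam / 2 * (η x ^ 2 * ‖U x‖ ^ 2) := j2.const_mul _
  have k3 : Integrable fun x => 2 / lam * (‖∇ η x‖ ^ 2 * u x ^ 2) := j3.const_mul _
  have e1 := integral_mono ((k1.add k2).sub k3) ((i1.const_mul _).add i2) key
  have e2 : ∫ x, (T⁻¹ * (u x * (η x * (η x * u x))) +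
      ⟪η x • (η x • U x + u x • ∇ η x) + (η x * u x) • ∇ η x, a x (U x)⟫_ℝ) = 0 := by
    rw [integral_add (i1.const_mul _) i2, integral_const_mul]; exact e.trans e0
  have e3 : ∫ x, (T⁻¹ * (η x ^ 2 * u x ^ 2) + lam / 2 * (η x ^ 2 * ‖U x‖ ^ 2) -
      2 / lam * (‖∇ η x‖ ^ 2 * u x ^ 2)) = T⁻¹ * (∫ x, η x ^ 2 * u x ^ 2) +
      lam / 2 * (∫ x, η x ^ 2 * ‖U x‖ ^ 2) - 2 / lam * ∫ x, ‖∇ η x‖ ^ 2 * u x ^ 2 := by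
    have k4 : Integrable fun x => T⁻¹ * (η x ^ 2 * u x ^ 2) + lam / 2 * (η x ^ 2 * ‖U x‖ ^ 2) :=
      k1.add k2
    rw [integral_sub k4 k3, integral_add k1 k2, integral_const_mul, integral_const_mul,
      integral_const_mul]
  have e4 := e1.trans_eq e2
  change ∫ x, (T⁻¹ * (η x ^ 2 * u x ^ 2) + lam / 2 * (η x ^ 2 * ‖U x‖ ^ 2) -
      2 / lam * (‖∇ η x‖ ^ 2 * u x ^ 2)) ≤ 0 at e4
  rw [e3] at e4
  linarith

theorem H1.band {u : E d → ℝ} {U : E d → E d} (hu : H1 u U) {k h : ℝ} (hk : 0 ≤ k) (hh : 0 ≤ h) :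
    H1 (fun x => min (max (u x - k) 0) h) ({x | k < u x ∧ u x ≤ k + h}.indicator U) := by
  have := (hu.trunc k).sub (hu.trunc (k + h))
  convert this using 1
  · ext x
    rw [max_eq_right (by linarith : -k ≤ 0), max_eq_right (by linarith : -(k + h) ≤ 0)]
    grind
  · ext1 x
    simp only [Set.indicator_apply, Set.mem_ofPred_eq]
    by_cases h1 : k < u x <;> by_cases h2 : k + h < u x <;> simp [h1, h2, not_le.2, not_lt.1]
    linarith

/-- Energy of a solution in a band between two levels, and its total mass. -/
theorem Sol.band {lam : ℝ} {a b : E d → E d →ₗ[ℝ] E d} (ha : Coef lam a b) {T : ℝ}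
    {g u : E d → ℝ} {U : E d → E d} (h : Sol a T g u U) (hg0 : ∀ x, 0 ≤ g x) (hg : Integrable g)
    (hg1 : ∫ x, g x = 1) {k l : ℝ} (hk : 0 ≤ k) (hl : 0 ≤ l) :
    T⁻¹ * (∫ x, u x * min (max (u x - k) 0) l) +
      lam * (∫ x in {x | k < u x ∧ u x ≤ k + l}, ‖U x‖ ^ 2) ≤ l := by
  have hb := h.h1.band hk hl
  have e := h.eq _ _ hb
  have mS : MeasurableSet {x | k < u x ∧ u x ≤ k + l} :=
    (measurableSet_lt measurable_const h.h1.mu).inter (measurableSet_le h.h1.mu measurable_const)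
  have e1 : ∫ x, g x * min (max (u x - k) 0) l ≤ l := by
    have : ∫ x, g x * min (max (u x - k) 0) l ≤ ∫ x, g x * l := by
      refine integral_mono_of_nonneg (ae_of_all _ fun x => ?_) (hg.mul_const l)
        (ae_of_all _ fun x => ?_)
      · exact mul_nonneg (hg0 x) (le_min (le_max_right _ _) hl)
      · exact mul_le_mul_of_nonneg_left (min_le_right _ _) (hg0 x)
    rwa [integral_mul_const, hg1, one_mul] at this
  have e2 : lam * (∫ x in {x | k < u x ∧ u x ≤ k + l}, ‖U x‖ ^ 2) ≤
      ∫ x, ⟪{x | k < u x ∧ u x ≤ k + l}.indicator U x, a x (U x)⟫_ℝ := by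
    rw [← integral_const_mul, ← integral_indicator mS]
    refine integral_mono ((h.h1.lU.norm.integrable_sq.const_mul _).indicator mS)
      (ha.integrable h.h1 hb) fun x => ?_
    by_cases hx : x ∈ {x | k < u x ∧ u x ≤ k + l}
    · simp only [Set.indicator_of_mem hx]; exact ha.ell x _
    · simp only [Set.indicator_of_notMem hx]; simp
  linarith

theorem Sol.grad_zero {lam : ℝ} {a b : E d → E d →ₗ[ℝ] E d} (ha : Coef lam a b) {T : ℝ}
    {g u : E d → ℝ} {U : E d → E d} (h : Sol a T g u U) (hu : ∀ x, 0 ≤ u x) :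
    ∀ᵐ x, u x = 0 → U x = 0 := by
  have hl := ha.pos
  have ht : H1 u ({x | 0 < u x}.indicator U) := by
    have := h.h1.trunc 0
    simpa [hu] using this
  have e1 := h.eq _ _ ht
  have e2 := h.eq _ _ h.h1
  have i1 := ha.integrable h.h1 ht
  have i2 := ha.integrable h.h1 h.h1
  have e3 : ∫ x, (⟪U x, a x (U x)⟫_ℝ - ⟪{x | 0 < u x}.indicator U x, a x (U x)⟫_ℝ) = 0 := by
    rw [integral_sub i2 i1]; linarith
  have nn : ∀ x, 0 ≤ ⟪U x, a x (U x)⟫_ℝ := fun x => by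
    have := ha.ell x (U x); nlinarith [sq_nonneg ‖U x‖]
  have e4 := (integral_eq_zero_iff_of_nonneg (fun x => ?_) (i2.sub i1)).1 e3
  · filter_upwards [e4] with x hx h0
    have hx' : x ∉ {x | 0 < u x} := by simp [h0]
    have h4 := ha.ell x (U x)
    simp only [Pi.sub_apply, Set.indicator_of_notMem hx', inner_zero_left, sub_zero,
      Pi.zero_apply] at hx
    rw [hx] at h4
    have : ‖U x‖ ^ 2 ≤ 0 := by nlinarith
    have : ‖U x‖ = 0 := by nlinarith [norm_nonneg (U x)]
    exact norm_eq_zero.1 this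
  · by_cases hx : x ∈ {x | 0 < u x}
    · simp [Set.indicator_of_mem hx]
    · simp [Set.indicator_of_notMem hx, nn x]

theorem Sol.band_zero {lam : ℝ} {a b : E d → E d →ₗ[ℝ] E d} (ha : Coef lam a b) {T : ℝ}
    (hT : 0 < T) {g u : E d → ℝ} {U : E d → E d} (h : Sol a T g u U) (hu : ∀ x, 0 ≤ u x)
    (hg0 : ∀ x, 0 ≤ g x) (hg : Integrable g) (hg1 : ∫ x, g x = 1) {l : ℝ} (hl : 0 ≤ l) :
    lam * (∫ x in {x | u x ≤ l}, ‖U x‖ ^ 2) ≤ l := by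
  have e := h.band ha hg0 hg hg1 le_rfl hl
  have p : 0 ≤ T⁻¹ * (∫ x, u x * min (max (u x - 0) 0) l) :=
    mul_nonneg (by positivity) (integral_nonneg fun x => mul_nonneg (hu x)
      (le_min (le_max_right _ _) hl))
  have : ∫ x in {x | u x ≤ l}, ‖U x‖ ^ 2 = ∫ x in {x | 0 < u x ∧ u x ≤ 0 + l}, ‖U x‖ ^ 2 := by
    have mS : MeasurableSet {x | 0 < u x ∧ u x ≤ 0 + l} :=
      (measurableSet_lt measurable_const h.h1.mu).inter (measurableSet_le h.h1.mu measurable_const)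
    rw [← integral_indicator (measurableSet_le h.h1.mu measurable_const), ← integral_indicator mS]
    refine integral_congr_ae ?_
    filter_upwards [h.grad_zero ha hu] with x hx
    simp only [Set.indicator_apply, Set.mem_ofPred_eq, zero_add]
    rcases (hu x).eq_or_lt with h0 | h0
    · simp [hx h0.symm]
    · simp [h0]
  rw [this]; linarith

theorem Sol.mass {lam : ℝ} {a b : E d → E d →ₗ[ℝ] E d} (ha : Coef lam a b) {T : ℝ}
    (hT : 0 < T) {g u : E d → ℝ} {U : E d → E d} (h : Sol a T g u U) (hu : ∀ x, 0 ≤ u x)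
    (hg0 : ∀ x, 0 ≤ g x) (hg : Integrable g) (hg1 : ∫ x, g x = 1) :
    ∫⁻ x, ENNReal.ofReal (u x) ≤ ENNReal.ofReal T := by
  have hl := ha.pos
  have e : ∀ n : ℕ, ∫⁻ x, ENNReal.ofReal (u x * min (u x * (n + 1)) 1) ≤ ENNReal.ofReal T := by
    intro n
    have hn : (0:ℝ) < n + 1 := by positivity
    have e1 := h.band ha hg0 hg hg1 le_rfl (l := 1 / ((n:ℝ) + 1)) (by positivity)
    have e2 : 0 ≤ lam * (∫ x in {x | 0 < u x ∧ u x ≤ 0 + 1 / ((n:ℝ) + 1)}, ‖U x‖ ^ 2) :=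
      mul_nonneg hl.le (integral_nonneg fun x => by positivity)
    have i0 : Integrable (fun x => u x * min (max (u x - 0) 0) (1 / ((n:ℝ) + 1))) :=
      h.h1.int_mul (h.h1.band le_rfl (by positivity))
    have e3 : ∀ x, u x * min (u x * (n + 1)) 1 =
        (n + 1) * (u x * min (max (u x - 0) 0) (1 / ((n:ℝ) + 1))) := by
      intro x
      rw [sub_zero, max_eq_left (hu x), mul_left_comm, mul_min_of_nonneg _ _ hn.le]
      field_simp
    simp only [e3]
    rw [← ofReal_integral_eq_lintegral_ofReal (i0.const_mul _) (ae_of_all _ fun x => by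
      have := hu x
      positivity)]
    refine ENNReal.ofReal_le_ofReal ?_
    rw [integral_const_mul]
    have e4 : T⁻¹ * (∫ x, u x * min (max (u x - 0) 0) (1 / ((n:ℝ) + 1))) ≤ 1 / (n + 1) := by
      linarith
    rw [inv_mul_le_iff₀ hT, mul_one_div, le_div_iff₀ hn] at e4
    linarith
  refine le_of_tendsto' (x := atTop) (lintegral_tendsto_of_tendsto_of_monotone (fun n => ?_)
    (ae_of_all _ fun x => ?_) (ae_of_all _ fun x => ?_)) e
  · exact (h.h1.mu.mul ((h.h1.mu.mul_const _).min measurable_const)).ennreal_ofReal.aemeasurable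
  · intro n m hnm
    refine ENNReal.ofReal_le_ofReal ?_
    have := hu x
    have : (n:ℝ) ≤ m := by exact_mod_cast hnm
    gcongr
  · refine tendsto_const_nhds.congr' ?_
    rcases (hu x).eq_or_lt with h0 | h0
    · simp [← h0]
    · obtain ⟨N, hN⟩ := exists_nat_gt (u x)⁻¹
      filter_upwards [eventually_ge_atTop N] with n hn
      have : (N:ℝ) ≤ n := by exact_mod_cast hn
      rw [min_eq_right, mul_one]
      rw [← inv_mul_le_iff₀ h0]; linarith

/-- The linear map field of a matrix field. -/
def coefMap {lam : ℝ} (W : CoeffField d lam) (x : E d) : E d →ₗ[ℝ] E d :=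
  Matrix.toEuclideanLin (W.A x)

/-- The linear map field of the transposed matrix field. -/
def coefMap' {lam : ℝ} (W : CoeffField d lam) (x : E d) : E d →ₗ[ℝ] E d :=
  Matrix.toEuclideanLin (W.A x)ᵀ

theorem inner_eq_dot (v w : E d) : ⟪v, w⟫_ℝ = v.ofLp ⬝ᵥ w.ofLp := by
  rw [EuclideanSpace.inner_eq_star_dotProduct, dotProduct_comm]; simp

theorem norm_sq_eq_dot (v : E d) : ‖v‖ ^ 2 = v.ofLp ⬝ᵥ v.ofLp := by
  rw [← real_inner_self_eq_norm_sq, inner_eq_dot]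

theorem CoeffField.coef {lam : ℝ} (hl : 0 < lam) (W : CoeffField d lam) :
    Coef lam (coefMap W) (coefMap' W) := by
  have me : ∀ i j, Measurable fun x => W.A x i j := fun i j =>
    (measurable_pi_apply j).comp ((measurable_pi_apply i).comp W.measurable)
  have hb : ∀ x v, ‖coefMap W x v‖ ≤ ‖v‖ := fun x v => by
    rw [← abs_of_nonneg (norm_nonneg v), ← abs_of_nonneg (norm_nonneg (coefMap W x v)),
      ← sq_le_sq, norm_sq_eq_dot, norm_sq_eq_dot]
    exact (W.elliptic x).1 _
  have hadj : ∀ x v w, ⟪v, coefMap W x w⟫_ℝ = ⟪w, coefMap' W x v⟫_ℝ := fun x v w => by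
    rw [inner_eq_dot, inner_eq_dot]
    change v.ofLp ⬝ᵥ (W.A x) *ᵥ w.ofLp = w.ofLp ⬝ᵥ (W.A x)ᵀ *ᵥ v.ofLp
    rw [Matrix.dotProduct_mulVec, Matrix.mulVec_transpose, dotProduct_comm]
  have hm : ∀ (B : E d → Matrix (Fin d) (Fin d) ℝ), (∀ i j, Measurable fun x => B x i j) →
      ∀ U : E d → E d, Measurable U → Measurable fun x => Matrix.toEuclideanLin (B x) (U x) := by
    intro B hB U hU
    refine (WithLp.measurable_toLp 2 (Fin d → ℝ)).comp (measurable_pi_lambda _ fun i => ?_)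
    change Measurable fun x => ∑ j, B x i j * (U x).ofLp j
    exact Finset.measurable_sum _ fun j _ => (hB i j).mul
      ((measurable_pi_apply j).comp ((WithLp.measurable_ofLp 2 (Fin d → ℝ)).comp hU))
  refine ⟨hl, hm _ me, hm _ fun i j => me j i, hb, fun x v => ?_, fun x v => ?_, hadj⟩
  · have h1 : ‖coefMap' W x v‖ * ‖coefMap' W x v‖ ≤ ‖v‖ * ‖coefMap' W x v‖ := by
      rw [← sq, ← real_inner_self_eq_norm_sq, ← hadj]
      exact (real_inner_le_norm _ _).trans (mul_le_mul_of_nonneg_left (hb _ _) (norm_nonneg _))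
    rcases (norm_nonneg (coefMap' W x v)).eq_or_lt with h0 | h0
    · rw [← h0]; exact norm_nonneg _
    · exact le_of_mul_le_mul_right h1 h0
  · rw [norm_sq_eq_dot, inner_eq_dot]; exact (W.elliptic x).2 _

/-- Nonnegative solutions whose right-hand side is a probability density. -/
structure PSol (a : E d → E d →ₗ[ℝ] E d) (T : ℝ) (g u : E d → ℝ) (U : E d → E d) : Prop
    extends Sol a T g u U where
  nonneg : ∀ x, 0 ≤ u x
  g_nonneg : ∀ x, 0 ≤ g x
  g_int : Integrable g
  g_mass : ∫ x, g x = 1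

/-- The scaling `m ^ (2 - d)` of the Green function. -/
def pw (d : ℕ) (m : ℝ) : ℝ := m ^ 2 / m ^ d

theorem pw_pos {m : ℝ} (hm : 0 < m) : 0 < pw d m := by unfold pw; positivity

theorem pw_anti (hd : 2 ≤ d) {m m' : ℝ} (hm : 0 < m) (h : m ≤ m') : pw d m' ≤ pw d m := by
  obtain ⟨e, rfl⟩ := Nat.exists_eq_add_of_le hd
  have hm' : 0 < m' := hm.trans_le h
  have : ∀ t : ℝ, 0 < t → pw (2 + e) t = 1 / t ^ e := fun t ht => by
    unfold pw; rw [pow_add]; field_simp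
  rw [this _ hm, this _ hm']
  gcongr

theorem pw_mul {m t : ℝ} : pw d (m * t) = pw d m * pw d t := by
  unfold pw; rw [mul_pow, mul_pow, mul_div_mul_comm]

theorem pw_half_pow (n : ℕ) : pw d ((1 / 2) ^ n) ≤ 2 ^ (n * d) := by
  unfold pw
  rw [div_le_iff₀ (by positivity), ← pow_mul, ← pow_mul, ← mul_pow]
  norm_num
  exact pow_le_one₀ (by norm_num) (by norm_num)

/-- The sequence of levels along which the superlevel sets of solutions shrink geometrically. -/
def lev (d : ℕ) (C s : ℝ) (i : ℕ) : ℝ := pw d s + C * ∑ l ∈ Finset.range i, pw d (s * (1 / 2) ^ l)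

theorem lev_pos {C s : ℝ} (hC : 0 < C) (hs : 0 < s) (i : ℕ) : 0 < lev d C s i := by
  have : 0 ≤ ∑ l ∈ Finset.range i, pw d (s * (1 / 2) ^ l) :=
    Finset.sum_nonneg fun l _ => (pw_pos (by positivity)).le
  have := pw_pos (d := d) hs
  unfold lev; positivity

theorem lev_succ (C s : ℝ) (i : ℕ) :
    lev d C s (i + 1) = lev d C s i + C * pw d (s * (1 / 2) ^ i) := by
  unfold lev; rw [Finset.sum_range_succ]; ring

theorem lev_add {C s : ℝ} (hC : 0 < C) (hs : 0 < s) (i n : ℕ) (hd : 2 ≤ d) :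
    lev d C s (i + n) ≤ lev d C s i + C * pw d (s * (1 / 2) ^ i) * 4 ^ (n * d) := by
  have hp := pw_pos (d := d) (m := s * (1 / 2) ^ i) (by positivity)
  have h1 : lev d C s (i + n) = lev d C s i +
      C * ∑ l ∈ Finset.range n, pw d (s * (1 / 2) ^ (i + l)) := by
    unfold lev; rw [Finset.sum_range_add]; ring
  have h2 : ∑ l ∈ Finset.range n, pw d (s * (1 / 2) ^ (i + l)) ≤
      ∑ _l ∈ Finset.range n, pw d (s * (1 / 2) ^ i) * 2 ^ (n * d) := by
    refine Finset.sum_le_sum fun l hl => ?_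
    rw [pow_add, ← mul_assoc, pw_mul]
    gcongr
    refine (pw_half_pow l).trans (pow_le_pow_right₀ (by norm_num) ?_)
    exact Nat.mul_le_mul_right d (Finset.mem_range.1 hl).le
  rw [Finset.sum_const, Finset.card_range, nsmul_eq_mul] at h2
  have h3 : (n : ℝ) ≤ 2 ^ (n * d) := by
    have : (n:ℝ) ≤ 2 ^ n := by exact_mod_cast Nat.lt_two_pow_self.le
    refine this.trans (pow_le_pow_right₀ (by norm_num) ?_)
    nlinarith
  have h4 : (4:ℝ) ^ (n * d) = 2 ^ (n * d) * 2 ^ (n * d) := by rw [← mul_pow]; norm_num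
  rw [h1, h4]
  have h5 : C * ∑ l ∈ Finset.range n, pw d (s * (1 / 2) ^ (i + l)) ≤
      C * (2 ^ (n * d) * (pw d (s * (1 / 2) ^ i) * 2 ^ (n * d))) := by
    refine mul_le_mul_of_nonneg_left (h2.trans ?_) hC.le
    gcongr
  nlinarith

theorem lev_le {C s : ℝ} (hC : 0 < C) (hs : 0 < s) (i : ℕ) (hd : 2 ≤ d) :
    lev d C s i ≤ (1 + C * i) * pw d (s * (1 / 2) ^ i) := by
  have h1 : ∀ l, l ≤ i → pw d (s * (1 / 2) ^ l) ≤ pw d (s * (1 / 2) ^ i) := fun l hl =>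
    pw_anti hd (by positivity) (mul_le_mul_of_nonneg_left
      (pow_le_pow_of_le_one (by norm_num) (by norm_num) hl) hs.le)
  have h2 : ∑ l ∈ Finset.range i, pw d (s * (1 / 2) ^ l) ≤ i * pw d (s * (1 / 2) ^ i) := by
    refine (Finset.sum_le_sum fun l hl => h1 l (Finset.mem_range.1 hl).le).trans ?_
    simp
  have h3 := h1 0 (Nat.zero_le _)
  rw [pow_zero, mul_one] at h3
  unfold lev
  have := mul_le_mul_of_nonneg_left h2 hC.le
  linarith

theorem lev_le_of_three {C s : ℝ} (hC : 0 < C) (hs : 0 < s) (i : ℕ) (hd : 3 ≤ d) :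
    lev d C s i ≤ (1 + C) * pw d (s * (1 / 2) ^ i) := by
  have h0 : ∀ l, 2 * pw d (s * (1 / 2) ^ l) ≤ pw d (s * (1 / 2) ^ (l + 1)) := fun l => by
    rw [pow_succ, ← mul_assoc, pw_mul (m := s * (1 / 2) ^ l) (t := 1 / 2), mul_comm]
    have hp := pw_pos (d := d) (m := s * (1 / 2) ^ l) (by positivity)
    refine mul_le_mul_of_nonneg_left ?_ hp.le
    unfold pw
    rw [le_div_iff₀ (by positivity)]
    obtain ⟨e, rfl⟩ := Nat.exists_eq_add_of_le hd
    rw [pow_add]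
    have : ((1:ℝ) / 2) ^ e ≤ 1 := pow_le_one₀ (by norm_num) (by norm_num)
    linarith
  have hmono : pw d s ≤ pw d (s * (1 / 2) ^ i) := pw_anti (by omega) (by positivity)
    (mul_le_of_le_one_right hs.le (pow_le_one₀ (by norm_num) (by norm_num)))
  have h1 : ∑ l ∈ Finset.range i, pw d (s * (1 / 2) ^ l) ≤ pw d (s * (1 / 2) ^ i) := by
    clear hmono
    induction i with
    | zero => simpa using (pw_pos (d := d) hs).le
    | succ i ih => rw [Finset.sum_range_succ]; linarith [h0 i]
  unfold lev
  nlinarith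

/-- `C` controls the decay of superlevel sets of solutions. -/
def LevelC (d : ℕ) (lam C : ℝ) : Prop :=
  0 < C ∧ ∀ (a b : E d → E d →ₗ[ℝ] E d) (T : ℝ) (g u : E d → ℝ) (U : E d → E d), Coef lam a b →
    0 < T → PSol a T g u U → ∀ i : ℕ,
      volume {x | lev d C (√T) i < u x} ≤ ENNReal.ofReal ((√T * (1 / 2) ^ i) ^ d)

theorem exists_levelC (hd : 2 ≤ d) {lam : ℝ} (hl : 0 < lam) : ∃ C, LevelC d lam C := by
  obtain ⟨C0, hC0, hFK⟩ := faberKrahn hd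
  refine ⟨2 ^ d * C0 / lam, by positivity, fun a b T g u U ha hT h i => ?_⟩
  set C := 2 ^ d * C0 / lam with hC
  have hCp : 0 < C := by positivity
  have hs : 0 < √T := Real.sqrt_pos.2 hT
  induction i with
  | zero =>
    have hp := pw_pos (d := d) hs
    have e0 : lev d C (√T) 0 = pw d (√T) := by simp [lev]
    rw [e0, pow_zero, mul_one]
    have e1 := mul_meas_ge_le_lintegral₀ (μ := (volume : Measure (E d)))
      h.h1.mu.ennreal_ofReal.aemeasurable (ENNReal.ofReal (pw d (√T)))
    have e2 : volume {x | pw d (√T) < u x} ≤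
        volume {x | ENNReal.ofReal (pw d (√T)) ≤ ENNReal.ofReal (u x)} := measure_mono fun x hx =>
      ENNReal.ofReal_le_ofReal (le_of_lt hx)
    have e3 := (mul_le_mul_right e2 (ENNReal.ofReal (pw d (√T)))).trans (e1.trans
      (h.mass ha hT h.nonneg h.g_nonneg h.g_int h.g_mass))
    have e4 : ENNReal.ofReal T = ENNReal.ofReal (pw d (√T)) * ENNReal.ofReal (√T ^ d) := by
      rw [← ENNReal.ofReal_mul hp.le]
      congr 1
      unfold pw
      rw [Real.sq_sqrt hT.le]; field_simp
    rw [e4] at e3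
    exact (ENNReal.mul_le_mul_iff_right (by simpa using hp) ENNReal.ofReal_ne_top).1 e3
  | succ i ih =>
    set m := √T * (1 / 2) ^ i with hm
    have hm0 : 0 < m := by positivity
    have hp := pw_pos (d := d) hm0
    set k := lev d C (√T) i with hk
    have hk0 : 0 < k := lev_pos hCp hs i
    rw [lev_succ, ← hm, ← hk]
    set l := C * pw d m with hl'
    have hl0 : 0 < l := by positivity
    have hb := h.h1.band hk0.le hl0.le
    have f1 := hFK _ _ m hb hm0.le ((measure_mono fun x hx => ?_).trans ih)
    · have f2 := h.band ha h.g_nonneg h.g_int h.g_mass hk0.le hl0.le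
      have mS : MeasurableSet {x | k < u x ∧ u x ≤ k + l} :=
        (measurableSet_lt measurable_const h.h1.mu).inter
          (measurableSet_le h.h1.mu measurable_const)
      have f3 : ∫ x, ‖{x | k < u x ∧ u x ≤ k + l}.indicator U x‖ ^ 2 =
          ∫ x in {x | k < u x ∧ u x ≤ k + l}, ‖U x‖ ^ 2 := by
        rw [← integral_indicator mS]
        congr 1; ext x
        by_cases hx : x ∈ {x | k < u x ∧ u x ≤ k + l}
        · simp only [Set.indicator_of_mem hx]
        · simp only [Set.indicator_of_notMem hx]; simp
      have f4 : 0 ≤ T⁻¹ * (∫ x, u x * min (max (u x - k) 0) l) :=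
        mul_nonneg (by positivity) (integral_nonneg fun x => mul_nonneg (h.nonneg x)
          (le_min (le_max_right _ _) hl0.le))
      have f5 : ∫ x in {x | k < u x ∧ u x ≤ k + l}, ‖U x‖ ^ 2 ≤ l / lam := by
        rw [le_div_iff₀ hl]; linarith
      have f6 : ∫ x, min (max (u x - k) 0) l ^ 2 ≤ C0 * m ^ 2 * (l / lam) := by
        refine f1.trans ?_
        rw [f3]; gcongr
      have f7 := mul_meas_ge_le_lintegral₀ (μ := (volume : Measure (E d)))
        (f := fun x => ENNReal.ofReal (min (max (u x - k) 0) l ^ 2))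
        (hb.mu.pow_const 2).ennreal_ofReal.aemeasurable (ENNReal.ofReal (l ^ 2))
      rw [← ofReal_integral_eq_lintegral_ofReal hb.lu.integrable_sq
        (ae_of_all _ fun x => sq_nonneg _)] at f7
      have f8 : volume {x | k + l < u x} ≤
          volume {x | ENNReal.ofReal (l ^ 2) ≤ ENNReal.ofReal (min (max (u x - k) 0) l ^ 2)} := by
        refine measure_mono fun x hx => ENNReal.ofReal_le_ofReal ?_
        have hx' : k + l < u x := hx
        rw [min_eq_right (le_max_of_le_left (by linarith))]
      have f9 := (mul_le_mul_right f8 (ENNReal.ofReal (l ^ 2))).trans (f7.trans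
        (ENNReal.ofReal_le_ofReal f6))
      have f10 : C0 * m ^ 2 * (l / lam) = l ^ 2 * (√T * (1 / 2) ^ (i + 1)) ^ d := by
        rw [pow_succ (1 / 2 : ℝ) i, ← mul_assoc (√T), ← hm, hl', hC]
        unfold pw
        rw [mul_pow m (1 / 2) d, one_div, inv_pow]
        field_simp
      rw [f10, ENNReal.ofReal_mul (by positivity)] at f9
      exact (ENNReal.mul_le_mul_iff_right (by simpa using hl0.ne') ENNReal.ofReal_ne_top).1 f9
    · change k < u x
      by_contra hx'
      rw [not_lt] at hx'
      apply hx
      rw [max_eq_right (by linarith), min_eq_left hl0.le]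

theorem Sol.dg_zero {lam : ℝ} {a b : E d → E d →ₗ[ℝ] E d} (ha : Coef lam a b) {T : ℝ} (hT : 0 < T)
    {g u : E d → ℝ} {U : E d → E d} (h : Sol a T g u U) (hu : ∀ x, 0 ≤ u x) {B : Set (E d)}
    (hg : ∀ x ∈ B, g x = 0) (k : ℝ) : DG (c1 lam) 0 k u U B :=
  h.dg ha hg le_rfl (ae_of_all _ fun x _ => by
    have := hu x
    have : 0 ≤ T⁻¹ * u x := by positivity
    linarith) k

/-- De Giorgi's bound without a quantitative constant. -/
theorem DG.exists_bound (hd : 2 ≤ d) {C1 : ℝ} (hC1 : 0 ≤ C1) {u : E d → ℝ} {U : E d → E d}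
    {x0 : E d} {ρ : ℝ} (hu : H1 u U) (h : DG C1 0 0 u U (ball x0 ρ)) (hρ : 0 < ρ) :
    ∃ M, ∀ᵐ x, x ∈ ball x0 (ρ / 2) → u x ≤ M := by
  obtain ⟨ε, hε, _, hB⟩ := DG.bound hd hC1
  set I := ∫ x in ball x0 ρ, max (u x - 0) 0 ^ 2
  have hI : 0 ≤ I := integral_nonneg fun x => sq_nonneg _
  have hp : 0 < (ε * ρ) ^ d := by positivity
  refine ⟨_, hB u U x0 0 0 ρ (4 * I / (ε * ρ) ^ d + 1) hu h hρ (by positivity) le_rfl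
    (by rw [zero_mul]; positivity) ?_⟩
  have h1 : 0 ≤ 4 * I / (ε * ρ) ^ d := by positivity
  calc 4 * I = (ε * ρ) ^ d * (4 * I / (ε * ρ) ^ d) := by field_simp
    _ ≤ (ε * ρ) ^ d * (4 * I / (ε * ρ) ^ d + 1) ^ 2 := by
      gcongr; nlinarith

theorem exists_pointwise (hd : 2 ≤ d) {lam C : ℝ} (hl : 0 < lam) (hC : LevelC d lam C) :
    ∃ K, 1 ≤ K ∧ ∀ (a b : E d → E d →ₗ[ℝ] E d) (T : ℝ) (g u : E d → ℝ) (U : E d → E d),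
      Coef lam a b → 0 < T → PSol a T g u U → ∀ (i : ℕ) (x : E d),
      (∀ z ∈ ball x (2 * (√T * (1 / 2) ^ i)), g z = 0) →
      ∀ᵐ z, z ∈ ball x (√T * (1 / 2) ^ i / 2) →
        u z ≤ lev d C (√T) i + K * pw d (√T * (1 / 2) ^ i) := by
  have hc := c1_nonneg hl
  obtain ⟨C', hC', hB⟩ := DG.bound_of_levels (C2 := 1) hd hc zero_le_one
  have hC0 := hC.1
  refine ⟨C' * C + 1, by nlinarith, fun a b T g u U ha hT h i x hg => ?_⟩
  have hs : 0 < √T := Real.sqrt_pos.2 hT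
  set m := √T * (1 / 2) ^ i with hm
  have hm0 : 0 < m := by positivity
  have hp := pw_pos (d := d) hm0
  have hdg := fun k => h.dg_zero ha hT h.nonneg hg k
  obtain ⟨M, hM⟩ := (hdg 0).exists_bound hd hc h.h1 (by positivity)
  rw [mul_div_cancel_left₀ _ (two_ne_zero' ℝ)] at hM
  have hsub : ball x m ⊆ ball x (2 * m) := ball_subset_ball (by linarith)
  have := hB u U x 0 (lev d C (√T) i) m (C * pw d m) M h.h1 ((hdg _).mono le_rfl hsub) hm0
    (by positivity) le_rfl (by rw [zero_mul]; positivity) hM fun n => ?_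
  · filter_upwards [this] with z hz hz'
    have := hz hz'
    nlinarith
  · have h1 := hC.2 a b T g u U ha hT h (i + n)
    refine ENNReal.toReal_le_of_le_ofReal (by positivity) ?_
    refine (measure_mono fun z hz => ?_).trans (h1.trans_eq ?_)
    · exact (lev_add hC0 hs i n hd).trans_lt hz.2
    · congr 1
      rw [pow_add, ← mul_assoc, ← hm, mul_pow, ← pow_mul]
      ring

theorem exists_median {u : E d → ℝ} (mu : Measurable u) (hu : ∀ x, 0 ≤ u x) (x0 : E d) (ρ : ℝ) :
    ∃ m, 0 ≤ m ∧ volume (ball x0 ρ) ≤ 2 * volume (ball x0 ρ ∩ {x | u x ≤ m}) ∧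
      volume (ball x0 ρ) ≤ 2 * volume (ball x0 ρ ∩ {x | m ≤ u x}) := by
  set B := ball x0 ρ
  have hB : volume B ≠ ∞ := measure_ball_lt_top.ne
  rcases eq_or_ne (volume B) 0 with h0 | h0
  · exact ⟨0, le_rfl, by simp [h0], by simp [h0]⟩
  have mle : ∀ t, MeasurableSet (B ∩ {x | u x ≤ t}) := fun t =>
    measurableSet_ball.inter (measurableSet_le mu measurable_const)
  set S := {t : ℝ | 0 ≤ t ∧ volume B ≤ 2 * volume (B ∩ {x | u x ≤ t})} with hS
  have hne : S.Nonempty := by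
    have ht : Tendsto (fun n : ℕ => volume (B ∩ {x | u x ≤ n})) atTop (𝓝 (volume B)) := by
      have := tendsto_measure_iUnion_atTop (μ := (volume : Measure (E d)))
        (s := fun n : ℕ => B ∩ {x | u x ≤ n}) (fun n m hnm x hx =>
          ⟨hx.1, le_trans (show u x ≤ n from hx.2) (by exact_mod_cast hnm)⟩)
      refine this.mono_right (le_of_eq (congrArg (fun s => 𝓝 (volume s)) (Eq.symm ?_)))
      ext x
      simp only [Set.mem_iUnion, Set.mem_inter_iff, Set.mem_ofPred_eq, exists_and_left]
      exact ⟨fun h => ⟨h, exists_nat_ge _⟩, fun h => h.1⟩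
    have hlt : volume B / 2 < volume B := ENNReal.half_lt_self h0 hB
    obtain ⟨n, hn⟩ := (ht.eventually (lt_mem_nhds hlt)).exists
    refine ⟨n, by positivity, ?_⟩
    rw [mul_comm, ← ENNReal.div_le_iff two_ne_zero (by norm_num)]
    exact hn.le
  have hbd : BddBelow S := ⟨0, fun t ht => ht.1⟩
  set m := sInf S with hm
  have hm0 : 0 ≤ m := le_csInf hne fun t ht => ht.1
  have hup : ∀ t, m < t → volume B ≤ 2 * volume (B ∩ {x | u x ≤ t}) := fun t ht => by
    obtain ⟨r, hr, hrt⟩ := exists_lt_of_csInf_lt hne ht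
    refine hr.2.trans ?_
    gcongr
  refine ⟨m, hm0, ?_, ?_⟩
  · have ht : Tendsto (fun n : ℕ => volume (B ∩ {x | u x ≤ m + 1 / ((n:ℝ) + 1)})) atTop
        (𝓝 (volume (B ∩ {x | u x ≤ m}))) := by
      have := tendsto_measure_iInter_atTop (μ := (volume : Measure (E d)))
        (s := fun n : ℕ => B ∩ {x | u x ≤ m + 1 / ((n:ℝ) + 1)})
        (fun n => (mle _).nullMeasurableSet) (fun n k hnk x hx => ⟨hx.1, ?_⟩)
        ⟨0, measure_ne_top_of_subset Set.inter_subset_left hB⟩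
      · refine this.mono_right (le_of_eq (congrArg (fun s => 𝓝 (volume s)) (Eq.symm ?_)))
        ext x
        simp only [Set.mem_iInter, Set.mem_inter_iff, Set.mem_ofPred_eq]
        refine ⟨fun h n => ⟨h.1, h.2.trans (by simp; positivity)⟩, fun h => ⟨(h 0).1, ?_⟩⟩
        refine ge_of_tendsto' (x := atTop) (f := fun n : ℕ => m + 1 / ((n:ℝ) + 1)) ?_
          fun n => (h n).2
        simpa using tendsto_const_nhds.add (tendsto_one_div_add_atTop_nhds_zero_nat (𝕜 := ℝ))
      · have hx2 : u x ≤ m + 1 / ((k:ℝ) + 1) := hx.2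
        refine le_trans hx2 ?_
        have : (n:ℝ) ≤ k := by exact_mod_cast hnk
        gcongr
    exact ge_of_tendsto' (ENNReal.Tendsto.const_mul ht (Or.inr (by norm_num))) fun n =>
      hup _ (by simp; positivity)
  · rcases hm0.eq_or_lt with h1 | h1
    · rw [← h1]
      have : B ∩ {x | 0 ≤ u x} = B := Set.inter_eq_left.2 fun x _ => hu x
      rw [this, two_mul]; exact le_self_add
    have hlow : 2 * volume (B ∩ {x | u x < m}) ≤ volume B := by
      have ht : Tendsto (fun n : ℕ => volume (B ∩ {x | u x ≤ m - m / ((n:ℝ) + 1)})) atTop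
          (𝓝 (volume (B ∩ {x | u x < m}))) := by
        have := tendsto_measure_iUnion_atTop (μ := (volume : Measure (E d)))
          (s := fun n : ℕ => B ∩ {x | u x ≤ m - m / ((n:ℝ) + 1)}) (fun n k hnk x hx => ⟨hx.1, ?_⟩)
        · refine this.mono_right (le_of_eq (congrArg (fun s => 𝓝 (volume s)) (Eq.symm ?_)))
          ext x
          simp only [Set.mem_iUnion, Set.mem_inter_iff, Set.mem_ofPred_eq, exists_and_left]
          refine and_congr_right fun _ => ⟨fun h => ?_, fun ⟨n, h⟩ => h.trans_lt ?_⟩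
          · obtain ⟨n, hn⟩ := exists_nat_gt (m / (m - u x))
            refine ⟨n, ?_⟩
            rw [div_lt_iff₀ (by linarith)] at hn
            have : m / ((n:ℝ) + 1) ≤ m - u x := by
              rw [div_le_iff₀ (by positivity)]; nlinarith
            linarith
          · have : 0 < m / ((n:ℝ) + 1) := by positivity
            linarith
        · have hx2 : u x ≤ m - m / ((n:ℝ) + 1) := hx.2
          refine le_trans hx2 ?_
          have : (n:ℝ) ≤ k := by exact_mod_cast hnk
          gcongr
      refine le_of_tendsto' (ENNReal.Tendsto.const_mul ht (Or.inr (by norm_num))) fun n => ?_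
      by_contra hcon
      have hlt : m - m / ((n:ℝ) + 1) < m := by
        have : 0 < m / ((n:ℝ) + 1) := by positivity
        linarith
      refine notMem_of_lt_csInf hlt hbd ⟨?_, (not_le.1 hcon).le⟩
      have : m / ((n:ℝ) + 1) ≤ m := div_le_self hm0 (by linarith [Nat.cast_nonneg (α := ℝ) n])
      linarith
    have hsplit : volume B = volume (B ∩ {x | u x < m}) + volume (B ∩ {x | m ≤ u x}) := by
      rw [← measure_inter_add_sdiff B (measurableSet_lt mu measurable_const : MeasurableSet {x | u x < m})]
      congr 2
      ext x; simp
    have hfin : volume (B ∩ {x | u x < m}) ≠ ∞ := measure_ne_top_of_subset Set.inter_subset_left hB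
    rw [hsplit, two_mul] at hlow
    have := (ENNReal.add_le_add_iff_left hfin).1 hlow
    rw [hsplit, two_mul]
    gcongr

theorem level_measure_le {lam : ℝ} (hl : 0 < lam) {u : E d → ℝ} {U : E d → E d} (hu : H1 u U)
    {x0 : E d} {ρ k h : ℝ} (hρ : 0 < ρ) {n : ℕ} (hh : pw d ρ * 4 ^ (n * d) ≤ h)
    (hk : volume (ball x0 ρ) ≤ 2 * volume (ball x0 ρ ∩ {x | u x ≤ k}))
    (hb : ∫ x in ball x0 ρ ∩ {x | k < u x ∧ u x ≤ k + h}, ‖U x‖ ^ 2 ≤ 2 * h / lam) :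
    volume.real (ball x0 ρ ∩ {x | k + h < u x}) ≤
      (2 * 4 ^ (d + 2) * vB d / lam + 1) * (1 / 2) ^ (n * d) * ρ ^ d := by
  have hp := pw_pos (d := d) hρ
  have hv := vB_pos (d := d)
  have hh0 : 0 < h := lt_of_lt_of_le (by positivity) hh
  have h1 := level_poincare hu x0 hρ hh0.le hk
  set S := ball x0 ρ ∩ {x | k < u x ∧ u x ≤ k + h}
  have hSB : volume S ≤ volume (ball x0 ρ) := measure_mono Set.inter_subset_left
  have hS : volume S ≠ ∞ := (hSB.trans_lt measure_ball_lt_top).ne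
  have h2 := sq_setIntegral_norm_le hS hu.lU
  have h3 : volume.real S ≤ ρ ^ d * vB d := by
    rw [← volume_real_ball x0 hρ]
    exact ENNReal.toReal_mono measure_ball_lt_top.ne hSB
  set V := volume.real (ball x0 ρ ∩ {x | k + h < u x}) with hV
  have hV0 : 0 ≤ V := measureReal_nonneg
  set I := ∫ x in S, ‖U x‖
  set J := ∫ x in S, ‖U x‖ ^ 2
  have hI0 : 0 ≤ I := integral_nonneg fun x => norm_nonneg _
  have hJ0 : 0 ≤ J := integral_nonneg fun x => sq_nonneg _
  set Q := 2 * 4 ^ (d + 2) * vB d / lam with hQ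
  have hQ0 : 0 ≤ Q := by positivity
  have h4 : I ^ 2 ≤ ρ ^ d * vB d * (2 * h / lam) := h2.trans (by gcongr)
  have h5 : (h * V) ^ 2 ≤ (2 ^ (d + 2) * ρ) ^ 2 * (ρ ^ d * vB d * (2 * h / lam)) := by
    calc (h * V) ^ 2 ≤ (2 ^ (d + 2) * ρ * I) ^ 2 := by gcongr
      _ = (2 ^ (d + 2) * ρ) ^ 2 * I ^ 2 := by ring
      _ ≤ _ := by gcongr
  have h6 : h * V ^ 2 ≤ Q * ρ ^ 2 * ρ ^ d := by
    have e : (2 ^ (d + 2) * ρ) ^ 2 * (ρ ^ d * vB d * (2 * h / lam)) = h * (Q * ρ ^ 2 * ρ ^ d) := by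
      rw [hQ, mul_pow, ← pow_mul, mul_comm (d + 2) 2, pow_mul]; norm_num; ring
    rw [e] at h5
    nlinarith [le_of_mul_le_mul_left (a := h) (b := h * V ^ 2) (c := Q * ρ ^ 2 * ρ ^ d)
      (by linarith) hh0]
  have h7 : V ^ 2 ≤ Q * ((1 / 2) ^ (n * d) * ρ ^ d) ^ 2 := by
    have e1 : pw d ρ * 4 ^ (n * d) * V ^ 2 ≤ Q * ρ ^ 2 * ρ ^ d :=
      (mul_le_mul_of_nonneg_right hh (sq_nonneg V)).trans h6
    have e2 : (4:ℝ) ^ (n * d) * ((1 / 2) ^ (n * d)) ^ 2 = 1 := by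
      rw [← pow_mul, mul_comm (n * d) 2, pow_mul (1 / 2 : ℝ), ← mul_pow]; norm_num
    have e3 : pw d ρ * 4 ^ (n * d) * (Q * ((1 / 2) ^ (n * d) * ρ ^ d) ^ 2) = Q * ρ ^ 2 * ρ ^ d := by
      unfold pw
      calc ρ ^ 2 / ρ ^ d * 4 ^ (n * d) * (Q * ((1 / 2) ^ (n * d) * ρ ^ d) ^ 2)
          = (4 ^ (n * d) * ((1 / 2) ^ (n * d)) ^ 2) * (ρ ^ 2 / ρ ^ d * (Q * (ρ ^ d) ^ 2)) := by ring
        _ = _ := by rw [e2]; field_simp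
    exact le_of_mul_le_mul_left (e1.trans_eq e3.symm) (by positivity)
  rw [mul_assoc]
  set w := (1 / 2) ^ (n * d) * ρ ^ d
  have hw : 0 ≤ w := by positivity
  refine le_of_sq_le_sq ?_ (by positivity)
  nlinarith [mul_nonneg hQ0 (sq_nonneg w), sq_nonneg w, mul_nonneg (sq_nonneg Q) (sq_nonneg w)]

/-- Local gradient bound with the sharp scaling. -/
theorem exists_grad_ball (hd : 2 ≤ d) {lam : ℝ} (hl : 0 < lam) :
    ∃ C, 0 < C ∧ ∀ (a b : E d → E d →ₗ[ℝ] E d) (T : ℝ) (g u : E d → ℝ) (U : E d → E d),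
      Coef lam a b → 0 < T → PSol a T g u U → ∀ (x : E d) (ρ M K0 : ℝ), 0 < ρ → 0 ≤ M → 1 ≤ K0 →
      (∀ z ∈ ball x ρ, g z = 0) → (∀ᵐ z, z ∈ ball x ρ → u z ≤ M) →
      T⁻¹ * M * ρ ^ 2 ≤ K0 * pw d ρ →
      ∫ z in ball x (ρ / 4), ‖U z‖ ^ 2 ≤ C * K0 ^ 2 * pw d ρ := by
  have hc := c1_nonneg hl
  have hv := vB_pos (d := d)
  set C2 := 2 * 4 ^ (d + 2) * vB d / lam + 1 with hC2
  have hC20 : 0 ≤ C2 := by positivity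
  obtain ⟨C', hC', hB⟩ := DG.bound_of_levels (C2 := C2) hd hc hC20
  obtain ⟨Cc, hCc, hcac⟩ := DG.caccioppoli
  refine ⟨c1 lam * (Cc * (3 * C') ^ 2 * 16) * vB d + 1, by positivity,
    fun a b T g u U ha hT h x ρ M K0 hρ hM hK hg hu hTM => ?_⟩
  have hp := pw_pos (d := d) hρ
  set Λ := K0 * pw d ρ with hΛ
  have hpΛ : pw d ρ ≤ Λ := by nlinarith
  have hΛ0 : 0 < Λ := hp.trans_le hpΛ
  obtain ⟨m, hm0, hm1, hm2⟩ := exists_median h.h1.mu h.nonneg x ρ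
  have hband : ∀ k l, 0 ≤ k → 0 ≤ l →
      ∫ x in {x | k < u x ∧ u x ≤ k + l}, ‖U x‖ ^ 2 ≤ l / lam := fun k l hk hl0 => by
    have f2 := h.band ha h.g_nonneg h.g_int h.g_mass hk hl0
    have f4 : 0 ≤ T⁻¹ * (∫ x, u x * min (max (u x - k) 0) l) :=
      mul_nonneg (by positivity) (integral_nonneg fun x => mul_nonneg (h.nonneg x)
        (le_min (le_max_right _ _) hl0))
    rw [le_div_iff₀ hl]; linarith
  have hUi : Integrable fun x => ‖U x‖ ^ 2 := h.h1.lU.integrable_norm_pow two_ne_zero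
  have hsub : ∀ S S' : Set (E d), MeasurableSet S' → S ⊆ S' →
      ∫ x in S, ‖U x‖ ^ 2 ≤ ∫ x in S', ‖U x‖ ^ 2 := fun S S' hS' hSS =>
    setIntegral_mono_set hUi.integrableOn (ae_of_all _ fun x => sq_nonneg _)
      (Eventually.of_forall hSS)
  have mband : ∀ k l, MeasurableSet {x | k < u x ∧ u x ≤ l} := fun k l =>
    (measurableSet_lt measurable_const h.h1.mu).inter (measurableSet_le h.h1.mu measurable_const)
  have up := hB u U x 0 m ρ Λ M h.h1 (h.dg_zero ha hT h.nonneg hg m) hρ hΛ0 le_rfl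
    (by rw [zero_mul]; exact hΛ0.le) hu fun n => by
      have h4 : 0 ≤ Λ * 4 ^ (n * d) := by positivity
      refine level_measure_le hl h.h1 hρ (by gcongr) hm1 ?_
      refine (hsub _ _ (mband _ _) Set.inter_subset_right).trans ((hband _ _ hm0 h4).trans ?_)
      exact div_le_div_of_nonneg_right (by linarith) hl.le
  have low := hB (-u) (-U) x (T⁻¹ * M) (-m) ρ Λ 0 h.h1.neg
    (h.neg.dg ha (fun z hz => by simp [hg z hz]) (by positivity) (by
      filter_upwards [hu] with z hz hz'
      have := hz hz'
      simp only [Pi.neg_apply, mul_neg, neg_neg]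
      gcongr) (-m)) hρ hΛ0 (by positivity) hTM
    (ae_of_all _ fun z _ => by simpa using h.nonneg z) fun n => by
      have hh : 0 < Λ * 4 ^ (n * d) := by positivity
      set hn := Λ * 4 ^ (n * d) with hhn
      by_cases hcase : m - hn ≤ 0
      · have : ball x ρ ∩ {x | -m + hn < (-u) x} = ∅ := by
          ext z
          simp only [Set.mem_inter_iff, Set.mem_ofPred_eq, Pi.neg_apply, Set.mem_empty_iff_false,
            iff_false, not_and, not_lt]
          intro _
          have := h.nonneg z
          linarith
        rw [this, measureReal_empty]
        positivity
      · rw [not_le] at hcase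
        refine level_measure_le hl h.h1.neg hρ (by rw [hhn]; gcongr) ?_ ?_
        · refine hm2.trans_eq ?_
          congr 3; ext z; simp
        · have hb := hband (max 0 (m - 2 * hn)) (m - max 0 (m - 2 * hn)) (le_max_left _ _)
            (by rw [sub_nonneg]; exact max_le hm0 (by linarith))
          simp only [norm_neg]
          refine (hsub _ _ (mband (max 0 (m - 2 * hn)) m) fun z hz => ?_).trans ?_
          · have h1 : -m < -u z := hz.2.1
            have h2 : -u z ≤ -m + hn := hz.2.2
            exact ⟨max_lt (by linarith) (by linarith), by linarith⟩
          · rw [add_sub_cancel] at hb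
            refine hb.trans ?_
            gcongr
            linarith [le_max_right 0 (m - 2 * hn)]
  have hC0 : 0 < C' := by linarith
  have hcc := hcac u U x (c1 lam) 0 (m - 2 * C' * Λ) (3 * C' * Λ) (ρ / 4) (ρ / 2) h.h1
    (h.dg_zero ha hT h.nonneg (fun z hz => hg z (ball_subset_ball (by linarith) hz)) _)
    (by linarith) (by linarith) le_rfl hc (by positivity) (by
      filter_upwards [up] with z hz hz'
      have := hz hz'
      linarith)
  have hae : (ball x (ρ / 4) ∩ {x | m - 2 * C' * Λ < u x} : Set (E d)) =ᵐ[volume] ball x (ρ / 4) := by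
    filter_upwards [low] with z hz
    refine propext ⟨fun h => h.1, fun hz' => ⟨hz', ?_⟩⟩
    have h1 := hz (ball_subset_ball (by linarith) hz')
    simp only [Pi.neg_apply] at h1
    change m - 2 * C' * Λ < u z
    nlinarith
  rw [setIntegral_congr_set hae] at hcc
  refine hcc.trans ?_
  rw [volume_real_ball _ (by linarith)]
  have e1 : c1 lam * (0 * (3 * C' * Λ) + Cc * (3 * C' * Λ) ^ 2 / (ρ / 2 - ρ / 4) ^ 2) *
      ((ρ / 2) ^ d * vB d) =
      c1 lam * (Cc * (3 * C') ^ 2 * 16) * vB d * K0 ^ 2 * pw d ρ * (1 / 2) ^ d := by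
    rw [hΛ]
    unfold pw
    rw [div_pow ρ 2 d, one_div, inv_pow]
    field_simp
    ring
  rw [e1]
  have h2 : ((1:ℝ) / 2) ^ d ≤ 1 := pow_le_one₀ (by norm_num) (by norm_num)
  have h3 : 0 ≤ c1 lam * (Cc * (3 * C') ^ 2 * 16) * vB d * K0 ^ 2 * pw d ρ := by positivity
  have h4 : 0 ≤ K0 ^ 2 * pw d ρ := by positivity
  nlinarith

theorem Cutoff.compl_grad {x0 : E d} {r R K : ℝ} {η : E d → ℝ} (h : Cutoff x0 r R K η) (x : E d) :
    ∇ (fun x => 1 - η x) x = - ∇ η x := by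
  have h1 : HasGradientAt η (∇ η x) x :=
    (h.smooth.differentiable (by simp) x).hasGradientAt
  have h2 : HasGradientAt (fun x => 1 - η x) (- ∇ η x) x := by
    have := h1.hasFDerivAt.const_sub (1:ℝ)
    rw [hasGradientAt_iff_hasFDerivAt, map_neg]
    exact this
  exact h2.gradient

theorem measurableSet_far (y : E d) (r : ℝ) : MeasurableSet {z : E d | r ≤ dist z y} :=
  measurableSet_le measurable_const (measurable_id.dist measurable_const)

theorem Sol.exterior : ∃ Kc : ℝ, 0 < Kc ∧ ∀ (d : ℕ) (lam : ℝ) (a b : E d → E d →ₗ[ℝ] E d) (T : ℝ)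
    (g u : E d → ℝ) (U : E d → E d) (y : E d) (r h : ℝ), Coef lam a b → 0 < T → Sol a T g u U →
    0 < r → 0 < h → (∀ z, r ≤ dist z y → g z = 0) →
    T⁻¹ * (∫ z in {z | r + h ≤ dist z y}, u z ^ 2) +
      lam / 2 * (∫ z in {z | r + h ≤ dist z y}, ‖U z‖ ^ 2) ≤
      Kc / (lam * h ^ 2) * ∫ z in {z | r ≤ dist z y}, u z ^ 2 := by
  obtain ⟨C, hC, hcut⟩ := exists_cutoff
  refine ⟨2 * C ^ 2, by positivity, fun d lam a b T g u U y r h ha hT hs hr hh hg => ?_⟩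
  have hlam := ha.pos
  obtain ⟨η, hη⟩ := hcut d y r (r + h) hr (by linarith)
  rw [add_sub_cancel_left] at hη
  have hgr : ∀ x, ‖∇ (fun x => 1 - η x) x‖ ≤ C / h := fun x => by
    rw [hη.compl_grad, norm_neg]; exact hη.grad_le x
  have he := hs.energy ha (η := fun x => 1 - η x) (contDiff_const.sub hη.contDiff_one)
    (K := 1 + C / h) (fun x => by
      have h1 := hη.nonneg x
      have h2 := hη.le_one x
      have : 0 < C / h := by positivity
      rw [abs_le]; constructor <;> linarith) (fun x => (hgr x).trans (by linarith)) (fun x => by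
      rcases le_or_gt r (dist x y) with hx | hx
      · rw [hg x hx, zero_mul]
      · rw [hη.one x hx.le]; ring)
  have iu : Integrable fun x => u x ^ 2 := hs.h1.lu.integrable_sq
  have iU : Integrable fun x => ‖U x‖ ^ 2 := hs.h1.lU.integrable_norm_pow two_ne_zero
  have hη1 : ∀ x, (1 - η x) ^ 2 ≤ 1 := fun x => by
    have h1 := hη.nonneg x
    have h2 := hη.le_one x
    nlinarith
  have mη : Measurable fun x => (1 - η x) ^ 2 :=
    ((contDiff_const.sub hη.contDiff_one).continuous.measurable).pow_const 2
  have lower : ∀ f : E d → ℝ, Integrable f → (∀ x, 0 ≤ f x) →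
      ∫ z in {z | r + h ≤ dist z y}, f z ≤ ∫ z, (1 - η z) ^ 2 * f z := fun f hf h0 => by
    rw [← integral_indicator (measurableSet_far y (r + h))]
    refine integral_mono (hf.indicator (measurableSet_far y (r + h)))
      (hf.bdd_mul (c := 1) mη.aestronglyMeasurable (ae_of_all _ fun x => ?_)) fun x => ?_
    · rw [Real.norm_of_nonneg (sq_nonneg _)]; exact hη1 x
    · by_cases hx : x ∈ {z | r + h ≤ dist z y}
      · simp only [Set.indicator_of_mem hx, hη.zero x hx]; simp
      · simp only [Set.indicator_of_notMem hx]
        exact mul_nonneg (sq_nonneg _) (h0 x)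
  have upper : ∫ z, ‖∇ (fun x => 1 - η x) z‖ ^ 2 * u z ^ 2 ≤
      (C / h) ^ 2 * ∫ z in {z | r ≤ dist z y}, u z ^ 2 := by
    rw [← integral_indicator (measurableSet_far y r), ← integral_const_mul]
    refine integral_mono_of_nonneg (ae_of_all _ fun x => by positivity)
      ((iu.indicator (measurableSet_far y r)).const_mul _) (ae_of_all _ fun x => ?_)
    by_cases hx : x ∈ {z | r ≤ dist z y}
    · simp only [Set.indicator_of_mem hx]
      have := hgr x
      gcongr
    · simp only [Set.indicator_of_notMem hx]
      have hx' : dist x y < r := not_le.1 hx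
      rw [hη.compl_grad, hη.grad_zero x (Or.inl hx')]
      simp
  have l1 := lower _ iu fun x => sq_nonneg _
  have l2 := lower _ iU fun x => sq_nonneg _
  calc _ ≤ T⁻¹ * (∫ x, (1 - η x) ^ 2 * u x ^ 2) +
        lam / 2 * (∫ x, (1 - η x) ^ 2 * ‖U x‖ ^ 2) := by gcongr
    _ ≤ _ := he
    _ ≤ 2 / lam * ((C / h) ^ 2 * ∫ z in {z | r ≤ dist z y}, u z ^ 2) := by gcongr
    _ = _ := by field_simp

theorem exists_scale {A N s r : ℝ} (hA : 0 < A) (hN : 2 * A ≤ N) (hs : 0 < s) (hr : 0 < r)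
    (h : r ≤ N * s) : ∃ i : ℕ, A * (s * (1 / 2) ^ i) ≤ r ∧ r ≤ N * (s * (1 / 2) ^ i) := by
  have hex : ∃ i : ℕ, A * (s * (1 / 2) ^ i) ≤ r := by
    obtain ⟨i, hi⟩ := exists_pow_lt_of_lt_one (y := (1/2:ℝ)) (show 0 < r / (A * s) by positivity) (by norm_num)
    refine ⟨i, ?_⟩
    rw [lt_div_iff₀ (by positivity)] at hi
    nlinarith
  classical
  refine ⟨Nat.find hex, Nat.find_spec hex, ?_⟩
  rcases hi : Nat.find hex with _ | i
  · simpa using h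
  · have := Nat.find_min hex (m := i) (by omega)
    rw [not_le] at this
    rw [pow_succ]
    have hp : 0 < s * (1 / 2) ^ i := by positivity
    nlinarith

theorem sq_eq_pow_mul_pw {m : ℝ} (hm : 0 < m) : m ^ 2 = m ^ d * pw d m := by unfold pw; field_simp

theorem exp_decay {L β : ℝ} (hL : 0 < L) (hβ : 1 ≤ β) : ∃ c C : ℝ, 0 < c ∧ 0 < C ∧
    ∀ s r : ℝ, 0 < s → 2 * β * s ≤ r → ∃ j : ℕ, β * s + j * L * s ≤ r ∧
      (1 / 2) ^ j * pw d s ≤ C * Real.exp (-(c * r) / s) * pw d r := by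
  set c := Real.log 2 / (4 * L) with hc
  have hl2 : 0 < Real.log 2 := Real.log_pos (by norm_num)
  have hc0 : 0 < c := by positivity
  refine ⟨c, 2 * (d.factorial / c ^ d), hc0, by positivity, fun s r hs hr => ?_⟩
  set t := r / s with ht
  have hts : r = t * s := by rw [ht]; field_simp
  have ht2 : 2 * β ≤ t := by rw [ht, le_div_iff₀ hs]; exact hr
  have ht1 : 1 ≤ t := by linarith
  have ht0 : 0 < t := by linarith
  refine ⟨⌊(t - β) / L⌋₊, ?_, ?_⟩
  · have h1 : (⌊(t - β) / L⌋₊ : ℝ) ≤ (t - β) / L := Nat.floor_le (div_nonneg (by linarith) hL.le)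
    rw [le_div_iff₀ hL] at h1
    rw [hts]; nlinarith
  · have h1 : (t - β) / L < ⌊(t - β) / L⌋₊ + 1 := Nat.lt_floor_add_one _
    set j := ⌊(t - β) / L⌋₊
    have h2 : 2 * c * t ≤ Real.log 2 * (j + 1) := by
      rw [div_lt_iff₀ hL] at h1
      rw [hc]
      have : 2 * (Real.log 2 / (4 * L)) * t = Real.log 2 * (t / 2) / L := by field_simp; ring
      rw [this, div_le_iff₀ hL]
      nlinarith
    have h3 : ((1:ℝ) / 2) ^ j ≤ 2 * Real.exp (-(2 * c * t)) := by
      have : ((1:ℝ) / 2) ^ j = 2 * Real.exp (-(Real.log 2 * (j + 1))) := by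
        rw [Real.exp_neg, Real.exp_mul, Real.exp_log (by norm_num), Real.rpow_add_one (by norm_num),
          Real.rpow_natCast, one_div, inv_pow]
        field_simp
      rw [this]
      gcongr
    have h4 : t ^ d ≤ d.factorial / c ^ d * Real.exp (c * t) := by
      have := Real.pow_div_factorial_le_exp (c * t) (by positivity) d
      rw [div_le_iff₀ (by positivity), mul_pow] at this
      rw [div_mul_eq_mul_div, le_div_iff₀ (by positivity)]
      linarith
    have h5 : pw d s ≤ t ^ d * pw d r := by
      have : t ^ d * pw d r = t ^ 2 * pw d s := by
        rw [hts]; unfold pw; rw [mul_pow, mul_pow]; field_simp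
      rw [this]
      exact le_mul_of_one_le_left (pw_pos hs).le (one_le_pow₀ ht1)
    have h6 := pw_pos (d := d) (m := r) (by rw [hts]; positivity)
    have h7 : -(c * r) / s = -(2 * c * t) + c * t := by rw [hts]; field_simp; ring
    have h8 := pw_pos (d := d) hs
    calc (1 / 2) ^ j * pw d s ≤ 2 * Real.exp (-(2 * c * t)) * (t ^ d * pw d r) := by gcongr
      _ ≤ 2 * Real.exp (-(2 * c * t)) * ((d.factorial / c ^ d * Real.exp (c * t)) * pw d r) := by
        gcongr
      _ = _ := by rw [h7, Real.exp_add]; ring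

theorem exists_near (hd : 2 ≤ d) {lam : ℝ} (hl : 0 < lam) : ∃ C K : ℝ, 0 < C ∧ 1 ≤ K ∧
    ∀ (a b : E d → E d →ₗ[ℝ] E d) (T : ℝ) (g u : E d → ℝ) (U : E d → E d) (y : E d) (ε : ℝ),
      Coef lam a b → 0 < T → PSol a T g u U → (∀ z, ε ≤ dist z y → g z = 0) →
      ∀ i : ℕ, ε ≤ √T * (1 / 2) ^ i → ∀ᵐ z, 4 * (√T * (1 / 2) ^ i) ≤ dist z y →
        u z ≤ lev d C (√T) i + K * pw d (√T * (1 / 2) ^ i) := by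
  obtain ⟨C, hC⟩ := exists_levelC hd hl
  obtain ⟨K, hK, h⟩ := exists_pointwise hd hl hC
  refine ⟨C, K, hC.1, hK, fun a b T g u U y ε ha hT hs hg i hi => ?_⟩
  have hs' : 0 < √T := Real.sqrt_pos.2 hT
  have hm : 0 < √T * (1 / 2) ^ i := by positivity
  refine ae_of_locally (B := {z | 4 * (√T * (1 / 2) ^ i) ≤ dist z y}) fun x hx =>
    ⟨√T * (1 / 2) ^ i / 2, by positivity, h a b T g u U ha hT hs i x fun z hz => hg z ?_⟩
  have h1 : dist z x < 2 * (√T * (1 / 2) ^ i) := hz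
  have h2 : 4 * (√T * (1 / 2) ^ i) ≤ dist x y := hx
  have h3 := dist_triangle x z y
  rw [dist_comm x z] at h3
  linarith

theorem setIntegral_le_sum_ball {f : E d → ℝ} (hf : Integrable f) (h0 : ∀ x, 0 ≤ f x)
    {S : Set (E d)} (hS : MeasurableSet S) (t : Finset (E d)) (c : E d → E d) (r : ℝ)
    (h : ∀ z ∈ S, ∃ w ∈ t, z ∈ ball (c w) r) :
    ∫ z in S, f z ≤ ∑ w ∈ t, ∫ z in ball (c w) r, f z := by
  simp only [← integral_indicator hS, ← integral_indicator measurableSet_ball]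
  rw [← integral_finsetSum _ fun w _ => hf.indicator measurableSet_ball]
  refine integral_mono (hf.indicator hS)
    (integrable_finsetSum _ fun w _ => hf.indicator measurableSet_ball) fun z => ?_
  by_cases hz : z ∈ S
  · obtain ⟨w, hw, hzw⟩ := h z hz
    simp only [Set.indicator_of_mem hz]
    refine le_trans ?_ (Finset.single_le_sum (fun w _ => ?_) hw)
    · rw [Set.indicator_of_mem hzw]
    · exact Set.indicator_nonneg (fun x _ => h0 x) _
  · simp only [Set.indicator_of_notMem hz]
    exact Finset.sum_nonneg fun w _ => Set.indicator_nonneg (fun x _ => h0 x) _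

theorem exists_near_grad (hd : 2 ≤ d) {lam : ℝ} (hl : 0 < lam) : ∃ C : ℝ, 0 < C ∧
    ∀ (a b : E d → E d →ₗ[ℝ] E d) (T : ℝ) (g u : E d → ℝ) (U : E d → E d) (y : E d) (ε : ℝ),
      Coef lam a b → 0 < T → PSol a T g u U → (∀ z, ε ≤ dist z y → g z = 0) →
      ∀ i : ℕ, ε ≤ √T * (1 / 2) ^ i →
        ∫ z in {z | 5 * (√T * (1 / 2) ^ i) ≤ dist z y ∧ dist z y ≤ 20 * (√T * (1 / 2) ^ i)},
          ‖U z‖ ^ 2 ≤ C * pw d (√T * (1 / 2) ^ i) := by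
  obtain ⟨C, K, hC, hK, hn⟩ := exists_near hd hl
  obtain ⟨C', hC', hg'⟩ := exists_grad_ball hd hl
  have hcomp : IsCompact {w : E d | 5 ≤ dist w 0 ∧ dist w 0 ≤ 20} := by
    have : {w : E d | 5 ≤ dist w 0 ∧ dist w 0 ≤ 20} = closedBall 0 20 ∩ {w | 5 ≤ dist w 0} := by
      ext w; simp [and_comm]
    rw [this]
    exact (isCompact_closedBall _ _).inter_right
      (isClosed_le continuous_const (continuous_id.dist continuous_const))
  obtain ⟨t, htS, htf, hcov⟩ := hcomp.finite_cover_balls (e := 1 / 4) (by norm_num)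
  lift t to Finset (E d) using htf
  refine ⟨(t.card + 1) * (C' * (1 + C + K) ^ 2), by positivity,
    fun a b T g u U y ε ha hT hs hg i hi => ?_⟩
  have hs' : 0 < √T := Real.sqrt_pos.2 hT
  have hnear := hn a b T g u U y ε ha hT hs hg i hi
  have hlev := lev_le hC hs' i hd
  have hTm : T⁻¹ * (√T * (1 / 2) ^ i) ^ 2 = (1 / 4) ^ i := by
    rw [mul_pow, Real.sq_sqrt hT.le, ← pow_mul, mul_comm i 2, pow_mul]
    field_simp; norm_num
  set m := √T * (1 / 2) ^ i with hm
  have hm0 : 0 < m := by positivity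
  have hp := pw_pos (d := d) hm0
  have hi4 : (i : ℝ) * (1 / 4) ^ i ≤ 1 := by
    rw [one_div, inv_pow, ← div_eq_mul_inv, div_le_one (by positivity)]
    exact_mod_cast (Nat.lt_pow_self (by norm_num : 1 < 4)).le
  have hi4' : ((1:ℝ) / 4) ^ i ≤ 1 := pow_le_one₀ (by norm_num) (by norm_num)
  have hball : ∀ w ∈ t, ∫ z in ball (y + m • w) (m / 4), ‖U z‖ ^ 2 ≤
      C' * (1 + C + K) ^ 2 * pw d m := fun w hw => by
    have h5 : 5 * m ≤ dist (y + m • w) y := by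
      have : 5 ≤ dist w 0 := (htS hw).1
      rw [dist_zero_right] at this
      rw [dist_eq_norm, add_sub_cancel_left, norm_smul, Real.norm_of_nonneg hm0.le]
      nlinarith
    have hfar : ∀ z ∈ ball (y + m • w) m, 4 * m ≤ dist z y := fun z hz => by
      have h1 : dist z (y + m • w) < m := hz
      have h3 := dist_triangle (y + m • w) z y
      rw [dist_comm _ z] at h3
      linarith
    refine hg' a b T g u U ha hT hs _ m ((1 + C * i) * pw d m + K * pw d m) (1 + C + K) hm0
      (by positivity) (by linarith) (fun z hz => hg z (by linarith [hfar z hz])) ?_ ?_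
    · filter_upwards [hnear] with z hz hz'
      linarith [hz (hfar z hz')]
    · calc T⁻¹ * ((1 + C * i) * pw d m + K * pw d m) * m ^ 2 =
          (((1 / 4) ^ i) * (1 + K) + C * (i * (1 / 4) ^ i)) * pw d m := by rw [← hTm]; ring
        _ ≤ (1 * (1 + K) + C * 1) * pw d m := by gcongr
        _ = _ := by ring
  have mS : MeasurableSet {z : E d | 5 * m ≤ dist z y ∧ dist z y ≤ 20 * m} :=
    (measurableSet_far y _).inter
      (measurableSet_le (measurable_id.dist measurable_const) measurable_const)
  have := setIntegral_le_sum_ball (f := fun z => ‖U z‖ ^ 2)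
    (hs.h1.lU.integrable_norm_pow two_ne_zero) (fun z => sq_nonneg _) mS t
    (fun w => y + m • w) (m / 4) fun z hz => by
      have hzw : m⁻¹ • (z - y) ∈ {w : E d | 5 ≤ dist w 0 ∧ dist w 0 ≤ 20} := by
        have h1 : 5 * m ≤ dist z y := hz.1
        have h2 : dist z y ≤ 20 * m := hz.2
        rw [dist_eq_norm] at h1 h2
        simp only [Set.mem_ofPred_eq, dist_zero_right, norm_smul, norm_inv,
          Real.norm_of_nonneg hm0.le]
        rw [inv_mul_eq_div, le_div_iff₀ hm0, div_le_iff₀ hm0]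
        exact ⟨h1, h2⟩
      have := hcov hzw
      simp only [Set.mem_iUnion] at this
      obtain ⟨w, hw, hzw⟩ := this
      refine ⟨w, hw, ?_⟩
      rw [mem_ball, dist_eq_norm] at hzw ⊢
      have e : z - (y + m • w) = m • (m⁻¹ • (z - y) - w) := by
        rw [smul_sub, smul_inv_smul₀ hm0.ne']; abel
      rw [e, norm_smul, Real.norm_of_nonneg hm0.le]
      nlinarith
  refine this.trans ((Finset.sum_le_sum hball).trans ?_)
  rw [Finset.sum_const, nsmul_eq_mul]
  have : 0 ≤ C' * (1 + C + K) ^ 2 * pw d m := by positivity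
  nlinarith

theorem exists_far (hd : 2 ≤ d) {lam : ℝ} (hl : 0 < lam) : ∃ L C : ℝ, 0 < L ∧ 0 < C ∧
    ∀ (a b : E d → E d →ₗ[ℝ] E d) (T : ℝ) (g u : E d → ℝ) (U : E d → E d) (y : E d) (ε : ℝ),
      Coef lam a b → 0 < T → PSol a T g u U → (∀ z, ε ≤ dist z y → g z = 0) → ε ≤ √T →
      ∀ j : ℕ, (∀ᵐ z, 5 * √T + j * L * √T ≤ dist z y → u z ≤ C * ((1 / 2) ^ j * pw d (√T))) ∧
        ∫ z in {z | 4 * √T + j * L * √T ≤ dist z y}, ‖U z‖ ^ 2 ≤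
          C * ((1 / 2) ^ j * pw d (√T)) := by
  obtain ⟨C, K, hC, hK, hn⟩ := exists_near hd hl
  obtain ⟨Kc, hKc, hext⟩ := Sol.exterior
  have hc := c1_nonneg hl
  obtain ⟨ε0, hε0, _, hDG⟩ := DG.bound hd hc
  set L := 4 * Kc / lam + 1 with hL
  have hL0 : 0 < L := by positivity
  have hLL : Kc / (lam * L ^ 2) ≤ 1 / 4 := by
    rw [div_le_iff₀ (by positivity)]
    have h1 : 4 * Kc / lam ≤ L ^ 2 := by
      have : 0 ≤ 4 * Kc / lam := by positivity
      rw [hL]; nlinarith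
    rw [div_le_iff₀ hl] at h1
    linarith
  set Q := 4 * (1 + K) / ε0 ^ d + 1 with hQ
  have hQ0 : 1 ≤ Q := by rw [hQ]; have : 0 ≤ 4 * (1 + K) / ε0 ^ d := by positivity
                         linarith
  refine ⟨L, Q + 2 * (1 + K) / lam, hL0, by positivity,
    fun a b T g u U y ε ha hT hs hg hε => ?_⟩
  set s := √T with hs'
  have hs0 : 0 < s := Real.sqrt_pos.2 hT
  have hsT : s ^ 2 = T := Real.sq_sqrt hT.le
  have hp := pw_pos (d := d) hs0
  have hnear : ∀ᵐ z, 4 * s ≤ dist z y → u z ≤ (1 + K) * pw d s := by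
    have := hn a b T g u U y ε ha hT hs hg 0 (by simpa using hε)
    simp only [pow_zero, mul_one, lev, Finset.range_zero, Finset.sum_empty, mul_zero,
      add_zero, ← hs'] at this
    filter_upwards [this] with z hz hz'
    linarith [hz hz']
  have iu : Integrable fun x => u x ^ 2 := hs.h1.lu.integrable_sq
  have iU : Integrable fun x => ‖U x‖ ^ 2 := hs.h1.lU.integrable_norm_pow two_ne_zero
  have hmass := hs.mass ha hT hs.nonneg hs.g_nonneg hs.g_int hs.g_mass
  have iu1 : Integrable u := by
    refine ⟨hs.h1.mu.aestronglyMeasurable, ?_⟩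
    rw [hasFiniteIntegral_iff_ofReal (ae_of_all _ hs.nonneg)]
    exact hmass.trans_lt ENNReal.ofReal_lt_top
  have iu2 : ∫ z, u z ≤ T := by
    rw [integral_eq_lintegral_of_nonneg_ae (ae_of_all _ hs.nonneg)
      hs.h1.mu.aestronglyMeasurable]
    exact ENNReal.toReal_le_of_le_ofReal hT.le hmass
  have hE : ∀ j : ℕ, ∫ z in {z | 4 * s + j * L * s ≤ dist z y}, u z ^ 2 ≤
      (1 / 4) ^ j * ((1 + K) * pw d s * s ^ 2) := by
    intro j
    induction j with
    | zero =>
      simp only [Nat.cast_zero, zero_mul, add_zero, pow_zero, one_mul]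
      rw [← integral_indicator (measurableSet_far y (4 * s)), hsT]
      refine le_trans (b := ∫ z, (1 + K) * pw d s * u z) (integral_mono_ae
        (iu.indicator (measurableSet_far y (4 * s))) (iu1.const_mul _) ?_) ?_
      · filter_upwards [hnear] with z hz
        by_cases hx : z ∈ {z | 4 * s ≤ dist z y}
        · simp only [Set.indicator_of_mem hx]
          have := hz hx
          rw [sq]
          exact mul_le_mul_of_nonneg_right this (hs.nonneg z)
        · simp only [Set.indicator_of_notMem hx]
          have := hs.nonneg z
          positivity
      · rw [integral_const_mul]
        gcongr
    | succ j ih =>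
      have h1 := hext d lam a b T g u U y (4 * s + j * L * s) (L * s) ha hT hs.toSol
        (by positivity) (by positivity) fun z hz => hg z (by
          have : 0 ≤ j * L * s := by positivity
          linarith)
      have e1 : 4 * s + j * L * s + L * s = 4 * s + (j + 1 : ℕ) * L * s := by push_cast; ring
      rw [e1] at h1
      have h2 : 0 ≤ lam / 2 * ∫ z in {z | 4 * s + (j + 1 : ℕ) * L * s ≤ dist z y}, ‖U z‖ ^ 2 :=
        mul_nonneg (by positivity) (integral_nonneg fun x => sq_nonneg _)
      have e2 : Kc / (lam * (L * s) ^ 2) = T⁻¹ * (Kc / (lam * L ^ 2)) := by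
        rw [← hsT]; field_simp
      set I1 := ∫ z in {z | 4 * s + (j + 1 : ℕ) * L * s ≤ dist z y}, u z ^ 2
      set I0 := ∫ z in {z | 4 * s + j * L * s ≤ dist z y}, u z ^ 2
      have hI0 : 0 ≤ I0 := integral_nonneg fun x => sq_nonneg _
      have h3 : T⁻¹ * I1 ≤ T⁻¹ * (Kc / (lam * L ^ 2) * I0) := by rw [e2] at h1; linarith
      have h4 : I1 ≤ Kc / (lam * L ^ 2) * I0 := le_of_mul_le_mul_left h3 (by positivity)
      calc I1 ≤ 1 / 4 * I0 := h4.trans (by gcongr)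
        _ ≤ 1 / 4 * ((1 / 4) ^ j * ((1 + K) * pw d s * s ^ 2)) := by gcongr
        _ = _ := by rw [pow_succ]; ring
  have h24 : ∀ j : ℕ, ((1:ℝ) / 4) ^ j = ((1 / 2) ^ j) ^ 2 := fun j => by
    rw [← pow_mul, mul_comm j 2, pow_mul]; norm_num
  intro j
  set q := ((1:ℝ) / 2) ^ j with hq
  have hq0 : 0 < q := by positivity
  have hq1 : q ≤ 1 := pow_le_one₀ (by norm_num) (by norm_num)
  constructor
  · refine ae_of_locally (B := {z | 5 * s + j * L * s ≤ dist z y}) fun x hx =>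
      ⟨s / 2, by positivity, ?_⟩
    have hx' : 5 * s + j * L * s ≤ dist x y := hx
    have hjL : 0 ≤ j * L * s := by positivity
    have hfar : ∀ z ∈ ball x s, 4 * s + j * L * s ≤ dist z y := fun z hz => by
      have h1 : dist z x < s := hz
      have h3 := dist_triangle x z y
      rw [dist_comm x z] at h3
      linarith
    have := hDG u U x 0 0 s (Q * (q * pw d s)) hs.h1 (hs.dg_zero ha hT hs.nonneg (fun z hz =>
      hg z (by linarith [hfar z hz])) 0) hs0 (by positivity) le_rfl (by rw [zero_mul]; positivity) ?_
    · filter_upwards [this] with z hz hz'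
      have h1 := hz hz'
      have h2 : 0 ≤ 2 * (1 + K) / lam * (q * pw d s) := by positivity
      linarith
    · have h1 : ∫ z in ball x s, max (u z - 0) 0 ^ 2 ≤ q ^ 2 * ((1 + K) * pw d s * s ^ 2) := by
        rw [← h24]
        refine le_trans ?_ (hE j)
        have : ∀ z, max (u z - 0) 0 ^ 2 = u z ^ 2 := fun z => by
          rw [sub_zero, max_eq_left (hs.nonneg z)]
        simp only [this]
        exact setIntegral_mono_set iu.integrableOn (ae_of_all _ fun x => sq_nonneg _)
          (Eventually.of_forall hfar)
      rw [sq_eq_pow_mul_pw (d := d) hs0] at h1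
      have h2 : 4 * (1 + K) ≤ ε0 ^ d * Q ^ 2 := by
        have e : ε0 ^ d * (4 * (1 + K) / ε0 ^ d) = 4 * (1 + K) := by field_simp
        have h3 : 4 * (1 + K) ≤ ε0 ^ d * Q := by
          rw [hQ, mul_add (ε0 ^ d), e]; have : 0 < ε0 ^ d := by positivity
          linarith
        refine h3.trans ?_
        gcongr
        nlinarith
      calc 4 * ∫ z in ball x s, max (u z - 0) 0 ^ 2
          ≤ 4 * (q ^ 2 * ((1 + K) * pw d s * (s ^ d * pw d s))) := by linarith
        _ = (4 * (1 + K)) * (s ^ d * (q * pw d s) ^ 2) := by ring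
        _ ≤ (ε0 ^ d * Q ^ 2) * (s ^ d * (q * pw d s) ^ 2) := by gcongr
        _ = _ := by rw [mul_pow ε0 s d]; ring
  · have hcase : ∫ z in {z | 4 * s + j * L * s ≤ dist z y}, ‖U z‖ ^ 2 ≤
        2 * (1 + K) / lam * (q * pw d s) := by
      rcases j with _ | j
      · simp only [Nat.cast_zero, zero_mul, add_zero]
        have hb := hs.band_zero ha hT hs.nonneg hs.g_nonneg hs.g_int hs.g_mass
          (l := (1 + K) * pw d s) (by positivity)
        have h1 : ∫ z in {z | 4 * s ≤ dist z y}, ‖U z‖ ^ 2 ≤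
            ∫ z in {z | u z ≤ (1 + K) * pw d s}, ‖U z‖ ^ 2 :=
          setIntegral_mono_set iU.integrableOn (ae_of_all _ fun x => sq_nonneg _) (by
            filter_upwards [hnear] with z hz using hz)
        have hq' : q = 1 := by simp [hq]
        rw [hq', one_mul, div_mul_eq_mul_div, le_div_iff₀ hl]
        have : 0 ≤ (1 + K) * pw d s := by positivity
        nlinarith
      · have h1 := hext d lam a b T g u U y (4 * s + j * L * s) (L * s) ha hT hs.toSol
          (by positivity) (by positivity) fun z hz => hg z (by
            have : 0 ≤ j * L * s := by positivity
            linarith)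
        have e1 : 4 * s + j * L * s + L * s = 4 * s + (j + 1 : ℕ) * L * s := by push_cast; ring
        rw [e1] at h1
        have h2 : 0 ≤ T⁻¹ * ∫ z in {z | 4 * s + (j + 1 : ℕ) * L * s ≤ dist z y}, u z ^ 2 :=
          mul_nonneg (by positivity) (integral_nonneg fun x => sq_nonneg _)
        have e2 : Kc / (lam * (L * s) ^ 2) = T⁻¹ * (Kc / (lam * L ^ 2)) := by
          rw [← hsT]; field_simp
        have h3 : T⁻¹ * (Kc / (lam * L ^ 2)) * (∫ z in {z | 4 * s + j * L * s ≤ dist z y}, u z ^ 2) ≤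
            T⁻¹ * (1 / 4) * ((1 / 4) ^ j * ((1 + K) * pw d s * s ^ 2)) := by
          have := hE j
          gcongr
        have h4 : T⁻¹ * (1 / 4) * ((1 / 4) ^ j * ((1 + K) * pw d s * s ^ 2)) =
            q ^ 2 * ((1 + K) * pw d s) := by
          rw [hq, ← h24, pow_succ (1 / 4 : ℝ) j, ← hsT]; field_simp
        rw [e2] at h1
        rw [div_mul_eq_mul_div, le_div_iff₀ hl]
        have h5 : q ^ 2 * ((1 + K) * pw d s) ≤ q * ((1 + K) * pw d s) := by
          gcongr; nlinarith
        linarith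
    refine hcase.trans ?_
    have : 0 ≤ Q * (q * pw d s) := by positivity
    linarith

theorem pw_two {m : ℝ} (hm : 0 < m) : pw 2 m = 1 := by unfold pw; field_simp

theorem rpow_two_sub {r : ℝ} (hr : 0 < r) : r ^ ((2:ℝ) - (d:ℝ)) = pw d r := by
  unfold pw
  rw [Real.rpow_sub hr, Real.rpow_natCast, Real.rpow_two]

theorem half_le_log {t : ℝ} (ht : 0 ≤ t) : 1 / 2 ≤ Real.log (2 + t) := by
  have h1 : Real.log 2 ≤ Real.log (2 + t) := Real.log_le_log (by norm_num) (by linarith)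
  linarith [Real.log_two_gt_d9]

/-- The singular factor of the pointwise bound. -/
def sing (d : ℕ) (s r : ℝ) : ℝ := if d = 2 then Real.log (2 + s / r) else pw d r

theorem gBound_eq {c T r : ℝ} (hr : 0 < r) :
    gBound d c T r = Real.exp (-(c * r) / √T) * sing d (√T) r := by
  unfold gBound sing
  rw [rpow_two_sub hr]

theorem pw_le_sing {s r : ℝ} (hs : 0 < s) (hr : 0 < r) : pw d r ≤ 2 * sing d s r := by
  unfold sing
  split_ifs with h
  · subst h
    rw [pw_two hr]
    linarith [half_le_log (t := s / r) (by positivity)]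
  · have := pw_pos (d := d) hr
    linarith

theorem sing_pos {s r : ℝ} (hs : 0 < s) (hr : 0 < r) : 0 < sing d s r := by
  have := pw_le_sing (d := d) hs hr
  have := pw_pos (d := d) hr
  linarith

theorem pw_le_of_le (hd : 2 ≤ d) {N m r : ℝ} (hN : 0 < N) (hr : 0 < r) (h : r ≤ N * m) :
    pw d m ≤ pw d N⁻¹ * pw d r := by
  rw [mul_comm, ← pw_mul]
  refine pw_anti hd (by positivity) ?_
  rw [← div_eq_mul_inv, div_le_iff₀ hN]; linarith

theorem lev_le_sing (hd : 2 ≤ d) {C K : ℝ} (hC : 0 < C) (hK : 1 ≤ K) : ∃ C', 0 < C' ∧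
    ∀ (s r : ℝ) (i : ℕ), 0 < s → 0 < r → r ≤ 20 * (s * (1 / 2) ^ i) →
      lev d C s i + K * pw d (s * (1 / 2) ^ i) ≤ C' * sing d s r := by
  rcases hd.eq_or_lt with rfl | hd3
  · refine ⟨2 * (1 + K) + 12 * C, by positivity, fun s r i hs hr h => ?_⟩
    have hm : 0 < s * (1 / 2) ^ i := by positivity
    have h1 := lev_le hC hs i hd
    rw [pw_two hm] at h1 ⊢
    unfold sing
    rw [if_pos rfl]
    set l := Real.log (2 + s / r) with hl
    have h2 : 1 / 2 ≤ l := half_le_log (by positivity)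
    have hlog2 : 1 / 2 ≤ Real.log 2 := by linarith [Real.log_two_gt_d9]
    have h3 : (i : ℝ) * Real.log 2 ≤ 6 * l := by
      rw [← Real.log_rpow (by norm_num), Real.rpow_natCast]
      have h4 : (2:ℝ) ^ i ≤ 20 * (s / r) := by
        rw [mul_div_assoc', le_div_iff₀ hr]
        have : (2:ℝ) ^ i * (1 / 2) ^ i = 1 := by rw [← mul_pow]; norm_num
        calc (2:ℝ) ^ i * r ≤ 2 ^ i * (20 * (s * (1 / 2) ^ i)) := by gcongr
          _ = 20 * s * (2 ^ i * (1 / 2) ^ i) := by ring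
          _ = _ := by rw [this, mul_one]
      have hsr : 0 < s / r := by positivity
      calc Real.log (2 ^ i) ≤ Real.log (2 ^ 5 * (2 + s / r)) := by
            refine Real.log_le_log (by positivity) (h4.trans ?_)
            norm_num; linarith
        _ = 5 * Real.log 2 + l := by
            rw [Real.log_mul (by positivity) (by positivity), Real.log_pow]; norm_num [hl]
        _ ≤ 6 * l := by
            have : Real.log 2 ≤ l := Real.log_le_log (by norm_num) (by linarith)
            linarith
    have h5 : (i : ℝ) ≤ 12 * l := by
      have : (0:ℝ) ≤ i := Nat.cast_nonneg i
      nlinarith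
    nlinarith
  · refine ⟨(1 + C + K) * pw d 20⁻¹, mul_pos (by linarith) (pw_pos (by norm_num)),
      fun s r i hs hr h => ?_⟩
    have h1 := lev_le_of_three hC hs i hd3
    have h2 := pw_le_of_le hd (N := 20) (by norm_num) hr h
    unfold sing
    rw [if_neg (by omega)]
    have : (1 + C + K) * pw d (s * (1 / 2) ^ i) ≤ (1 + C + K) * (pw d 20⁻¹ * pw d r) := by gcongr
    linarith

theorem exp_le_exp_of_le {c c' r s : ℝ} (h : c ≤ c') (hr : 0 < r) (hs : 0 < s) :
    Real.exp (-(c' * r) / s) ≤ Real.exp (-(c * r) / s) := by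
  gcongr

theorem one_le_exp_mul {c r s N : ℝ} (hc : 0 < c) (hs : 0 < s) (h : r ≤ N * s) :
    1 ≤ Real.exp (c * N) * Real.exp (-(c * r) / s) := by
  rw [← Real.exp_add]
  refine Real.one_le_exp ?_
  have : c * r / s ≤ c * N := by rw [div_le_iff₀ hs]; nlinarith
  rw [neg_div]; linarith

/-- Uniform bounds for solutions with concentrated right-hand side. -/
theorem exists_green_bound (hd : 2 ≤ d) {lam : ℝ} (hl : 0 < lam) : ∃ c C : ℝ, 0 < c ∧ 0 < C ∧
    ∀ (a b : E d → E d →ₗ[ℝ] E d) (T : ℝ) (g u : E d → ℝ) (U : E d → E d) (y : E d) (ε : ℝ),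
      Coef lam a b → 0 < T → PSol a T g u U → (∀ z, ε ≤ dist z y → g z = 0) →
      ε ≤ √T → ∀ r, 0 < r → 20 * ε ≤ r →
        (∀ᵐ z, r / 2 ≤ dist z y → u z ≤ C * gBound d c T r) ∧
        ∫ z in {z | r < dist z y ∧ dist z y < 2 * r}, ‖U z‖ ^ 2 ≤
          C * Real.exp (-(c * r) / √T) ^ 2 * pw d r := by
  obtain ⟨C0, K, hC0, hK, hnear⟩ := exists_near hd hl
  obtain ⟨C1, hC1, hng⟩ := exists_near_grad hd hl
  obtain ⟨L, C2, hL, hC2, hfar⟩ := exists_far hd hl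
  obtain ⟨C3, hC3, hsing⟩ := lev_le_sing hd hC0 hK
  obtain ⟨c5, C5, hc5, hC5, hd5⟩ := exp_decay (d := d) hL (β := 5) (by norm_num)
  obtain ⟨c4, C4, hc4, hC4, hd4⟩ := exp_decay (d := d) hL (β := 4) (by norm_num)
  have hp2 : 0 < pw d 2⁻¹ := pw_pos (by norm_num)
  have hp10 : 0 < pw d 10⁻¹ := pw_pos (by norm_num)
  set c := min (c5 / 2) (c4 / 2) with hc
  have hc0 : 0 < c := lt_min (by positivity) (by positivity)
  set CA := C3 * Real.exp (c * 20) with hCA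
  set CB := C2 * C5 * pw d 2⁻¹ * 2 with hCB
  set CD := C1 * pw d 10⁻¹ * Real.exp (c * 10) ^ 2 with hCD
  set CE := C2 * C4 with hCE
  have hCA0 : 0 < CA := by positivity
  have hCB0 : 0 < CB := by positivity
  have hCD0 : 0 < CD := by positivity
  have hCE0 : 0 < CE := by positivity
  refine ⟨c, CA + CB + CD + CE, hc0, by positivity,
    fun a b T g u U y ε ha hT h hg hεT r hr hε => ?_⟩
  have hs : 0 < √T := Real.sqrt_pos.2 hT
  set s := √T with hs'
  have hpr := pw_pos (d := d) hr
  have hsi := sing_pos (d := d) hs hr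
  constructor
  · rw [gBound_eq hr]
    set X := Real.exp (-(c * r) / s) with hX
    have hX0 : 0 < X := Real.exp_pos _
    suffices hh : ∀ᵐ z, r / 2 ≤ dist z y → u z ≤ (CA + CB) * (X * sing d s r) by
      filter_upwards [hh] with z hz hz'
      exact (hz hz').trans (mul_le_mul_of_nonneg_right (by linarith) (by positivity))
    rcases le_total r (20 * s) with hrs | hrs
    · obtain ⟨i, hi1, hi2⟩ := exists_scale (A := 8) (N := 20) (by norm_num) (by norm_num) hs hr hrs
      filter_upwards [hnear a b T g u U y ε ha hT h hg i (by linarith)] with z hz hz'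
      refine (hz (by linarith)).trans ((hsing s r i hs hr hi2).trans ?_)
      have h1 := one_le_exp_mul hc0 hs hrs
      calc C3 * sing d s r ≤ C3 * sing d s r * (Real.exp (c * 20) * X) :=
            le_mul_of_one_le_right (by positivity) h1
        _ = CA * (X * sing d s r) := by rw [hCA]; ring
        _ ≤ _ := mul_le_mul_of_nonneg_right (le_add_of_nonneg_right hCB0.le) (by positivity)
    · obtain ⟨j, hj1, hj2⟩ := hd5 s (r / 2) hs (by linarith)
      filter_upwards [(hfar a b T g u U y ε ha hT h hg hεT j).1] with z hz hz'
      refine (hz (by linarith)).trans ?_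
      have h1 : pw d (r / 2) = pw d 2⁻¹ * pw d r := by rw [div_eq_mul_inv, pw_mul]; ring
      have h2 : Real.exp (-(c5 * (r / 2)) / s) ≤ X := by
        have : c5 * (r / 2) = c5 / 2 * r := by ring
        rw [this]
        exact exp_le_exp_of_le (min_le_left _ _) hr hs
      have h3 := pw_le_sing (d := d) hs hr
      calc C2 * ((1 / 2) ^ j * pw d s) ≤ C2 * (C5 * X * (pw d 2⁻¹ * pw d r)) := by
            refine mul_le_mul_of_nonneg_left (hj2.trans ?_) hC2.le
            rw [h1]; gcongr
        _ ≤ C2 * (C5 * X * (pw d 2⁻¹ * (2 * sing d s r))) := by gcongr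
        _ = CB * (X * sing d s r) := by rw [hCB]; ring
        _ ≤ _ := mul_le_mul_of_nonneg_right (by linarith) (by positivity)
  · set X := Real.exp (-(c * r) / s) with hX
    have hX0 : 0 < X := Real.exp_pos _
    suffices hh : ∫ z in {z | r < dist z y ∧ dist z y < 2 * r}, ‖U z‖ ^ 2 ≤
        (CD + CE) * (X ^ 2 * pw d r) by
      refine hh.trans ?_
      rw [mul_assoc]
      exact mul_le_mul_of_nonneg_right (by linarith) (by positivity)
    have iU : Integrable fun x => ‖U x‖ ^ 2 := h.h1.lU.integrable_norm_pow two_ne_zero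
    rcases le_total r (10 * s) with hrs | hrs
    · obtain ⟨i, hi1, hi2⟩ := exists_scale (A := 5) (N := 10) (by norm_num) (by norm_num) hs hr hrs
      have h1 := hng a b T g u U y ε ha hT h hg i (by linarith)
      have h2 := pw_le_of_le hd (N := 10) (by norm_num) hr hi2
      have h3 := one_le_exp_mul hc0 hs hrs
      refine (setIntegral_mono_set iU.integrableOn (ae_of_all _ fun x => sq_nonneg _)
        (Eventually.of_forall fun z hz => ?_)).trans (h1.trans ?_)
      · have hz1 : r < dist z y := hz.1
        have hz2 : dist z y < 2 * r := hz.2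
        exact ⟨by linarith, by linarith⟩
      · calc C1 * pw d (s * (1 / 2) ^ i) ≤ C1 * (pw d 10⁻¹ * pw d r) := by gcongr
          _ ≤ C1 * (pw d 10⁻¹ * pw d r) * (Real.exp (c * 10) * X) ^ 2 :=
            le_mul_of_one_le_right (by positivity) (one_le_pow₀ h3)
          _ = CD * (X ^ 2 * pw d r) := by rw [hCD]; ring
          _ ≤ _ := mul_le_mul_of_nonneg_right (le_add_of_nonneg_right hCE0.le) (by positivity)
    · obtain ⟨j, hj1, hj2⟩ := hd4 s r hs (by linarith)
      have h1 := (hfar a b T g u U y ε ha hT h hg hεT j).2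
      refine (setIntegral_mono_set iU.integrableOn (ae_of_all _ fun x => sq_nonneg _)
        (Eventually.of_forall fun z hz => ?_)).trans (h1.trans ?_)
      · have hz1 : r < dist z y := hz.1
        exact (hj1.trans hz1.le : _ ≤ _)
      · have h2 : Real.exp (-(c4 * r) / s) ≤ X ^ 2 := by
          rw [hX, ← Real.exp_nat_mul]
          refine Real.exp_le_exp.2 ?_
          have : c ≤ c4 / 2 := min_le_right _ _
          have h3 : ((2:ℕ):ℝ) * (-(c * r) / s) = -(2 * c * r) / s := by push_cast; ring
          rw [h3]
          gcongr
          linarith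
        calc C2 * ((1 / 2) ^ j * pw d s) ≤ C2 * (C4 * X ^ 2 * pw d r) := by
              refine mul_le_mul_of_nonneg_left (hj2.trans ?_) hC2.le
              gcongr
          _ = CE * (X ^ 2 * pw d r) := by rw [hCE]; ring
          _ ≤ _ := mul_le_mul_of_nonneg_right (by linarith) (by positivity)

/-- Uniform smallness of the mass and the gradient on high superlevel sets. -/
theorem exists_tail (hd : 2 ≤ d) {lam T : ℝ} (hl : 0 < lam) (hT : 0 < T) :
    ∃ (B : ℝ) (κ : ℕ → ℝ), 0 < B ∧ (∀ j, 0 < κ j) ∧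
    ∀ (a b : E d → E d →ₗ[ℝ] E d) (g u : E d → ℝ) (U : E d → E d), Coef lam a b →
      PSol a T g u U → ∀ j : ℕ,
      ∫⁻ x in {x | κ j < u x}, (ENNReal.ofReal (u x) + ENNReal.ofReal ‖U x‖) ≤
        ENNReal.ofReal (B * (1 / 2) ^ j) := by
  obtain ⟨C, hC0, hC⟩ := exists_levelC hd hl
  have hs : 0 < √T := Real.sqrt_pos.2 hT
  set s := √T with hs'
  have hC' : 0 < C / lam := by positivity
  set B0 := (1 + 2 * C) * 2 ^ d * s ^ 2 + (C / lam + 1) * s with hB0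
  have hB00 : 0 < B0 := by positivity
  refine ⟨2 * B0, lev d C s, by positivity, fun j => lev_pos hC0 hs j,
    fun a b g u U ha h j => ?_⟩
  have hvol := hC a b T g u U ha hT h
  rw [← hs'] at hvol
  set κ := lev d C s with hκ
  have iU : Integrable fun x => ‖U x‖ ^ 2 := h.h1.lU.integrable_norm_pow two_ne_zero
  set Bd : ℕ → Set (E d) := fun i => {x | κ i < u x ∧ u x ≤ κ (i + 1)} with hBd
  have mBd : ∀ i, MeasurableSet (Bd i) := fun i =>
    (measurableSet_lt measurable_const h.h1.mu).inter (measurableSet_le h.h1.mu measurable_const)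
  set N : Set (E d) := ⋂ i, {x | κ i < u x} with hN
  have hN0 : volume N = 0 := by
    have ht : Tendsto (fun i : ℕ => ENNReal.ofReal ((s * (1 / 2) ^ i) ^ d)) atTop (𝓝 0) := by
      rw [← ENNReal.ofReal_zero]
      refine ENNReal.tendsto_ofReal ?_
      have h1 : Tendsto (fun i : ℕ => (s * (1 / 2) ^ i) ^ d) atTop (𝓝 ((s * 0) ^ d)) :=
        ((_root_.tendsto_pow_atTop_nhds_zero_of_lt_one (by norm_num) (by norm_num)).const_mul s).pow d
      rwa [mul_zero, zero_pow (by omega)] at h1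
    exact le_antisymm (ge_of_tendsto' ht fun i =>
      (measure_mono (Set.iInter_subset _ i)).trans (hvol i)) bot_le
  have hsub : {x | κ j < u x} ⊆ N ∪ ⋃ i : ℕ, Bd (j + i) := by
    intro x hx
    by_cases hxN : x ∈ N
    · exact Or.inl hxN
    · right
      simp only [hN, Set.mem_iInter, Set.mem_ofPred_eq, not_forall, not_lt] at hxN
      classical
      have hj : ∃ i, u x ≤ κ (j + i + 1) := by
        obtain ⟨i, hi⟩ := hxN
        have hmono : Monotone κ := monotone_nat_of_le_succ fun n => by
          rw [hκ, lev_succ]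
          have := pw_pos (d := d) (m := s * (1 / 2) ^ n) (by positivity)
          nlinarith
        exact ⟨i, hi.trans (hmono (by omega))⟩
      refine Set.mem_iUnion.2 ⟨Nat.find hj, ?_, Nat.find_spec hj⟩
      rcases hf : Nat.find hj with _ | i
      · exact hx
      · have := Nat.find_min hj (m := i) (by omega)
        rw [not_le] at this
        exact this
  have hband : ∀ i, ∫⁻ x in Bd i, (ENNReal.ofReal (u x) + ENNReal.ofReal ‖U x‖) ≤
      ENNReal.ofReal (B0 * (1 / 2) ^ i) := fun i => by
    have hm : 0 < s * (1 / 2) ^ i := by positivity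
    have hpm := pw_pos (d := d) hm
    have hκ0 : 0 < κ i := lev_pos hC0 hs i
    have hv : volume (Bd i) ≤ ENNReal.ofReal ((s * (1 / 2) ^ i) ^ d) :=
      (measure_mono fun x hx => hx.1).trans (hvol i)
    have hvf : volume (Bd i) ≠ ∞ := (hv.trans_lt ENNReal.ofReal_lt_top).ne
    have hvr : volume.real (Bd i) ≤ (s * (1 / 2) ^ i) ^ d :=
      ENNReal.toReal_le_of_le_ofReal (by positivity) hv
    rw [lintegral_add_left h.h1.mu.ennreal_ofReal]
    have p1 : ∫⁻ x in Bd i, ENNReal.ofReal (u x) ≤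
        ENNReal.ofReal ((1 + 2 * C) * 2 ^ d * s ^ 2 * (1 / 2) ^ i) := by
      calc ∫⁻ x in Bd i, ENNReal.ofReal (u x) ≤ ∫⁻ _x in Bd i, ENNReal.ofReal (κ (i + 1)) :=
            setLIntegral_mono measurable_const fun x hx => ENNReal.ofReal_le_ofReal hx.2
        _ = ENNReal.ofReal (κ (i + 1)) * volume (Bd i) := by rw [setLIntegral_const]
        _ ≤ ENNReal.ofReal (κ (i + 1)) * ENNReal.ofReal ((s * (1 / 2) ^ i) ^ d) := by gcongr
        _ = ENNReal.ofReal (κ (i + 1) * (s * (1 / 2) ^ i) ^ d) := by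
            rw [ENNReal.ofReal_mul (lev_pos hC0 hs _).le]
        _ ≤ _ := by
            refine ENNReal.ofReal_le_ofReal ?_
            have h1 := lev_le hC0 hs (i + 1) hd
            have h2 : pw d (s * (1 / 2) ^ (i + 1)) * (s * (1 / 2) ^ i) ^ d ≤
                2 ^ d * s ^ 2 * (1 / 4) ^ i := by
              have e : (s * (1 / 2) ^ i) ^ d = 2 ^ d * (s * (1 / 2) ^ (i + 1)) ^ d := by
                rw [← mul_pow, pow_succ]; congr 1; ring
              rw [e]
              unfold pw
              have hm' : 0 < s * (1 / 2) ^ (i + 1) := by positivity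
              calc (s * (1 / 2) ^ (i + 1)) ^ 2 / (s * (1 / 2) ^ (i + 1)) ^ d *
                  (2 ^ d * (s * (1 / 2) ^ (i + 1)) ^ d) = 2 ^ d * (s * (1 / 2) ^ (i + 1)) ^ 2 := by
                    field_simp
                _ = 2 ^ d * s ^ 2 * (1 / 4) ^ (i + 1) := by
                    rw [mul_pow, ← pow_mul, mul_comm (i + 1) 2, pow_mul (1 / 2 : ℝ)]; norm_num; ring
                _ ≤ _ := by
                    gcongr ?_ * ?_
                    rw [pow_succ]
                    have : (0:ℝ) < (1 / 4) ^ i := by positivity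
                    linarith
            have h3 : (1 + C * (i + 1 : ℕ)) * (1 / 4) ^ i ≤ (1 + 2 * C) * (1 / 2) ^ i := by
              have e : ((1:ℝ) / 4) ^ i = (1 / 2) ^ i * (1 / 2) ^ i := by rw [← mul_pow]; norm_num
              have e1 : ((i + 1 : ℕ) : ℝ) ≤ 2 ^ i := by exact_mod_cast Nat.lt_two_pow_self
              have e2 : (2:ℝ) ^ i * (1 / 2) ^ i = 1 := by rw [← mul_pow]; norm_num
              have e3 : ((1:ℝ) / 2) ^ i ≤ 1 := pow_le_one₀ (by norm_num) (by norm_num)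
              have e0 : (0:ℝ) < (1 / 2) ^ i := by positivity
              have e4 : ((i + 1 : ℕ) : ℝ) * (1 / 2) ^ i ≤ 1 :=
                (mul_le_mul_of_nonneg_right e1 e0.le).trans_eq e2
              rw [e, ← mul_assoc]
              gcongr
              nlinarith
            calc κ (i + 1) * (s * (1 / 2) ^ i) ^ d ≤
                (1 + C * (i + 1 : ℕ)) * pw d (s * (1 / 2) ^ (i + 1)) * (s * (1 / 2) ^ i) ^ d := by
                  gcongr
              _ = (1 + C * (i + 1 : ℕ)) * (pw d (s * (1 / 2) ^ (i + 1)) * (s * (1 / 2) ^ i) ^ d) := by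
                  ring
              _ ≤ (1 + C * (i + 1 : ℕ)) * (2 ^ d * s ^ 2 * (1 / 4) ^ i) := by gcongr
              _ = 2 ^ d * s ^ 2 * ((1 + C * (i + 1 : ℕ)) * (1 / 4) ^ i) := by ring
              _ ≤ 2 ^ d * s ^ 2 * ((1 + 2 * C) * (1 / 2) ^ i) := by gcongr
              _ = _ := by ring
    have p2 : ∫⁻ x in Bd i, ENNReal.ofReal ‖U x‖ ≤
        ENNReal.ofReal ((C / lam + 1) * s * (1 / 2) ^ i) := by
      have iUB : IntegrableOn (fun x => ‖U x‖) (Bd i) := by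
        have : IsFiniteMeasure (volume.restrict (Bd i)) := ⟨by
          rw [Measure.restrict_apply_univ]; exact hvf.lt_top⟩
        exact ((h.h1.lU.restrict (Bd i)).integrable one_le_two).norm
      rw [← ofReal_integral_eq_lintegral_ofReal iUB (ae_of_all _ fun x => norm_nonneg _)]
      refine ENNReal.ofReal_le_ofReal ?_
      have h1 := sq_setIntegral_norm_le hvf h.h1.lU
      have h2 : ∫ x in Bd i, ‖U x‖ ^ 2 ≤ C * pw d (s * (1 / 2) ^ i) / lam := by
        have f2 := h.band ha h.g_nonneg h.g_int h.g_mass hκ0.le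
          (l := C * pw d (s * (1 / 2) ^ i)) (by positivity)
        have f4 : 0 ≤ T⁻¹ * (∫ x, u x * min (max (u x - κ i) 0) (C * pw d (s * (1 / 2) ^ i))) :=
          mul_nonneg (by positivity) (integral_nonneg fun x => mul_nonneg (h.nonneg x)
            (le_min (le_max_right _ _) (by positivity)))
        have e : κ i + C * pw d (s * (1 / 2) ^ i) = κ (i + 1) := (lev_succ C s i).symm
        rw [e] at f2
        rw [le_div_iff₀ hl]; linarith
      have h0 : 0 ≤ ∫ x in Bd i, ‖U x‖ ^ 2 := integral_nonneg fun x => sq_nonneg _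
      refine le_of_sq_le_sq ?_ (by positivity)
      calc _ ≤ _ := h1
        _ ≤ (s * (1 / 2) ^ i) ^ d * (C * pw d (s * (1 / 2) ^ i) / lam) := by gcongr
        _ = C / lam * ((s * (1 / 2) ^ i) ^ d * pw d (s * (1 / 2) ^ i)) := by ring
        _ = C / lam * (s * (1 / 2) ^ i) ^ 2 := by rw [← sq_eq_pow_mul_pw hm]
        _ ≤ (C / lam + 1) ^ 2 * (s * (1 / 2) ^ i) ^ 2 := by gcongr; nlinarith
        _ = _ := by ring
    refine (add_le_add p1 p2).trans_eq ?_
    rw [← ENNReal.ofReal_add (by positivity) (by positivity)]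
    congr 1
    rw [hB0]; ring
  calc ∫⁻ x in {x | κ j < u x}, (ENNReal.ofReal (u x) + ENNReal.ofReal ‖U x‖)
      ≤ ∫⁻ x in N ∪ ⋃ i : ℕ, Bd (j + i), (ENNReal.ofReal (u x) + ENNReal.ofReal ‖U x‖) :=
        lintegral_mono_set hsub
    _ ≤ (∫⁻ x in N, (ENNReal.ofReal (u x) + ENNReal.ofReal ‖U x‖)) +
        ∫⁻ x in ⋃ i : ℕ, Bd (j + i), (ENNReal.ofReal (u x) + ENNReal.ofReal ‖U x‖) :=
        lintegral_union_le _ _ _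
    _ ≤ 0 + ∑' i : ℕ, ENNReal.ofReal (B0 * (1 / 2) ^ (j + i)) := by
        gcongr
        · rw [setLIntegral_measure_zero _ _ hN0]
        · exact (lintegral_iUnion_le _ _).trans (ENNReal.tsum_le_tsum fun i => hband (j + i))
    _ = ENNReal.ofReal (2 * B0 * (1 / 2) ^ j) := by
        rw [zero_add]
        have hsum : HasSum (fun i : ℕ => B0 * (1 / 2) ^ (j + i)) (2 * B0 * (1 / 2) ^ j) := by
          have := (hasSum_geometric_two).mul_left (B0 * (1 / 2) ^ j)
          have e : (fun i : ℕ => B0 * (1 / 2) ^ (j + i)) = fun i => B0 * (1 / 2) ^ j * (1 / 2) ^ i := by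
            ext i; rw [pow_add]; ring
          rw [e, show 2 * B0 * (1 / 2) ^ j = B0 * (1 / 2) ^ j * 2 by ring]
          exact this
        rw [← ENNReal.ofReal_tsum_of_nonneg (fun i => by positivity) hsum.summable, hsum.tsum_eq]

/-- Equi-integrability of solutions and their gradients. -/
theorem equi_integrable (hd : 2 ≤ d) {lam T : ℝ} (hl : 0 < lam) (hT : 0 < T) {δ : ℝ}
    (hδ : 0 < δ) : ∃ τ : ℝ, 0 < τ ∧
    ∀ (a b : E d → E d →ₗ[ℝ] E d) (g u : E d → ℝ) (U : E d → E d), Coef lam a b →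
      PSol a T g u U → ∀ S : Set (E d), MeasurableSet S → volume S ≤ ENNReal.ofReal τ →
      ∫⁻ x in S, (ENNReal.ofReal (u x) + ENNReal.ofReal ‖U x‖) ≤ ENNReal.ofReal δ := by
  obtain ⟨B, κ, hB, hκ, ht⟩ := exists_tail hd hl hT
  obtain ⟨j, hj⟩ := exists_pow_lt_of_lt_one (y := (1/2:ℝ)) (show 0 < δ / (2 * B) by positivity)
    (by norm_num)
  rw [lt_div_iff₀ (by positivity)] at hj
  have hk := hκ j
  set k := κ j
  set τ := min (δ / (4 * k)) (δ ^ 2 * lam / (16 * k)) with hτ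
  have hτ0 : 0 < τ := lt_min (by positivity) (by positivity)
  refine ⟨τ, hτ0, fun a b g u U ha h S hS hv => ?_⟩
  have m1 : MeasurableSet {x | k < u x} := measurableSet_lt measurable_const h.h1.mu
  have hvf : volume (S ∩ {x | k < u x}ᶜ) ≠ ∞ :=
    ((measure_mono Set.inter_subset_left).trans_lt (hv.trans_lt ENNReal.ofReal_lt_top)).ne
  have hvr : volume.real (S ∩ {x | k < u x}ᶜ) ≤ τ :=
    ENNReal.toReal_le_of_le_ofReal hτ0.le ((measure_mono Set.inter_subset_left).trans hv)
  have p0 : ∫⁻ x in S ∩ {x | k < u x}, (ENNReal.ofReal (u x) + ENNReal.ofReal ‖U x‖) ≤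
      ENNReal.ofReal (δ / 2) :=
    (lintegral_mono_set Set.inter_subset_right).trans ((ht a b g u U ha h j).trans
      (ENNReal.ofReal_le_ofReal (by linarith)))
  have p1 : ∫⁻ x in S ∩ {x | k < u x}ᶜ, ENNReal.ofReal (u x) ≤ ENNReal.ofReal (δ / 4) := by
    calc _ ≤ ∫⁻ _x in S ∩ {x | k < u x}ᶜ, ENNReal.ofReal k :=
          setLIntegral_mono measurable_const fun x hx => ENNReal.ofReal_le_ofReal (not_lt.1 hx.2)
      _ = ENNReal.ofReal k * volume (S ∩ {x | k < u x}ᶜ) := by rw [setLIntegral_const]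
      _ ≤ ENNReal.ofReal k * ENNReal.ofReal τ := by
          gcongr; exact (measure_mono Set.inter_subset_left).trans hv
      _ = ENNReal.ofReal (k * τ) := by rw [ENNReal.ofReal_mul hk.le]
      _ ≤ _ := by
          refine ENNReal.ofReal_le_ofReal ?_
          calc k * τ ≤ k * (δ / (4 * k)) := by gcongr; exact min_le_left _ _
            _ = δ / 4 := by field_simp
  have p2 : ∫⁻ x in S ∩ {x | k < u x}ᶜ, ENNReal.ofReal ‖U x‖ ≤ ENNReal.ofReal (δ / 4) := by
    have iUB : IntegrableOn (fun x => ‖U x‖) (S ∩ {x | k < u x}ᶜ) := by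
      have : IsFiniteMeasure (volume.restrict (S ∩ {x | k < u x}ᶜ)) := ⟨by
        rw [Measure.restrict_apply_univ]; exact hvf.lt_top⟩
      exact ((h.h1.lU.restrict _).integrable one_le_two).norm
    rw [← ofReal_integral_eq_lintegral_ofReal iUB (ae_of_all _ fun x => norm_nonneg _)]
    refine ENNReal.ofReal_le_ofReal ?_
    have h1 := sq_setIntegral_norm_le hvf h.h1.lU
    have h2 := h.band_zero ha hT h.nonneg h.g_nonneg h.g_int h.g_mass hk.le
    have iU : Integrable fun x => ‖U x‖ ^ 2 := h.h1.lU.integrable_norm_pow two_ne_zero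
    have h3 : ∫ x in S ∩ {x | k < u x}ᶜ, ‖U x‖ ^ 2 ≤ k / lam := by
      refine le_trans (setIntegral_mono_set (t := {x | u x ≤ k}) iU.integrableOn
        (ae_of_all _ fun x => sq_nonneg _) (Eventually.of_forall fun x hx => not_lt.1 hx.2)) ?_
      rw [le_div_iff₀ hl]; linarith
    refine le_of_sq_le_sq ?_ (by positivity)
    have h4 : 0 ≤ ∫ x in S ∩ {x | k < u x}ᶜ, ‖U x‖ ^ 2 := integral_nonneg fun x => sq_nonneg _
    calc _ ≤ _ := h1
      _ ≤ τ * (k / lam) := by gcongr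
      _ ≤ δ ^ 2 * lam / (16 * k) * (k / lam) := by gcongr; exact min_le_right _ _
      _ = (δ / 4) ^ 2 := by field_simp; ring
  rw [← lintegral_inter_add_sdiff _ S m1]
  refine (add_le_add p0
    (?_ : _ ≤ ENNReal.ofReal (δ / 4) + ENNReal.ofReal (δ / 4))).trans_eq ?_
  · rw [lintegral_add_left h.h1.mu.ennreal_ofReal]
    exact add_le_add p1 p2
  · rw [← ENNReal.ofReal_add (by positivity) (by positivity),
      ← ENNReal.ofReal_add (by positivity) (by positivity)]
    congr 1; ring

/-- Uniform modulus of continuity of solutions away from the support of the right-hand side. -/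
theorem exists_osc_modulus (hd : 2 ≤ d) {lam T : ℝ} (hl : 0 < lam) (hT : 0 < T) {r δ : ℝ}
    (hr : 0 < r) (hδ : 0 < δ) : ∃ ρ : ℝ, 0 < ρ ∧ ρ ≤ r ∧
    ∀ (a b : E d → E d →ₗ[ℝ] E d) (g u : E d → ℝ) (U : E d → E d) (x : E d), Coef lam a b →
      PSol a T g u U → (∀ z ∈ ball x r, g z = 0) →
      ∃ m, ∀ᵐ z, z ∈ ball x ρ → m ≤ u z ∧ u z ≤ m + δ := by
  obtain ⟨CL, hCL0, hCL⟩ := exists_levelC hd hl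
  obtain ⟨K, hK, hpt⟩ := exists_pointwise hd hl ⟨hCL0, hCL⟩
  obtain ⟨θ, C, hθ0, hθ1, hC, hosc⟩ := DG.osc hd (c1_nonneg hl)
  have hs : 0 < √T := Real.sqrt_pos.2 hT
  obtain ⟨i, hi⟩ := exists_pow_lt_of_lt_one (y := (1/2:ℝ)) (show 0 < r / (2 * √T) by positivity)
    (by norm_num)
  rw [lt_div_iff₀ (by positivity)] at hi
  set ρ0 := √T * (1 / 2) ^ i / 2 with hρ0
  have hρ00 : 0 < ρ0 := by positivity
  have hρr : ρ0 ≤ r := by rw [hρ0]; nlinarith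
  set M := lev d CL (√T) i + K * pw d (√T * (1 / 2) ^ i) with hM
  have hp := pw_pos (d := d) (m := √T * (1 / 2) ^ i) (by positivity)
  have hM0 : 0 < M := add_pos (lev_pos hCL0 hs i) (mul_pos (by linarith) hp)
  set N := M + C * (T⁻¹ * M) * ρ0 ^ 2 with hN
  have hN0 : 0 < N := by positivity
  obtain ⟨j, hj⟩ := exists_pow_lt_of_lt_one (show 0 < δ / N by positivity) hθ1
  rw [lt_div_iff₀ hN0] at hj
  refine ⟨ρ0 * (1 / 4) ^ j, by positivity,
    (mul_le_of_le_one_right hρ00.le (pow_le_one₀ (by norm_num) (by norm_num))).trans hρr,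
    fun a b g u U x ha h hg => ?_⟩
  have hb := hpt a b T g u U ha hT h i x fun z hz => hg z (ball_subset_ball (by linarith) hz)
  have hgB : ∀ z ∈ ball x ρ0, g z = 0 := fun z hz => hg z (ball_subset_ball hρr hz)
  obtain ⟨m, hm⟩ := hosc u U x (T⁻¹ * M) 0 M ρ0 h.h1
    (fun k => h.toSol.dg ha hgB (by positivity) (ae_of_all _ fun z _ => by
      have := h.nonneg z
      have h2 : 0 ≤ T⁻¹ * u z := by positivity
      have h3 : 0 < T⁻¹ * M := by positivity
      linarith) k)
    (fun k => h.toSol.neg.dg ha (fun z hz => by simp [hgB z hz]) (by positivity) (by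
      filter_upwards [hb] with z hz hz'
      have h2 : T⁻¹ * u z ≤ T⁻¹ * M := by gcongr; exact hz hz'
      simpa using h2) k)
    hρ00 hM0 (by positivity) (by
      filter_upwards [hb] with z hz hz'
      exact ⟨h.nonneg z, by rw [zero_add]; exact hz hz'⟩) j
  refine ⟨m, ?_⟩
  filter_upwards [hm] with z hz hz'
  exact ⟨(hz hz').1, (hz hz').2.trans (by linarith)⟩

theorem average_mem {f u : E d → ℝ} {S : Set (E d)} {m M : ℝ} (hf : MemLp f 2 volume)
    (hu : MemLp u 2 volume) (fi : Integrable f) (f0 : ∀ x, 0 ≤ f x) (f1 : ∫ x, f x = 1)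
    (fS : ∀ x ∉ S, f x = 0) (h : ∀ᵐ x, x ∈ S → m ≤ u x ∧ u x ≤ M) :
    m ≤ ∫ x, f x * u x ∧ ∫ x, f x * u x ≤ M := by
  have i1 : Integrable fun x => f x * u x := hf.integrable_mul hu
  constructor
  · calc m = ∫ x, f x * m := by rw [integral_mul_const, f1, one_mul]
      _ ≤ _ := integral_mono_ae (fi.mul_const m) i1 (by
          filter_upwards [h] with x hx
          by_cases hS : x ∈ S
          · exact mul_le_mul_of_nonneg_left (hx hS).1 (f0 x)
          · simp [fS x hS])
  · calc _ ≤ ∫ x, f x * M := integral_mono_ae i1 (fi.mul_const M) (by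
          filter_upwards [h] with x hx
          by_cases hS : x ∈ S
          · exact mul_le_mul_of_nonneg_left (hx hS).2 (f0 x)
          · simp [fS x hS])
      _ = M := by rw [integral_mul_const, f1, one_mul]

/-- A normalized solution whose right-hand side is square integrable and supported in `ball y ε`. -/
structure BSol (a : E d → E d →ₗ[ℝ] E d) (T : ℝ) (y : E d) (ε : ℝ) (g u : E d → ℝ)
    (U : E d → E d) : Prop extends PSol a T g u U where
  g_mem : MemLp g 2 volume
  g_supp : ∀ z ∉ ball y ε, g z = 0

theorem BSol.mono {a : E d → E d →ₗ[ℝ] E d} {T : ℝ} {y y' : E d} {ε ε' : ℝ} {g u : E d → ℝ}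
    {U : E d → E d} (h : BSol a T y ε g u U) (hs : dist y y' + ε ≤ ε') : BSol a T y' ε' g u U where
  toPSol := h.toPSol
  g_mem := h.g_mem
  g_supp z hz := h.g_supp z fun h' => hz (by
    rw [mem_ball] at h' ⊢
    linarith [dist_triangle z y y'])

/-- The normalized indicator function of a ball. -/
def bump (y : E d) (ε : ℝ) : E d → ℝ := (ball y ε).indicator fun _ => (volume.real (ball y ε))⁻¹

theorem integrable_bump (y : E d) (ε : ℝ) : Integrable (bump y ε) :=
  (integrable_indicator_iff measurableSet_ball).2 (integrableOn_const measure_ball_lt_top.ne)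

theorem memLp_bump (y : E d) (ε : ℝ) : MemLp (bump y ε) 2 volume :=
  memLp_indicator_const 2 measurableSet_ball _ (Or.inr measure_ball_lt_top.ne)

theorem bump_nonneg (y : E d) (ε : ℝ) (z : E d) : 0 ≤ bump y ε z :=
  Set.indicator_nonneg (fun _ _ => inv_nonneg.2 measureReal_nonneg) z

theorem integral_bump (y : E d) {ε : ℝ} (hε : 0 < ε) : ∫ z, bump y ε z = 1 := by
  unfold bump
  rw [integral_indicator measurableSet_ball, setIntegral_const, smul_eq_mul]
  refine mul_inv_cancel₀ ?_
  exact (ENNReal.toReal_pos (measure_ball_pos volume y hε).ne' measure_ball_lt_top.ne).ne'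

theorem exists_bsol {lam : ℝ} {a b : E d → E d →ₗ[ℝ] E d} (ha : Coef lam a b) {T : ℝ}
    (hT : 0 < T) (y : E d) {ε : ℝ} (hε : 0 < ε) : ∃ u U, BSol a T y ε (bump y ε) u U := by
  obtain ⟨u, U, h, h0⟩ := exists_sol_nonneg ha hT (memLp_bump y ε) (bump_nonneg y ε)
  exact ⟨u, U, ⟨h, h0, bump_nonneg y ε, integrable_bump y ε, integral_bump y hε⟩, memLp_bump y ε,
    fun z hz => Set.indicator_of_notMem hz _⟩

/-- Pairings of solutions with concentrated functions stabilize off the diagonal. -/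
theorem exists_pairing (hd : 2 ≤ d) {lam T : ℝ} (hl : 0 < lam) (hT : 0 < T) {r δ : ℝ}
    (hr : 0 < r) (hδ : 0 < δ) : ∃ ρ : ℝ, 0 < ρ ∧ ρ ≤ r ∧
    ∀ (a b : E d → E d →ₗ[ℝ] E d) (x y : E d), Coef lam a b → 2 * r ≤ dist x y →
      (∀ g u U g' u' U' f v V f' v' V', BSol a T y ρ g u U → BSol a T y ρ g' u' U' →
        BSol b T x ρ f v V → BSol b T x ρ f' v' V' →
        |(∫ z, f z * u z) - ∫ z, f' z * u' z| ≤ δ) ∧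
      (∀ g u U f v V, BSol a T y ρ g u U → BSol b T x ρ f v V →
        ∀ᵐ z, z ∈ ball x ρ → |u z - ∫ z, f z * u z| ≤ δ) := by
  obtain ⟨ρ, hρ, hρr, ho⟩ := exists_osc_modulus hd hl hT hr (half_pos hδ)
  refine ⟨ρ, hρ, hρr, fun a b x y ha hxy => ?_⟩
  have hdisj : ∀ z, z ∈ ball x r → z ∉ ball y ρ := fun z h1 h2 => by
    rw [mem_ball] at h1 h2
    have := dist_triangle_left x y z
    linarith
  have hdisj' : ∀ z, z ∈ ball y r → z ∉ ball x ρ := fun z h1 h2 => by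
    rw [mem_ball] at h1 h2
    have := dist_triangle_left x y z
    linarith
  constructor
  · intro g u U g' u' U' f v V f' v' V' hg hg' hf hf'
    obtain ⟨m, hm⟩ := ho a b g u U x ha hg.toPSol fun z hz => hg.g_supp z (hdisj z hz)
    obtain ⟨m', hm'⟩ := ho b a f' v' V' y ha.symm hf'.toPSol fun z hz => hf'.g_supp z (hdisj' z hz)
    have p1 := average_mem hf.g_mem hg.h1.lu hf.g_int hf.g_nonneg hf.g_mass hf.g_supp hm
    have p2 := average_mem hf'.g_mem hg.h1.lu hf'.g_int hf'.g_nonneg hf'.g_mass hf'.g_supp hm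
    have p3 := average_mem hg.g_mem hf'.h1.lu hg.g_int hg.g_nonneg hg.g_mass hg.g_supp hm'
    have p4 := average_mem hg'.g_mem hf'.h1.lu hg'.g_int hg'.g_nonneg hg'.g_mass hg'.g_supp hm'
    rw [hg.toSol.duality ha hf'.toSol] at p3
    rw [hg'.toSol.duality ha hf'.toSol] at p4
    rw [abs_le]
    constructor <;> linarith [p1.1, p1.2, p2.1, p2.2, p3.1, p3.2, p4.1, p4.2]
  · intro g u U f v V hg hf
    obtain ⟨m, hm⟩ := ho a b g u U x ha hg.toPSol fun z hz => hg.g_supp z (hdisj z hz)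
    have p1 := average_mem hf.g_mem hg.h1.lu hf.g_int hf.g_nonneg hf.g_mass hf.g_supp hm
    filter_upwards [hm] with z hz hz'
    have := hz hz'
    rw [abs_le]
    constructor <;> linarith [p1.1, p1.2]

/-- `G` is the off-diagonal limit of solutions with concentrating right-hand sides. -/
structure Ker (a : E d → E d →ₗ[ℝ] E d) (T : ℝ) (G : E d → E d → ℝ) : Prop where
  nonneg : ∀ x y, 0 ≤ G x y
  cont : ContinuousOn (fun p : E d × E d => G p.1 p.2) {p : E d × E d | p.1 ≠ p.2}
  lim : ∀ r δ : ℝ, 0 < r → 0 < δ → ∃ ρ > 0, ∀ x y, r ≤ dist x y → ∀ g u U,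
    BSol a T y ρ g u U → ∀ᵐ z, z ∈ ball x ρ → |u z - G z y| ≤ δ

theorem exists_ker (hd : 2 ≤ d) {lam T : ℝ} (hl : 0 < lam) (hT : 0 < T)
    {a b : E d → E d →ₗ[ℝ] E d} (ha : Coef lam a b) :
    ∃ G, Ker a T G ∧ Ker b T fun x y => G y x := by
  have hε : ∀ n : ℕ, (0:ℝ) < 1 / (n + 1) := fun n => by positivity
  choose u U hu using fun (n : ℕ) (y : E d) => exists_bsol ha hT y (hε n)
  choose v V hv using fun (n : ℕ) (y : E d) => exists_bsol ha.symm hT y (hε n)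
  set p : ℕ → E d → E d → ℝ := fun n x y => ∫ z, bump x (1 / (n + 1)) z * u n y z with hp
  have p0 : ∀ n x y, 0 ≤ p n x y := fun n x y =>
    integral_nonneg fun z => mul_nonneg (bump_nonneg _ _ z) ((hu n y).nonneg z)
  have hsmall : ∀ ρ : ℝ, 0 < ρ → ∃ N : ℕ, ∀ n ≥ N, (1:ℝ) / (n + 1) < ρ := fun ρ hρ => by
    obtain ⟨N, hN⟩ := exists_nat_one_div_lt hρ
    exact ⟨N, fun n hn => (Nat.one_div_le_one_div hn).trans_lt hN⟩
  have hcau : ∀ x y, x ≠ y → ∃ l, Tendsto (fun n => p n x y) atTop (𝓝 l) := by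
    intro x y hxy
    refine cauchySeq_tendsto_of_complete (Metric.cauchySeq_iff.2 fun δ hδ => ?_)
    obtain ⟨ρ, hρ, -, h⟩ := exists_pairing hd hl hT (r := dist x y / 2)
      (by have := dist_pos.2 hxy; linarith) (half_pos hδ)
    obtain ⟨N, hN⟩ := hsmall ρ hρ
    refine ⟨N, fun m hm n hn => ?_⟩
    have hm' := (hN m hm).le
    have hn' := (hN n hn).le
    have := (h a b x y ha (by linarith)).1 _ _ _ _ _ _ _ _ _ _ _ _
      ((hu m y).mono (y' := y) (by simpa using hm')) ((hu n y).mono (y' := y) (by simpa using hn'))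
      ((hv m x).mono (y' := x) (by simpa using hm')) ((hv n x).mono (y' := x) (by simpa using hn'))
    rw [Real.dist_eq]
    exact this.trans_lt (by linarith)
  classical
  choose! l hlim using hcau
  set G : E d → E d → ℝ := fun x y => if x = y then 0 else l x y with hG
  have hGlim : ∀ x y, x ≠ y → Tendsto (fun n => p n x y) atTop (𝓝 (G x y)) := fun x y hxy => by
    rw [hG]; simp only [if_neg hxy]; exact hlim x y hxy
  have hG0 : ∀ x y, 0 ≤ G x y := fun x y => by
    by_cases hxy : x = y
    · simp [hG, hxy]
    · exact ge_of_tendsto' (hGlim x y hxy) fun n => p0 n x y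
  have hclose : ∀ r δ : ℝ, 0 < r → 0 < δ → ∃ ρ, 0 < ρ ∧ ∀ x y, 2 * r ≤ dist x y →
      (∀ g u U f v V, BSol a T y ρ g u U → BSol b T x ρ f v V → ∀ x' ∈ ball x ρ, ∀ y' ∈ ball y ρ,
        |(∫ z, f z * u z) - G x' y'| ≤ δ) := by
    intro r δ hr hδ
    obtain ⟨ρ, hρ, hρr, h⟩ := exists_pairing hd hl hT hr hδ
    refine ⟨ρ, hρ, fun x y hxy g w W f q Q hg hf x' hx' y' hy' => ?_⟩
    rw [mem_ball] at hx' hy'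
    have hne : x' ≠ y' := by
      rintro rfl
      have := dist_triangle_left x y x'
      linarith
    refine le_of_tendsto ((tendsto_const_nhds.sub (hGlim x' y' hne)).abs) ?_
    obtain ⟨N1, h1⟩ := hsmall (ρ - dist x' x) (by linarith)
    obtain ⟨N2, h2⟩ := hsmall (ρ - dist y' y) (by linarith)
    filter_upwards [eventually_ge_atTop (max N1 N2)] with n hn
    have e1 := h1 n ((le_max_left _ _).trans hn)
    have e2 := h2 n ((le_max_right _ _).trans hn)
    exact (h a b x y ha hxy).1 _ _ _ _ _ _ _ _ _ _ _ _ hg ((hu n y').mono (by linarith)) hf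
      ((hv n x').mono (by linarith))
  have hcont : ContinuousOn (fun p : E d × E d => G p.1 p.2) {p : E d × E d | p.1 ≠ p.2} := by
    rintro ⟨x, y⟩ hxy
    have hxy' : 0 < dist x y := dist_pos.2 hxy
    refine ContinuousAt.continuousWithinAt (Metric.continuousAt_iff'.2 fun δ hδ => ?_)
    obtain ⟨ρ, hρ, h⟩ := hclose (dist x y / 2) (δ / 3) (by linarith) (by linarith)
    obtain ⟨w, W, hw⟩ := exists_bsol ha hT y hρ
    obtain ⟨q, Q, hq⟩ := exists_bsol ha.symm hT x hρ
    have hm : ball x ρ ×ˢ ball y ρ ∈ 𝓝 (x, y) := prod_mem_nhds (ball_mem_nhds x hρ)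
      (ball_mem_nhds y hρ)
    filter_upwards [hm] with ⟨x', y'⟩ hp'
    have e1 := h x y (by linarith) _ _ _ _ _ _ hw hq x' hp'.1 y' hp'.2
    have e2 := h x y (by linarith) _ _ _ _ _ _ hw hq x (mem_ball_self hρ) y (mem_ball_self hρ)
    rw [Real.dist_eq]
    rw [abs_le] at e1 e2
    rw [abs_lt]
    constructor <;> linarith [e1.1, e1.2, e2.1, e2.2]
  refine ⟨G, ⟨hG0, hcont, fun r δ hr hδ => ?_⟩, ⟨fun x y => hG0 y x, ?_, fun r δ hr hδ => ?_⟩⟩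
  · obtain ⟨ρ1, hρ1, h1⟩ := hclose (r / 2) (δ / 2) (by linarith) (by linarith)
    obtain ⟨ρ2, hρ2, -, h2⟩ := exists_pairing hd hl hT (r := r / 2) (by linarith) (half_pos hδ)
    have hρ : 0 < min ρ1 ρ2 := lt_min hρ1 hρ2
    refine ⟨min ρ1 ρ2, hρ, fun x y hxy g w W hg => ?_⟩
    obtain ⟨q, Q, hq⟩ := exists_bsol ha.symm hT x hρ
    have k1 : dist y y + min ρ1 ρ2 ≤ ρ1 := by simp
    have k2 : dist y y + min ρ1 ρ2 ≤ ρ2 := by simp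
    have k1' : dist x x + min ρ1 ρ2 ≤ ρ1 := by simp
    have k2' : dist x x + min ρ1 ρ2 ≤ ρ2 := by simp
    filter_upwards [(h2 a b x y ha (by linarith)).2 _ _ _ _ _ _ (hg.mono k2) (hq.mono k2')] with z hz hz'
    have e1 := hz (ball_subset_ball (min_le_right _ _) hz')
    have e2 := h1 x y (by linarith) _ _ _ _ _ _ (hg.mono k1) (hq.mono k1') z
      (ball_subset_ball (min_le_left _ _) hz') y (mem_ball_self hρ1)
    rw [abs_le] at e1 e2 ⊢
    constructor <;> linarith [e1.1, e1.2, e2.1, e2.2]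
  · exact hcont.comp continuous_swap.continuousOn fun p hp => Ne.symm hp
  · obtain ⟨ρ1, hρ1, h1⟩ := hclose (r / 2) (δ / 2) (by linarith) (by linarith)
    obtain ⟨ρ2, hρ2, -, h2⟩ := exists_pairing hd hl hT (r := r / 2) (by linarith) (half_pos hδ)
    have hρ : 0 < min ρ1 ρ2 := lt_min hρ1 hρ2
    refine ⟨min ρ1 ρ2, hρ, fun x y hxy g w W hg => ?_⟩
    obtain ⟨q, Q, hq⟩ := exists_bsol ha hT x hρ
    have k1 : dist y y + min ρ1 ρ2 ≤ ρ1 := by simp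
    have k2 : dist y y + min ρ1 ρ2 ≤ ρ2 := by simp
    have k1' : dist x x + min ρ1 ρ2 ≤ ρ1 := by simp
    have k2' : dist x x + min ρ1 ρ2 ≤ ρ2 := by simp
    filter_upwards [(h2 b a x y ha.symm (by linarith)).2 _ _ _ _ _ _ (hg.mono k2) (hq.mono k2')]
      with z hz hz'
    have e1 := hz (ball_subset_ball (min_le_right _ _) hz')
    have e2 := h1 y x (by rw [dist_comm]; linarith) _ _ _ _ _ _ (hq.mono k1') (hg.mono k1) y
      (mem_ball_self hρ1) z (ball_subset_ball (min_le_left _ _) hz')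
    rw [hg.toSol.duality ha.symm hq.toSol |>.symm] at e1
    rw [abs_le] at e1 e2 ⊢
    constructor <;> linarith [e1.1, e1.2, e2.1, e2.2]

theorem tendsto_integral_of_L2 {F F' : Type*} [NormedAddCommGroup F] [NormedAddCommGroup F']
    {f : ℕ → E d → F} {f0 : E d → F} {g : E d → F'} {H : ℕ → E d → ℝ} {H0 : E d → ℝ}
    (hH : ∀ n, Integrable (H n)) (hH0 : Integrable H0)
    (hb : ∀ n x, ‖H n x - H0 x‖ ≤ ‖f n x - f0 x‖ * ‖g x‖)
    (mf : ∀ n, AEStronglyMeasurable (f n - f0) volume) (hg : MemLp g 2 volume)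
    (h : Tendsto (fun n => eLpNorm (f n - f0) 2 volume) atTop (𝓝 0)) :
    Tendsto (fun n => ∫ x, H n x) atTop (𝓝 (∫ x, H0 x)) := by
  refine tendsto_integral_of_L1 H0 hH0.1 (Eventually.of_forall hH) ?_
  have h1 : Tendsto (fun n => eLpNorm (f n - f0) 2 volume * eLpNorm g 2 volume) atTop
      (𝓝 (0 * eLpNorm g 2 volume)) := ENNReal.Tendsto.mul_const h (Or.inr hg.2.ne)
  rw [zero_mul] at h1
  refine tendsto_of_tendsto_of_tendsto_of_le_of_le tendsto_const_nhds h1 (fun _ => bot_le)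
    fun n => ?_
  have h2 := eLpNorm_smul_le_mul_eLpNorm (p := 2) (q := 2) (r := 1) (μ := volume) (𝕜 := ℝ)
    (f := fun x => ‖g x‖) (φ := fun x => ‖(f n - f0) x‖) hg.1.norm (mf n).norm
  rw [eLpNorm_norm, eLpNorm_norm, eLpNorm_one_eq_lintegral_enorm] at h2
  refine (lintegral_mono fun x => ?_).trans h2
  rw [← ofReal_norm, ← ofReal_norm]
  refine ENNReal.ofReal_le_ofReal ((hb n x).trans ?_)
  simp

theorem IsTestFun.cc1 {χ : E d → ℝ} (h : IsTestFun d χ) : CC1 χ :=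
  ⟨h.1.of_le (by exact_mod_cast le_top), h.2⟩

theorem gradAt_eq {χ : E d → ℝ} (h : CC1 χ) (x : E d) : gradAt χ x = (∇ χ x).ofLp := by
  ext i
  have h1 := (h.hasGrad x).hasFDerivAt.fderiv
  rw [gradAt, h1, InnerProductSpace.toDual_apply_apply, EuclideanSpace.inner_single_right, one_mul]
  rfl

theorem abs_apply_le (v : E d) (i : Fin d) : |v i| ≤ ‖v‖ := by
  simpa using PiLp.norm_apply_le v i

theorem measurable_coord (i : Fin d) : Measurable fun v : E d => v i :=
  (EuclideanSpace.proj (𝕜 := ℝ) i).continuous.measurable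

theorem memLp_coord {U : E d → E d} (hU : MemLp U 2 volume) (i : Fin d) :
    MemLp (fun x => U x i) 2 volume :=
  hU.of_le ((measurable_coord i).comp_aemeasurable hU.1.aemeasurable).aestronglyMeasurable
    (ae_of_all _ fun x => by rw [Real.norm_eq_abs]; exact abs_apply_le _ _)

theorem H1.integral_by_parts {u χ : E d → ℝ} {U : E d → E d} (h : H1 u U) (hχ : CC1 χ)
    (i : Fin d) : ∫ x, u x * (∇ χ x) i = - ∫ x, U x i * χ x := by
  obtain ⟨φ, hφ, h1, h2, -⟩ := h.exists_seq
  have l1 := memLp_coord (hχ.memLp_grad 2) i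
  have e : ∀ n, ∫ x, φ n x * (∇ χ x) i = - ∫ x, (∇ (φ n) x) i * χ x := fun n => by
    have l2 := memLp_coord ((hφ n).memLp_grad 2) i
    have e1 : ∀ {ψ : E d → ℝ}, CC1 ψ → ∀ x, fderiv ℝ ψ x (EuclideanSpace.single i 1) = (∇ ψ x) i :=
      fun hψ x => congrFun (gradAt_eq hψ x) i
    have := integral_mul_fderiv_eq_neg_fderiv_mul_of_integrable (μ := (volume : Measure (E d)))
      (f := φ n) (g := χ) (v := EuclideanSpace.single i 1)
      (by simp only [e1 (hφ n)]; exact l2.integrable_mul (hχ.memLp 2))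
      (by simp only [e1 hχ]; exact ((hφ n).memLp 2).integrable_mul l1)
      (((hφ n).memLp 2).integrable_mul (hχ.memLp 2))
      (fun x _ => ((hφ n).1.differentiable one_ne_zero) x)
      (fun x _ => (hχ.1.differentiable one_ne_zero) x)
    simpa only [e1 hχ, e1 (hφ n)] using this
  have t1 : Tendsto (fun n => ∫ x, φ n x * (∇ χ x) i) atTop (𝓝 (∫ x, u x * (∇ χ x) i)) :=
    tendsto_integral_of_L2 (g := fun x => (∇ χ x) i) (f := φ) (f0 := u)
      (fun n => ((hφ n).memLp 2).integrable_mul l1) (h.lu.integrable_mul l1)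
      (fun n x => by rw [← sub_mul, norm_mul])
      (fun n => ((hφ n).memLp 2).1.sub h.lu.1) l1 h1
  have t2 : Tendsto (fun n => ∫ x, (∇ (φ n) x) i * χ x) atTop (𝓝 (∫ x, U x i * χ x)) :=
    tendsto_integral_of_L2 (g := χ) (f := fun n => ∇ (φ n)) (f0 := U)
      (fun n => (memLp_coord ((hφ n).memLp_grad 2) i).integrable_mul (hχ.memLp 2))
      ((memLp_coord h.lU i).integrable_mul (hχ.memLp 2))
      (fun n x => by
        rw [← sub_mul, norm_mul]
        exact mul_le_mul_of_nonneg_right (abs_apply_le (∇ (φ n) x - U x) i) (norm_nonneg _))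
      (fun n => ((hφ n).memLp_grad 2).1.sub h.lU.1) (hχ.memLp 2) h2
  simp only [e] at t1
  exact tendsto_nhds_unique t1 t2.neg

theorem far_subset (y : E d) {r s : ℝ} (h : r ≤ s) :
    {z : E d | s ≤ dist z y} ⊆ {z | r ≤ dist z y} := fun z hz => by
  have hz' : s ≤ dist z y := hz
  exact h.trans hz'

/-- A sequence which is Cauchy in `L²` outside every neighbourhood of `y` has a limit. -/
theorem exists_limit_off_point (hd : 2 ≤ d) {U : ℕ → E d → E d} {y : E d}
    (hU : ∀ n, MemLp (U n) 2 volume)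
    (h : ∀ r : ℝ, 0 < r → Tendsto (fun n : ℕ × ℕ => eLpNorm (U n.1 - U n.2) 2
      (volume.restrict {z | r ≤ dist z y})) atTop (𝓝 0)) :
    ∃ D : E d → E d, Measurable D ∧ ∀ r : ℝ, 0 < r →
      Tendsto (fun n => eLpNorm (U n - D) 2 (volume.restrict {z | r ≤ dist z y})) atTop (𝓝 0) := by
  have hε : ∀ n : ℕ, (0:ℝ) < 1 / (n + 1) := fun n => by positivity
  set μ : ℕ → Measure (E d) := fun k => volume.restrict {z | 1 / ((k:ℝ) + 1) ≤ dist z y} with hμ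
  have hUk : ∀ k n, MemLp (U n) 2 (μ k) := fun k n => (hU n).restrict _
  have hk : ∀ k, ∃ D : E d → E d, StronglyMeasurable D ∧
      Tendsto (fun n => eLpNorm (U n - D) 2 (μ k)) atTop (𝓝 0) := by
    intro k
    have hc : CauchySeq fun n => (hUk k n).toLp (U n) := by
      rw [Lp.cauchySeq_Lp_iff_cauchySeq_eLpNorm]
      refine (h _ (hε k)).congr fun n => eLpNorm_congr_ae ?_
      filter_upwards [(hUk k n.1).coeFn_toLp, (hUk k n.2).coeFn_toLp] with x h1 h2
      simp only [Pi.sub_apply, h1, h2]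
    obtain ⟨L, hL⟩ := cauchySeq_tendsto_of_complete hc
    refine ⟨L, Lp.stronglyMeasurable L, ?_⟩
    rw [Lp.tendsto_Lp_iff_tendsto_eLpNorm'] at hL
    refine hL.congr fun n => eLpNorm_congr_ae ?_
    filter_upwards [(hUk k n).coeFn_toLp] with x h1
    simp only [Pi.sub_apply, h1]
  choose D mD hD using hk
  have hle : ∀ {k l : ℕ}, k ≤ l → μ k ≤ μ l := fun {k l} hkl =>
    Measure.restrict_mono (far_subset y (Nat.one_div_le_one_div hkl)) le_rfl
  have hcomp : ∀ k l, k ≤ l → D k =ᵐ[μ k] D l := by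
    intro k l hkl
    have h0 : eLpNorm (D k - D l) 2 (μ k) = 0 := by
      have t : Tendsto (fun n => eLpNorm (U n - D l) 2 (μ l) + eLpNorm (U n - D k) 2 (μ k)) atTop
          (𝓝 (0 + 0)) := (hD l).add (hD k)
      rw [add_zero] at t
      refine le_antisymm (ge_of_tendsto' t fun n => ?_) bot_le
      have e : D k - D l = (U n - D l) - (U n - D k) := by abel
      rw [e]
      refine (eLpNorm_sub_le (((hUk k n).1.sub (mD l).aestronglyMeasurable))
        (((hUk k n).1.sub (mD k).aestronglyMeasurable)) one_le_two).trans ?_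
      exact add_le_add (eLpNorm_mono_measure _ (hle hkl)) le_rfl
    rw [eLpNorm_eq_zero_iff ((mD k).sub (mD l)).aestronglyMeasurable two_ne_zero] at h0
    filter_upwards [h0] with x hx
    simpa [sub_eq_zero] using hx
  have hcomp' : ∀ᵐ z, ∀ k l : ℕ, k ≤ l → 1 / ((k:ℝ) + 1) ≤ dist z y → D k z = D l z := by
    rw [ae_all_iff]; intro k
    rw [ae_all_iff]; intro l
    by_cases hkl : k ≤ l
    · filter_upwards [(ae_restrict_iff' (measurableSet_far y _)).1 (hcomp k l hkl)] with z hz _ hz'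
      exact hz hz'
    · exact ae_of_all _ fun z h' => absurd h' hkl
  have : Nontrivial (E d) := by
    have : Nonempty (Fin d) := ⟨⟨0, by omega⟩⟩
    infer_instance
  have hne : ∀ᵐ z : E d, z ≠ y := by
    rw [ae_iff]; simp
  obtain ⟨D0, mD0, hD0⟩ := measurable_limit_of_tendsto_metrizable_ae (L := atTop)
    (μ := (volume : Measure (E d))) (f := D)
    (fun k => (mD k).measurable.aemeasurable) (by
      filter_upwards [hcomp', hne] with z hz hzy
      obtain ⟨k, hk⟩ := exists_nat_one_div_lt (dist_pos.2 hzy)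
      refine ⟨D k z, tendsto_const_nhds.congr' ?_⟩
      filter_upwards [eventually_ge_atTop k] with l hl
      exact hz k l hl hk.le)
  refine ⟨D0, mD0, fun r hr => ?_⟩
  obtain ⟨k, hk⟩ := exists_nat_one_div_lt hr
  have e : D k =ᵐ[μ k] D0 := by
    refine (ae_restrict_iff' (measurableSet_far y _)).2 ?_
    filter_upwards [hcomp', hD0] with z hz hz0 hzk
    refine tendsto_nhds_unique (tendsto_const_nhds.congr' ?_) hz0
    filter_upwards [eventually_ge_atTop k] with l hl
    exact hz k l hl hzk
  refine tendsto_of_tendsto_of_tendsto_of_le_of_le tendsto_const_nhds (hD k) (fun _ => bot_le)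
    fun n => ?_
  calc _ ≤ eLpNorm (U n - D0) 2 (μ k) :=
        eLpNorm_mono_measure _ (Measure.restrict_mono (far_subset y hk.le) le_rfl)
    _ = _ := eLpNorm_congr_ae (by filter_upwards [e] with z hz; simp only [Pi.sub_apply, hz])

theorem ball_diff_eq_iUnion (y : E d) (r : ℝ) :
    ball y r \ {y} = ⋃ k : ℕ, {z | 1 / ((k:ℝ) + 1) ≤ dist z y} ∩ ball y r := by
  ext z
  constructor
  · rintro ⟨h1, h2⟩
    obtain ⟨k, hk⟩ := exists_nat_one_div_lt (dist_pos.2 h2)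
    exact Set.mem_iUnion.2 ⟨k, hk.le, h1⟩
  · intro h
    obtain ⟨k, hk, h1⟩ := Set.mem_iUnion.1 h
    refine ⟨h1, fun h2 => ?_⟩
    rw [Set.mem_singleton_iff] at h2
    have hk' : 1 / ((k:ℝ) + 1) ≤ dist z y := hk
    rw [h2, dist_self] at hk'
    have : (0:ℝ) < 1 / ((k:ℝ) + 1) := by positivity
    linarith

theorem tendsto_L1_of_off_point (hd : 2 ≤ d) {F : Type*} [NormedAddCommGroup F]
    {f : ℕ → E d → F} {f0 : E d → F} {y : E d}
    (mf : ∀ n, AEStronglyMeasurable (f n) volume)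
    (heq : ∀ δ : ℝ, 0 < δ → ∃ r > 0, ∀ n, ∫⁻ z in ball y r, ‖f n z‖ₑ ≤ ENNReal.ofReal δ)
    (hc : ∀ r R : ℝ, 0 < r → Tendsto (fun n => ∫⁻ z in {z | r ≤ dist z y} ∩ ball y R,
      ‖f n z - f0 z‖ₑ) atTop (𝓝 0)) (R : ℝ) :
    Tendsto (fun n => ∫⁻ z in ball y R, ‖f n z - f0 z‖ₑ) atTop (𝓝 0) := by
  have : Nontrivial (E d) := by
    have : Nonempty (Fin d) := ⟨⟨0, by omega⟩⟩
    infer_instance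
  have h0 : ∀ δ r : ℝ, (∀ n, ∫⁻ z in ball y r, ‖f n z‖ₑ ≤ ENNReal.ofReal δ) →
      ∫⁻ z in ball y r, ‖f0 z‖ₑ ≤ ENNReal.ofReal δ := by
    intro δ r hr
    have e : ∫⁻ z in ball y r, ‖f0 z‖ₑ = ∫⁻ z in ball y r \ {y}, ‖f0 z‖ₑ :=
      setLIntegral_congr (sdiff_null_ae_eq_self (measure_singleton y)).symm
    rw [e, ball_diff_eq_iUnion, setLIntegral_iUnion_of_directed _ (directed_of_isDirected_le ?_)]
    · refine iSup_le fun k => ?_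
      have t := (hc (1 / ((k:ℝ) + 1)) r (by positivity)).const_add (ENNReal.ofReal δ)
      rw [add_zero] at t
      refine ge_of_tendsto' t fun n => ?_
      calc ∫⁻ z in {z | 1 / ((k:ℝ) + 1) ≤ dist z y} ∩ ball y r, ‖f0 z‖ₑ
          ≤ ∫⁻ z in {z | 1 / ((k:ℝ) + 1) ≤ dist z y} ∩ ball y r, (‖f n z‖ₑ + ‖f n z - f0 z‖ₑ) := by
            refine lintegral_mono fun z => ?_
            have e : f0 z = f n z - (f n z - f0 z) := by abel
            calc ‖f0 z‖ₑ = ‖f n z - (f n z - f0 z)‖ₑ := by rw [← e]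
              _ ≤ _ := enorm_sub_le
        _ = _ := lintegral_add_left' (mf n).enorm.restrict _
        _ ≤ _ := by
            gcongr
            exact (lintegral_mono_set Set.inter_subset_right).trans (hr n)
    · intro k l hkl
      exact Set.inter_subset_inter_left _ (far_subset y (Nat.one_div_le_one_div hkl))
  rw [ENNReal.tendsto_nhds_zero]
  intro ε hε
  obtain ⟨δ, hδ, hδε⟩ : ∃ δ : ℝ, 0 < δ ∧ ENNReal.ofReal δ ≤ ε := by
    rcases eq_or_ne ε ∞ with rfl | hne
    · exact ⟨1, one_pos, le_top⟩
    · exact ⟨ε.toReal, ENNReal.toReal_pos hε.ne' hne, ENNReal.ofReal_toReal_le⟩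
  obtain ⟨r, hr, hr'⟩ := heq (δ / 3) (by linarith)
  have t := ENNReal.tendsto_nhds_zero.1 (hc r R hr) (ENNReal.ofReal (δ / 3))
    (ENNReal.ofReal_pos.2 (by linarith))
  filter_upwards [t] with n hn
  have hs : ball y R ⊆ ball y r ∪ ({z | r ≤ dist z y} ∩ ball y R) := fun z hz => by
    rcases lt_or_ge (dist z y) r with h | h
    · exact Or.inl h
    · exact Or.inr ⟨h, hz⟩
  calc ∫⁻ z in ball y R, ‖f n z - f0 z‖ₑ
      ≤ (∫⁻ z in ball y r, ‖f n z - f0 z‖ₑ) +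
        ∫⁻ z in {z | r ≤ dist z y} ∩ ball y R, ‖f n z - f0 z‖ₑ :=
        (lintegral_mono_set hs).trans (lintegral_union_le _ _ _)
    _ ≤ ((∫⁻ z in ball y r, ‖f n z‖ₑ) + ∫⁻ z in ball y r, ‖f0 z‖ₑ) + ENNReal.ofReal (δ / 3) := by
        refine add_le_add ?_ hn
        rw [← lintegral_add_left' (mf n).enorm.restrict]
        exact lintegral_mono fun z => enorm_sub_le
    _ ≤ (ENNReal.ofReal (δ / 3) + ENNReal.ofReal (δ / 3)) + ENNReal.ofReal (δ / 3) := by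
        gcongr
        · exact hr' n
        · exact h0 _ _ hr'
    _ = ENNReal.ofReal δ := by
        rw [← ENNReal.ofReal_add (by linarith) (by linarith),
          ← ENNReal.ofReal_add (by linarith) (by linarith)]
        congr 1; ring
    _ ≤ ε := hδε

theorem eLpNorm_two_sq_restrict {F : Type*} [NormedAddCommGroup F] {f : E d → F}
    (hf : MemLp f 2 volume) (S : Set (E d)) :
    eLpNorm f 2 (volume.restrict S) ^ 2 = ENNReal.ofReal (∫ x in S, ‖f x‖ ^ 2) := by
  have h1 : Integrable (fun x => ‖f x‖ ^ 2) (volume.restrict S) :=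
    (hf.integrable_norm_pow two_ne_zero).integrableOn
  rw [eLpNorm_eq_lintegral_rpow_enorm_toReal (by norm_num) (by norm_num)]
  rw [← ENNReal.rpow_natCast, ← ENNReal.rpow_mul]
  simp only [toReal_ofNat, one_div, Nat.cast_ofNat, ne_eq, OfNat.ofNat_ne_zero, not_false_eq_true,
    inv_mul_cancel₀, ENNReal.rpow_one]
  rw [ofReal_integral_eq_lintegral_ofReal h1 (Eventually.of_forall fun x => by positivity)]
  refine lintegral_congr fun x => ?_
  rw [ENNReal.ofReal_pow (norm_nonneg _), ofReal_norm]
  exact ENNReal.rpow_natCast _ 2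

theorem eLpNorm_two_restrict_le {F : Type*} [NormedAddCommGroup F] {f : E d → F}
    (hf : MemLp f 2 volume) (S : Set (E d)) {η : ℝ} (hη : 0 ≤ η)
    (h : ∫ x in S, ‖f x‖ ^ 2 ≤ η ^ 2) : eLpNorm f 2 (volume.restrict S) ≤ ENNReal.ofReal η := by
  have h1 := eLpNorm_two_sq_restrict hf S
  have h2 : eLpNorm f 2 (volume.restrict S) ^ 2 ≤ ENNReal.ofReal η ^ 2 := by
    rw [h1, ← ENNReal.ofReal_pow hη]
    exact ENNReal.ofReal_le_ofReal h
  exact (ENNReal.pow_le_pow_left_iff two_ne_zero).1 h2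

theorem nontrivial_space (hd : 2 ≤ d) : Nontrivial (E d) := by
  have : Nonempty (Fin d) := ⟨⟨0, by omega⟩⟩
  infer_instance

theorem ae_ne_point (hd : 2 ≤ d) (y : E d) : ∀ᵐ z : E d, z ≠ y := by
  have := nontrivial_space hd
  rw [ae_iff]; simp

theorem aestronglyMeasurable_of_continuousOn_off (hd : 2 ≤ d) {w : E d → ℝ} {y : E d}
    (hw : ContinuousOn w {y}ᶜ) : AEStronglyMeasurable w volume := by
  have h := hw.aestronglyMeasurable (μ := volume) (measurableSet_singleton y).compl
  rwa [Measure.restrict_eq_self_of_ae_mem (s := {y}ᶜ) (ae_ne_point hd y)] at h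

/-- A fundamental solution with pole `y`, with quantitative bounds. -/
structure FSol (a : E d → E d →ₗ[ℝ] E d) (T c C : ℝ) (y : E d) (w : E d → ℝ) (D : E d → E d) :
    Prop where
  nonneg : ∀ z, 0 ≤ w z
  cont : ContinuousOn w {y}ᶜ
  le : ∀ z, z ≠ y → w z ≤ C * gBound d c T (dist z y)
  int_w : ∀ R, IntegrableOn w (ball y R)
  int_D : ∀ R, IntegrableOn D (ball y R)
  ann : ∀ R, 0 < R → ∫⁻ z in {z | R < dist z y ∧ dist z y < 2 * R}, ENNReal.ofReal (‖D z‖ ^ 2) ≤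
    ENNReal.ofReal (C ^ 2 * Real.exp (-(c * R) / √T) ^ 2 * pw d R)
  parts : ∀ χ, IsTestFun d χ → ∀ i, ∫ z, w z * (∇ χ z) i = - ∫ z, D z i * χ z
  eq : ∀ χ, IsTestFun d χ → ∫ z, (T⁻¹ * w z * χ z + ⟪∇ χ z, a z (D z)⟫_ℝ) = χ y

theorem Ker.cont_left {a : E d → E d →ₗ[ℝ] E d} {T : ℝ} {G : E d → E d → ℝ} (h : Ker a T G)
    (y : E d) : ContinuousOn (fun z => G z y) {y}ᶜ :=
  h.cont.comp (f := fun z => (z, y)) (by fun_prop) fun _ hz => hz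

theorem Ker.unif {a : E d → E d →ₗ[ℝ] E d} {T : ℝ} {G : E d → E d → ℝ} (h : Ker a T G) {r δ : ℝ}
    (hr : 0 < r) (hδ : 0 < δ) : ∃ ρ > 0, ∀ y g u U, BSol a T y ρ g u U →
      ∀ᵐ z, r ≤ dist z y → |u z - G z y| ≤ δ := by
  obtain ⟨ρ, hρ, h'⟩ := h.lim r δ hr hδ
  exact ⟨ρ, hρ, fun y g u U hu => ae_of_locally (B := {z | r ≤ dist z y}) fun x hx =>
    ⟨ρ, hρ, h' x y hx g u U hu⟩⟩

theorem BSol.integrable {lam : ℝ} {a b : E d → E d →ₗ[ℝ] E d} (ha : Coef lam a b) {T : ℝ}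
    (hT : 0 < T) {y : E d} {ε : ℝ} {g u : E d → ℝ} {U : E d → E d} (h : BSol a T y ε g u U) :
    Integrable u ∧ ∫ z, u z ≤ T := by
  have h1 := h.toSol.mass ha hT h.nonneg h.g_nonneg h.g_int h.g_mass
  have h2 : Integrable u := by
    refine ⟨h.h1.mu.aestronglyMeasurable, ?_⟩
    rw [hasFiniteIntegral_iff_ofReal (ae_of_all _ h.nonneg)]
    exact h1.trans_lt ENNReal.ofReal_lt_top
  refine ⟨h2, ?_⟩
  rw [← ofReal_integral_eq_lintegral_ofReal h2 (ae_of_all _ h.nonneg)] at h1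
  exact (ENNReal.ofReal_le_ofReal_iff hT.le).1 h1

theorem Ker.cauchy_grad {lam : ℝ} {a b : E d → E d →ₗ[ℝ] E d} (ha : Coef lam a b) {T : ℝ}
    (hT : 0 < T) {G : E d → E d → ℝ} (h : Ker a T G) {r η : ℝ} (hr : 0 < r) (hη : 0 < η) :
    ∃ ρ > 0, ∀ y g u U g' u' U', BSol a T y ρ g u U → BSol a T y ρ g' u' U' →
      eLpNorm (U - U') 2 (volume.restrict {z | r ≤ dist z y}) ≤ ENNReal.ofReal η := by
  obtain ⟨Kc, hKc, hext⟩ := Sol.exterior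
  have hl := ha.pos
  set δ : ℝ := η ^ 2 * (lam ^ 2 * (r / 2) ^ 2) / (8 * Kc * T) with hδ
  have hδ0 : 0 < δ := by positivity
  obtain ⟨ρ, hρ, hu⟩ := h.unif (half_pos hr) hδ0
  refine ⟨min ρ (r / 2), by positivity, fun y g u U g' u' U' h1 h2 => ?_⟩
  have h1' := hu y g u U (h1.mono (by simp))
  have h2' := hu y g' u' U' (h2.mono (by simp))
  obtain ⟨i1, m1⟩ := h1.integrable ha hT
  obtain ⟨i2, m2⟩ := h2.integrable ha hT
  have hs := h1.toSol.sub ha h1.g_mem h2.g_mem h2.toSol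
  have hzero : ∀ z, r / 2 ≤ dist z y → g z - g' z = 0 := fun z hz => by
    have hz' : z ∉ ball y (min ρ (r / 2)) := fun hm => by
      have := (mem_ball.1 hm).trans_le (min_le_right _ _)
      linarith
    rw [h1.g_supp z hz', h2.g_supp z hz', sub_zero]
  have e := hext d lam a b T _ _ _ y (r / 2) (r / 2) ha hT hs (half_pos hr) (half_pos hr) hzero
  rw [add_halves] at e
  have e2 : ∫ z in {z | r / 2 ≤ dist z y}, (u z - u' z) ^ 2 ≤ 4 * δ * T := by
    calc ∫ z in {z | r / 2 ≤ dist z y}, (u z - u' z) ^ 2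
        ≤ ∫ z in {z | r / 2 ≤ dist z y}, 2 * δ * (u z + u' z) := by
          refine setIntegral_mono_on_ae ?_ ((i1.add i2).const_mul _).integrableOn
            (measurableSet_far y _) ?_
          · exact hs.h1.lu.integrable_sq.integrableOn
          · filter_upwards [h1', h2'] with z a1 a2 hz
            have b1 := a1 hz
            have b2 := a2 hz
            rw [abs_le] at b1 b2
            have n1 := h1.nonneg z
            have n2 := h2.nonneg z
            have : |u z - u' z| ≤ 2 * δ := abs_le.2 ⟨by linarith, by linarith⟩
            have h3 : |u z - u' z| ≤ u z + u' z := abs_le.2 ⟨by linarith, by linarith⟩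
            rw [← sq_abs, sq]
            exact mul_le_mul this h3 (abs_nonneg _) (by linarith)
      _ ≤ ∫ z, 2 * δ * (u z + u' z) :=
          setIntegral_le_integral ((i1.add i2).const_mul _) (ae_of_all _ fun z => by
            have n1 := h1.nonneg z
            have n2 := h2.nonneg z
            show 0 ≤ 2 * δ * (u z + u' z)
            positivity)
      _ = 2 * δ * ((∫ z, u z) + ∫ z, u' z) := by rw [integral_const_mul, integral_add i1 i2]
      _ ≤ 2 * δ * (T + T) := by gcongr
      _ = 4 * δ * T := by ring
  have e3 : 0 ≤ T⁻¹ * ∫ z in {z | r ≤ dist z y}, (u z - u' z) ^ 2 :=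
    mul_nonneg (by positivity) (integral_nonneg fun z => sq_nonneg _)
  have e4 : lam / 2 * (∫ z in {z | r ≤ dist z y}, ‖U z - U' z‖ ^ 2) ≤
      Kc / (lam * (r / 2) ^ 2) * (4 * δ * T) := by
    have := mul_le_mul_of_nonneg_left e2 (a := Kc / (lam * (r / 2) ^ 2)) (by positivity)
    linarith
  have e5 : Kc / (lam * (r / 2) ^ 2) * (4 * δ * T) = lam / 2 * η ^ 2 := by
    rw [hδ]; field_simp; ring
  rw [e5] at e4
  exact eLpNorm_two_restrict_le (h1.h1.lU.sub h2.h1.lU) _ hη.le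
    (le_of_mul_le_mul_left e4 (by positivity))

theorem exists_ball_small {τ : ℝ} (hτ : 0 < τ) : ∃ r : ℝ, 0 < r ∧ ∀ y : E d, 0 < d →
    volume (ball y r) ≤ ENNReal.ofReal τ := by
  have hv := vB_pos (d := d)
  refine ⟨min 1 (τ / vB d), by positivity, fun y hd => ?_⟩
  have h0 : 0 < min 1 (τ / vB d) := by positivity
  rw [← ENNReal.ofReal_toReal (measure_ball_lt_top (μ := volume) (x := y)).ne]
  refine ENNReal.ofReal_le_ofReal ?_
  have := volume_real_ball y h0
  rw [measureReal_def] at this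
  rw [this]
  calc min 1 (τ / vB d) ^ d * vB d ≤ min 1 (τ / vB d) * vB d := by
        gcongr
        exact pow_le_of_le_one h0.le (min_le_left _ _) hd.ne'
    _ ≤ τ / vB d * vB d := by gcongr; exact min_le_right _ _
    _ = τ := by field_simp

theorem integrableOn_of_tendsto_L1 {F : Type*} [NormedAddCommGroup F] {f : ℕ → E d → F}
    {f0 : E d → F} {S : Set (E d)} (hf : ∀ n, IntegrableOn (f n) S)
    (m0 : AEStronglyMeasurable f0 volume)
    (h : Tendsto (fun n => ∫⁻ z in S, ‖f n z - f0 z‖ₑ) atTop (𝓝 0)) : IntegrableOn f0 S := by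
  obtain ⟨n, hn⟩ := (ENNReal.tendsto_nhds_zero.1 h 1 one_pos).exists
  have h1 : IntegrableOn (fun z => f n z - f0 z) S :=
    ⟨(hf n).1.sub m0.restrict, hn.trans_lt one_lt_top⟩
  have := (hf n).sub h1
  refine this.congr (ae_of_all _ fun z => ?_)
  simp

theorem tendsto_integral_of_L1_ball {F : Type*} [NormedAddCommGroup F] {f : ℕ → E d → F}
    {f0 : E d → F} {S : Set (E d)} {H : ℕ → E d → ℝ} {H0 : E d → ℝ} {K : ℝ} (hS : MeasurableSet S)
    (hH : ∀ n, Integrable (H n)) (hH0 : Integrable H0)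
    (hb : ∀ n z, z ∈ S → ‖H n z - H0 z‖ ≤ K * ‖f n z - f0 z‖) (hz : ∀ n z, z ∉ S → H n z = H0 z)
    (h : Tendsto (fun n => ∫⁻ z in S, ‖f n z - f0 z‖ₑ) atTop (𝓝 0)) :
    Tendsto (fun n => ∫ x, H n x) atTop (𝓝 (∫ x, H0 x)) := by
  refine tendsto_integral_of_L1 H0 hH0.1 (Eventually.of_forall hH) ?_
  have h1 := ENNReal.Tendsto.const_mul h (a := ENNReal.ofReal K) (Or.inr ENNReal.ofReal_ne_top)
  rw [mul_zero] at h1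
  refine tendsto_of_tendsto_of_tendsto_of_le_of_le tendsto_const_nhds h1 (fun _ => bot_le)
    fun n => ?_
  simp only
  rw [← lintegral_const_mul' _ _ ENNReal.ofReal_ne_top, ← lintegral_indicator hS]
  refine lintegral_mono fun z => ?_
  by_cases hm : z ∈ S
  · rw [Set.indicator_of_mem hm, ← ofReal_norm, ← ofReal_norm, ← ENNReal.ofReal_mul' (norm_nonneg _)]
    exact ENNReal.ofReal_le_ofReal (hb n z hm)
  · rw [hz n z hm]; simp

theorem integrable_mul_of_integrableOn {w χ : E d → ℝ} {S : Set (E d)} {K : ℝ}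
    (hw : IntegrableOn w S) (mχ : Continuous χ) (hχ : ∀ z, |χ z| ≤ K)
    (hz : ∀ z, z ∉ S → χ z = 0) : Integrable fun z => w z * χ z := by
  have h1 : IntegrableOn (fun z => w z * χ z) S :=
    Integrable.mul_bdd (c := K) hw mχ.aestronglyMeasurable (ae_of_all _ hχ)
  refine (integrableOn_iff_integrable_of_support_subset fun z hz' => ?_).1 h1
  by_contra hn
  exact hz' (by simp only [hz z hn, mul_zero])

theorem Coef.aesm {lam : ℝ} {a b : E d → E d →ₗ[ℝ] E d} (h : Coef lam a b) {D : E d → E d}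
    {μ : Measure (E d)} (hD : AEStronglyMeasurable D μ) :
    AEStronglyMeasurable (fun z => a z (D z)) μ := by
  refine ⟨fun z => a z (hD.mk D z), (h.meas _ hD.stronglyMeasurable_mk.measurable).stronglyMeasurable,
    ?_⟩
  filter_upwards [hD.ae_eq_mk] with z hz
  rw [hz]

theorem Coef.integrable_inner_ball {lam : ℝ} {a b : E d → E d →ₗ[ℝ] E d} (h : Coef lam a b)
    {D X : E d → E d} {S : Set (E d)} {K : ℝ} (hD : IntegrableOn D S)
    (mX : AEStronglyMeasurable X volume)
    (hX : ∀ z, ‖X z‖ ≤ K) (hz : ∀ z, z ∉ S → X z = 0) : Integrable fun z => ⟪X z, a z (D z)⟫_ℝ := by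
  have h1 : IntegrableOn (fun z => ⟪X z, a z (D z)⟫_ℝ) S := by
    refine Integrable.mono' (hD.norm.const_mul K) (mX.restrict.inner (h.aesm hD.1))
      (ae_of_all _ fun z => ?_)
    exact (norm_inner_le_norm _ _).trans (mul_le_mul (hX z) (h.bound z _) (norm_nonneg _)
      ((norm_nonneg _).trans (hX z)))
  refine (integrableOn_iff_integrable_of_support_subset fun z hz' => ?_).1 h1
  by_contra hn
  exact hz' (by simp only [hz z hn, inner_zero_left])

theorem CC1.exists_ball {χ : E d → ℝ} (h : CC1 χ) (y : E d) :
    ∃ R > 0, (∀ z, z ∉ ball y R → χ z = 0) ∧ ∀ z, z ∉ ball y R → ∇ χ z = 0 := by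
  obtain ⟨R, hR⟩ := (h.2.isCompact.isBounded).subset_ball y
  have h1 : ∀ z, z ∉ ball y (max R 1) → z ∉ tsupport χ := fun z hz hm =>
    hz (ball_subset_ball (le_max_left _ _) (hR hm))
  refine ⟨max R 1, by positivity, fun z hz => image_eq_zero_of_notMem_tsupport (h1 z hz),
    fun z hz => ?_⟩
  have : fderiv ℝ χ z = 0 := by
    have hs := tsupport_fderiv_subset ℝ (f := χ)
    exact image_eq_zero_of_notMem_tsupport fun hm => h1 z hz (hs hm)
  rw [gradient, this, map_zero]

theorem tendsto_integral_bump {h : E d → ℝ} (hh : MemLp h 2 volume) {y : E d}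
    (hc : ContinuousAt h y) {ε : ℕ → ℝ} (hε0 : ∀ n, 0 < ε n) (hε : Tendsto ε atTop (𝓝 0)) :
    Tendsto (fun n => ∫ z, bump y (ε n) z * h z) atTop (𝓝 (h y)) := by
  rw [Metric.tendsto_atTop']
  intro δ hδ
  obtain ⟨ρ, hρ, h1⟩ := Metric.continuousAt_iff.1 hc (δ / 2) (by linarith)
  obtain ⟨N, hN⟩ := (hε.eventually (gt_mem_nhds hρ)).exists_forall_of_atTop
  refine ⟨N, fun n hn => ?_⟩
  have := average_mem (S := ball y (ε n)) (m := h y - δ / 2) (M := h y + δ / 2)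
    (memLp_bump y (ε n)) hh (integrable_bump y (ε n)) (bump_nonneg y (ε n))
    (integral_bump y (hε0 n)) (fun x hx => Set.indicator_of_notMem hx _) (ae_of_all _ fun x hx => by
      have h2 := h1 ((mem_ball.1 hx).trans (hN n hn.le))
      rw [Real.dist_eq, abs_lt] at h2
      exact ⟨by linarith, by linarith⟩)
  rw [Real.dist_eq, abs_lt]
  exact ⟨by linarith, by linarith⟩

theorem Ker.exists_seq (hd : 2 ≤ d) {lam : ℝ} {a b : E d → E d →ₗ[ℝ] E d} (ha : Coef lam a b)
    {T : ℝ} (hT : 0 < T) {G : E d → E d → ℝ} (h : Ker a T G) (y : E d) :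
    ∃ (u : ℕ → E d → ℝ) (U : ℕ → E d → E d) (D : E d → E d), Measurable D ∧
      (∀ n : ℕ, BSol a T y (1 / ((n:ℝ) + 1)) (bump y (1 / ((n:ℝ) + 1))) (u n) (U n)) ∧
      (∀ r δ : ℝ, 0 < r → 0 < δ → ∀ᶠ n in atTop, ∀ᵐ z, r ≤ dist z y → |u n z - G z y| ≤ δ) ∧
      (∀ r : ℝ, 0 < r →
        Tendsto (fun n => eLpNorm (U n - D) 2 (volume.restrict {z | r ≤ dist z y})) atTop (𝓝 0)) ∧
      (∀ R, Tendsto (fun n => ∫⁻ z in ball y R, ‖u n z - G z y‖ₑ) atTop (𝓝 0)) ∧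
      ∀ R, Tendsto (fun n => ∫⁻ z in ball y R, ‖U n z - D z‖ₑ) atTop (𝓝 0) := by
  have hε : ∀ n : ℕ, (0:ℝ) < 1 / ((n:ℝ) + 1) := fun n => by positivity
  choose u U hu using fun n : ℕ => exists_bsol ha hT y (hε n)
  have small : ∀ ρ : ℝ, 0 < ρ → ∀ᶠ n : ℕ in atTop, 1 / ((n:ℝ) + 1) ≤ ρ := fun ρ hρ =>
    (tendsto_one_div_add_atTop_nhds_zero_nat.eventually (gt_mem_nhds hρ)).mono fun n hn => hn.le
  have hunif : ∀ r δ : ℝ, 0 < r → 0 < δ → ∀ᶠ n in atTop, ∀ᵐ z, r ≤ dist z y →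
      |u n z - G z y| ≤ δ := by
    intro r δ hr hδ
    obtain ⟨ρ, hρ, h1⟩ := h.unif hr hδ
    filter_upwards [small ρ hρ] with n hn
    exact h1 y _ _ _ ((hu n).mono (by simpa using hn))
  obtain ⟨D, mD, hD⟩ := exists_limit_off_point hd (U := U) (y := y) (fun n => (hu n).h1.lU) (by
    intro r hr
    rw [ENNReal.tendsto_nhds_zero]
    intro ε hε'
    obtain ⟨η, hη, hηε⟩ : ∃ η : ℝ, 0 < η ∧ ENNReal.ofReal η ≤ ε := by
      rcases eq_or_ne ε ∞ with rfl | hne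
      · exact ⟨1, one_pos, le_top⟩
      · exact ⟨ε.toReal, ENNReal.toReal_pos hε'.ne' hne, ENNReal.ofReal_toReal_le⟩
    obtain ⟨ρ, hρ, h1⟩ := h.cauchy_grad ha hT hr hη
    obtain ⟨N, hN⟩ := (small ρ hρ).exists_forall_of_atTop
    rw [eventually_atTop]
    refine ⟨(N, N), fun n hn => (h1 y _ _ _ _ _ _ ((hu n.1).mono ?_) ((hu n.2).mono ?_)).trans hηε⟩
    · simpa using hN n.1 hn.1
    · simpa using hN n.2 hn.2)
  have hsmall : ∀ δ : ℝ, 0 < δ → ∃ r > 0, ∀ n,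
      ∫⁻ x in ball y r, (ENNReal.ofReal (u n x) + ENNReal.ofReal ‖U n x‖) ≤ ENNReal.ofReal δ := by
    intro δ hδ
    obtain ⟨τ, hτ, h1⟩ := equi_integrable hd ha.pos hT hδ
    obtain ⟨r, hr, h2⟩ := exists_ball_small (d := d) hτ
    exact ⟨r, hr, fun n => h1 a b _ _ _ ha (hu n).toPSol _ measurableSet_ball (h2 y (by omega))⟩
  refine ⟨u, U, D, mD, hu, hunif, hD, ?_, ?_⟩
  · refine tendsto_L1_of_off_point hd (f0 := fun z => G z y)
      (fun n => (hu n).h1.mu.aestronglyMeasurable) ?_ ?_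
    · intro δ hδ
      obtain ⟨r, hr, h1⟩ := hsmall δ hδ
      refine ⟨r, hr, fun n => le_trans (lintegral_mono fun z => ?_) (h1 n)⟩
      rw [Real.enorm_of_nonneg ((hu n).nonneg z)]
      exact le_self_add
    · intro r R hr
      have hV : volume (ball y R) ≠ ∞ := measure_ball_lt_top.ne
      rw [ENNReal.tendsto_nhds_zero]
      intro ε hε'
      obtain ⟨δ, hδ, hδε⟩ : ∃ δ : ℝ, 0 < δ ∧ ENNReal.ofReal δ * volume (ball y R) ≤ ε := by
        have t : Tendsto (fun δ : ℝ => ENNReal.ofReal δ * volume (ball y R)) (𝓝[>] 0)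
            (𝓝 (ENNReal.ofReal 0 * volume (ball y R))) :=
          ENNReal.Tendsto.mul_const ((ENNReal.continuous_ofReal.tendsto 0).mono_left
            nhdsWithin_le_nhds) (Or.inr hV)
        rw [ENNReal.ofReal_zero, zero_mul] at t
        obtain ⟨δ, h1, h2⟩ := ((ENNReal.tendsto_nhds_zero.1 t ε hε').and
          self_mem_nhdsWithin).exists
        exact ⟨δ, h2, h1⟩
      filter_upwards [hunif r δ hr hδ] with n hn
      refine le_trans ?_ hδε
      calc ∫⁻ z in {z | r ≤ dist z y} ∩ ball y R, ‖u n z - G z y‖ₑ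
          ≤ ∫⁻ _ in {z | r ≤ dist z y} ∩ ball y R, ENNReal.ofReal δ := by
            refine setLIntegral_mono_ae' ((measurableSet_far y r).inter measurableSet_ball) ?_
            filter_upwards [hn] with z hz hz'
            rw [← ofReal_norm]
            exact ENNReal.ofReal_le_ofReal (hz hz'.1)
        _ = ENNReal.ofReal δ * volume ({z | r ≤ dist z y} ∩ ball y R) := by
            rw [lintegral_const, Measure.restrict_apply_univ]
        _ ≤ _ := by gcongr; exact Set.inter_subset_right
  · refine tendsto_L1_of_off_point hd (f0 := D)
      (fun n => (hu n).h1.mU.aestronglyMeasurable) ?_ ?_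
    · intro δ hδ
      obtain ⟨r, hr, h1⟩ := hsmall δ hδ
      refine ⟨r, hr, fun n => le_trans (lintegral_mono fun z => ?_) (h1 n)⟩
      rw [← ofReal_norm]
      exact le_add_self
    · intro r R hr
      have hV : volume (ball y R) ^ (1 / (2:ℝ)) ≠ ∞ :=
        ENNReal.rpow_ne_top_of_nonneg (by positivity) measure_ball_lt_top.ne
      have t := ENNReal.Tendsto.mul_const (hD r hr) (b := volume (ball y R) ^ (1 / (2:ℝ)))
        (Or.inr hV)
      rw [zero_mul] at t
      refine tendsto_of_tendsto_of_tendsto_of_le_of_le tendsto_const_nhds t (fun _ => bot_le)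
        fun n => ?_
      have hm : AEStronglyMeasurable (U n - D)
          (volume.restrict ({z | r ≤ dist z y} ∩ ball y R)) :=
        ((hu n).h1.mU.sub mD).aestronglyMeasurable
      have h1 := eLpNorm_le_eLpNorm_mul_rpow_measure_univ (p := 1) (q := 2) one_le_two hm
      rw [eLpNorm_one_eq_lintegral_enorm, Measure.restrict_apply_univ] at h1
      refine h1.trans ?_
      have e : (1 / (1:ℝ≥0∞).toReal - 1 / (2:ℝ≥0∞).toReal) = 1 / (2:ℝ) := by norm_num
      rw [e]
      gcongr
      · exact Set.inter_subset_left
      · exact Set.inter_subset_right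

theorem le_of_ae_ball {f : E d → ℝ} {x : E d} {s M : ℝ} (hs : 0 < s) (hf : ContinuousAt f x)
    (h : ∀ᵐ z, z ∈ ball x s → f z ≤ M) : f x ≤ M := by
  by_contra! hM
  have h1 : {z | M < f z} ∩ ball x s ∈ 𝓝 x :=
    Filter.inter_mem (hf.eventually (lt_mem_nhds hM)) (ball_mem_nhds x hs)
  refine (Measure.measure_pos_of_mem_nhds volume h1).ne' (measure_mono_null (fun z hz => ?_) (ae_iff.1 h))
  have hz' : M < f z := hz.1
  exact fun hn => absurd (hn hz.2) (not_le.2 hz')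

/-- The kernel is a fundamental solution in its first variable. -/
theorem Ker.exists_fsol (hd : 2 ≤ d) {lam : ℝ} (hl : 0 < lam) : ∃ c C : ℝ, 0 < c ∧ 0 < C ∧
    ∀ (a b : E d → E d →ₗ[ℝ] E d) (T : ℝ) (G : E d → E d → ℝ), Coef lam a b → 0 < T → Ker a T G →
      ∀ y, ∃ D, FSol a T c C y (fun z => G z y) D := by
  obtain ⟨c, C, hc, hC, hb⟩ := exists_green_bound hd hl
  refine ⟨c, C + 1, hc, by linarith, fun a b T G ha hT h y => ?_⟩
  obtain ⟨u, U, D, mD, hu, hunif, hD, tu, tU⟩ := h.exists_seq hd ha hT y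
  have hcont := h.cont_left y
  have mG := aestronglyMeasurable_of_continuousOn_off hd hcont
  have small : ∀ ρ : ℝ, 0 < ρ → ∀ᶠ n : ℕ in atTop, 1 / ((n:ℝ) + 1) ≤ ρ := fun ρ hρ =>
    (tendsto_one_div_add_atTop_nhds_zero_nat.eventually (gt_mem_nhds hρ)).mono fun n hn => hn.le
  have hb' : ∀ r : ℝ, 0 < r → ∀ᶠ n : ℕ in atTop,
      (∀ᵐ z, r / 2 ≤ dist z y → u n z ≤ C * gBound d c T r) ∧
        ∫ z in {z | r < dist z y ∧ dist z y < 2 * r}, ‖U n z‖ ^ 2 ≤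
          C * Real.exp (-(c * r) / √T) ^ 2 * pw d r := fun r hr => by
    filter_upwards [small (√T) (by positivity), small (r / 20) (by positivity)] with n h1 h2
    exact hb a b T _ _ _ y _ ha hT (hu n).toPSol
      (fun z hz => (hu n).g_supp z fun hm => absurd (mem_ball.1 hm) (not_lt.2 hz)) h1 r hr
      (by linarith)
  have iU : ∀ n R, IntegrableOn (U n) (ball y R) := fun n R => by
    have : IsFiniteMeasure (volume.restrict (ball y R)) :=
      ⟨by rw [Measure.restrict_apply_univ]; exact measure_ball_lt_top⟩
    exact ((hu n).h1.lU.restrict _).integrable one_le_two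
  have iw : ∀ R, IntegrableOn (fun z => G z y) (ball y R) := fun R =>
    integrableOn_of_tendsto_L1 (fun n => ((hu n).integrable ha hT).1.integrableOn) mG (tu R)
  have iD : ∀ R, IntegrableOn D (ball y R) := fun R =>
    integrableOn_of_tendsto_L1 (fun n => iU n _)
      mD.aestronglyMeasurable (tU R)
  refine ⟨D, fun z => h.nonneg z y, hcont, fun x hx => ?_, iw, iD, fun R hR => ?_, fun χ hχ i => ?_,
    fun χ hχ => ?_⟩
  · have hr : 0 < dist x y := dist_pos.2 hx
    have hg : 0 ≤ gBound d c T (dist x y) := by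
      rw [gBound_eq hr]
      exact mul_nonneg (Real.exp_pos _).le (sing_pos (by positivity) hr).le
    refine le_trans (b := C * gBound d c T (dist x y)) (le_of_forall_pos_le_add fun δ hδ => ?_)
      (by linarith)
    obtain ⟨n, h1, h2, -⟩ := ((hunif (dist x y / 2) δ (by positivity) hδ).and (hb' _ hr)).exists
    refine le_of_ae_ball (f := fun z => G z y) (s := dist x y / 2) (by positivity)
      (hcont.continuousAt (isOpen_compl_singleton.mem_nhds hx)) ?_
    filter_upwards [h1, h2] with z h1 h2 hz
    have hz' : dist x y / 2 ≤ dist z y := by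
      have := dist_triangle_left x y z
      rw [mem_ball] at hz
      linarith
    have a1 := (abs_le.1 (h1 hz')).1
    have a2 := h2 hz'
    linarith
  · set S := {z : E d | R < dist z y ∧ dist z y < 2 * R} with hS
    set η : ℝ := (C + 1) * Real.exp (-(c * R) / √T) * √(pw d R) with hη
    have hp := pw_pos (d := d) hR
    have hη0 : 0 ≤ η := by positivity
    have hη2 : η ^ 2 = (C + 1) ^ 2 * Real.exp (-(c * R) / √T) ^ 2 * pw d R := by
      rw [hη, mul_pow, mul_pow, Real.sq_sqrt hp.le]
    have hDS : eLpNorm D 2 (volume.restrict S) ≤ ENNReal.ofReal η := by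
      have t := (hD R hR).const_add (ENNReal.ofReal η)
      rw [add_zero] at t
      refine ge_of_tendsto t ?_
      filter_upwards [hb' R hR] with n hn
      have e : D = U n - (U n - D) := by abel
      have e1 : eLpNorm D 2 (volume.restrict S) ≤ eLpNorm (U n) 2 (volume.restrict S) +
          eLpNorm (U n - D) 2 (volume.restrict S) := by
        conv_lhs => rw [e]
        exact eLpNorm_sub_le (hu n).h1.mU.aestronglyMeasurable
          ((hu n).h1.mU.sub mD).aestronglyMeasurable one_le_two
      refine e1.trans (add_le_add ?_ ?_)
      · refine eLpNorm_two_restrict_le (hu n).h1.lU _ hη0 (hn.2.trans ?_)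
        rw [hη2]
        have : C ≤ (C + 1) ^ 2 := by nlinarith
        gcongr
      · exact eLpNorm_mono_measure _ (Measure.restrict_mono (fun z hz => hz.1.le) le_rfl)
    have e2 : ∫⁻ z in S, ENNReal.ofReal (‖D z‖ ^ 2) = eLpNorm D 2 (volume.restrict S) ^ 2 := by
      rw [eLpNorm_eq_lintegral_rpow_enorm_toReal (by norm_num) (by norm_num)]
      rw [← ENNReal.rpow_natCast, ← ENNReal.rpow_mul]
      simp only [toReal_ofNat, one_div, Nat.cast_ofNat, ne_eq, OfNat.ofNat_ne_zero,
        not_false_eq_true, inv_mul_cancel₀, ENNReal.rpow_one]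
      refine lintegral_congr fun x => ?_
      rw [ENNReal.ofReal_pow (norm_nonneg _), ofReal_norm]
      exact (ENNReal.rpow_natCast _ 2).symm
    rw [e2, ← hη2, ENNReal.ofReal_pow hη0]
    gcongr
  · obtain ⟨K, hK, hK'⟩ := hχ.cc1.exists_bound
    obtain ⟨R, hR, hz, hz'⟩ := hχ.cc1.exists_ball y
    have c1 : Continuous fun z => (∇ χ z) i :=
      (EuclideanSpace.proj (𝕜 := ℝ) i).continuous.comp (continuous_gradient hχ.cc1.1)
    have b1 : ∀ z, |(∇ χ z) i| ≤ K := fun z => (abs_apply_le _ _).trans (hK' z)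
    have z1 : ∀ z, z ∉ ball y R → (∇ χ z) i = 0 := fun z hm => by rw [hz' z hm]; rfl
    have t1 : Tendsto (fun n => ∫ z, u n z * (∇ χ z) i) atTop (𝓝 (∫ z, G z y * (∇ χ z) i)) :=
      tendsto_integral_of_L1_ball (K := K) measurableSet_ball
        (fun n => integrable_mul_of_integrableOn ((hu n).integrable ha hT).1.integrableOn c1 b1 z1)
        (integrable_mul_of_integrableOn (iw R) c1 b1 z1)
        (fun n z _ => by
          rw [← sub_mul, norm_mul, mul_comm]
          exact mul_le_mul_of_nonneg_right (b1 z) (norm_nonneg _))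
        (fun n z hm => by simp only [z1 z hm, mul_zero]) (tu R)
    have icoord : ∀ {V : E d → E d}, IntegrableOn V (ball y R) →
        IntegrableOn (fun z => V z i) (ball y R) := fun hV =>
      Integrable.mono' hV.norm
        ((measurable_coord i).comp_aemeasurable hV.1.aemeasurable).aestronglyMeasurable
        (ae_of_all _ fun z => abs_apply_le _ _)
    have t2 : Tendsto (fun n => ∫ z, U n z i * χ z) atTop (𝓝 (∫ z, D z i * χ z)) :=
      tendsto_integral_of_L1_ball (K := K) measurableSet_ball
        (fun n => integrable_mul_of_integrableOn
          (icoord (iU n _)) hχ.cc1.continuous hK hz)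
        (integrable_mul_of_integrableOn (icoord (iD R)) hχ.cc1.continuous hK hz)
        (fun n z _ => by
          rw [← sub_mul, norm_mul, mul_comm]
          exact mul_le_mul (hK z) (abs_apply_le (U n z - D z) i) (norm_nonneg _)
            ((abs_nonneg _).trans (hK z)))
        (fun n z hm => by simp only [hz z hm, mul_zero]) (tU R)
    simp only [(hu _).h1.integral_by_parts hχ.cc1 i] at t1
    exact tendsto_nhds_unique t1 t2.neg
  · obtain ⟨K, hK, hK'⟩ := hχ.cc1.exists_bound
    obtain ⟨R, hR, hz, hz'⟩ := hχ.cc1.exists_ball y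
    have mχ := (continuous_gradient hχ.cc1.1).aestronglyMeasurable (μ := (volume : Measure (E d)))
    have j1 := integrable_mul_of_integrableOn (iw R) hχ.cc1.continuous hK hz
    have j2 := ha.integrable_inner_ball (iD R) mχ hK' hz'
    have t1 : Tendsto (fun n => ∫ z, u n z * χ z) atTop (𝓝 (∫ z, G z y * χ z)) :=
      tendsto_integral_of_L1_ball (K := K) measurableSet_ball
        (fun n => integrable_mul_of_integrableOn ((hu n).integrable ha hT).1.integrableOn
          hχ.cc1.continuous hK hz) j1
        (fun n z _ => by
          rw [← sub_mul, norm_mul, mul_comm]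
          exact mul_le_mul_of_nonneg_right (hK z) (norm_nonneg _))
        (fun n z hm => by simp only [hz z hm, mul_zero]) (tu R)
    have t2 : Tendsto (fun n => ∫ z, ⟪∇ χ z, a z (U n z)⟫_ℝ) atTop
        (𝓝 (∫ z, ⟪∇ χ z, a z (D z)⟫_ℝ)) :=
      tendsto_integral_of_L1_ball (K := K) measurableSet_ball
        (fun n => ha.integrable_inner_ball (iU n _) mχ hK'
          hz') j2
        (fun n z _ => by
          rw [← inner_sub_right, ← map_sub]
          exact (norm_inner_le_norm _ _).trans (mul_le_mul (hK' z) (ha.bound z _) (norm_nonneg _)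
            ((norm_nonneg _).trans (hK' z))))
        (fun n z hm => by simp only [hz' z hm, inner_zero_left]) (tU R)
    have t3 := tendsto_integral_bump (hχ.cc1.memLp 2) (y := y) hχ.cc1.continuous.continuousAt
      (ε := fun n : ℕ => 1 / ((n:ℝ) + 1)) (fun n => by positivity)
      tendsto_one_div_add_atTop_nhds_zero_nat
    have t4 := (t1.const_mul T⁻¹).add t2
    have e : ∀ n, T⁻¹ * (∫ z, u n z * χ z) + ∫ z, ⟪∇ χ z, a z (U n z)⟫_ℝ =
        ∫ z, bump y (1 / ((n:ℝ) + 1)) z * χ z := fun n => (hu n).eq χ _ (H1.of_CC1 hχ.cc1)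
    simp only [e] at t4
    rw [tendsto_nhds_unique t3 t4, ← integral_const_mul, ← integral_add (j1.const_mul _) j2]
    simp only [mul_assoc]

theorem enorm_weighted_integral_sq_le {F : Type*} [NormedAddCommGroup F] [NormedSpace ℝ F]
    {ρ : E d → ℝ} (mρ : Measurable ρ) (hρ : ∀ t, 0 ≤ ρ t) (iρ : Integrable ρ) (h1 : ∫ t, ρ t = 1)
    {g : E d → F} (mg : StronglyMeasurable g) :
    ‖∫ t, ρ t • g t‖ₑ ^ 2 ≤ ∫⁻ t, ENNReal.ofReal (ρ t) * ‖g t‖ₑ ^ 2 := by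
  set ν := (volume : Measure (E d)).withDensity fun t => ENNReal.ofReal (ρ t) with hν
  have mρ' : Measurable fun t => ENNReal.ofReal (ρ t) := mρ.ennreal_ofReal
  have hν1 : IsProbabilityMeasure ν := ⟨by
    rw [hν, withDensity_apply _ MeasurableSet.univ, Measure.restrict_univ,
      ← ofReal_integral_eq_lintegral_ofReal iρ (ae_of_all _ hρ), h1, ENNReal.ofReal_one]⟩
  have e1 : ‖∫ t, ρ t • g t‖ₑ ≤ eLpNorm g 1 ν := by
    rw [eLpNorm_one_eq_lintegral_enorm, hν, lintegral_withDensity_eq_lintegral_mul _ mρ' mg.enorm]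
    refine (enorm_integral_le_lintegral_enorm _).trans (lintegral_mono fun t => ?_)
    rw [enorm_smul, Real.enorm_of_nonneg (hρ t)]
    exact le_rfl
  have e2 : eLpNorm g 1 ν ≤ eLpNorm g 2 ν :=
    eLpNorm_le_eLpNorm_of_exponent_le one_le_two mg.aestronglyMeasurable
  have e3 : eLpNorm g 2 ν ^ 2 = ∫⁻ t, ENNReal.ofReal (ρ t) * ‖g t‖ₑ ^ 2 := by
    rw [eLpNorm_eq_lintegral_rpow_enorm_toReal (by norm_num) (by norm_num)]
    rw [← ENNReal.rpow_natCast, ← ENNReal.rpow_mul]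
    simp only [toReal_ofNat, one_div, Nat.cast_ofNat, ne_eq, OfNat.ofNat_ne_zero,
      not_false_eq_true, inv_mul_cancel₀, ENNReal.rpow_one]
    rw [hν, lintegral_withDensity_eq_lintegral_mul _ mρ' (mg.enorm.pow_const _)]
    refine lintegral_congr fun t => ?_
    simp only [Pi.mul_apply]
    congr 1
    exact ENNReal.rpow_natCast _ 2
  rw [← e3]
  gcongr
  exact e1.trans e2

theorem translation_continuous {F : Type*} [NormedAddCommGroup F] {f : E d → F}
    (hf : MemLp f 2 volume) {ε : ℝ≥0∞} (hε : 0 < ε) :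
    ∃ δ > 0, ∀ t : E d, ‖t‖ < δ → eLpNorm (fun x => f (x - t) - f x) 2 volume ≤ ε := by
  have : Fact ((1:ℝ≥0∞) ≤ 2) := ⟨one_le_two⟩
  have : Fact ((2:ℝ≥0∞) ≠ ∞) := ⟨by norm_num⟩
  have hc : Continuous fun t : E d => DomAddAct.mk (-t) +ᵥ hf.toLp f := by
    have h1 : Continuous fun t : E d => DomAddAct.mk (-t) :=
      DomAddAct.continuous_mk.comp continuous_neg
    fun_prop
  have h0 := EMetric.continuousAt_iff.1 (hc.continuousAt (x := 0)) ε hε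
  obtain ⟨δ, hδ, h⟩ := h0
  obtain ⟨δ', hδ', hle⟩ : ∃ δ' : ℝ, 0 < δ' ∧ ENNReal.ofReal δ' ≤ δ := by
    rcases eq_or_ne δ ∞ with rfl | hne
    · exact ⟨1, one_pos, le_top⟩
    · exact ⟨δ.toReal, ENNReal.toReal_pos hδ.ne' hne, ENNReal.ofReal_toReal_le⟩
  refine ⟨δ', hδ', fun t ht => ?_⟩
  have h2 := h (x := t) (by
    rw [edist_dist, dist_zero_right]
    exact (ENNReal.ofReal_lt_ofReal_iff hδ').2 ht |>.trans_le hle)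
  rw [DomAddAct.mk_vadd_toLp, DomAddAct.mk_vadd_toLp, Lp.edist_toLp_toLp] at h2
  refine (le_of_eq (eLpNorm_congr_ae (ae_of_all _ fun x => ?_))).trans h2.le
  simp [sub_eq_add_neg, add_comm]

/-- Mollification. -/
def moll {F : Type*} [NormedAddCommGroup F] [NormedSpace ℝ F] (φ : ContDiffBump (0 : E d))
    (f : E d → F) (x : E d) : F := ∫ t, φ.normed volume t • f (x - t)

theorem moll_L2 {F : Type*} [NormedAddCommGroup F] [NormedSpace ℝ F] [CompleteSpace F]
    [SecondCountableTopology F] [MeasurableSpace F] [BorelSpace F]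
    {f : E d → F} (mf : Measurable f) (hf : MemLp f 2 volume) {ε : ℝ≥0∞} (hε : 0 < ε) :
    ∃ δ > 0, ∀ φ : ContDiffBump (0 : E d), φ.rOut < δ → eLpNorm (moll φ f - f) 2 volume ≤ ε := by
  obtain ⟨δ, hδ, h⟩ := translation_continuous hf hε
  refine ⟨δ, hδ, fun φ hφ => ?_⟩
  set ρ := φ.normed (volume : Measure (E d)) with hρ
  have mρ : Continuous ρ := φ.contDiff_normed (n := 0) |>.continuous
  have iρ : Integrable ρ := mρ.integrable_of_hasCompactSupport φ.hasCompactSupport_normed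
  have ρ1 : ∫ t, ρ t = 1 := φ.integral_normed
  have ρ0 : ∀ t, 0 ≤ ρ t := φ.nonneg_normed
  have hloc : LocallyIntegrable f volume := hf.locallyIntegrable one_le_two
  have e1 : ∀ x, (moll φ f - f) x = ∫ t, ρ t • (f (x - t) - f x) := fun x => by
    have i1 : Integrable fun t => ρ t • f (x - t) :=
      HasCompactSupport.convolutionExists_left (ContinuousLinearMap.lsmul ℝ ℝ)
        φ.hasCompactSupport_normed mρ hloc x
    simp only [smul_sub]
    rw [integral_sub i1 (iρ.smul_const _), integral_smul_const, ρ1, one_smul]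
    rfl
  have sq : ∀ g : E d → F, eLpNorm g 2 volume ^ 2 = ∫⁻ x, ‖g x‖ₑ ^ 2 := fun g => by
    rw [eLpNorm_eq_lintegral_rpow_enorm_toReal (by norm_num) (by norm_num)]
    rw [← ENNReal.rpow_natCast, ← ENNReal.rpow_mul]
    simp only [toReal_ofNat, one_div, Nat.cast_ofNat, ne_eq, OfNat.ofNat_ne_zero,
      not_false_eq_true, inv_mul_cancel₀, ENNReal.rpow_one]
    exact lintegral_congr fun t => ENNReal.rpow_natCast _ 2
  refine (ENNReal.pow_le_pow_left_iff two_ne_zero).1 ?_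
  rw [sq]
  calc ∫⁻ x, ‖(moll φ f - f) x‖ₑ ^ 2
      ≤ ∫⁻ x, ∫⁻ t, ENNReal.ofReal (ρ t) * ‖f (x - t) - f x‖ₑ ^ 2 := by
        refine lintegral_mono fun x => ?_
        rw [e1]
        exact enorm_weighted_integral_sq_le mρ.measurable ρ0 iρ ρ1
          (Measurable.stronglyMeasurable (by fun_prop))
    _ = ∫⁻ t, ∫⁻ x, ENNReal.ofReal (ρ t) * ‖f (x - t) - f x‖ₑ ^ 2 := by
        refine lintegral_lintegral_swap (Measurable.aemeasurable ?_)
        have := mρ.measurable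
        fun_prop
    _ ≤ ∫⁻ t, ENNReal.ofReal (ρ t) * ε ^ 2 := by
        refine lintegral_mono fun t => ?_
        simp only
        rw [lintegral_const_mul' _ _ ENNReal.ofReal_ne_top]
        by_cases ht : ‖t‖ < φ.rOut
        · gcongr
          rw [← sq]
          gcongr
          exact h t (ht.trans hφ)
        · have : ρ t = 0 := by
            by_contra hne
            have : t ∈ Function.support ρ := hne
            rw [hρ, φ.support_normed_eq, mem_ball_zero_iff] at this
            exact ht this
          simp [this]
    _ = ε ^ 2 := by
        rw [lintegral_mul_const _ mρ.measurable.ennreal_ofReal,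
          ← ofReal_integral_eq_lintegral_ofReal iρ (ae_of_all _ ρ0), ρ1, ENNReal.ofReal_one, one_mul]

theorem moll_grad {k : E d → ℝ} {K : E d → E d} (hk : LocallyIntegrable k volume)
    (hK : LocallyIntegrable K volume)
    (hp : ∀ χ, IsTestFun d χ → ∀ i, ∫ z, k z * (∇ χ z) i = - ∫ z, K z i * χ z)
    (φ : ContDiffBump (0 : E d)) (x : E d) : ∇ (moll φ k) x = moll φ K x := by
  set ρ := φ.normed (volume : Measure (E d)) with hρ
  have sρ : ContDiff ℝ (⊤ : ℕ∞) ρ := φ.contDiff_normed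
  have cρ : HasCompactSupport ρ := φ.hasCompactSupport_normed
  have hd := cρ.hasFDerivAt_convolution_left (ContinuousLinearMap.lsmul ℝ ℝ)
    (sρ.of_le (by exact_mod_cast le_top)) hk x
  have hf : fderiv ℝ (moll φ k) x = _ := hd.fderiv
  have htest : IsTestFun d fun s => ρ (x - s) :=
    ⟨sρ.comp (contDiff_const.sub contDiff_id), cρ.comp_homeomorph (Homeomorph.subLeft x)⟩
  have hχ : ∀ s i, (∇ (fun s => ρ (x - s)) s) i = - fderiv ℝ ρ (x - s) (EuclideanSpace.single i 1) :=
    fun s i => by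
      rw [← congrFun (gradAt_eq htest.cc1 s) i, gradAt]
      have hr : DifferentiableAt ℝ ρ (x - s) := (sρ.differentiable (by simp)).differentiableAt
      have hh := HasFDerivAt.comp s hr.hasFDerivAt ((hasFDerivAt_id s).const_sub x)
      have h2 : fderiv ℝ (fun s => ρ (x - s)) s = _ := hh.fderiv
      rw [h2]
      simp
  ext i
  have hdiff : DifferentiableAt ℝ (moll φ k) x := hd.differentiableAt
  have e0 : (∇ (moll φ k) x) i = fderiv ℝ (moll φ k) x (EuclideanSpace.single i 1) := by
    have h1 := hdiff.hasGradientAt.hasFDerivAt.fderiv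
    rw [h1, InnerProductSpace.toDual_apply_apply, EuclideanSpace.inner_single_right, one_mul]
    rfl
  have cd : Continuous (fderiv ℝ ρ) := sρ.continuous_fderiv (by simp)
  have i1 : Integrable fun t => (ContinuousLinearMap.precompL (E d) (ContinuousLinearMap.lsmul ℝ ℝ))
      (fderiv ℝ ρ t) (k (x - t)) :=
    HasCompactSupport.convolutionExists_left _ (cρ.fderiv ℝ) cd hk x
  have i2 : Integrable fun t => ρ t • K (x - t) :=
    HasCompactSupport.convolutionExists_left (ContinuousLinearMap.lsmul ℝ ℝ) cρ sρ.continuous hK x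
  rw [e0, hf, convolution_def, ContinuousLinearMap.integral_apply i1]
  have e1 := hp _ htest i
  simp only [hχ] at e1
  have e2 : moll φ K x i = ∫ t, ρ t * K (x - t) i :=
    ((EuclideanSpace.proj (𝕜 := ℝ) i).integral_comp_comm i2).symm
  rw [e2, ← integral_sub_left_eq_self _ volume x]
  simp only [ContinuousLinearMap.precompL_apply, ContinuousLinearMap.lsmul_apply,
    _root_.sub_sub_cancel]
  rw [← integral_sub_left_eq_self (fun t => ρ t * K (x - t) i) volume x]
  simp only [_root_.sub_sub_cancel]
  have e3 : ∫ s, k s * -(fderiv ℝ ρ (x - s)) (EuclideanSpace.single i 1) =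
      - ∫ s, (fderiv ℝ ρ (x - s)) (EuclideanSpace.single i 1) • k s := by
    rw [← integral_neg]
    refine integral_congr_ae (ae_of_all _ fun s => ?_)
    simp [mul_comm]
  rw [e3, neg_inj] at e1
  rw [e1]
  exact integral_congr_ae (ae_of_all _ fun s => mul_comm _ _)

/-- A compactly supported function with a weak gradient in `L²` is approximated by smooth functions. -/
theorem exists_test_approx {k : E d → ℝ} {K : E d → E d} (mk : Measurable k) (mK : Measurable K)
    (hk : MemLp k 2 volume) (hK : MemLp K 2 volume) (hc : HasCompactSupport k)
    (hp : ∀ χ, IsTestFun d χ → ∀ i, ∫ z, k z * (∇ χ z) i = - ∫ z, K z i * χ z)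
    {ε : ℝ≥0∞} (hε : 0 < ε) : ∃ φ, IsTestFun d φ ∧ eLpNorm (φ - k) 2 volume ≤ ε ∧
      eLpNorm (∇ φ - K) 2 volume ≤ ε := by
  obtain ⟨δ, hδ, h1⟩ := moll_L2 mk hk hε
  obtain ⟨δ', hδ', h2⟩ := moll_L2 mK hK hε
  have hm : 0 < min δ δ' := by positivity
  let φ : ContDiffBump (0 : E d) := ⟨min δ δ' / 4, min δ δ' / 2, by positivity, by linarith⟩
  have hφ : φ.rOut < min δ δ' := by change min δ δ' / 2 < _; linarith
  have lk : LocallyIntegrable k volume := hk.locallyIntegrable one_le_two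
  have lK : LocallyIntegrable K volume := hK.locallyIntegrable one_le_two
  refine ⟨moll φ k, ⟨?_, ?_⟩, h1 φ (hφ.trans_le (min_le_left _ _)), ?_⟩
  · exact φ.hasCompactSupport_normed.contDiff_convolution_left (ContinuousLinearMap.lsmul ℝ ℝ)
      φ.contDiff_normed lk
  · exact HasCompactSupport.convolution (ContinuousLinearMap.lsmul ℝ ℝ)
      φ.hasCompactSupport_normed hc
  · have : ∇ (moll φ k) = moll φ K := funext fun x => moll_grad lk lK hp φ x
    rw [this]
    exact h2 φ (hφ.trans_le (min_le_right _ _))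

theorem H1.of_weak {k : E d → ℝ} {K : E d → E d} (mk : Measurable k) (mK : Measurable K)
    (hk : MemLp k 2 volume) (hK : MemLp K 2 volume) (hc : HasCompactSupport k)
    (hp : ∀ χ, IsTestFun d χ → ∀ i, ∫ z, k z * (∇ χ z) i = - ∫ z, K z i * χ z) : H1 k K where
  mu := mk
  mU := mK
  lu := hk
  lU := hK
  approx ε hε := by
    obtain ⟨φ, h, h'⟩ := exists_test_approx mk mK hk hK hc hp hε
    exact ⟨φ, h.cc1, h'⟩

theorem H1.exists_test_seq {u : E d → ℝ} {U : E d → E d} (h : H1 u U) :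
    ∃ φ : ℕ → E d → ℝ, (∀ n, IsTestFun d (φ n)) ∧
      Tendsto (fun n => eLpNorm (φ n - u) 2 volume) atTop (𝓝 0) ∧
      Tendsto (fun n => eLpNorm (∇ (φ n) - U) 2 volume) atTop (𝓝 0) := by
  obtain ⟨ψ, hψ, h1, h2, -⟩ := h.exists_seq
  have hε : ∀ n : ℕ, (0:ℝ≥0∞) < ((n:ℝ≥0∞) + 1)⁻¹ := fun n => by simp
  choose φ hφ h3 h4 using fun n : ℕ =>
    exists_test_approx (hψ n).continuous.measurable (continuous_gradient (hψ n).1).measurable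
      ((hψ n).memLp 2) ((hψ n).memLp_grad 2) (hψ n).2
      (fun χ hχ i => (H1.of_CC1 (hψ n)).integral_by_parts hχ.cc1 i) (hε n)
  have t : Tendsto (fun n : ℕ => ((n:ℝ≥0∞) + 1)⁻¹) atTop (𝓝 0) := by
    have := (tendsto_add_atTop_iff_nat 1).2 ENNReal.tendsto_inv_nat_nhds_zero
    simpa using this
  refine ⟨φ, hφ, ?_, ?_⟩
  · have t1 := t.add h1
    rw [add_zero] at t1
    refine tendsto_of_tendsto_of_tendsto_of_le_of_le tendsto_const_nhds t1 (fun _ => bot_le)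
      fun n => ?_
    have e : φ n - u = (φ n - ψ n) + (ψ n - u) := by abel
    simp only
    rw [e]
    exact (eLpNorm_add_le (((hφ n).cc1.memLp 2).1.sub ((hψ n).memLp 2).1)
      (((hψ n).memLp 2).1.sub h.lu.1) one_le_two).trans (add_le_add (h3 n) le_rfl)
  · have t1 := t.add h2
    rw [add_zero] at t1
    refine tendsto_of_tendsto_of_tendsto_of_le_of_le tendsto_const_nhds t1 (fun _ => bot_le)
      fun n => ?_
    have e : ∇ (φ n) - U = (∇ (φ n) - ∇ (ψ n)) + (∇ (ψ n) - U) := by abel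
    simp only
    rw [e]
    exact (eLpNorm_add_le (((hφ n).cc1.memLp_grad 2).1.sub ((hψ n).memLp_grad 2).1)
      (((hψ n).memLp_grad 2).1.sub h.lU.1) one_le_two).trans (add_le_add (h4 n) le_rfl)

/-- Solutions of the homogeneous equation away from `y`, with at most the singularity of the
fundamental solution at `y`, for which the point `y` carries no mass. -/
structure NSol (a : E d → E d →ₗ[ℝ] E d) (T C : ℝ) (y : E d) (h : E d → ℝ) (H : E d → E d) :
    Prop where
  cont : ContinuousOn h {y}ᶜ
  le : ∀ z, z ≠ y → |h z| ≤ C * sing d (√T) (dist z y)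
  meas : Measurable H
  int_h : ∀ R, IntegrableOn h (ball y R)
  int_H : ∀ R, IntegrableOn H (ball y R)
  ann : ∀ R, 0 < R → ∫⁻ z in {z | R < dist z y ∧ dist z y < 2 * R}, ENNReal.ofReal (‖H z‖ ^ 2) ≤
    ENNReal.ofReal (C ^ 2 * pw d R)
  parts : ∀ χ, IsTestFun d χ → ∀ i, ∫ z, h z * (∇ χ z) i = - ∫ z, H z i * χ z
  eq : ∀ χ, IsTestFun d χ → ∫ z, (T⁻¹ * h z * χ z + ⟪∇ χ z, a z (H z)⟫_ℝ) = 0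

theorem NSol.measurable {a : E d → E d →ₗ[ℝ] E d} {T C : ℝ} {y : E d} {h : E d → ℝ}
    {H : E d → E d} (hn : NSol a T C y h H) : Measurable h :=
  measurable_of_continuousOn_compl_singleton y hn.cont

theorem isOpen_annulus (y : E d) (R : ℝ) : IsOpen {z : E d | R < dist z y ∧ dist z y < 2 * R} :=
  (isOpen_lt (f := fun _ => R) (g := fun z => dist z y) (by fun_prop) (by fun_prop)).inter
    (isOpen_lt (f := fun z => dist z y) (g := fun _ => 2 * R) (by fun_prop) (by fun_prop))

theorem memLp_two_restrict {F : Type*} [NormedAddCommGroup F] {f : E d → F} {S : Set (E d)}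
    (hf : AEStronglyMeasurable f volume) (h : ∫⁻ z in S, ENNReal.ofReal (‖f z‖ ^ 2) < ∞) :
    MemLp f 2 (volume.restrict S) := by
  refine ⟨hf.restrict, ?_⟩
  rw [eLpNorm_lt_top_iff_lintegral_rpow_enorm_lt_top (by norm_num) (by norm_num)]
  refine lt_of_le_of_lt (lintegral_mono fun z => ?_) h
  rw [ENNReal.ofReal_pow (norm_nonneg _), ofReal_norm, ← ENNReal.rpow_natCast]
  simp

theorem NSol.memLp_grad {a : E d → E d →ₗ[ℝ] E d} {T C : ℝ} {y : E d} {h : E d → ℝ}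
    {H : E d → E d} (hn : NSol a T C y h H) {r R : ℝ} (hr : 0 < r) :
    MemLp H 2 (volume.restrict (closedBall y R \ ball y r)) := by
  refine memLp_two_restrict hn.meas.aestronglyMeasurable ?_
  have hc : IsCompact (closedBall y R \ ball y r) := (isCompact_closedBall y R).diff isOpen_ball
  set μ := (volume : Measure (E d)).withDensity fun z => ENNReal.ofReal (‖H z‖ ^ 2)
  rw [← withDensity_apply _ (hc.measurableSet)]
  refine hc.measure_lt_top_of_nhdsWithin fun z hz => ?_
  have hd0 : r ≤ dist z y := by simpa using hz.2
  refine ⟨{w | 2 / 3 * dist z y < dist w y ∧ dist w y < 2 * (2 / 3 * dist z y)},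
    mem_nhdsWithin_of_mem_nhds ((isOpen_annulus y _).mem_nhds ⟨by linarith, by linarith⟩), ?_⟩
  rw [withDensity_apply _ (isOpen_annulus y _).measurableSet]
  exact (hn.ann _ (by linarith)).trans_lt ENNReal.ofReal_lt_top

theorem NSol.memLp {a : E d → E d →ₗ[ℝ] E d} {T C : ℝ} {y : E d} {h : E d → ℝ}
    {H : E d → E d} (hn : NSol a T C y h H) {r R : ℝ} (hr : 0 < r) :
    MemLp h 2 (volume.restrict (closedBall y R \ ball y r)) := by
  have hc : IsCompact (closedBall y R \ ball y r) := (isCompact_closedBall y R).diff isOpen_ball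
  have : IsFiniteMeasure (volume.restrict (closedBall y R \ ball y r)) :=
    ⟨by rw [Measure.restrict_apply_univ]; exact hc.measure_lt_top⟩
  obtain ⟨M, hM⟩ := hc.exists_bound_of_continuousOn (hn.cont.mono fun z hz => by
    rintro rfl
    exact hz.2 (mem_ball_self hr))
  exact MemLp.of_bound hn.measurable.aestronglyMeasurable M
    ((ae_restrict_iff' hc.measurableSet).2 (ae_of_all _ hM))

/-- Weak equations with square integrable data extend from test functions to `H¹`. -/
theorem H1.extend_eq {k : E d → ℝ} {K : E d → E d} (hk : MemLp k 2 volume) (hK : MemLp K 2 volume)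
    (h : ∀ φ, IsTestFun d φ → (∫ z, φ z * k z) + ∫ z, ⟪∇ φ z, K z⟫_ℝ = 0) {v : E d → ℝ}
    {V : E d → E d} (hv : H1 v V) : (∫ z, v z * k z) + ∫ z, ⟪V z, K z⟫_ℝ = 0 := by
  obtain ⟨φ, hφ, t1, t2⟩ := hv.exists_test_seq
  have l1 := tendsto_integral_of_L2 (H := fun n z => φ n z * k z) (H0 := fun z => v z * k z)
    (fun n => ((hφ n).cc1.memLp 2).integrable_mul hk) (hv.lu.integrable_mul hk)
    (fun n z => by rw [← sub_mul, norm_mul]) (fun n => ((hφ n).cc1.memLp 2).1.sub hv.lu.1) hk t1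
  have l2 := tendsto_integral_of_L2 (H := fun n z => ⟪∇ (φ n) z, K z⟫_ℝ)
    (H0 := fun z => ⟪V z, K z⟫_ℝ)
    (fun n => integrable_inner ((hφ n).cc1.memLp_grad 2) hK) (integrable_inner hv.lU hK)
    (fun n z => by rw [← inner_sub_left]; exact abs_real_inner_le_norm _ _)
    (fun n => ((hφ n).cc1.memLp_grad 2).1.sub hv.lU.1) hK t2
  have l3 := l1.add l2
  simp only [h _ (hφ _)] at l3
  exact tendsto_nhds_unique l3 tendsto_const_nhds

theorem IsTestFun.mul {χ φ : E d → ℝ} (hχ : IsTestFun d χ) (hφ : IsTestFun d φ) :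
    IsTestFun d fun z => χ z * φ z := ⟨hχ.1.mul hφ.1, hχ.2.mul_right⟩

theorem IsTestFun.sub {χ φ : E d → ℝ} (hχ : IsTestFun d χ) (hφ : IsTestFun d φ) :
    IsTestFun d fun z => χ z - φ z := ⟨hχ.1.sub hφ.1, hχ.2.sub hφ.2⟩

theorem IsTestFun.grad_mul {χ φ : E d → ℝ} (hχ : IsTestFun d χ) (hφ : IsTestFun d φ) (z : E d) :
    ∇ (fun z => χ z * φ z) z = χ z • ∇ φ z + φ z • ∇ χ z :=
  (HasGradientAt.mul (hχ.cc1.hasGrad z) (hφ.cc1.hasGrad z)).gradient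

theorem memLp_of_le_on {F F' : Type*} [NormedAddCommGroup F] [NormedAddCommGroup F'] {g : E d → F}
    {Q : E d → F'} {S : Set (E d)} {K : ℝ} (hS : MeasurableSet S)
    (hg : AEStronglyMeasurable g volume) (hb : ∀ z, ‖g z‖ ≤ K * ‖Q z‖) (h0 : ∀ z ∉ S, g z = 0)
    (hQ : MemLp Q 2 (volume.restrict S)) : MemLp g 2 volume := by
  have h1 : MemLp (S.indicator Q) 2 volume := (memLp_indicator_iff_restrict hS).2 hQ
  refine h1.of_le_mul (c := K) hg (ae_of_all _ fun z => ?_)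
  by_cases hz : z ∈ S
  · simpa [hz] using hb z
  · simp [h0 z hz, hz]

theorem NSol.identity {lam : ℝ} {a b : E d → E d →ₗ[ℝ] E d} (ha : Coef lam a b) {T C : ℝ} {y : E d}
    {h f v χ : E d → ℝ} {H V : E d → E d} (hn : NSol a T C y h H) (hv : Sol b T f v V)
    {r R : ℝ} (hr : 0 < r) (hχ : IsTestFun d χ) (z0 : ∀ z ∉ closedBall y R \ ball y r, χ z = 0)
    (z1 : ∀ z ∉ closedBall y R \ ball y r, ∇ χ z = 0) :
    ∫ z, f z * (χ z * h z) = (∫ z, h z * ⟪∇ χ z, b z (V z)⟫_ℝ) -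
      ∫ z, v z * ⟪∇ χ z, a z (H z)⟫_ℝ := by
  have hS : MeasurableSet (closedBall y R \ ball y r) := measurableSet_closedBall.diff measurableSet_ball
  have lh := hn.memLp (R := R) hr
  have lH := hn.memLp_grad (R := R) hr
  have mh := hn.measurable
  have cχ := hχ.cc1.continuous
  have cG : Continuous (∇ χ) := continuous_gradient hχ.cc1.1
  have maH : Measurable fun z => a z (H z) := ha.meas _ hn.meas
  obtain ⟨K, k0, k1⟩ := hχ.cc1.exists_bound
  have m1 : MemLp (fun z => χ z * h z) 2 volume := memLp_of_le_on (K := K) hS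
    (cχ.measurable.mul mh).aestronglyMeasurable
    (fun z => by rw [norm_mul]; gcongr; exact k0 z) (fun z hz => by rw [z0 z hz, zero_mul]) lh
  have m2 : MemLp (fun z => ⟪∇ χ z, a z (H z)⟫_ℝ) 2 volume := memLp_of_le_on (K := K) hS
    (cG.aestronglyMeasurable.inner maH.aestronglyMeasurable)
    (fun z => (norm_inner_le_norm _ _).trans
      (mul_le_mul (k1 z) (ha.bound z _) (norm_nonneg _) ((norm_nonneg _).trans (k1 z))))
    (fun z hz => by rw [z1 z hz, inner_zero_left]) lH
  have m3 : MemLp (fun z => χ z • a z (H z)) 2 volume := memLp_of_le_on (K := K) hS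
    (cχ.aestronglyMeasurable.smul maH.aestronglyMeasurable)
    (fun z => by
      rw [norm_smul]
      exact mul_le_mul (k0 z) (ha.bound z _) (norm_nonneg _) ((abs_nonneg _).trans (k0 z)))
    (fun z hz => by rw [z0 z hz, zero_smul]) lH
  have m4 : MemLp (fun z => χ z • H z) 2 volume := memLp_of_le_on (K := K) hS
    (cχ.aestronglyMeasurable.smul hn.meas.aestronglyMeasurable)
    (fun z => by rw [norm_smul]; gcongr; exact k0 z)
    (fun z hz => by rw [z0 z hz, zero_smul]) lH
  have m5 : MemLp (fun z => h z • ∇ χ z) 2 volume := memLp_of_le_on (K := K) hS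
    (mh.aestronglyMeasurable.smul cG.aestronglyMeasurable)
    (fun z => by rw [norm_smul, mul_comm]; gcongr; exact k1 z)
    (fun z hz => by rw [z1 z hz, smul_zero]) lh
  have q1 : MemLp (fun z => T⁻¹ * (χ z * h z) + ⟪∇ χ z, a z (H z)⟫_ℝ) 2 volume :=
    (m1.const_mul T⁻¹).add m2
  have hI := H1.extend_eq q1 m3 (fun φ hφ => by
    have e := hn.eq _ (hχ.mul hφ)
    have j : Integrable fun z => φ z * (T⁻¹ * (χ z * h z) + ⟪∇ χ z, a z (H z)⟫_ℝ) :=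
      (hφ.cc1.memLp 2).integrable_mul q1
    rw [← integral_add j (integrable_inner (hφ.cc1.memLp_grad 2) m3), ← e]
    refine integral_congr_ae (ae_of_all _ fun z => ?_)
    simp only [hχ.grad_mul hφ, inner_add_left, real_inner_smul_left, real_inner_smul_right]
    ring) hv.h1
  have mK : Measurable fun z => χ z • H z + h z • ∇ χ z :=
    (cχ.measurable.smul hn.meas).add (mh.smul cG.measurable)
  have hk : H1 (fun z => χ z * h z) (fun z => χ z • H z + h z • ∇ χ z) := by
    refine H1.of_weak (cχ.measurable.mul mh) mK m1 (m4.add m5) hχ.2.mul_right fun ψ hψ i => ?_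
    have e := hn.parts _ (hχ.mul hψ) i
    have j1 : Integrable fun z => χ z * h z * (∇ ψ z) i :=
      m1.integrable_mul (memLp_coord (hψ.cc1.memLp_grad 2) i)
    have j2 : Integrable fun z => (h z • ∇ χ z) i * ψ z :=
      (memLp_coord m5 i).integrable_mul (hψ.cc1.memLp 2)
    have j3 : Integrable fun z => (χ z • H z) i * ψ z :=
      (memLp_coord m4 i).integrable_mul (hψ.cc1.memLp 2)
    have e1 : ∫ z, h z * (∇ (fun z => χ z * ψ z) z) i =
        (∫ z, χ z * h z * (∇ ψ z) i) + ∫ z, (h z • ∇ χ z) i * ψ z := by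
      rw [← integral_add j1 j2]
      refine integral_congr_ae (ae_of_all _ fun z => ?_)
      simp only [hχ.grad_mul hψ, PiLp.add_apply, PiLp.smul_apply, smul_eq_mul]
      ring
    have e2 : ∫ z, H z i * (χ z * ψ z) = ∫ z, (χ z • H z) i * ψ z :=
      integral_congr_ae (ae_of_all _ fun z => by
        simp only [PiLp.smul_apply, smul_eq_mul]
        ring)
    have e3 : ∫ z, (χ z • H z + h z • ∇ χ z) i * ψ z =
        (∫ z, (χ z • H z) i * ψ z) + ∫ z, (h z • ∇ χ z) i * ψ z := by
      rw [← integral_add j3 j2]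
      refine integral_congr_ae (ae_of_all _ fun z => ?_)
      simp only [PiLp.add_apply]
      ring
    linarith
  have hII := hv.eq _ _ hk
  have lV : MemLp (fun z => b z (V z)) 2 volume := ha.symm.memLp hv.h1.mU hv.h1.lU
  have i1 : Integrable fun z => v z * (χ z * h z) := hv.h1.lu.integrable_mul m1
  have i2 : Integrable fun z => v z * ⟪∇ χ z, a z (H z)⟫_ℝ := hv.h1.lu.integrable_mul m2
  have e1 : ∫ z, v z * (T⁻¹ * (χ z * h z) + ⟪∇ χ z, a z (H z)⟫_ℝ) =
      T⁻¹ * (∫ z, v z * (χ z * h z)) + ∫ z, v z * ⟪∇ χ z, a z (H z)⟫_ℝ := by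
    rw [← integral_const_mul, ← integral_add (i1.const_mul _) i2]
    exact integral_congr_ae (ae_of_all _ fun z => by ring)
  have e2 : ∫ z, ⟪χ z • H z + h z • ∇ χ z, b z (V z)⟫_ℝ =
      (∫ z, ⟪V z, χ z • a z (H z)⟫_ℝ) + ∫ z, h z * ⟪∇ χ z, b z (V z)⟫_ℝ := by
    have j : Integrable fun z => h z * ⟪∇ χ z, b z (V z)⟫_ℝ := by
      simpa only [real_inner_smul_left] using integrable_inner m5 lV
    rw [← integral_add (integrable_inner hv.h1.lU m3) j]
    refine integral_congr_ae (ae_of_all _ fun z => ?_)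
    simp only [inner_add_left, real_inner_smul_left, real_inner_smul_right, ha.adj]
  rw [e1] at hI
  rw [e2] at hII
  linarith

/-- Hölder decay of the oscillation and the corresponding decay of the energy, away from the
source. -/
theorem PSol.exists_decay (hd : 2 ≤ d) {lam T : ℝ} {a b : E d → E d →ₗ[ℝ] E d} (ha : Coef lam a b)
    (hT : 0 < T) {g u : E d → ℝ} {U : E d → E d} (h : PSol a T g u U) {y : E d} {s : ℝ} (hs : 0 < s)
    (hg : ∀ z ∈ ball y s, g z = 0) : ∃ ρ θ B : ℝ, 0 < ρ ∧ ρ ≤ s ∧ 0 < θ ∧ θ < 1 ∧ 0 < B ∧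
      ∀ j : ℕ, (∃ m, |m| ≤ B ∧ ∀ᵐ z, z ∈ ball y (ρ * (1 / 4) ^ j) → |u z - m| ≤ B * θ ^ j) ∧
        ∫ z in ball y (ρ * (1 / 4) ^ j / 2), ‖U z‖ ^ 2 ≤ B * θ ^ j / pw d (ρ * (1 / 4) ^ j) := by
  have hC1 := c1_nonneg ha.pos
  obtain ⟨θ, C, hθ0, hθ1, hC, hosc⟩ := DG.osc hd hC1
  obtain ⟨K, hK, hcac⟩ := DG.caccioppoli
  have hub : ∀ᵐ z, z ∈ ball y s → -(T⁻¹ * u z) ≤ 0 := ae_of_all _ fun z _ => by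
    have := mul_nonneg (inv_pos.2 hT).le (h.nonneg z)
    linarith
  obtain ⟨M', hM'⟩ := DG.exists_bound hd hC1 h.h1 (h.toSol.dg ha hg le_rfl hub 0) hs
  set ρ := s / 2 with hρ
  set M := max M' 1
  have hM0 : 0 < M := lt_max_of_lt_right one_pos
  have hρ0 : 0 < ρ := by positivity
  have hgB : ∀ z ∈ ball y ρ, g z = 0 := fun z hz => hg z (ball_subset_ball (by linarith) hz)
  have hb : ∀ᵐ z, z ∈ ball y ρ → u z ≤ M := by
    filter_upwards [hM'] with z hz hz'
    exact (hz hz').trans (le_max_left _ _)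
  set F := T⁻¹ * M with hF
  have hF0 : 0 < F := by positivity
  have d1 : ∀ k, DG (c1 lam) F k u U (ball y ρ) := fun k =>
    h.toSol.dg ha hgB hF0.le (ae_of_all _ fun z _ => by
      have := mul_nonneg (inv_pos.2 hT).le (h.nonneg z)
      linarith) k
  have d2 : ∀ k, DG (c1 lam) F k (-u) (-U) (ball y ρ) := fun k =>
    h.toSol.neg.dg ha (fun z hz => by simp [hgB z hz]) hF0.le (by
      filter_upwards [hb] with z hz hz'
      have h2 : T⁻¹ * u z ≤ T⁻¹ * M := by gcongr; exact hz hz'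
      simpa using h2) k
  set N := M + C * F * ρ ^ 2 with hN
  have hN0 : 0 < N := by positivity
  have hv := vB_pos (d := d)
  set B := M + N + 2 * c1 lam * vB d * (F * N * ρ ^ 2 + 4 * K * N ^ 2) with hB
  have hB1 : 2 * c1 lam * vB d * (F * N * ρ ^ 2 + 4 * K * N ^ 2) ≤ B := by linarith
  have hQ : 0 ≤ 2 * c1 lam * vB d * (F * N * ρ ^ 2 + 4 * K * N ^ 2) := by positivity
  refine ⟨ρ, θ, B, hρ0, by linarith, hθ0, hθ1, by positivity, fun j => ?_⟩
  obtain ⟨m', hm'⟩ := hosc u U y F 0 M ρ h.h1 d1 d2 hρ0 hM0 hF0.le (by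
    filter_upwards [hb] with z hz hz'
    exact ⟨h.nonneg z, by rw [zero_add]; exact hz hz'⟩) j
  set r := ρ * (1 / 4) ^ j with hr
  have hr0 : 0 < r := by positivity
  have hrρ : r ≤ ρ := mul_le_of_le_one_right hρ0.le (pow_le_one₀ (by norm_num) (by norm_num))
  have hsub : ball y r ⊆ ball y ρ := ball_subset_ball hrρ
  set m := min (max m' 0) M
  have ht : 0 < θ ^ j := by positivity
  have ht1 : θ ^ j ≤ 1 := pow_le_one₀ hθ0.le hθ1.le
  set H := θ ^ j * N with hH
  have hH0 : 0 < H := by positivity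
  have hm : ∀ᵐ z, z ∈ ball y r → m ≤ u z ∧ u z ≤ m + H := by
    filter_upwards [hm', hb] with z hz hz2 hz'
    have h1 := hz hz'
    have h2 := hz2 (hsub hz')
    refine ⟨(min_le_left _ _).trans (max_le h1.1 (h.nonneg z)), ?_⟩
    rcases min_choice (max m' 0) M with e | e
    · have := le_max_left m' 0
      simp only [m, e]
      linarith
    · simp only [m, e]
      linarith
  have hm0 : 0 ≤ m := le_min (le_max_right _ _) hM0.le
  have hmM : m ≤ M := min_le_right _ _
  refine ⟨⟨m, by rw [abs_of_nonneg hm0]; linarith, ?_⟩, ?_⟩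
  · filter_upwards [hm] with z hz hz'
    have h1 := hz hz'
    rw [abs_of_nonneg (by linarith)]
    have : θ ^ j * N ≤ B * θ ^ j := by
      rw [mul_comm]
      exact mul_le_mul_of_nonneg_right (by linarith) ht.le
    linarith
  · have e1 := hcac u U y (c1 lam) F m H (r / 2) r h.h1 ((d1 m).mono le_rfl hsub) (by positivity)
      (by linarith) hF0.le hC1 hH0.le (by filter_upwards [hm] with z hz hz'; exact (hz hz').2)
    have e2 := hcac (-u) (-U) y (c1 lam) F (-(m + H)) H (r / 2) r h.toSol.neg.h1
      ((d2 _).mono le_rfl hsub) (by positivity)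
      (by linarith) hF0.le hC1 hH0.le (by
        filter_upwards [hm] with z hz hz'
        have := (hz hz').1
        simp only [Pi.neg_apply]
        linarith)
    simp only [Pi.neg_apply, norm_neg] at e2
    have iU : Integrable fun z => ‖U z‖ ^ 2 := h.h1.lU.integrable_norm_pow (by norm_num)
    have mu := h.h1.mu
    have s1 : MeasurableSet {z | m < u z} := measurableSet_lt measurable_const mu
    have c3 : ∫ z in ball y (r / 2), ‖U z‖ ^ 2 ≤ (∫ z in ball y (r / 2) ∩ {z | m < u z}, ‖U z‖ ^ 2) +
        ∫ z in ball y (r / 2) ∩ {z | -(m + H) < -u z}, ‖U z‖ ^ 2 := by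
      rw [← integral_inter_add_sdiff s1 iU.integrableOn]
      refine add_le_add le_rfl (setIntegral_mono_set iU.integrableOn
        (ae_of_all _ fun z => by positivity) (LE.le.eventuallyLE fun z hz => ⟨hz.1, ?_⟩))
      have := hz.2
      simp only [Set.mem_ofPred_eq, not_lt] at this ⊢
      linarith
    rw [volume_real_ball y hr0] at e1 e2
    have c4 : c1 lam * (F * H + K * H ^ 2 / (r - r / 2) ^ 2) * (r ^ d * vB d) ≤
        (1 / 2) * (2 * c1 lam * vB d * (F * N * ρ ^ 2 + 4 * K * N ^ 2)) * θ ^ j / pw d r := by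
      have e1 : F * H ≤ F * N * ρ ^ 2 * θ ^ j / r ^ 2 := by
        rw [le_div_iff₀ (by positivity), hH]
        have : r ^ 2 ≤ ρ ^ 2 := by gcongr
        calc F * (θ ^ j * N) * r ^ 2 ≤ F * (θ ^ j * N) * ρ ^ 2 := by gcongr
          _ = _ := by ring
      have e2 : K * H ^ 2 / (r - r / 2) ^ 2 ≤ 4 * K * N ^ 2 * θ ^ j / r ^ 2 := by
        have : K * H ^ 2 / (r - r / 2) ^ 2 = 4 * K * N ^ 2 * (θ ^ j * θ ^ j) / r ^ 2 := by
          rw [hH]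
          field_simp
          ring
        rw [this]
        gcongr
        exact mul_le_of_le_one_left ht.le ht1
      calc _ ≤ c1 lam * (F * N * ρ ^ 2 * θ ^ j / r ^ 2 + 4 * K * N ^ 2 * θ ^ j / r ^ 2) *
            (r ^ d * vB d) := by gcongr
        _ = _ := by
          unfold pw
          field_simp
    calc _ ≤ _ := c3
      _ ≤ (2 * c1 lam * vB d * (F * N * ρ ^ 2 + 4 * K * N ^ 2)) * θ ^ j / pw d r := by
        refine (add_le_add (e1.trans c4) (e2.trans c4)).trans (le_of_eq ?_)
        ring
      _ ≤ _ := by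
        have := pw_pos (d := d) hr0
        gcongr

theorem Coef.pairing {lam : ℝ} {a b : E d → E d →ₗ[ℝ] E d} (ha : Coef lam a b) {A : Set (E d)}
    {p : E d → ℝ} {X Q : E d → E d} {κ P J : ℝ} (mX : Continuous X)
    (hp : MemLp p 2 (volume.restrict A)) (hQ : MemLp Q 2 (volume.restrict A))
    (h0 : ∀ z ∉ A, X z = 0) (hX : ∀ z, ‖X z‖ ≤ κ) (hP : 0 ≤ P) (hJ : 0 ≤ J)
    (bP : ∫ z in A, p z ^ 2 ≤ P ^ 2) (bJ : ∫ z in A, ‖Q z‖ ^ 2 ≤ J ^ 2) :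
    (Integrable fun z => p z * ⟪X z, a z (Q z)⟫_ℝ) ∧
      |∫ z, p z * ⟪X z, a z (Q z)⟫_ℝ| ≤ κ * (P * J) := by
  have hκ : 0 ≤ κ := (norm_nonneg _).trans (hX 0)
  have hpt : ∀ z, ‖p z * ⟪X z, a z (Q z)⟫_ℝ‖ ≤ κ * (|p z| * ‖Q z‖) := fun z => by
    rw [norm_mul, Real.norm_eq_abs]
    have : ‖⟪X z, a z (Q z)⟫_ℝ‖ ≤ κ * ‖Q z‖ := (norm_inner_le_norm _ _).trans
      (mul_le_mul (hX z) (ha.bound z _) (norm_nonneg _) hκ)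
    calc _ ≤ |p z| * (κ * ‖Q z‖) := by gcongr
      _ = _ := by ring
  have iA : IntegrableOn (fun z => |p z| * ‖Q z‖) A := hp.abs.integrable_mul hQ.norm
  have z0 : ∀ z ∉ A, p z * ⟪X z, a z (Q z)⟫_ℝ = 0 := fun z hz => by
    rw [h0 z hz, inner_zero_left, mul_zero]
  have iO : IntegrableOn (fun z => p z * ⟪X z, a z (Q z)⟫_ℝ) A :=
    Integrable.mono' (iA.const_mul κ) (hp.1.mul (mX.aestronglyMeasurable.inner (ha.aesm hQ.1)))
      (ae_of_all _ hpt)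
  refine ⟨(integrableOn_iff_integrable_of_support_subset fun z hz => ?_).1 iO, ?_⟩
  · by_contra hc
    exact hz (z0 z hc)
  rw [← setIntegral_eq_integral_of_forall_compl_eq_zero z0]
  have h1 : |∫ z in A, p z * ⟪X z, a z (Q z)⟫_ℝ| ≤ κ * ∫ z in A, |p z| * ‖Q z‖ := by
    rw [← integral_const_mul]
    exact norm_integral_le_of_norm_le (iA.const_mul κ) (ae_of_all _ hpt)
  refine h1.trans (mul_le_mul_of_nonneg_left ?_ hκ)
  refine abs_le_of_sq_le_sq' ?_ (by positivity) |>.2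
  have h2 := integral_mul_sq_le (f := fun z => |p z|) (g := fun z => ‖Q z‖) hp.abs hQ.norm
  simp only [sq_abs] at h2
  refine h2.trans ?_
  rw [mul_pow]
  exact mul_le_mul bP bJ (integral_nonneg fun z => by positivity) (by positivity)

theorem sing_anti (hd : 2 ≤ d) {s r r' : ℝ} (hs : 0 ≤ s) (hr : 0 < r) (h : r ≤ r') :
    sing d s r' ≤ sing d s r := by
  unfold sing
  split_ifs
  · have : 0 < r' := by linarith
    exact Real.log_le_log (by positivity) (by gcongr)
  · exact pw_anti hd hr h

/-- The scale invariant constant comparing the volume of annuli with powers. -/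
theorem volume_annulus_le (y : E d) {r : ℝ} (hr : 0 < r) :
    volume.real {z : E d | r < dist z y ∧ dist z y < 2 * r} ≤ (√(2 ^ d * vB d) * (r / √(pw d r))) ^ 2 := by
  have h1 : volume.real {z : E d | r < dist z y ∧ dist z y < 2 * r} ≤ volume.real (ball y (2 * r)) :=
    measureReal_mono (fun z hz => hz.2) measure_ball_lt_top.ne
  refine h1.trans (le_of_eq ?_)
  have := pw_pos (d := d) hr
  have := vB_pos (d := d)
  rw [volume_real_ball y (by positivity), mul_pow (√(2 ^ d * vB d)), div_pow,
    Real.sq_sqrt (by positivity), Real.sq_sqrt (by positivity), mul_pow]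
  unfold pw
  field_simp

theorem annulus_subset (y : E d) (r : ℝ) :
    {z : E d | r < dist z y ∧ dist z y < 2 * r} ⊆ closedBall y (2 * r) \ ball y r := fun z hz =>
  ⟨mem_closedBall.2 hz.2.le, by simpa using hz.1.le⟩

theorem volume_annulus_ne_top (y : E d) (r : ℝ) :
    volume {z : E d | r < dist z y ∧ dist z y < 2 * r} ≠ ∞ :=
  ((measure_mono fun _ hz => hz.2).trans_lt (measure_ball_lt_top (x := y) (r := 2 * r))).ne

theorem Cutoff.grad_off_annulus {y : E d} {r K : ℝ} (hr : 0 < r) {η : E d → ℝ}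
    (h : Cutoff y (3 / 2 * r) (2 * r) K η) (z : E d)
    (hz : z ∉ {z : E d | r < dist z y ∧ dist z y < 2 * r}) : ∇ η z = 0 := by
  refine h.grad_zero z ?_
  by_contra hc
  push Not at hc
  exact hz ⟨by linarith, hc.2⟩

theorem NSol.pairing_left (hd : 2 ≤ d) {lam : ℝ} {a b : E d → E d →ₗ[ℝ] E d} (ha : Coef lam a b)
    {T C : ℝ} (hT : 0 < T) (hC : 0 ≤ C) {y : E d} {h η : E d → ℝ} {H V : E d → E d}
    (hn : NSol a T C y h H) (hV : MemLp V 2 volume) {r K J : ℝ} (hr : 0 < r)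
    (hη : Cutoff y (3 / 2 * r) (2 * r) (K / r) η) (hJ : 0 ≤ J)
    (bJ : ∫ z in {z | r < dist z y ∧ dist z y < 2 * r}, ‖V z‖ ^ 2 ≤ J ^ 2) :
    (Integrable fun z => h z * ⟪∇ η z, b z (V z)⟫_ℝ) ∧ |∫ z, h z * ⟪∇ η z, b z (V z)⟫_ℝ| ≤
      K * C * √(2 ^ d * vB d) * (sing d (√T) r / √(pw d r)) * J := by
  have hA := (isOpen_annulus y r).measurableSet
  have hs := Real.sqrt_pos.2 hT
  have hsg := sing_pos (d := d) hs hr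
  have hb : ∀ z ∈ {z | r < dist z y ∧ dist z y < 2 * r}, |h z| ≤ C * sing d (√T) r := fun z hz =>
    (hn.le z (dist_pos.1 (hr.trans hz.1))).trans
      (mul_le_mul_of_nonneg_left (sing_anti hd hs.le hr hz.1.le) hC)
  have hp : MemLp h 2 (volume.restrict {z | r < dist z y ∧ dist z y < 2 * r}) :=
    (hn.memLp (R := 2 * r) hr).mono_measure (Measure.restrict_mono (annulus_subset y r) le_rfl)
  have hv := volume_annulus_le y hr
  have := ha.symm.pairing (P := C * sing d (√T) r * (√(2 ^ d * vB d) * (r / √(pw d r))))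
    (continuous_gradient hη.contDiff_one) hp (hV.restrict _) (hη.grad_off_annulus hr) hη.grad_le
    (by positivity) hJ (by
      calc _ ≤ ∫ z in {z | r < dist z y ∧ dist z y < 2 * r}, (C * sing d (√T) r) ^ 2 :=
            setIntegral_mono_on hp.integrable_sq
              (integrableOn_const (volume_annulus_ne_top y r)) hA fun z hz => by
                rw [← sq_abs]
                gcongr
                exact hb z hz
        _ ≤ _ := by
          rw [setIntegral_const, smul_eq_mul, mul_comm, mul_pow (C * _)]
          exact mul_le_mul_of_nonneg_left hv (by positivity)) bJ
  refine ⟨this.1, this.2.trans (le_of_eq ?_)⟩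
  field_simp

theorem NSol.pairing_right {lam : ℝ} {a b : E d → E d →ₗ[ℝ] E d} (ha : Coef lam a b)
    {T C : ℝ} (hC : 0 ≤ C) {y : E d} {h η p : E d → ℝ} {H : E d → E d}
    (hn : NSol a T C y h H) {r K P : ℝ} (hr : 0 < r)
    (hη : Cutoff y (3 / 2 * r) (2 * r) (K / r) η)
    (hp : MemLp p 2 (volume.restrict {z | r < dist z y ∧ dist z y < 2 * r})) (hP : 0 ≤ P)
    (bP : ∫ z in {z | r < dist z y ∧ dist z y < 2 * r}, p z ^ 2 ≤ P ^ 2) :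
    (Integrable fun z => p z * ⟪∇ η z, a z (H z)⟫_ℝ) ∧ |∫ z, p z * ⟪∇ η z, a z (H z)⟫_ℝ| ≤
      K / r * (P * (C * √(pw d r))) := by
  have hA := (isOpen_annulus y r).measurableSet
  have hQ : MemLp H 2 (volume.restrict {z | r < dist z y ∧ dist z y < 2 * r}) :=
    (hn.memLp_grad (R := 2 * r) hr).mono_measure (Measure.restrict_mono (annulus_subset y r) le_rfl)
  have hpw := pw_pos (d := d) hr
  refine ha.pairing (continuous_gradient hη.contDiff_one) hp hQ (hη.grad_off_annulus hr)
    hη.grad_le hP (by positivity) bP ?_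
  have h1 := hn.ann r hr
  rw [← ofReal_integral_eq_lintegral_ofReal (hQ.integrable_norm_pow (by norm_num))
    (ae_of_all _ fun z => by positivity), ENNReal.ofReal_le_ofReal_iff (by positivity)] at h1
  rwa [mul_pow, Real.sq_sqrt hpw.le]

theorem NSol.pairing_bdd {lam : ℝ} {a b : E d → E d →ₗ[ℝ] E d} (ha : Coef lam a b)
    {T C : ℝ} (hC : 0 ≤ C) {y : E d} {h η p : E d → ℝ} {H : E d → E d}
    (hn : NSol a T C y h H) {r K M : ℝ} (hr : 0 < r)
    (hη : Cutoff y (3 / 2 * r) (2 * r) (K / r) η) (mp : Measurable p) (hM : 0 ≤ M)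
    (bM : ∀ᵐ z, z ∈ ball y (2 * r) → |p z| ≤ M) :
    (Integrable fun z => p z * ⟪∇ η z, a z (H z)⟫_ℝ) ∧ |∫ z, p z * ⟪∇ η z, a z (H z)⟫_ℝ| ≤
      K * M * C * √(2 ^ d * vB d) := by
  have hA := (isOpen_annulus y r).measurableSet
  have hfin : IsFiniteMeasure (volume.restrict {z : E d | r < dist z y ∧ dist z y < 2 * r}) :=
    ⟨by rw [Measure.restrict_apply_univ]; exact (volume_annulus_ne_top y r).lt_top⟩
  have hb : ∀ᵐ z, z ∈ {z | r < dist z y ∧ dist z y < 2 * r} → |p z| ≤ M := by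
    filter_upwards [bM] with z hz hz'
    exact hz hz'.2
  have hp : MemLp p 2 (volume.restrict {z | r < dist z y ∧ dist z y < 2 * r}) :=
    MemLp.of_bound mp.aestronglyMeasurable M ((ae_restrict_iff' hA).2 hb)
  have hpw := pw_pos (d := d) hr
  have := hn.pairing_right ha hC hr hη hp (P := M * (√(2 ^ d * vB d) * (r / √(pw d r))))
    (by positivity) (by
      calc _ ≤ ∫ z in {z | r < dist z y ∧ dist z y < 2 * r}, M ^ 2 :=
            setIntegral_mono_on_ae hp.integrable_sq
              (integrableOn_const (volume_annulus_ne_top y r)) hA (by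
                filter_upwards [hb] with z hz hz'
                rw [← sq_abs]
                gcongr
                exact hz hz')
        _ ≤ _ := by
          rw [setIntegral_const, smul_eq_mul, mul_comm, mul_pow M]
          gcongr
          exact volume_annulus_le y hr)
  refine ⟨this.1, this.2.trans (le_of_eq ?_)⟩
  field_simp

theorem IsTestFun.grad_sub {χ φ : E d → ℝ} (hχ : IsTestFun d χ) (hφ : IsTestFun d φ) (z : E d) :
    ∇ (fun z => χ z - φ z) z = ∇ χ z - ∇ φ z := by
  have h := HasGradientAt.add (hχ.cc1.hasGrad z)
    (HasGradientAt.mul (ContDiff.hasGrad (f := fun _ => (-1 : ℝ)) contDiff_const z) (hφ.cc1.hasGrad z))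
  have e : (fun z => χ z - φ z) = fun z => χ z + -1 * φ z := funext fun z => by ring
  rw [e, h.gradient]
  simp [sub_eq_add_neg]

theorem Cutoff.isTestFun {x0 : E d} {r R K : ℝ} {η : E d → ℝ} (h : Cutoff x0 r R K η) :
    IsTestFun d η := ⟨h.smooth, h.hasCompactSupport⟩

theorem NSol.integral_grad {lam : ℝ} {a b : E d → E d →ₗ[ℝ] E d} (ha : Coef lam a b) {T C : ℝ}
    (hT : 0 < T) {y : E d} {h η : E d → ℝ} {H : E d → E d} (hn : NSol a T C y h H) {r R K : ℝ}
    (hη : Cutoff y r R K η) :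
    |∫ z, ⟪∇ η z, a z (H z)⟫_ℝ| ≤ T⁻¹ * ∫ z in ball y R, |h z| := by
  have z0 : ∀ z, z ∉ ball y R → η z = 0 := fun z hz => hη.zero z (by simpa using hz)
  have j1 : Integrable fun z => h z * η z := integrable_mul_of_integrableOn (hn.int_h R)
    hη.cc1.continuous (fun z => by rw [abs_of_nonneg (hη.nonneg z)]; exact hη.le_one z) z0
  have j2 : Integrable fun z => ⟪∇ η z, a z (H z)⟫_ℝ := ha.integrable_inner_ball (hn.int_H R)
    (continuous_gradient hη.contDiff_one).aestronglyMeasurable hη.grad_le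
    fun z hz => hη.grad_zero z (Or.inr (by simpa using hz))
  have e := hn.eq η hη.isTestFun
  have e1 : ∫ z, (T⁻¹ * h z * η z + ⟪∇ η z, a z (H z)⟫_ℝ) =
      T⁻¹ * (∫ z, h z * η z) + ∫ z, ⟪∇ η z, a z (H z)⟫_ℝ := by
    rw [← integral_const_mul, ← integral_add (j1.const_mul _) j2]
    exact integral_congr_ae (ae_of_all _ fun z => by ring)
  have e2 : |∫ z, h z * η z| ≤ ∫ z in ball y R, |h z| := by
    have z1 : ∀ z, z ∉ ball y R → h z * η z = 0 := fun z hz => by rw [z0 z hz, mul_zero]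
    rw [← setIntegral_eq_integral_of_forall_compl_eq_zero z1,
      ← Real.norm_eq_abs]
    refine norm_integral_le_of_norm_le (hn.int_h R).abs (ae_of_all _ fun z => ?_)
    rw [norm_mul, Real.norm_eq_abs, Real.norm_eq_abs, abs_of_nonneg (hη.nonneg z)]
    exact mul_le_of_le_one_right (abs_nonneg _) (hη.le_one z)
  have e3 : ∫ z, ⟪∇ η z, a z (H z)⟫_ℝ = -(T⁻¹ * ∫ z, h z * η z) := by linarith
  rw [e3, abs_neg, abs_mul, abs_of_pos (inv_pos.2 hT)]
  exact mul_le_mul_of_nonneg_left e2 (inv_pos.2 hT).le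

theorem NSol.abs_integral_le (hd : 2 ≤ d) {lam : ℝ} {a b : E d → E d →ₗ[ℝ] E d}
    (ha : Coef lam a b) {T C : ℝ} (hT : 0 < T) (hC : 0 ≤ C) {y : E d} {h f v η ξ : E d → ℝ}
    {H V : E d → E d} (hn : NSol a T C y h H) (hv : Sol b T f v V) {r N K J J' M m : ℝ}
    (hr : 0 < r) (hrN : 2 * r ≤ N) (hη : Cutoff y (3 / 2 * r) (2 * r) (K / r) η)
    (hξ : Cutoff y (3 / 2 * N) (2 * N) (K / N) ξ)
    (hf : ∀ z, f z ≠ 0 → 2 * r ≤ dist z y ∧ dist z y ≤ N)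
    (hJ : 0 ≤ J) (bJ : ∫ z in {z | r < dist z y ∧ dist z y < 2 * r}, ‖V z‖ ^ 2 ≤ J ^ 2)
    (hJ' : 0 ≤ J') (bJ' : ∫ z in {z | N < dist z y ∧ dist z y < 2 * N}, ‖V z‖ ^ 2 ≤ J' ^ 2)
    (hM : 0 ≤ M) (bM : ∀ᵐ z, z ∈ ball y (2 * r) → |v z - m| ≤ M) :
    |∫ z, f z * h z| ≤ K * C * √(2 ^ d * vB d) * (sing d (√T) N / √(pw d N)) * J' +
      K / N * (√(∫ z, v z ^ 2) * (C * √(pw d N))) +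
      (K * C * √(2 ^ d * vB d) * (sing d (√T) r / √(pw d r)) * J + K * M * C * √(2 ^ d * vB d) +
        |m| * (T⁻¹ * ∫ z in ball y (2 * r), |h z|)) := by
  have hN : 0 < N := by linarith
  have hη' := hη.isTestFun
  have hξ' := hξ.isTestFun
  have hχ := hξ'.sub hη'
  have hgr := hξ'.grad_sub hη'
  have id := hn.identity ha hv (R := 2 * N) hr hχ (fun z hz => by
      by_cases h1 : dist z y < r
      · rw [hξ.one z (by linarith), hη.one z (by linarith), sub_self]
      · have h2 : 2 * N < dist z y := by
          by_contra hc
          exact hz ⟨mem_closedBall.2 (not_lt.1 hc), fun h => h1 h⟩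
        rw [hξ.zero z h2.le, hη.zero z (by linarith), sub_self]) (fun z hz => by
      rw [hgr]
      by_cases h1 : dist z y < r
      · rw [hξ.grad_zero z (Or.inl (by linarith)), hη.grad_zero z (Or.inl (by linarith)), sub_self]
      · have h2 : 2 * N < dist z y := by
          by_contra hc
          exact hz ⟨mem_closedBall.2 (not_lt.1 hc), fun h => h1 h⟩
        rw [hξ.grad_zero z (Or.inr h2.le), hη.grad_zero z (Or.inr (by linarith)), sub_self])
  have e0 : ∫ z, f z * ((ξ z - η z) * h z) = ∫ z, f z * h z :=
    integral_congr_ae (ae_of_all _ fun z => by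
      by_cases hz : f z = 0
      · simp [hz]
      · have := hf z hz
        simp only
        rw [hξ.one z (by linarith), hη.zero z this.1, sub_zero, one_mul])
  have p1 := hn.pairing_left hd ha hT hC hv.h1.lU hN hξ hJ' bJ'
  have p2 := hn.pairing_left hd ha hT hC hv.h1.lU hr hη hJ bJ
  have p3 := hn.pairing_right ha hC hN hξ (hv.h1.lu.restrict _) (Real.sqrt_nonneg (∫ z, v z ^ 2)) (by
    rw [Real.sq_sqrt (integral_nonneg fun z => by positivity)]
    exact setIntegral_le_integral hv.h1.lu.integrable_sq (ae_of_all _ fun z => by positivity))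
  have p4 := hn.pairing_bdd ha hC hr hη (hv.h1.mu.sub_const m) hM bM
  have p5 := hn.integral_grad ha hT hη
  have p6 := (hn.pairing_bdd ha hC hr hη (p := fun _ => m) measurable_const (abs_nonneg m)
    (ae_of_all _ fun z _ => le_rfl)).1
  have e1 : ∫ z, h z * ⟪∇ (fun z => ξ z - η z) z, b z (V z)⟫_ℝ =
      (∫ z, h z * ⟪∇ ξ z, b z (V z)⟫_ℝ) - ∫ z, h z * ⟪∇ η z, b z (V z)⟫_ℝ := by
    rw [← integral_sub p1.1 p2.1]
    exact integral_congr_ae (ae_of_all _ fun z => by simp only [hgr, inner_sub_left]; ring)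
  have e2 : ∫ z, v z * ⟪∇ (fun z => ξ z - η z) z, a z (H z)⟫_ℝ =
      (∫ z, v z * ⟪∇ ξ z, a z (H z)⟫_ℝ) - ((∫ z, (v z - m) * ⟪∇ η z, a z (H z)⟫_ℝ) +
        m * ∫ z, ⟪∇ η z, a z (H z)⟫_ℝ) := by
    have j : Integrable fun z => (v z - m) * ⟪∇ η z, a z (H z)⟫_ℝ + m * ⟪∇ η z, a z (H z)⟫_ℝ :=
      p4.1.add p6
    rw [← integral_const_mul, ← integral_add p4.1 p6, ← integral_sub p3.1 j]
    exact integral_congr_ae (ae_of_all _ fun z => by simp only [hgr, inner_sub_left]; ring)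
  have p7 : |m * ∫ z, ⟪∇ η z, a z (H z)⟫_ℝ| ≤ |m| * (T⁻¹ * ∫ z in ball y (2 * r), |h z|) := by
    rw [abs_mul]
    exact mul_le_mul_of_nonneg_left p5 (abs_nonneg m)
  rw [← e0, id, e1, e2]
  have q1 := abs_le.1 p1.2
  have q2 := abs_le.1 p2.2
  have q3 := abs_le.1 p3.2
  have q4 := abs_le.1 p4.2
  have q7 := abs_le.1 p7
  rw [abs_le]
  constructor <;> linarith [q1.1, q1.2, q2.1, q2.2, q3.1, q3.2, q4.1, q4.2, q7.1, q7.2]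

/-- Growth of the singularity relative to the scale invariant power along a geometric sequence. -/
theorem exists_sing_le {s ρ : ℝ} (hs : 0 < s) (hρ : 0 < ρ) : ∃ L : ℝ, 0 < L ∧ ∀ j : ℕ,
    sing d s (ρ * (1 / 4) ^ j) ≤ L * (j + 1) * pw d (ρ * (1 / 4) ^ j) := by
  by_cases h2 : d = 2
  · subst h2
    have hl : 0 < Real.log (2 + s / ρ) := Real.log_pos (by
      have : 0 < s / ρ := by positivity
      linarith)
    have hl4 : 0 < Real.log 4 := Real.log_pos (by norm_num)
    refine ⟨Real.log (2 + s / ρ) + Real.log 4, by positivity, fun j => ?_⟩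
    simp only [sing, if_true, pw_two (by positivity : 0 < (ρ * (1 / 4) ^ j)), mul_one]
    have h4 : (1:ℝ) ≤ 4 ^ j := one_le_pow₀ (by norm_num)
    have e : 2 + s / (ρ * (1 / 4) ^ j) ≤ (2 + s / ρ) * 4 ^ j := by
      have : s / (ρ * (1 / 4) ^ j) = s / ρ * 4 ^ j := by
        rw [one_div, inv_pow]
        field_simp
      rw [this]
      nlinarith
    refine (Real.log_le_log (by positivity) e).trans ?_
    rw [Real.log_mul (by positivity) (by positivity), Real.log_pow]
    have : (0:ℝ) ≤ j := by positivity
    nlinarith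
  · refine ⟨1, one_pos, fun j => ?_⟩
    have hp := pw_pos (d := d) (m := ρ * (1 / 4) ^ j) (by positivity)
    simp only [sing, if_neg h2, one_mul]
    have : (1:ℝ) ≤ j + 1 := by simp
    nlinarith

theorem sing_le_of_large (hd : 2 ≤ d) {s N : ℝ} (hs : 0 ≤ s) (h1 : 1 ≤ N) (hN : s ≤ N) :
    pw d N ≤ 1 ∧ sing d s N / √(pw d N) ≤ 2 := by
  have h0 : 0 < N := by linarith
  have hp : pw d N ≤ 1 := (pw_anti hd one_pos h1).trans (by simp [pw])
  refine ⟨hp, ?_⟩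
  by_cases h2 : d = 2
  · subst h2
    simp only [sing, if_true, pw_two h0, Real.sqrt_one, div_one]
    have : s / N ≤ 1 := (div_le_one h0).2 hN
    have := Real.log_le_sub_one_of_pos (show 0 < 2 + s / N by positivity)
    linarith
  · simp only [sing, if_neg h2]
    rw [Real.div_sqrt]
    exact (Real.sqrt_le_one.2 hp).trans (by norm_num)

theorem tendsto_tail {g : E d → ℝ} (hg : Integrable g) (y : E d) :
    Tendsto (fun n : ℕ => ∫ z in {z | (n:ℝ) < dist z y}, g z) atTop (𝓝 0) := by
  have h := tendsto_setIntegral_of_antitone (μ := volume) (f := g)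
    (s := fun n : ℕ => {z : E d | (n:ℝ) < dist z y})
    (fun n => measurableSet_lt measurable_const (by fun_prop))
    (fun m n hmn z hz => by
      have : (m:ℝ) ≤ n := by exact_mod_cast hmn
      exact this.trans_lt hz) ⟨0, hg.integrableOn⟩
  have e : ⋂ n : ℕ, {z : E d | (n:ℝ) < dist z y} = ∅ := by
    ext z
    obtain ⟨n, hn⟩ := exists_nat_gt (dist z y)
    simp only [Set.mem_iInter, Set.mem_ofPred_eq, Set.mem_empty_iff_false, iff_false, not_forall,
      not_lt]
    exact ⟨n, hn.le⟩
  rwa [e, setIntegral_empty] at h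

theorem tendsto_setIntegral_ball (hd : 2 ≤ d) {g : E d → ℝ} {y : E d} {R : ℝ}
    (hg : IntegrableOn g (ball y R)) {δ : ℕ → ℝ} (hδ0 : ∀ n, 0 ≤ δ n) (hδ : ∀ n, δ n ≤ R)
    (ht : Tendsto δ atTop (𝓝 0)) :
    Tendsto (fun n => ∫ z in ball y (δ n), g z) atTop (𝓝 0) := by
  have : Nontrivial (E d) := nontrivial_space hd
  have h1 : Tendsto (volume.restrict (ball y R) ∘ fun n => ball y (δ n)) atTop (𝓝 0) := by
    have h2 : Tendsto (fun n => ENNReal.ofReal (δ n ^ d) * volume (ball (0 : E d) 1)) atTop (𝓝 0) := by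
      have h3 : Tendsto (fun n => δ n ^ d) atTop (𝓝 0) := by
        simpa [show d ≠ 0 by omega] using ht.pow d
      have h4 := ENNReal.Tendsto.mul_const (b := volume (ball (0 : E d) 1))
        (ENNReal.tendsto_ofReal h3) (Or.inr measure_ball_lt_top.ne)
      simpa using h4
    refine tendsto_of_tendsto_of_tendsto_of_le_of_le tendsto_const_nhds h2 (fun _ => bot_le)
      fun n => (Measure.restrict_apply_le _ _).trans (le_of_eq ?_)
    rw [Measure.addHaar_ball volume y (hδ0 n)]
    simp
  refine (Integrable.tendsto_setIntegral_nhds_zero hg h1).congr fun n => ?_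
  rw [Measure.restrict_restrict measurableSet_ball,
    Set.inter_eq_left.2 (ball_subset_ball (hδ n))]

theorem NSol.abs_integral_le_of_inner (hd : 2 ≤ d) {lam : ℝ} {a b : E d → E d →ₗ[ℝ] E d}
    (ha : Coef lam a b) {T C : ℝ} (hT : 0 < T) (hC : 0 ≤ C) {y : E d} {h f v : E d → ℝ}
    {H V : E d → E d} (hn : NSol a T C y h H) (hv : Sol b T f v V) {K : ℝ} (hK : 0 ≤ K)
    (hcut : ∀ r, 0 < r → ∃ η, Cutoff y (3 / 2 * r) (2 * r) (K / r) η) {r R J M m : ℝ}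
    (hr : 0 < r) (hf : ∀ z, f z ≠ 0 → 2 * r ≤ dist z y ∧ dist z y ≤ R)
    (hJ : 0 ≤ J) (bJ : ∫ z in {z | r < dist z y ∧ dist z y < 2 * r}, ‖V z‖ ^ 2 ≤ J ^ 2)
    (hM : 0 ≤ M) (bM : ∀ᵐ z, z ∈ ball y (2 * r) → |v z - m| ≤ M) :
    |∫ z, f z * h z| ≤ K * C * √(2 ^ d * vB d) * (sing d (√T) r / √(pw d r)) * J +
      K * M * C * √(2 ^ d * vB d) + |m| * (T⁻¹ * ∫ z in ball y (2 * r), |h z|) := by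
  have hsT := Real.sqrt_pos.2 hT
  obtain ⟨η, hη⟩ := hcut r hr
  have iV : Integrable fun z => ‖V z‖ ^ 2 := hv.h1.lU.integrable_norm_pow (by norm_num)
  have t1 := (Real.continuous_sqrt.tendsto 0).comp (tendsto_tail iV y)
  rw [Real.sqrt_zero] at t1
  have t2 : Tendsto (fun n : ℕ => (n:ℝ)⁻¹) atTop (𝓝 0) := tendsto_inv_atTop_nhds_zero_nat
  have t3 := (t1.const_mul (K * C * √(2 ^ d * vB d) * 2)).add
    (t2.const_mul (K * √(∫ z, v z ^ 2) * C))
  have t4 := t3.add (tendsto_const_nhds (x := K * C * √(2 ^ d * vB d) *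
    (sing d (√T) r / √(pw d r)) * J + K * M * C * √(2 ^ d * vB d) +
    |m| * (T⁻¹ * ∫ z in ball y (2 * r), |h z|)))
  rw [mul_zero, mul_zero, add_zero, zero_add] at t4
  refine ge_of_tendsto t4 ?_
  obtain ⟨n0, hn0⟩ := exists_nat_ge (1 + √T + 2 * r + |R|)
  filter_upwards [eventually_ge_atTop n0] with n hn'
  have hn1 : 1 + √T + 2 * r + |R| ≤ n := hn0.trans (by exact_mod_cast hn')
  have hR0 := le_abs_self R
  have hR1 := abs_nonneg R
  have n1 : (1:ℝ) ≤ n := by linarith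
  obtain ⟨ξ, hξ⟩ := hcut n (by linarith)
  obtain ⟨l1, l2⟩ := sing_le_of_large hd hsT.le n1 (by linarith)
  have l3 : √(pw d n) ≤ 1 := Real.sqrt_le_one.2 l1
  have main := hn.abs_integral_le hd ha hT hC hv hr (by linarith) hη hξ
    (fun z hz => ⟨(hf z hz).1, by linarith [(hf z hz).2]⟩) hJ bJ
    (Real.sqrt_nonneg (∫ z in {z | (n:ℝ) < dist z y}, ‖V z‖ ^ 2)) (by
      rw [Real.sq_sqrt (integral_nonneg fun z => by positivity)]
      exact setIntegral_mono_set iV.integrableOn (ae_of_all _ fun z => by positivity)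
        (LE.le.eventuallyLE fun z hz => hz.1)) hM bM
  refine main.trans (add_le_add (add_le_add ?_ ?_) le_rfl)
  · exact mul_le_mul_of_nonneg_right (mul_le_mul_of_nonneg_left l2 (by positivity))
      (Real.sqrt_nonneg _)
  · calc _ ≤ K / n * (√(∫ z, v z ^ 2) * (C * 1)) :=
          mul_le_mul_of_nonneg_left (mul_le_mul_of_nonneg_left
            (mul_le_mul_of_nonneg_left l3 hC) (Real.sqrt_nonneg _)) (by positivity)
      _ = _ := by ring

theorem NSol.integral_eq_zero (hd : 2 ≤ d) {lam : ℝ} {a b : E d → E d →ₗ[ℝ] E d}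
    (ha : Coef lam a b) {T C : ℝ} (hT : 0 < T) (hC : 0 ≤ C) {x y : E d} {h f v : E d → ℝ}
    {H V : E d → E d} (hn : NSol a T C y h H) {s ε : ℝ} (hs : 0 < s) (hε : s + ε ≤ dist x y)
    (hv : BSol b T x ε f v V) : ∫ z, f z * h z = 0 := by
  obtain ⟨K0, hK0, hcut⟩ := exists_cutoff
  set K := 2 * K0 with hK
  have hcut' : ∀ r, 0 < r → ∃ η, Cutoff y (3 / 2 * r) (2 * r) (K / r) η := fun r hr => by
    obtain ⟨η, hη⟩ := hcut d y (3 / 2 * r) (2 * r) (by positivity) (by linarith)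
    refine ⟨η, ?_⟩
    have : K0 / (2 * r - 3 / 2 * r) = K / r := by rw [hK]; field_simp; ring
    rwa [this] at hη
  have hsT := Real.sqrt_pos.2 hT
  have hfs : ∀ z, f z ≠ 0 → s ≤ dist z y ∧ dist z y ≤ dist x y + ε := fun z hz => by
    have h1 : dist z x < ε := by
      by_contra hc
      exact hz (hv.g_supp z hc)
    have h2 := dist_triangle x z y
    have h3 := dist_triangle z x y
    rw [dist_comm] at h1
    exact ⟨by linarith, by rw [dist_comm z x] at h3; linarith⟩
  obtain ⟨ρ, θ, B, hρ, hρs, hθ0, hθ1, hB, hdec⟩ := hv.toPSol.exists_decay hd ha.symm hT hs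
    (fun z hz => by
      by_contra hc
      exact absurd hz (not_lt.2 (hfs z hc).1))
  obtain ⟨L, hL, hsing⟩ := exists_sing_le (d := d) hsT (show 0 < ρ / 4 by positivity)
  have hp4 := pw_pos (d := d) (m := 4) (by norm_num)
  have t1 : Tendsto (fun j : ℕ => (j + 1 : ℝ) * √θ ^ j) atTop (𝓝 0) := by
    have hθ' : √θ < 1 := by rw [Real.sqrt_lt' one_pos]; simpa using hθ1
    have := (tendsto_self_mul_const_pow_of_lt_one (Real.sqrt_nonneg θ) hθ').add
      (_root_.tendsto_pow_atTop_nhds_zero_of_lt_one (Real.sqrt_nonneg θ) hθ')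
    simpa [add_mul] using this
  have t2 : Tendsto (fun j : ℕ => θ ^ j) atTop (𝓝 0) :=
    _root_.tendsto_pow_atTop_nhds_zero_of_lt_one hθ0.le hθ1
  have t3 : Tendsto (fun j : ℕ => ∫ z in ball y (2 * (ρ / 4 * (1 / 4) ^ j)), |h z|) atTop (𝓝 0) := by
    refine tendsto_setIntegral_ball hd (hn.int_h ρ).abs (fun n => by positivity) (fun n => ?_) ?_
    · have : (1 / 4 : ℝ) ^ n ≤ 1 := pow_le_one₀ (by norm_num) (by norm_num)
      nlinarith
    · have := (_root_.tendsto_pow_atTop_nhds_zero_of_lt_one (by norm_num : (0:ℝ) ≤ 1 / 4)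
        (by norm_num)).const_mul (2 * (ρ / 4))
      simpa [mul_assoc] using this
  have t4 := ((t1.const_mul (K * C * √(2 ^ d * vB d) * L * √(B / pw d 4))).add (t2.const_mul (K * B * C * √(2 ^ d * vB d)))).add
    (t3.const_mul (B * T⁻¹))
  rw [mul_zero, mul_zero, mul_zero, add_zero, add_zero] at t4
  have key := ge_of_tendsto t4 (Eventually.of_forall fun j : ℕ => (?_ : |∫ z, f z * h z| ≤ _))
  · exact abs_eq_zero.1 (le_antisymm key (abs_nonneg _))
  set r := ρ / 4 * (1 / 4) ^ j with hr
  have hr0 : 0 < r := by positivity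
  obtain ⟨⟨m, hm, bm⟩, bV⟩ := hdec j
  have hr4 : ρ * (1 / 4) ^ j = r * 4 := by rw [hr]; ring
  rw [hr4] at bm bV
  have hpr := pw_pos (d := d) hr0
  have hr1 : (1 / 4 : ℝ) ^ j ≤ 1 := pow_le_one₀ (by norm_num) (by norm_num)
  have hrρ : r ≤ ρ / 4 := mul_le_of_le_one_right (by positivity) hr1
  have iV : Integrable fun z => ‖V z‖ ^ 2 := hv.h1.lU.integrable_norm_pow (by norm_num)
  refine (hn.abs_integral_le_of_inner (M := B * θ ^ j) (m := m) hd ha hT hC hv.toSol (by positivity) hcut' hr0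
    (fun z hz => ⟨by linarith [(hfs z hz).1], (hfs z hz).2⟩)
    (Real.sqrt_nonneg (B * θ ^ j / pw d (r * 4))) ?_ (by positivity) ?_).trans ?_
  · rw [Real.sq_sqrt (div_nonneg (by positivity) (pw_pos (by positivity)).le)]
    refine le_trans ?_ bV
    refine setIntegral_mono_set iV.integrableOn (ae_of_all _ fun z => by positivity)
      (LE.le.eventuallyLE fun z hz => ?_)
    rw [mem_ball]
    linarith [hz.2]
  · filter_upwards [bm] with z hz hz'
    exact hz (ball_subset_ball (by linarith) hz')
  · have e1 : √(B * θ ^ j / pw d (r * 4)) = √(B / pw d 4) * √θ ^ j / √(pw d r) := by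
      have e2 : √(θ ^ j) = √θ ^ j := by
        rw [Real.sqrt_eq_iff_mul_self_eq (by positivity) (by positivity), ← mul_pow,
          Real.mul_self_sqrt hθ0.le]
      rw [pw_mul, ← e2, ← Real.sqrt_mul (by positivity), ← Real.sqrt_div (by positivity)]
      congr 1
      field_simp
    have i0 : 0 ≤ ∫ z in ball y (2 * r), |h z| := integral_nonneg fun z => abs_nonneg _
    refine add_le_add (add_le_add ?_ (le_of_eq (by ring))) ?_
    · rw [e1]
      have hq : √(pw d r) * √(pw d r) = pw d r := Real.mul_self_sqrt hpr.le
      have hsq := Real.sqrt_pos.2 hpr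
      calc _ = K * C * √(2 ^ d * vB d) * (sing d (√T) r / pw d r) * (√(B / pw d 4) * √θ ^ j) := by
            generalize √(pw d r) = q at hq hsq
            rw [← hq]
            field_simp
        _ ≤ K * C * √(2 ^ d * vB d) * (L * (j + 1)) * (√(B / pw d 4) * √θ ^ j) := by
            gcongr
            rw [div_le_iff₀ hpr]
            exact hsing j
        _ = _ := by ring
    · rw [mul_assoc]
      have := inv_pos.2 hT
      gcongr

theorem NSol.eq_zero (hd : 2 ≤ d) {lam : ℝ} {a b : E d → E d →ₗ[ℝ] E d}
    (ha : Coef lam a b) {T C : ℝ} (hT : 0 < T) (hC : 0 ≤ C) {y : E d} {h : E d → ℝ}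
    {H : E d → E d} (hn : NSol a T C y h H) {x : E d} (hx : x ≠ y) : h x = 0 := by
  set δ := dist x y with hδ
  have hδ0 : 0 < δ := dist_pos.2 hx
  set S := closedBall y (2 * δ) \ ball y (δ / 2) with hS
  have mS : MeasurableSet S := measurableSet_closedBall.diff measurableSet_ball
  have hBS : ball x (δ / 2) ⊆ S := fun z hz => by
    rw [mem_ball] at hz
    have h1 := dist_triangle z x y
    have h2 := dist_triangle x z y
    rw [dist_comm x z] at h2
    exact ⟨mem_closedBall.2 (by linarith), fun hc => by rw [mem_ball] at hc; linarith⟩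
  have hm : MemLp (S.indicator h) 2 volume :=
    (memLp_indicator_iff_restrict mS).2 (hn.memLp (by positivity))
  have hev : S.indicator h =ᶠ[𝓝 x] h := by
    filter_upwards [ball_mem_nhds x (half_pos hδ0)] with z hz
    exact Set.indicator_of_mem (hBS hz) h
  have hc : ContinuousAt (S.indicator h) x :=
    ((hn.cont.continuousAt (isOpen_compl_singleton.mem_nhds hx)).congr hev.symm)
  have hε : ∀ n : ℕ, 0 < δ / 2 * (1 / 2) ^ n := fun n => by positivity
  have hε1 : ∀ n : ℕ, δ / 2 * (1 / 2) ^ n ≤ δ / 2 := fun n =>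
    mul_le_of_le_one_right (by positivity) (pow_le_one₀ (by norm_num) (by norm_num))
  have t := tendsto_integral_bump hm hc hε (by
    simpa using (_root_.tendsto_pow_atTop_nhds_zero_of_lt_one (by norm_num : (0:ℝ) ≤ 1 / 2)
      (by norm_num)).const_mul (δ / 2))
  have e : ∀ n : ℕ, ∫ z, bump x (δ / 2 * (1 / 2) ^ n) z * S.indicator h z = 0 := fun n => by
    obtain ⟨v, V, hv⟩ := exists_bsol ha.symm hT x (hε n)
    rw [← hn.integral_eq_zero hd ha hT hC (half_pos hδ0) (by linarith [hε1 n]) hv]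
    refine integral_congr_ae (ae_of_all _ fun z => ?_)
    by_cases hz : z ∈ ball x (δ / 2 * (1 / 2) ^ n)
    · simp only [Set.indicator_of_mem (hBS (ball_subset_ball (hε1 n) hz))]
    · simp only [bump, Set.indicator_of_notMem hz, zero_mul]
  simp only [e] at t
  rw [← hev.eq_of_nhds]
  exact tendsto_nhds_unique t tendsto_const_nhds

theorem FSol.aesm {a : E d → E d →ₗ[ℝ] E d} {T c C : ℝ} {y : E d} {w : E d → ℝ} {D : E d → E d}
    (h : FSol a T c C y w D) : AEStronglyMeasurable D volume := by
  refine LocallyIntegrable.aestronglyMeasurable fun x => ?_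
  exact ⟨ball y (dist x y + 1), isOpen_ball.mem_nhds (by simp), h.int_D _⟩

theorem FSol.ann_le {a : E d → E d →ₗ[ℝ] E d} {T c C : ℝ} (hc : 0 ≤ c) {y : E d} {w : E d → ℝ}
    {D : E d → E d} (h : FSol a T c C y w D) {R : ℝ} (hR : 0 < R) :
    ∫⁻ z in {z | R < dist z y ∧ dist z y < 2 * R}, ENNReal.ofReal (‖D z‖ ^ 2) ≤
      ENNReal.ofReal (C ^ 2 * pw d R) := by
  refine (h.ann R hR).trans (ENNReal.ofReal_le_ofReal ?_)
  have h1 : Real.exp (-(c * R) / √T) ^ 2 ≤ 1 := pow_le_one₀ (Real.exp_nonneg _)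
    (Real.exp_le_one_iff.2 (div_nonpos_of_nonpos_of_nonneg (by nlinarith) (Real.sqrt_nonneg _)))
  have h2 := pw_pos (d := d) hR
  exact mul_le_mul_of_nonneg_right (mul_le_of_le_one_right (sq_nonneg C) h1) h2.le

theorem FSol.le_sing {a : E d → E d →ₗ[ℝ] E d} {T c C : ℝ} (hT : 0 < T) (hc : 0 ≤ c) (hC : 0 ≤ C)
    {y : E d} {w : E d → ℝ} {D : E d → E d} (h : FSol a T c C y w D) {z : E d} (hz : z ≠ y) :
    w z ≤ C * sing d (√T) (dist z y) := by
  have hr := dist_pos.2 hz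
  refine (h.le z hz).trans ?_
  rw [gBound_eq hr]
  have h1 : Real.exp (-(c * dist z y) / √T) ≤ 1 :=
    Real.exp_le_one_iff.2 (div_nonpos_of_nonpos_of_nonneg (by nlinarith) (Real.sqrt_nonneg _))
  exact mul_le_mul_of_nonneg_left
    (mul_le_of_le_one_left (sing_pos (Real.sqrt_pos.2 hT) hr).le h1) hC

theorem FSol.eq_of_ne (hd : 2 ≤ d) {lam : ℝ} {a b : E d → E d →ₗ[ℝ] E d} (ha : Coef lam a b)
    {T c C c' C' : ℝ} (hT : 0 < T) (hc : 0 ≤ c) (hC : 0 ≤ C) (hc' : 0 ≤ c') (hC' : 0 ≤ C')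
    {y : E d} {w w' : E d → ℝ} {D D' : E d → E d} (h : FSol a T c C y w D)
    (h' : FSol a T c' C' y w' D') {x : E d} (hx : x ≠ y) : w x = w' x := by
  have mD := h.aesm.sub h'.aesm
  have eH := mD.ae_eq_mk
  set H := mD.mk with hH
  refine sub_eq_zero.1 (NSol.eq_zero hd ha hT (C := 2 * (C + C')) (h := fun z => w z - w' z)
    (H := H) (by positivity) ?_ hx)
  refine ⟨h.cont.sub h'.cont, fun z hz => ?_, mD.stronglyMeasurable_mk.measurable,
    fun R => (h.int_w R).sub (h'.int_w R), fun R => ?_, fun R hR => ?_, fun χ hχ i => ?_,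
    fun χ hχ => ?_⟩
  · have h1 := h.le_sing hT hc hC hz
    have h2 := h'.le_sing hT hc' hC' hz
    have := sing_pos (d := d) (Real.sqrt_pos.2 hT) (dist_pos.2 hz)
    rw [abs_le]
    constructor <;> nlinarith [h.nonneg z, h'.nonneg z, mul_nonneg hC this.le,
      mul_nonneg hC' this.le]
  · exact ((h.int_D R).sub (h'.int_D R)).congr (ae_restrict_of_ae eH)
  · set S := {z | R < dist z y ∧ dist z y < 2 * R}
    have hp := (pw_pos (d := d) hR).le
    have m1 : AEMeasurable (fun z => ENNReal.ofReal (‖D z‖ ^ 2)) (volume.restrict S) :=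
      ((h.aesm.norm.aemeasurable.pow_const 2).ennreal_ofReal).restrict
    have m2 : AEMeasurable (fun z => ENNReal.ofReal (‖D' z‖ ^ 2)) (volume.restrict S) :=
      ((h'.aesm.norm.aemeasurable.pow_const 2).ennreal_ofReal).restrict
    obtain ⟨κ, hκ⟩ : ∃ κ, κ = ENNReal.ofReal 2 := ⟨_, rfl⟩
    calc ∫⁻ z in S, ENNReal.ofReal (‖H z‖ ^ 2)
        ≤ ∫⁻ z in S, (κ * ENNReal.ofReal (‖D z‖ ^ 2) + κ * ENNReal.ofReal (‖D' z‖ ^ 2)) := by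
          refine lintegral_mono_ae (ae_restrict_of_ae ?_)
          filter_upwards [eH] with z hz
          rw [← hz, hκ, ← ENNReal.ofReal_mul (by norm_num),
            ← ENNReal.ofReal_mul (by norm_num), ← ENNReal.ofReal_add (by positivity) (by positivity)]
          refine ENNReal.ofReal_le_ofReal ?_
          have := norm_sub_le (D z) (D' z)
          simp only [Pi.sub_apply]
          nlinarith [norm_nonneg (D z - D' z), sq_nonneg (‖D z‖ - ‖D' z‖)]
      _ ≤ κ * ENNReal.ofReal (C ^ 2 * pw d R) + κ * ENNReal.ofReal (C' ^ 2 * pw d R) := by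
          rw [lintegral_add_left' (m1.const_mul κ), lintegral_const_mul'' κ m1,
            lintegral_const_mul'' κ m2]
          exact add_le_add (mul_le_mul_right (h.ann_le hc hR) κ)
            (mul_le_mul_right (h'.ann_le hc' hR) κ)
      _ ≤ _ := by
          rw [hκ, ← ENNReal.ofReal_mul (by norm_num),
            ← ENNReal.ofReal_mul (by norm_num), ← ENNReal.ofReal_add (by positivity) (by positivity)]
          refine ENNReal.ofReal_le_ofReal ?_
          nlinarith [mul_nonneg (sq_nonneg C) hp, mul_nonneg (sq_nonneg C') hp,
            mul_nonneg (mul_nonneg hC hC') hp]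
  all_goals
    obtain ⟨R, hR, z0, z1⟩ := hχ.cc1.exists_ball y
    obtain ⟨K, k0, k1⟩ := hχ.cc1.exists_bound
    have cg := continuous_gradient hχ.cc1.1
  · have c1 : Continuous fun z => (∇ χ z) i := by fun_prop
    have b1 : ∀ z, |(∇ χ z) i| ≤ K := fun z => (PiLp.norm_apply_le _ i).trans (k1 z)
    have s1 : ∀ z, z ∉ ball y R → (∇ χ z) i = 0 := fun z hz => by rw [z1 z hz]; rfl
    have i1 := integrable_mul_of_integrableOn (h.int_w R) c1 b1 s1
    have i2 := integrable_mul_of_integrableOn (h'.int_w R) c1 b1 s1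
    have q : ∀ {D : E d → E d}, IntegrableOn D (ball y R) →
        Integrable fun z => D z i * χ z := fun hD =>
      integrable_mul_of_integrableOn ((EuclideanSpace.proj (𝕜 := ℝ) i).integrable_comp hD)
        hχ.1.continuous k0 z0
    calc ∫ z, (w z - w' z) * (∇ χ z) i = ∫ z, (w z * (∇ χ z) i - w' z * (∇ χ z) i) := by
          simp only [sub_mul]
      _ = -((∫ z, D z i * χ z) - ∫ z, D' z i * χ z) := by
          rw [integral_sub i1 i2, h.parts χ hχ i, h'.parts χ hχ i]
          ring
      _ = _ := by
          rw [← integral_sub (q (h.int_D R)) (q (h'.int_D R))]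
          congr 1
          refine integral_congr_ae ?_
          filter_upwards [eH] with z hz
          rw [← hz]
          simp only [Pi.sub_apply, PiLp.sub_apply]
          ring
  · have q : ∀ {w : E d → ℝ} {D : E d → E d}, IntegrableOn w (ball y R) →
        IntegrableOn D (ball y R) →
        Integrable fun z => T⁻¹ * w z * χ z + ⟪∇ χ z, a z (D z)⟫_ℝ := fun hw hD =>
      (integrable_mul_of_integrableOn (hw.const_mul T⁻¹) hχ.1.continuous k0 z0).add
        (ha.integrable_inner_ball hD cg.aestronglyMeasurable k1 z1)
    have := integral_sub (q (h.int_w R) (h.int_D R)) (q (h'.int_w R) (h'.int_D R))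
    rw [h.eq χ hχ, h'.eq χ hχ, sub_self] at this
    rw [← this]
    refine integral_congr_ae ?_
    filter_upwards [eH] with z hz
    rw [← hz]
    simp only [Pi.sub_apply, map_sub, inner_sub_right]
    ring

theorem integrableOn_ball_iff {F : Type*} [NormedAddCommGroup F] {f : E d → F} (y : E d) :
    (∀ R, IntegrableOn f (ball y R)) ↔ ∀ R, 0 < R → IntegrableOn f (ball 0 R) := by
  constructor
  · exact fun h R _ => (h (R + dist 0 y)).mono_set (ball_subset_ball' (by linarith))
  · intro h R
    refine (h (|R| + dist y 0 + 1) (by positivity)).mono_set (ball_subset_ball' ?_)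
    linarith [le_abs_self R]

theorem integrableOn_toLp_iff {D : E d → Fin d → ℝ} {S : Set (E d)} :
    IntegrableOn (fun z => WithLp.toLp 2 (D z)) S ↔ ∀ i, IntegrableOn (fun z => D z i) S := by
  constructor
  · exact fun h i => (EuclideanSpace.proj (𝕜 := ℝ) i).integrable_comp h
  · intro h
    exact (PiLp.continuousLinearEquiv 2 ℝ (fun _ : Fin d => ℝ)).symm.toContinuousLinearMap.integrable_comp
      (Integrable.of_eval h)

/-- Properties of the Green function in one variable, with the other one frozen. -/
theorem fsol_iff {M : E d → Matrix (Fin d) (Fin d) ℝ} {T c C : ℝ} {y : E d} {w : E d → ℝ}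
    {D : E d → Fin d → ℝ} :
    FSol (fun x => Matrix.toEuclideanLin (M x)) T c C y w (fun z => WithLp.toLp 2 (D z)) ↔
      (∀ z, 0 ≤ w z) ∧ ContinuousOn w {y}ᶜ ∧ (∀ z, z ≠ y → w z ≤ C * gBound d c T (dist z y)) ∧
      HasWeakGrad w D ∧
      (∀ R : ℝ, 0 < R → IntegrableOn w (ball (0:E d) R) volume ∧
        ∀ i : Fin d, IntegrableOn (fun x => D x i) (ball (0:E d) R) volume) ∧
      (∀ R : ℝ, 0 < R →
        (∫⁻ x in {x : E d | R < dist x y ∧ dist x y < 2*R}, ENNReal.ofReal (D x ⬝ᵥ D x)) ≤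
          ENNReal.ofReal ((C * Real.exp (-(c*R) / Real.sqrt T) * R ^ ((1:ℝ) - (d:ℝ))) ^ 2 * R ^ d)) ∧
      ∀ χ : E d → ℝ, IsTestFun d χ →
        ∫ x : E d, (T⁻¹ * w x * χ x + gradAt χ x ⬝ᵥ (M x).mulVec (D x)) = χ y := by
  have eR : ∀ R : ℝ, 0 < R → (C * Real.exp (-(c*R) / √T) * R ^ ((1:ℝ) - (d:ℝ))) ^ 2 * R ^ d =
      C ^ 2 * Real.exp (-(c * R) / √T) ^ 2 * pw d R := fun R hR => by
    rw [Real.rpow_sub hR, Real.rpow_one, Real.rpow_natCast, pw]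
    field_simp
  have eD : ∀ z, ‖WithLp.toLp 2 (D z)‖ ^ 2 = D z ⬝ᵥ D z := fun z => norm_sq_eq_dot _
  have eχ : ∀ χ : E d → ℝ, IsTestFun d χ →
      ∫ x : E d, (T⁻¹ * w x * χ x + gradAt χ x ⬝ᵥ (M x).mulVec (D x)) =
        ∫ z, (T⁻¹ * w z * χ z + ⟪∇ χ z, Matrix.toEuclideanLin (M z) (WithLp.toLp 2 (D z))⟫_ℝ) :=
    fun χ hχ => by
      refine integral_congr_ae (ae_of_all _ fun z => ?_)
      simp only [gradAt_eq hχ.cc1, inner_eq_dot]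
      rfl
  have eg : ∀ χ : E d → ℝ, IsTestFun d χ → ∀ i, ∫ z, w z * (∇ χ z) i = ∫ z, w z * gradAt χ z i :=
    fun χ hχ i => by simp only [gradAt_eq hχ.cc1]
  constructor
  · intro h
    refine ⟨h.nonneg, h.cont, h.le, fun χ hχ i => ?_, fun R hR => ⟨(integrableOn_ball_iff y).1 h.int_w R hR,
      integrableOn_toLp_iff.1 ((integrableOn_ball_iff y).1 h.int_D R hR)⟩, fun R hR => ?_, fun χ hχ => ?_⟩
    · rw [← eg χ hχ]
      exact h.parts χ hχ i
    · rw [eR R hR]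
      simpa only [eD] using h.ann R hR
    · rw [eχ χ hχ]
      exact h.eq χ hχ
  · rintro ⟨h1, h2, h3, h4, h5, h6, h7⟩
    refine ⟨h1, h2, h3, (integrableOn_ball_iff y).2 fun R hR => (h5 R hR).1,
      (integrableOn_ball_iff y).2 fun R hR => integrableOn_toLp_iff.2 (h5 R hR).2, fun R hR => ?_,
      fun χ hχ i => ?_, fun χ hχ => ?_⟩
    · rw [← eR R hR]
      simpa only [eD] using h6 R hR
    · rw [eg χ hχ]
      exact h4 χ hχ i
    · rw [← eχ χ hχ]
      exact h7 χ hχ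

theorem GreenProps.fsol_left {lam : ℝ} {W : CoeffField d lam} {T c C : ℝ} {G : E d → E d → ℝ}
    {DxG DyG : E d → E d → Fin d → ℝ} (h : GreenProps W T c C G DxG DyG) (y : E d) :
    FSol (coefMap W) T c C y (fun x => G x y) (fun x => WithLp.toLp 2 (DxG x y)) := by
  obtain ⟨h1, h2, h3, h4, -, h6, -, h8, -, h10, -⟩ := h
  refine fsol_iff.2 ⟨fun z => h1 z y, ?_, fun z hz => h3 z y hz, h4 y, h6 y, h8 y, h10 y⟩
  exact h2.comp (f := fun x => (x, y)) (by fun_prop) fun z hz => hz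

theorem Ker.greenProps {lam : ℝ} {W : CoeffField d lam} {T c C : ℝ} {G : E d → E d → ℝ}
    {DxG DyG : E d → E d → E d} (h : Ker (coefMap W) T G)
    (hx : ∀ y, FSol (coefMap W) T c C y (fun x => G x y) fun x => DxG x y)
    (hy : ∀ x, FSol (coefMap' W) T c C x (fun y => G x y) fun y => DyG x y) :
    GreenProps W T c C G (fun x y => (DxG x y).ofLp) (fun x y => (DyG x y).ofLp) := by
  have kx := fun y => (fsol_iff (D := fun x => (DxG x y).ofLp)).1 (hx y)
  have ky := fun x => (fsol_iff (D := fun y => (DyG x y).ofLp)).1 (hy x)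
  exact ⟨h.nonneg, h.cont, fun x y => (kx y).2.2.1 x, fun y => (kx y).2.2.2.1,
    fun x => (ky x).2.2.2.1, fun y => (kx y).2.2.2.2.1, fun x => (ky x).2.2.2.2.1,
    fun y => (kx y).2.2.2.2.2.1, fun x => (ky x).2.2.2.2.2.1, fun y => (kx y).2.2.2.2.2.2,
    fun x => (ky x).2.2.2.2.2.2⟩

end GreenFunction

end GO

namespace GO

/-- Definition/Lemma: existence and uniqueness of the Green function.
There are constants `c > 0` and `C < ∞` depending only on `d` and `λ` such that for every
coefficient field `A ∈ Ω` and `0 < T < ∞` there exists a function `G_T(·,·;A) ≥ 0`,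
continuous off the diagonal, satisfying the pointwise upper bound, the averaged gradient
bounds, local integrability, and the two distributional equations; it is unique (off the
diagonal) among all Green functions, and `G_T(x,y;A*) = G_T(y,x;A)`. -/
theorem statement18 (d : ℕ) (hd : 2 ≤ d) (lam : ℝ) (hlam : 0 < lam) (hlam' : lam ≤ 1) :
    ∃ c C : ℝ, 0 < c ∧ 0 < C ∧
      ∀ (W : CoeffField d lam) (T : ℝ), 0 < T →
        ∃ (G : E d → E d → ℝ) (DxG DyG : E d → E d → Fin d → ℝ),
          GreenProps W T c C G DxG DyG ∧
          (∀ (G' : E d → E d → ℝ) (DxG' DyG' : E d → E d → Fin d → ℝ),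
            IsGreenFunction W T G' DxG' DyG' →
              ∀ x y : E d, x ≠ y → G' x y = G x y) ∧
          (∀ (W' : CoeffField d lam), (∀ x, W'.A x = (W.A x).transpose) →
            ∀ (G' : E d → E d → ℝ) (DxG' DyG' : E d → E d → Fin d → ℝ),
              IsGreenFunction W' T G' DxG' DyG' →
                ∀ x y : E d, x ≠ y → G' x y = G y x) := by
  obtain ⟨c, C, hc, hC, hF⟩ := Ker.exists_fsol hd hlam
  refine ⟨c, C, hc, hC, fun W T hT => ?_⟩
  have ha := CoeffField.coef hlam W
  obtain ⟨G, hG, hG'⟩ := exists_ker hd hlam hT ha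
  choose Dx hx using hF _ _ T G ha hT hG
  choose Dy hy using hF _ _ T _ ha.symm hT hG'
  refine ⟨G, fun x y => (Dx y x).ofLp, fun x y => (Dy x y).ofLp, hG.greenProps hx hy, ?_, ?_⟩
  · rintro G' Dx' Dy' ⟨c', C', hc', hC', h⟩ x y hxy
    exact (h.fsol_left y).eq_of_ne hd ha hT hc'.le hC'.le hc.le hC.le (hx y) hxy
  · rintro W' hW G' Dx' Dy' ⟨c', C', hc', hC', h⟩ x y hxy
    have e : coefMap W' = coefMap' W := funext fun z => by rw [coefMap, coefMap', hW]
    exact (e ▸ h.fsol_left y).eq_of_ne hd ha.symm hT hc'.le hC'.le hc.le hC.le (hy y) hxy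

end GO
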